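/- Let p be a prime and {u_n} a sequence of integers satisfying a linear recurrence u_{n+m} + c_{m-1}u_{n+m-1} + ... + c_0 u_n = 0 with c_0 ≠ 0 whose characteristic polynomial has a root λ that is multiplicatively independent from p (i.e., λ^r = p^s with integers r,s implies r = s = 0), and assume all characteristic roots and their ratios that are roots of unity equal 1 (non-degeneracy). Then for any fixed c_1,...,c_k ∈ ℤ and k_1,...,k_k ∈ ℕ₀, if no proper subsum of ∑_{i} P_i(n)r_i^n − ∑_j c_j p^{k_j n_j} vanishes at a solution, the set of n ∈ ℕ₀ for which there exist n_1,...,n_k ∈ ℕ₀ with u_n = c_1 p^{k_1 n_1} + ... + c_k p^{k_k n_k} is finite. -/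

import Mathlib

open Finset

namespace Sub15

set_option linter.unusedSectionVars false

noncomputable section

/-- the usual absolute value on ℤ, real valued -/
def zav : AbsoluteValue ℤ ℝ where
  toFun n := |(n : ℝ)|
  map_mul' := by intro a b; simp [abs_mul]
  nonneg' := by intro a; exact abs_nonneg _
  eq_zero' := by intro a; simp
  add_le' := by intro a b; push_cast; exact abs_add_le _ _

lemma zav_apply (n : ℤ) : zav n = |(n : ℝ)| := rfl

section Wnorm
variable {R : Type*} [CommRing R] {σ : Type*}

/-- weighted ℓ¹ norm of a polynomial -/
def wnorm (v : AbsoluteValue R ℝ) (w : σ → ℝ) (P : MvPolynomial σ R) : ℝ :=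
  ∑ e ∈ P.support, v (P.coeff e) * e.prod fun i k => w i ^ k

variable (v : AbsoluteValue R ℝ) (w : σ → ℝ)

lemma mon_nonneg (hw : ∀ i, 0 ≤ w i) (e : σ →₀ ℕ) : 0 ≤ e.prod fun i k => w i ^ k :=
  Finset.prod_nonneg fun i _ => pow_nonneg (hw i) _

lemma wnorm_nonneg (hw : ∀ i, 0 ≤ w i) (P : MvPolynomial σ R) : 0 ≤ wnorm v w P :=
  Finset.sum_nonneg fun e _ => mul_nonneg (v.nonneg _) (mon_nonneg w hw e)

lemma wnorm_eq_of_subset (P : MvPolynomial σ R) (s : Finset (σ →₀ ℕ)) (h : P.support ⊆ s) :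
    wnorm v w P = ∑ e ∈ s, v (P.coeff e) * e.prod fun i k => w i ^ k := by
  apply Finset.sum_subset h
  intro e _ he
  rw [MvPolynomial.notMem_support_iff.1 he]; simp

lemma wnorm_zero : wnorm v w (0 : MvPolynomial σ R) = 0 := by simp [wnorm]

lemma wnorm_add (hw : ∀ i, 0 ≤ w i) (P Q : MvPolynomial σ R) :
    wnorm v w (P + Q) ≤ wnorm v w P + wnorm v w Q := by
  classical
  rw [wnorm_eq_of_subset v w (P + Q) (P.support ∪ Q.support) MvPolynomial.support_add,
    wnorm_eq_of_subset v w P (P.support ∪ Q.support) subset_union_left,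
    wnorm_eq_of_subset v w Q (P.support ∪ Q.support) subset_union_right, ← sum_add_distrib]
  apply sum_le_sum
  intro e _
  rw [← add_mul, MvPolynomial.coeff_add]
  exact mul_le_mul_of_nonneg_right (v.add_le _ _) (mon_nonneg w hw e)

lemma wnorm_sum (hw : ∀ i, 0 ≤ w i) {ι : Type*} (s : Finset ι) (P : ι → MvPolynomial σ R) :
    wnorm v w (∑ i ∈ s, P i) ≤ ∑ i ∈ s, wnorm v w (P i) := by
  classical
  induction s using Finset.induction_on with
  | empty => simp [wnorm_zero]
  | insert a s ha ih =>
    rw [sum_insert ha, sum_insert ha]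
    exact (wnorm_add v w hw _ _).trans (by gcongr)

lemma wnorm_monomial (e : σ →₀ ℕ) (a : R) :
    wnorm v w (MvPolynomial.monomial e a) = v a * e.prod fun i k => w i ^ k := by
  classical
  rw [wnorm_eq_of_subset v w _ {e} MvPolynomial.support_monomial_subset]
  simp

lemma wnorm_C (a : R) : wnorm v w (MvPolynomial.C a : MvPolynomial σ R) = v a := by
  rw [MvPolynomial.C_apply, wnorm_monomial]; simp

lemma wnorm_X [IsDomain R] (i : σ) :
    wnorm v w (MvPolynomial.X i : MvPolynomial σ R) = w i := by
  rw [MvPolynomial.X, wnorm_monomial]; simp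

lemma wnorm_mul (hw : ∀ i, 0 ≤ w i) (P Q : MvPolynomial σ R) :
    wnorm v w (P * Q) ≤ wnorm v w P * wnorm v w Q := by
  classical
  have h : P * Q = ∑ a ∈ P.support, ∑ b ∈ Q.support,
      MvPolynomial.monomial (a + b) (P.coeff a * Q.coeff b) := by
    conv_lhs => rw [P.as_sum, Q.as_sum, Finset.sum_mul_sum]
    simp [MvPolynomial.monomial_mul]
  rw [h]
  refine (wnorm_sum v w hw _ _).trans ?_
  rw [wnorm, wnorm, Finset.sum_mul_sum]
  refine sum_le_sum fun a _ => (wnorm_sum v w hw _ _).trans (sum_le_sum fun b _ => ?_)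
  rw [wnorm_monomial, map_mul, Finsupp.prod_add_index' (by simp) (by intros; rw [pow_add])]
  apply le_of_eq; ring

lemma wnorm_one [IsDomain R] : wnorm v w (1 : MvPolynomial σ R) = 1 := by
  rw [← MvPolynomial.C_1, wnorm_C]; simp

lemma wnorm_pow [IsDomain R] (hw : ∀ i, 0 ≤ w i) (P : MvPolynomial σ R) (n : ℕ) :
    wnorm v w (P ^ n) ≤ wnorm v w P ^ n := by
  induction n with
  | zero => simp [wnorm_one]
  | succ n ih =>
    rw [pow_succ, pow_succ]
    exact (wnorm_mul v w hw _ _).trans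
      (mul_le_mul_of_nonneg_right ih (wnorm_nonneg v w hw _))

lemma wnorm_prod [IsDomain R] (hw : ∀ i, 0 ≤ w i) {ι : Type*} (s : Finset ι)
    (P : ι → MvPolynomial σ R) :
    wnorm v w (∏ i ∈ s, P i) ≤ ∏ i ∈ s, wnorm v w (P i) := by
  classical
  induction s using Finset.induction_on with
  | empty => simp [wnorm_one]
  | insert a s ha ih =>
    rw [prod_insert ha, prod_insert ha]
    exact (wnorm_mul v w hw _ _).trans
      (mul_le_mul_of_nonneg_left ih (wnorm_nonneg v w hw _))

lemma coeff_le_wnorm (hw : ∀ i, 0 ≤ w i) (P : MvPolynomial σ R) (e : σ →₀ ℕ) :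
    v (P.coeff e) * (e.prod fun i k => w i ^ k) ≤ wnorm v w P := by
  classical
  rw [wnorm_eq_of_subset v w P (insert e P.support) (subset_insert _ _)]
  exact single_le_sum (f := fun e : σ →₀ ℕ => v (P.coeff e) * e.prod fun i k => w i ^ k)
    (fun e _ => mul_nonneg (v.nonneg _) (mon_nonneg w hw e)) (mem_insert_self _ _)

lemma wnorm_neg (P : MvPolynomial σ R) : wnorm v w (-P) = wnorm v w P := by
  classical
  rw [wnorm_eq_of_subset v w (-P) P.support (by rw [MvPolynomial.support_neg]), wnorm]
  simp [v.map_neg]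

end Wnorm

/-- ℓ¹ norm of an integer polynomial in several variables -/
def l1 {σ : Type*} (P : MvPolynomial σ ℤ) : ℝ := wnorm zav (fun _ => 1) P

lemma l1_eq {σ : Type*} (P : MvPolynomial σ ℤ) : l1 P = ∑ e ∈ P.support, |((P.coeff e : ℤ) : ℝ)| := by
  simp [l1, wnorm, zav_apply, Finsupp.prod]

lemma l1_nonneg {σ : Type*} (P : MvPolynomial σ ℤ) : 0 ≤ l1 P := wnorm_nonneg _ _ (by simp) _

lemma l1_mul {σ : Type*} (P Q : MvPolynomial σ ℤ) : l1 (P * Q) ≤ l1 P * l1 Q :=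
  wnorm_mul _ _ (by simp) _ _

lemma l1_prod {σ ι : Type*} (s : Finset ι) (P : ι → MvPolynomial σ ℤ) :
    l1 (∏ i ∈ s, P i) ≤ ∏ i ∈ s, l1 (P i) :=
  wnorm_prod _ _ (by simp) _ _

lemma l1_pow {σ : Type*} (P : MvPolynomial σ ℤ) (n : ℕ) : l1 (P ^ n) ≤ l1 P ^ n :=
  wnorm_pow _ _ (by simp) _ _

lemma l1_sum {σ ι : Type*} (s : Finset ι) (P : ι → MvPolynomial σ ℤ) :
    l1 (∑ i ∈ s, P i) ≤ ∑ i ∈ s, l1 (P i) :=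
  wnorm_sum _ _ (by simp) _ _

lemma coeff_le_l1 {σ : Type*} (P : MvPolynomial σ ℤ) (e : σ →₀ ℕ) :
    |((P.coeff e : ℤ) : ℝ)| ≤ l1 P := by
  simpa [Finsupp.prod, zav_apply, l1] using coeff_le_wnorm zav (fun _ : σ => (1:ℝ)) (by simp) P e

lemma one_le_l1 {σ : Type*} (P : MvPolynomial σ ℤ) (hP : P ≠ 0) : 1 ≤ l1 P := by
  obtain ⟨e, he⟩ := MvPolynomial.ne_zero_iff.1 hP
  refine le_trans ?_ (coeff_le_l1 P e)
  exact_mod_cast Int.one_le_abs he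

end

end Sub15


open Finset

namespace Sub15

set_option linter.unusedSimpArgs false
set_option linter.unusedVariables false
set_option linter.unusedSectionVars false

noncomputable section

section Wronskian
variable {F A ι : Type*} [Field F] [CommRing A] [IsDomain A] [Algebra F A]

/-- iterated derivation along a list -/
def iterD (D : ι → Derivation F A A) : List ι → A → A
  | [], x => x
  | h :: l, x => D h (iterD D l x)

lemma gen_wronskian (D : ι → Derivation F A A)
    (hconst : ∀ x y : A, y ≠ 0 → (∀ h, y * D h x = x * D h y) → ∃ c : F, x = c • y)
    (k : ℕ) (φ : Fin k → A) (hφ : LinearIndependent F φ) :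
    ∃ l : Fin k → List ι, (∀ i, (l i).length ≤ i) ∧
      (Matrix.of fun i j => iterD D (l i) (φ j)).det ≠ 0 := by
  induction k with
  | zero => exact ⟨fun _ => [], fun i => i.elim0, by simp⟩
  | succ k ih =>
    obtain ⟨l, hl, hdet⟩ := ih (fun j => φ j.castSucc)
      (hφ.comp _ (Fin.castSucc_injective k))
    by_contra hcon
    push Not at hcon
    -- extended matrix
    let ext : List ι → Fin (k+1) → List ι := fun l' => Fin.snoc (α := fun _ => List ι) l l'
    let Cf : Fin (k+1) → A := fun j => (-1) ^ ((Fin.last k : ℕ) + (j : ℕ)) *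
      (Matrix.of fun (i : Fin k) (j' : Fin k) => iterD D (l i) (φ (j.succAbove j'))).det
    have hexp : ∀ l' : List ι, l'.length ≤ k → ∑ j, Cf j * iterD D l' (φ j) = 0 := by
      intro l' hl'
      have h0 := hcon (ext l') (by
        intro i
        refine Fin.lastCases ?_ (fun i => ?_) i
        · simpa [ext] using hl'
        · simpa [ext] using hl i)
      rw [Matrix.det_succ_row _ (Fin.last k)] at h0
      rw [← h0]
      refine sum_congr rfl fun j _ => ?_
      simp only [Cf, Matrix.of_apply, ext, Fin.snoc_last]
      rw [mul_right_comm]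
      congr 2
      ext i j'
      simp [Matrix.submatrix_apply]
    have hlast : Cf (Fin.last k) ≠ 0 := by
      simp only [Cf, Fin.succAbove_last]
      exact mul_ne_zero (pow_ne_zero _ (by simp)) hdet
    have hd : ∀ h j, Cf (Fin.last k) * D h (Cf j) = Cf j * D h (Cf (Fin.last k)) := by
      intro h
      have h1 : ∀ l' : List ι, l'.length + 1 ≤ k → ∑ j, D h (Cf j) * iterD D l' (φ j) = 0 := by
        intro l' hl'
        have e1 := congrArg (D h) (hexp l' (by omega))
        have e2 := hexp (h :: l') (by simpa using hl')
        rw [map_sum, map_zero] at e1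
        have : ∑ j, D h (Cf j * iterD D l' (φ j)) = ∑ j, Cf j * iterD D (h :: l') (φ j)
            + ∑ j, D h (Cf j) * iterD D l' (φ j) := by
          rw [← sum_add_distrib]
          refine sum_congr rfl fun j _ => ?_
          rw [Derivation.leibniz]; simp only [smul_eq_mul, iterD]; ring
        rw [this, e2, zero_add] at e1
        exact e1
      have h2 : ∀ i : Fin k, ∑ j : Fin k, iterD D (l i) (φ j.castSucc) *
          (Cf (Fin.last k) * D h (Cf j.castSucc) - Cf j.castSucc * D h (Cf (Fin.last k))) = 0 := by
        intro i
        have e1 := h1 (l i) (by have := hl i; omega)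
        have e2 := hexp (l i) (by have := hl i; omega)
        rw [Fin.sum_univ_castSucc] at e1 e2
        have : ∑ j : Fin k, iterD D (l i) (φ j.castSucc) *
          (Cf (Fin.last k) * D h (Cf j.castSucc) - Cf j.castSucc * D h (Cf (Fin.last k)))
          = Cf (Fin.last k) * (∑ j : Fin k, D h (Cf j.castSucc) * iterD D (l i) (φ j.castSucc))
            - D h (Cf (Fin.last k)) *
              ∑ j : Fin k, Cf j.castSucc * iterD D (l i) (φ j.castSucc) := by
          rw [mul_sum, mul_sum, ← sum_sub_distrib]
          refine sum_congr rfl fun j _ => ?_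
          ring
        rw [this]
        linear_combination Cf (Fin.last k) * e1 - D h (Cf (Fin.last k)) * e2
      have h3 := Matrix.eq_zero_of_mulVec_eq_zero hdet
        (v := fun j => Cf (Fin.last k) * D h (Cf j.castSucc)
          - Cf j.castSucc * D h (Cf (Fin.last k))) (by
          funext i
          simpa [Matrix.mulVec, dotProduct] using h2 i)
      intro j
      refine Fin.lastCases ?_ (fun j => ?_) j
      · rfl
      · exact sub_eq_zero.1 (congrFun h3 j)
    choose c hc using fun j => hconst (Cf j) (Cf (Fin.last k)) hlast (fun h => hd h j)
    have h4 := hexp [] (by simp)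
    have h5 : Cf (Fin.last k) * ∑ j, c j • φ j = 0 := by
      rw [← h4, mul_sum]
      refine sum_congr rfl fun j _ => ?_
      conv_rhs => rw [hc j]
      simp [iterD]
    have h6 := (mul_eq_zero.1 h5).resolve_left hlast
    have h7 := (Fintype.linearIndependent_iff.1 hφ) c h6 (Fin.last k)
    have h8 := hc (Fin.last k)
    rw [h7, zero_smul] at h8
    exact hlast h8

end Wronskian

section consts
variable {F : Type*} [Field F] [CharZero F]

lemma mv_const {n : ℕ} (x y : MvPolynomial (Fin n) F) (hy : y ≠ 0)
    (h : ∀ i, y * MvPolynomial.pderiv i x = x * MvPolynomial.pderiv i y) :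
    ∃ c : F, x = c • y := by
  classical
  set m : MonomialOrder (Fin n) := MonomialOrder.lex
  have key : ∀ z : MvPolynomial (Fin n) F, z ≠ 0 →
      (∀ i, y * MvPolynomial.pderiv i z = z * MvPolynomial.pderiv i y) →
      m.degree z = m.degree y := by
    intro z hz hh
    have co : ∀ (u : MvPolynomial (Fin n) F) (i : Fin n) (b : Fin n →₀ ℕ),
        (MvPolynomial.X i * MvPolynomial.pderiv i u).coeff b = (b i : F) * u.coeff b := by
      intro u i b
      induction u using MvPolynomial.induction_on' with
      | monomial a r =>
        rw [MvPolynomial.pderiv_monomial, MvPolynomial.coeff_monomial]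
        by_cases ha : a i = 0
        · simp only [ha, Nat.cast_zero, mul_zero, MvPolynomial.monomial_zero, mul_zero,
            MvPolynomial.coeff_zero]
          split_ifs with hab
          · subst hab; simp [ha]
          · simp
        · have : Finsupp.single i 1 + (a - Finsupp.single i 1) = a := by
            ext t; by_cases ht : t = i
            · subst ht; simp; omega
            · simp [Finsupp.single_apply, Ne.symm ht]
          rw [MvPolynomial.X, MvPolynomial.monomial_mul, this, MvPolynomial.coeff_monomial]
          split_ifs with hab
          · subst hab; ring
          · simp
      | add p q hp hq => rw [map_add, mul_add, MvPolynomial.coeff_add, hp, hq,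
          MvPolynomial.coeff_add]; ring
    have le : ∀ (u : MvPolynomial (Fin n) F) (i : Fin n),
        m.toSyn (m.degree (MvPolynomial.X i * MvPolynomial.pderiv i u)) ≤ m.toSyn (m.degree u) := by
      intro u i
      rw [MonomialOrder.degree_le_iff]
      intro b hb
      rw [MvPolynomial.mem_support_iff, co] at hb
      exact m.le_degree (MvPolynomial.mem_support_iff.2 (right_ne_zero_of_mul hb))
    ext i
    have e := congrArg (fun u => (MvPolynomial.X i * u).coeff (m.degree y + m.degree z)) (hh i)
    rw [show MvPolynomial.X i * (y * MvPolynomial.pderiv i z)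
        = y * (MvPolynomial.X i * MvPolynomial.pderiv i z) by ring,
      show MvPolynomial.X i * (z * MvPolynomial.pderiv i y)
        = (MvPolynomial.X i * MvPolynomial.pderiv i y) * z by ring,
      MonomialOrder.coeff_mul_of_add_of_degree_le (m := m) le_rfl (le z i),
      MonomialOrder.coeff_mul_of_add_of_degree_le (m := m) (le y i) le_rfl, co, co] at e
    have h1 : y.coeff (m.degree y) ≠ 0 := m.coeff_degree_ne_zero_iff.2 hy
    have h2 : z.coeff (m.degree z) ≠ 0 := m.coeff_degree_ne_zero_iff.2 hz
    have e' : ((m.degree z i : ℕ) : F) = (m.degree y i : ℕ) := by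
      apply mul_right_cancel₀ (mul_ne_zero h1 h2)
      linear_combination e
    exact_mod_cast e'
  have h1 : y.coeff (m.degree y) ≠ 0 := m.coeff_degree_ne_zero_iff.2 hy
  refine ⟨x.coeff (m.degree y) / y.coeff (m.degree y), ?_⟩
  by_contra hne
  have hz := sub_ne_zero.2 hne
  have hk := key _ hz (by
    intro i
    rw [map_sub, Derivation.map_smul, mul_sub, sub_mul, h i]
    simp)
  have := m.coeff_degree_ne_zero_iff.2 hz
  rw [hk] at this
  apply this
  simp [h1]

lemma poly_const (x y : Polynomial F) (hy : y ≠ 0)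
    (h : y * Polynomial.derivative x = x * Polynomial.derivative y) :
    ∃ c : F, x = c • y := by
  have key : ∀ z : Polynomial F, z ≠ 0 →
      (y * Polynomial.derivative z = z * Polynomial.derivative y) →
      z.natDegree = y.natDegree := by
    intro z hz hh
    have co : ∀ (u : Polynomial F) (b : ℕ),
        (Polynomial.X * Polynomial.derivative u).coeff b = (b : F) * u.coeff b := by
      intro u b
      cases b with
      | zero => simp
      | succ b => rw [Polynomial.coeff_X_mul, Polynomial.coeff_derivative]; push_cast; ring
    have le : ∀ (u : Polynomial F),
        (Polynomial.X * Polynomial.derivative u).natDegree ≤ u.natDegree := by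
      intro u
      rw [Polynomial.natDegree_le_iff_coeff_eq_zero]
      intro b hb
      rw [co, Polynomial.coeff_eq_zero_of_natDegree_lt hb, mul_zero]
    have e := congrArg (fun u => (Polynomial.X * u).coeff (y.natDegree + z.natDegree)) hh
    rw [show Polynomial.X * (y * Polynomial.derivative z)
        = y * (Polynomial.X * Polynomial.derivative z) by ring,
      show Polynomial.X * (z * Polynomial.derivative y)
        = (Polynomial.X * Polynomial.derivative y) * z by ring,
      Polynomial.coeff_mul_add_eq_of_natDegree_le le_rfl (le z),
      Polynomial.coeff_mul_add_eq_of_natDegree_le (le y) le_rfl, co, co] at e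
    have h1 : y.coeff y.natDegree ≠ 0 := by simpa using hy
    have h2 : z.coeff z.natDegree ≠ 0 := by simpa using hz
    have e' : ((z.natDegree : ℕ) : F) = (y.natDegree : ℕ) := by
      apply mul_right_cancel₀ (mul_ne_zero h1 h2)
      linear_combination e
    exact_mod_cast e'
  have h1 : y.coeff y.natDegree ≠ 0 := by simpa using hy
  refine ⟨x.coeff y.natDegree / y.coeff y.natDegree, ?_⟩
  by_contra hne
  have hz := sub_ne_zero.2 hne
  have hk := key _ hz (by
    rw [Polynomial.derivative_sub, Polynomial.derivative_smul, mul_sub, sub_mul, h]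
    simp)
  have : (x - (x.coeff y.natDegree / y.coeff y.natDegree) • y).coeff
    (x - (x.coeff y.natDegree / y.coeff y.natDegree) • y).natDegree ≠ 0 := by simpa using hz
  rw [hk] at this
  apply this
  rw [Polynomial.coeff_sub, Polynomial.coeff_smul, smul_eq_mul]
  field_simp
  ring

end consts

end

end Sub15


open Finset

namespace Sub15

set_option linter.unusedSimpArgs false
set_option linter.unusedVariables false
set_option linter.unusedSectionVars false

noncomputable section

section Hasse
variable {R : Type*} [CommRing R] {σ : Type*}

/-- multi-binomial coefficient -/
def chi (e a : σ →₀ ℕ) : ℕ := ∏ i ∈ e.support, (a i).choose (e i)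

lemma chi_eq [Fintype σ] (e a : σ →₀ ℕ) : chi e a = ∏ i, (a i).choose (e i) := by
  apply Finset.prod_subset (subset_univ _)
  intro i _ hi
  rw [Finsupp.notMem_support_iff.1 hi]; simp

/-- Hasse derivative -/
def hd (e : σ →₀ ℕ) : MvPolynomial σ R →ₗ[R] MvPolynomial σ R :=
  (MvPolynomial.basisMonomials σ R).constr R
    (fun a => MvPolynomial.monomial (a - e) (chi e a : R))

lemma hd_monomial (e a : σ →₀ ℕ) (r : R) :
    hd e (MvPolynomial.monomial a r) = MvPolynomial.monomial (a - e) (r * chi e a) := by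
  have : MvPolynomial.monomial a r = r • (MvPolynomial.basisMonomials σ R) a := by
    simp [MvPolynomial.smul_monomial]
  rw [this, map_smul, hd, Module.Basis.constr_basis, MvPolynomial.smul_monomial, smul_eq_mul]

lemma chi_eq_zero (e a : σ →₀ ℕ) (h : ¬ e ≤ a) : chi e a = 0 := by
  rw [Finsupp.le_def] at h
  push Not at h
  obtain ⟨i, hi⟩ := h
  apply Finset.prod_eq_zero (i := i) (by rw [Finsupp.mem_support_iff]; omega)
  exact Nat.choose_eq_zero_of_lt hi

lemma coeff_hd (e b : σ →₀ ℕ) (P : MvPolynomial σ R) :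
    (hd e P).coeff b = P.coeff (b + e) * chi e (b + e) := by
  classical
  induction P using MvPolynomial.induction_on' with
  | monomial a r =>
    rw [hd_monomial, MvPolynomial.coeff_monomial, MvPolynomial.coeff_monomial]
    by_cases h : e ≤ a
    · have : a - e = b ↔ a = b + e := by
        constructor
        · intro h1; rw [← h1, tsub_add_cancel_of_le h]
        · intro h1; rw [h1, add_tsub_cancel_right]
      simp only [this]
      split_ifs with h2
      · rw [h2]
      · simp
    · rw [chi_eq_zero e a h, if_neg (c := a = b + e)]
      · simp
      · rintro rfl; exact h le_add_self
  | add p q hp hq => rw [map_add, MvPolynomial.coeff_add, hp, hq, MvPolynomial.coeff_add, add_mul]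

lemma hd_zero (P : MvPolynomial σ R) : hd 0 P = P := by
  ext b; rw [coeff_hd]; simp [chi]

lemma coeff_pderiv' (i : σ) (P : MvPolynomial σ R) (b : σ →₀ ℕ) :
    (MvPolynomial.pderiv i P).coeff b = P.coeff (b + Finsupp.single i 1) * (b i + 1) := by
  classical
  induction P using MvPolynomial.induction_on' with
  | monomial a r =>
    rw [MvPolynomial.pderiv_monomial, MvPolynomial.coeff_monomial, MvPolynomial.coeff_monomial]
    by_cases h : a i = 0
    · rw [if_neg (c := a = _)]
      · simp [h]
      · rintro rfl; simp at h
    · have : a - Finsupp.single i 1 = b ↔ a = b + Finsupp.single i 1 := by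
        constructor
        · intro h1; rw [← h1, tsub_add_cancel_of_le]
          rw [Finsupp.single_le_iff]; omega
        · intro h1; rw [h1, add_tsub_cancel_right]
      simp only [this]
      split_ifs with h2
      · rw [h2]; simp
      · simp
  | add p q hp hq => rw [map_add, MvPolynomial.coeff_add, hp, hq, MvPolynomial.coeff_add, add_mul]

lemma chi_succ [DecidableEq σ] (e a : σ →₀ ℕ) (i : σ) (ha : e i + 1 ≤ a i) :
    chi (e + Finsupp.single i 1) a * (e i + 1) = chi e a * (a i - e i) := by
  have h1 : chi (e + Finsupp.single i 1) a =
      ∏ j ∈ insert i e.support, (a j).choose ((e + Finsupp.single i 1 : σ →₀ ℕ) j) := by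
    apply Finset.prod_subset
    · intro j hj
      rw [Finsupp.mem_support_iff] at hj
      by_cases h : j = i
      · simp [h]
      · simp [h, Finsupp.single_apply, Ne.symm h] at hj ⊢
        omega
    · intro j _ hj
      rw [Finsupp.notMem_support_iff.1 hj]; simp
  have h2 : chi e a = ∏ j ∈ insert i e.support, (a j).choose (e j) := by
    apply Finset.prod_subset (subset_insert _ _)
    intro j _ hj
    rw [Finsupp.notMem_support_iff.1 hj]; simp
  rw [h1, h2, ← Finset.mul_prod_erase _ _ (mem_insert_self i e.support),
    ← Finset.mul_prod_erase _ _ (mem_insert_self i e.support)]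
  have h3 : ∀ j ∈ (insert i e.support).erase i, (a j).choose ((e + Finsupp.single i 1 : σ →₀ ℕ) j)
      = (a j).choose (e j) := by
    intro j hj
    have : j ≠ i := ne_of_mem_erase hj
    simp [Finsupp.single_apply, this.symm]
  rw [prod_congr rfl h3]
  have h4 := Nat.choose_succ_right_eq (a i) (e i)
  simp only [Finsupp.add_apply, Finsupp.single_eq_same]
  linear_combination (∏ x ∈ (insert i e.support).erase i, (a x).choose (e x)) * h4

lemma pderiv_hd (e : σ →₀ ℕ) (i : σ) (P : MvPolynomial σ R) :
    MvPolynomial.pderiv i (hd e P) = ((e i + 1 : ℕ) : R) • hd (e + Finsupp.single i 1) P := by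
  classical
  ext b
  rw [coeff_pderiv', coeff_hd, MvPolynomial.coeff_smul, coeff_hd]
  have := chi_succ e (b + Finsupp.single i 1 + e) i (by simp)
  have h2 : (b + Finsupp.single i 1 + e : σ →₀ ℕ) i - e i = b i + 1 := by simp
  rw [h2] at this
  rw [show b + (e + Finsupp.single i 1) = b + Finsupp.single i 1 + e by abel, smul_eq_mul]
  have h3 := congrArg (Nat.cast : ℕ → R) this
  push_cast at h3 ⊢
  linear_combination (-MvPolynomial.coeff (b + Finsupp.single i 1 + e) P) * h3

lemma hd_map {S : Type*} [CommRing S] (f : R →+* S) (e : σ →₀ ℕ) (P : MvPolynomial σ R) :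
    hd e (MvPolynomial.map f P) = MvPolynomial.map f (hd e P) := by
  ext b; simp [coeff_hd, MvPolynomial.coeff_map]

/-- shift -/
def sh (ξ : σ → R) : MvPolynomial σ R →ₐ[R] MvPolynomial σ R :=
  MvPolynomial.aeval fun i => MvPolynomial.X i + MvPolynomial.C (ξ i)

lemma pderiv_sh (ξ : σ → R) (i : σ) (P : MvPolynomial σ R) :
    MvPolynomial.pderiv i (sh ξ P) = sh ξ (MvPolynomial.pderiv i P) := by
  classical
  induction P using MvPolynomial.induction_on with
  | C a => simp [sh]
  | add p q hp hq => simp [hp, hq]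
  | mul_X p j hp =>
    rw [map_mul, Derivation.leibniz, hp, Derivation.leibniz]
    simp only [smul_eq_mul, map_add, map_mul]
    have : MvPolynomial.pderiv i (sh ξ (MvPolynomial.X j)) =
        sh ξ (MvPolynomial.pderiv i (MvPolynomial.X j)) := by
      simp only [sh, MvPolynomial.aeval_X, map_add, MvPolynomial.pderiv_C, add_zero,
        MvPolynomial.pderiv_X]
      by_cases h : j = i
      · subst h; simp
      · simp [Pi.single_apply, h]
    rw [this]

end Hasse

lemma hd_sh {F σ : Type*} [Field F] [CharZero F] (ξ : σ → F) (e : σ →₀ ℕ)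
    (P : MvPolynomial σ F) : hd e (sh ξ P) = sh ξ (hd e P) := by
  classical
  generalize hn : e.degree = n
  induction n generalizing e with
  | zero =>
    have : e = 0 := (Finsupp.degree_eq_zero_iff e).1 hn
    rw [this, hd_zero, hd_zero]
  | succ n ih =>
    have hne : e ≠ 0 := by rintro rfl; simp at hn
    obtain ⟨i, hi⟩ := Finsupp.ne_iff.1 hne
    obtain ⟨e', rfl⟩ : ∃ e', e = e' + Finsupp.single i 1 :=
      ⟨e - Finsupp.single i 1, by
        rw [tsub_add_cancel_of_le]
        rw [Finsupp.single_le_iff]; simp at hi; omega⟩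
    have h1 := ih e' (by simpa [map_add] using hn)
    have h2 := congrArg (MvPolynomial.pderiv i) h1
    rw [pderiv_hd, pderiv_sh, pderiv_hd, map_smul] at h2
    exact smul_right_injective _ (by exact_mod_cast Nat.succ_ne_zero (e' i)) h2

lemma iterD_mv {F σ : Type*} [Field F] [CharZero F] (l : List σ) :
    ∃ (e : σ →₀ ℕ) (c : ℕ), c ≠ 0 ∧ e.degree = l.length ∧
      ∀ P : MvPolynomial σ F,
        iterD (fun i => MvPolynomial.pderiv i) l P = (c : F) • hd e P := by
  classical
  induction l with
  | nil => exact ⟨0, 1, one_ne_zero, by simp, fun P => by simp [iterD, hd_zero]⟩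
  | cons i l ih =>
    obtain ⟨e, c, hc, he, hP⟩ := ih
    refine ⟨e + Finsupp.single i 1, c * (e i + 1), mul_ne_zero hc (by omega), ?_, ?_⟩
    · simp [map_add, he]
    · intro P
      rw [iterD, hP, Derivation.map_smul, pderiv_hd, smul_smul]
      push_cast; rfl

lemma iterD_poly {F : Type*} [Field F] [CharZero F] (l : List Unit) (P : Polynomial F) :
    iterD (fun _ : Unit => (Polynomial.derivative' (R := F))) l P
      = ((l.length.factorial : ℕ) : F) • Polynomial.hasseDeriv l.length P := by
  have : iterD (fun _ : Unit => (Polynomial.derivative' (R := F))) l P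
      = Polynomial.derivative^[l.length] P := by
    induction l with
    | nil => rfl
    | cons i l ih =>
      rw [iterD, ih, List.length_cons, Function.iterate_succ_apply']; rfl
  rw [this]
  have h := congrFun (Polynomial.factorial_smul_hasseDeriv (R := F) l.length) P
  rw [← h]
  simp [Nat.cast_smul_eq_nsmul]

/-- Generalized Wronskian, Hasse form, several variables -/
lemma wr_mv {F : Type*} [Field F] [CharZero F] {n k : ℕ} (φ : Fin k → MvPolynomial (Fin n) F)
    (hφ : LinearIndependent F φ) :
    ∃ e : Fin k → (Fin n →₀ ℕ), (∀ i, (e i).degree ≤ i) ∧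
      (Matrix.of fun i j => hd (e i) (φ j)).det ≠ 0 := by
  obtain ⟨l, hl, hdet⟩ := gen_wronskian (F := F) (A := MvPolynomial (Fin n) F)
    (fun i : Fin n => MvPolynomial.pderiv i) (fun x y hy h => mv_const x y hy h) k φ hφ
  choose e c hc he hP using fun i => iterD_mv (F := F) (l i)
  refine ⟨e, fun i => (he i).trans_le (hl i), ?_⟩
  intro h0
  apply hdet
  have : (Matrix.of fun i j => iterD (fun i : Fin n => MvPolynomial.pderiv i) (l i) (φ j))
      = Matrix.of fun i j => (MvPolynomial.C (c i : F)) *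
        (Matrix.of fun i j => hd (e i) (φ j)) i j := by
    refine Matrix.ext fun i j => ?_
    simp only [Matrix.of_apply]
    rw [hP, MvPolynomial.smul_eq_C_mul]
  rw [this, Matrix.det_mul_column, h0, mul_zero]

lemma wr_poly {F : Type*} [Field F] [CharZero F] {k : ℕ} (φ : Fin k → Polynomial F)
    (hφ : LinearIndependent F φ) :
    ∃ e : Fin k → ℕ, (∀ i, e i ≤ i) ∧
      (Matrix.of fun i j => Polynomial.hasseDeriv (e i) (φ j)).det ≠ 0 := by
  obtain ⟨l, hl, hdet⟩ := gen_wronskian (F := F) (A := Polynomial F)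
    (fun i : Unit => Polynomial.derivative') (fun x y hy h => poly_const x y hy (h ())) k φ hφ
  refine ⟨fun i => (l i).length, hl, ?_⟩
  intro h0
  apply hdet
  have : (Matrix.of fun i j => iterD (fun _ : Unit => Polynomial.derivative' (R := F)) (l i) (φ j))
      = Matrix.of fun i j => (Polynomial.C (((l i).length.factorial : ℕ) : F)) *
        (Matrix.of fun i j => Polynomial.hasseDeriv (l i).length (φ j)) i j := by
    refine Matrix.ext fun i j => ?_
    simp only [Matrix.of_apply]
    rw [iterD_poly, Polynomial.smul_eq_C_mul]
  rw [this, Matrix.det_mul_column, h0, mul_zero]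

end

end Sub15


open Finset

namespace Sub15

set_option linter.unusedSimpArgs false
set_option linter.unusedVariables false
set_option linter.unusedSectionVars false

noncomputable section

section Emb
variable {K : Type*} [Field K] {n : ℕ}

/-- product of a polynomial in variables 1..n and a polynomial in variable 0 -/
def emb (A : MvPolynomial (Fin n) K) (B : Polynomial K) : MvPolynomial (Fin (n+1)) K :=
  MvPolynomial.rename Fin.succ A * Polynomial.aeval (MvPolynomial.X 0) B

lemma fse_rename (A : MvPolynomial (Fin n) K) :
    MvPolynomial.finSuccEquiv K n (MvPolynomial.rename Fin.succ A) = Polynomial.C A := by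
  induction A using MvPolynomial.induction_on with
  | C a => simp [MvPolynomial.finSuccEquiv_apply]
  | add p q hp hq => simp [hp, hq]
  | mul_X p j hp => simp [hp, MvPolynomial.finSuccEquiv_X_succ]

lemma fse_aeval (B : Polynomial K) :
    MvPolynomial.finSuccEquiv K n (Polynomial.aeval (MvPolynomial.X 0) B)
      = B.map MvPolynomial.C := by
  induction B using Polynomial.induction_on' with
  | add p q hp hq => simp [hp, hq]
  | monomial k a =>
    rw [Polynomial.aeval_monomial, map_mul, map_pow, MvPolynomial.finSuccEquiv_X_zero,
      Polynomial.map_monomial, ← Polynomial.C_mul_X_pow_eq_monomial]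
    congr 1
    simp [MvPolynomial.algebraMap_eq, MvPolynomial.finSuccEquiv_apply]

lemma coeff_emb (A : MvPolynomial (Fin n) K) (B : Polynomial K) (r : ℕ) (e : Fin n →₀ ℕ) :
    (emb A B).coeff (e.cons r) = A.coeff e * B.coeff r := by
  rw [← MvPolynomial.finSuccEquiv_coeff_coeff, emb, map_mul, fse_rename, fse_aeval,
    Polynomial.coeff_C_mul, Polynomial.coeff_map, mul_comm, MvPolynomial.coeff_C_mul, mul_comm]

lemma ext_cons (P Q : MvPolynomial (Fin (n+1)) K)
    (h : ∀ (r : ℕ) (e : Fin n →₀ ℕ), P.coeff (e.cons r) = Q.coeff (e.cons r)) : P = Q := by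
  ext b
  rw [← Finsupp.cons_tail b]
  exact h _ _

lemma chi_cons (a r : ℕ) (e b : Fin n →₀ ℕ) :
    chi (e.cons a) (b.cons r) = r.choose a * chi e b := by
  rw [chi_eq, chi_eq, Fin.prod_univ_succ]
  simp

lemma cons_add_cons (a r : ℕ) (e b : Fin n →₀ ℕ) :
    (b.cons r + e.cons a : Fin (n+1) →₀ ℕ) = (b + e).cons (r + a) := by
  ext i
  refine Fin.cases ?_ (fun i => ?_) i <;> simp

lemma hd_emb (a : ℕ) (e : Fin n →₀ ℕ) (A : MvPolynomial (Fin n) K) (B : Polynomial K) :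
    hd (e.cons a) (emb A B) = emb (hd e A) (Polynomial.hasseDeriv a B) := by
  apply ext_cons
  intro r b
  rw [coeff_hd, cons_add_cons, coeff_emb, coeff_emb, chi_cons, coeff_hd,
    Polynomial.hasseDeriv_coeff]
  push_cast
  ring

lemma sh_emb (ξ : Fin (n+1) → K) (A : MvPolynomial (Fin n) K) (B : Polynomial K) :
    sh ξ (emb A B) = emb (sh (fun i => ξ i.succ) A) (Polynomial.taylor (ξ 0) B) := by
  rw [emb, map_mul, emb]
  congr 1
  · induction A using MvPolynomial.induction_on with
    | C a => simp [sh]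
    | add p q hp hq => simp [hp, hq]
    | mul_X p j hp =>
      rw [map_mul, map_mul, hp, map_mul, map_mul]; congr 1; simp [sh]
  · induction B using Polynomial.induction_on' with
    | add p q hp hq => simp [hp, hq]
    | monomial k a => simp [sh, Polynomial.taylor_monomial, Polynomial.aeval_monomial,
        MvPolynomial.algebraMap_eq]

/-- decomposition -/
lemma decomp (d : ℕ) (P : MvPolynomial (Fin (n+1)) K) (hP : P ≠ 0) (hd0 : P.degreeOf 0 ≤ d) :
    ∃ (k : ℕ) (φ : Fin k → MvPolynomial (Fin n) K) (ψ : Fin k → Polynomial K),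
      0 < k ∧ k ≤ d + 1 ∧ LinearIndependent K φ ∧ LinearIndependent K ψ ∧
      P = ∑ j, emb (φ j) (ψ j) := by
  classical
  set q := MvPolynomial.finSuccEquiv K n P with hq
  set U : Submodule K (MvPolynomial (Fin n) K) :=
    Submodule.span K (Set.range fun i : Fin (d+1) => q.coeff i) with hU
  have : FiniteDimensional K U := FiniteDimensional.span_of_finite K (Set.finite_range _)
  set k := Module.finrank K U
  let bs : Module.Basis (Fin k) K U := Module.finBasis K U
  have hmem : ∀ i : Fin (d+1), q.coeff i ∈ U := fun i => Submodule.subset_span ⟨i, rfl⟩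
  have hdeg : q.natDegree ≤ d := by rw [hq, MvPolynomial.natDegree_finSuccEquiv]; exact hd0
  let ψ : Fin k → Polynomial K := fun j =>
    ∑ i : Fin (d+1), Polynomial.monomial (i : ℕ) (bs.repr ⟨q.coeff i, hmem i⟩ j)
  have hψc : ∀ j (i : ℕ) (hi : i < d + 1), (ψ j).coeff i = bs.repr ⟨q.coeff i, hmem ⟨i, hi⟩⟩ j := by
    intro j i hi
    simp only [ψ, Polynomial.finsetSum_coeff, Polynomial.coeff_monomial]
    rw [Finset.sum_eq_single ⟨i, hi⟩]
    · simp
    · intro b _ hb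
      rw [if_neg]; intro h; exact hb (Fin.ext h)
    · simp
  have hψ0 : ∀ j (i : ℕ), d < i → (ψ j).coeff i = 0 := by
    intro j i hi
    simp only [ψ, Polynomial.finsetSum_coeff, Polynomial.coeff_monomial]
    apply Finset.sum_eq_zero
    intro b _
    rw [if_neg]; omega
  refine ⟨k, fun j => (bs j : MvPolynomial (Fin n) K), ψ, ?_, ?_, ?_, ?_, ?_⟩
  · rw [Nat.pos_iff_ne_zero]
    intro hk
    have hU0 : U = ⊥ := Submodule.finrank_eq_zero.1 hk
    apply hP
    have : q = 0 := by
      ext1 i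
      by_cases hi : i < d + 1
      · have := hmem ⟨i, hi⟩
        rw [hU0, Submodule.mem_bot] at this
        simpa using this
      · rw [Polynomial.coeff_eq_zero_of_natDegree_lt (by omega)]; simp
    exact (map_eq_zero_iff _ (MvPolynomial.finSuccEquiv K n).injective).1 this
  · have := finrank_range_le_card (R := K) (fun i : Fin (d+1) => q.coeff i)
    simpa [Set.finrank] using this
  · exact bs.linearIndependent.map' U.subtype (Submodule.ker_subtype U)
  · rw [Fintype.linearIndependent_iff]
    intro g hg
    -- functional
    let fl : U →ₗ[K] K := bs.constr K g
    have hfl : ∀ u : U, fl u = ∑ j, bs.repr u j * g j := by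
      intro u
      simp only [fl, Module.Basis.constr_apply_fintype, smul_eq_mul]
      rfl
    have hz : ∀ i : Fin (d+1), fl ⟨q.coeff i, hmem i⟩ = 0 := by
      intro i
      rw [hfl]
      have := congrArg (fun p => Polynomial.coeff p (i : ℕ)) hg
      simp only [Polynomial.finsetSum_coeff, Polynomial.coeff_smul, smul_eq_mul,
        Polynomial.coeff_zero] at this
      rw [← this]
      refine sum_congr rfl fun j _ => ?_
      rw [hψc j i i.2, mul_comm]
    have hz' : fl = 0 := by
      apply LinearMap.ext
      rintro ⟨u, hu⟩
      have hu' := hu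
      refine Submodule.span_induction
        (p := fun u hu => fl ⟨u, hu⟩ = 0) ?_ ?_ ?_ ?_ hu'
      · rintro x ⟨i, rfl⟩; exact hz i
      · exact map_zero fl
      · intro x y hx hy h1 h2
        have : fl (⟨x, hx⟩ + ⟨y, hy⟩) = 0 := by rw [map_add, h1, h2, add_zero]
        exact this
      · intro a x hx h1
        have : fl (a • ⟨x, hx⟩) = 0 := by rw [map_smul, h1, smul_zero]
        exact this
    intro j
    have := LinearMap.congr_fun hz' (bs j)
    simpa [fl, Module.Basis.constr_basis] using this
  · apply ext_cons
    intro r e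
    rw [MvPolynomial.coeff_sum, ← MvPolynomial.finSuccEquiv_coeff_coeff, ← hq]
    simp only [coeff_emb]
    by_cases hr : r < d + 1
    · have h1 : q.coeff r = ∑ j, bs.repr ⟨q.coeff r, hmem ⟨r, hr⟩⟩ j •
          (bs j : MvPolynomial (Fin n) K) := by
        have := congrArg (Subtype.val) (bs.sum_repr ⟨q.coeff r, hmem ⟨r, hr⟩⟩)
        refine this.symm.trans ?_; rw [AddSubmonoidClass.coe_finsetSum]; rfl
      conv_lhs => rw [h1]
      rw [MvPolynomial.coeff_sum]
      refine sum_congr rfl fun j _ => ?_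
      rw [hψc j r hr, MvPolynomial.coeff_smul, smul_eq_mul, mul_comm]
    · rw [Polynomial.coeff_eq_zero_of_natDegree_lt (by omega), MvPolynomial.coeff_zero]
      symm
      apply sum_eq_zero
      intro j _
      rw [hψ0 j r (by omega), mul_zero]

lemma det_emb {k : ℕ} (φ : Fin k → MvPolynomial (Fin n) K) (ψ : Fin k → Polynomial K)
    (e : Fin k → (Fin n →₀ ℕ)) (a : Fin k → ℕ) :
    (Matrix.of fun i j => hd ((e i).cons (a j)) (∑ l, emb (φ l) (ψ l))).det
      = emb (Matrix.of fun i j => hd (e i) (φ j)).det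
        (Matrix.of fun i j => Polynomial.hasseDeriv (a i) (ψ j)).det := by
  have : (Matrix.of fun i j => hd ((e i).cons (a j)) (∑ l, emb (φ l) (ψ l)))
    = (MvPolynomial.rename Fin.succ).toRingHom.mapMatrix (Matrix.of fun i j => hd (e i) (φ j)) *
      ((Polynomial.aeval (R := K) (MvPolynomial.X (0 : Fin (n+1)))).toRingHom.mapMatrix
        (Matrix.of fun i j => Polynomial.hasseDeriv (a i) (ψ j))).transpose := by
    refine Matrix.ext fun i j => ?_
    simp only [Matrix.of_apply, Matrix.mul_apply, map_sum, hd_emb]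
    rfl
  rw [this, Matrix.det_mul, Matrix.det_transpose, ← RingHom.map_det, ← RingHom.map_det]
  rfl

end Emb

section Van
variable {R : Type*} [CommRing R] {σ : Type*} [Fintype σ]

/-- weight of an exponent -/
def wt (δ : σ → ℝ) (a : σ →₀ ℕ) : ℝ := ∑ i, (a i : ℝ) * δ i

/-- all exponents have weight at least τ -/
def Van (δ : σ → ℝ) (τ : ℝ) (P : MvPolynomial σ R) : Prop := ∀ a ∈ P.support, τ ≤ wt δ a

lemma wt_add (δ : σ → ℝ) (a b : σ →₀ ℕ) : wt δ (a + b) = wt δ a + wt δ b := by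
  simp [wt, add_mul, sum_add_distrib]

lemma wt_nonneg (δ : σ → ℝ) (hδ : ∀ i, 0 ≤ δ i) (a : σ →₀ ℕ) : 0 ≤ wt δ a :=
  sum_nonneg fun i _ => mul_nonneg (Nat.cast_nonneg _) (hδ i)

lemma Van.mul {δ : σ → ℝ} {τ τ' : ℝ} {P Q : MvPolynomial σ R} (hP : Van δ τ P)
    (hQ : Van δ τ' Q) : Van δ (τ + τ') (P * Q) := by
  classical
  intro a ha
  have := MvPolynomial.support_mul P Q ha
  rw [Finset.mem_add] at this
  obtain ⟨b, hb, c, hc, rfl⟩ := this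
  rw [wt_add]
  exact add_le_add (hP b hb) (hQ c hc)

lemma Van.sum {ι : Type*} {δ : σ → ℝ} {τ : ℝ} (s : Finset ι) (P : ι → MvPolynomial σ R)
    (h : ∀ i ∈ s, Van δ τ (P i)) : Van δ τ (∑ i ∈ s, P i) := by
  classical
  intro a ha
  rw [MvPolynomial.mem_support_iff, MvPolynomial.coeff_sum] at ha
  obtain ⟨i, hi, hne⟩ := exists_ne_zero_of_sum_ne_zero ha
  exact h i hi a (MvPolynomial.mem_support_iff.2 hne)

lemma Van.one {δ : σ → ℝ} : Van δ 0 (1 : MvPolynomial σ R) := by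
  classical
  intro a ha
  rw [MvPolynomial.mem_support_iff, MvPolynomial.coeff_one] at ha
  have : a = 0 := by by_contra h; exact ha (if_neg (Ne.symm h))
  simp [this, wt]

lemma Van.prod {ι : Type*} {δ : σ → ℝ} {τ : ι → ℝ} (s : Finset ι) (P : ι → MvPolynomial σ R)
    (h : ∀ i ∈ s, Van δ (τ i) (P i)) : Van δ (∑ i ∈ s, τ i) (∏ i ∈ s, P i) := by
  classical
  induction s using Finset.induction_on with
  | empty => simpa using Van.one
  | insert a s ha ih =>
    rw [sum_insert ha, prod_insert ha]
    exact (h a (mem_insert_self _ _)).mul (ih fun i hi => h i (mem_insert_of_mem hi))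

lemma Van.det {k : ℕ} {δ : σ → ℝ} {τ : Fin k → ℝ} (M : Matrix (Fin k) (Fin k) (MvPolynomial σ R))
    (h : ∀ i j, Van δ (τ j) (M i j)) : Van δ (∑ j, τ j) M.det := by
  rw [Matrix.det_apply]
  refine Van.sum _ _ fun s _ => ?_
  have h1 : Van δ (∑ j, τ j) (∏ i, M (s i) i) := Van.prod _ _ fun i _ => h _ _
  rcases Int.units_eq_one_or (Equiv.Perm.sign s) with hs | hs <;> rw [hs]
  · simpa using h1
  · intro a ha
    apply h1 a
    simpa using ha

lemma Van.hd {δ : σ → ℝ} {τ : ℝ} {P : MvPolynomial σ R} (h : Van δ τ P) (e : σ →₀ ℕ) :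
    Van δ (τ - wt δ e) (Sub15.hd e P) := by
  intro b hb
  rw [MvPolynomial.mem_support_iff, coeff_hd] at hb
  have := h (b + e) (MvPolynomial.mem_support_iff.2 (left_ne_zero_of_mul hb))
  rw [wt_add] at this
  linarith

end Van

section l1b
variable {σ : Type*} [Fintype σ]

lemma l1_hd (e : σ →₀ ℕ) (P : MvPolynomial σ ℤ) (d : σ → ℕ) (hd' : ∀ i, P.degreeOf i ≤ d i) :
    l1 (hd e P) ≤ 2 ^ (∑ i, d i) * l1 P := by
  classical
  rw [l1_eq, l1_eq, mul_sum]
  have hinj : Function.Injective (fun b : σ →₀ ℕ => b + e) := add_left_injective e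
  calc ∑ b ∈ (hd e P).support, |(((hd e P).coeff b : ℤ) : ℝ)|
      ≤ ∑ b ∈ (hd e P).support, 2 ^ (∑ i, d i) * |((P.coeff (b + e) : ℤ) : ℝ)| := by
        refine sum_le_sum fun b hb => ?_
        rw [MvPolynomial.mem_support_iff, coeff_hd] at hb
        have hmem := MvPolynomial.mem_support_iff.2 (left_ne_zero_of_mul hb)
        rw [coeff_hd]
        push_cast
        rw [abs_mul, mul_comm]
        gcongr
        rw [abs_of_nonneg (Nat.cast_nonneg _), chi_eq]
        push_cast
        rw [← prod_pow_eq_pow_sum]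
        refine prod_le_prod (fun i _ => Nat.cast_nonneg _) fun i _ => ?_
        have h1 : (b + e) i ≤ d i := (MvPolynomial.degreeOf_le_iff.1 (hd' i)) _ hmem
        have h2 : ((b + e) i).choose (e i) ≤ 2 ^ (d i) :=
          (Nat.choose_le_two_pow _ _).trans (Nat.pow_le_pow_right (by norm_num) h1)
        exact_mod_cast h2
    _ = ∑ a ∈ ((hd e P).support.image fun b => b + e),
          2 ^ (∑ i, d i) * |((P.coeff a : ℤ) : ℝ)| := by
        rw [sum_image (fun a _ b _ h => hinj h)]
    _ ≤ ∑ a ∈ P.support, 2 ^ (∑ i, d i) * |((P.coeff a : ℤ) : ℝ)| := by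
        apply sum_le_sum_of_subset_of_nonneg
        · intro a ha
          obtain ⟨b, hb, rfl⟩ := mem_image.1 ha
          rw [MvPolynomial.mem_support_iff, coeff_hd] at hb
          exact MvPolynomial.mem_support_iff.2 (left_ne_zero_of_mul hb)
        · intros; positivity

lemma degreeOf_hd {R : Type*} [CommRing R] (e : σ →₀ ℕ) (P : MvPolynomial σ R) (i : σ) :
    (hd e P).degreeOf i ≤ P.degreeOf i := by
  rw [MvPolynomial.degreeOf_le_iff]
  intro b hb
  rw [MvPolynomial.mem_support_iff, coeff_hd] at hb
  have := MvPolynomial.degreeOf_le_iff.1 (le_refl (P.degreeOf i)) _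
    (MvPolynomial.mem_support_iff.2 (left_ne_zero_of_mul hb))
  simp at this
  omega

lemma l1_det {k : ℕ} (M : Matrix (Fin k) (Fin k) (MvPolynomial σ ℤ)) (C : ℝ)
    (h : ∀ i j, l1 (M i j) ≤ C) : l1 M.det ≤ k.factorial * C ^ k := by
  rw [Matrix.det_apply]
  refine (l1_sum _ _).trans ?_
  have : ∀ s : Equiv.Perm (Fin k), l1 (Equiv.Perm.sign s • ∏ i, M (s i) i) ≤ C ^ k := by
    intro s
    have h1 : l1 (∏ i, M (s i) i) ≤ C ^ k := by
      refine (l1_prod _ _).trans ?_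
      calc ∏ i, l1 (M (s i) i) ≤ ∏ i : Fin k, C :=
            prod_le_prod (fun i _ => l1_nonneg _) fun i _ => h _ _
        _ = C ^ k := by simp
    rcases Int.units_eq_one_or (Equiv.Perm.sign s) with hs | hs <;> rw [hs]
    · simpa using h1
    · rw [Units.neg_smul, one_smul, l1, wnorm_neg]; exact h1
  refine (sum_le_sum fun s _ => this s).trans ?_
  simp [Fintype.card_perm]

lemma degreeOf_det {R : Type*} [CommRing R] {k : ℕ} (M : Matrix (Fin k) (Fin k) (MvPolynomial σ R))
    (i : σ) (d : ℕ) (h : ∀ a b, (M a b).degreeOf i ≤ d) : M.det.degreeOf i ≤ k * d := by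
  rw [Matrix.det_apply]
  refine (MvPolynomial.degreeOf_sum_le _ _ _).trans ?_
  refine Finset.sup_le fun s _ => ?_
  have h1 : (∏ j, M (s j) j).degreeOf i ≤ k * d := by
    refine (MvPolynomial.degreeOf_prod_le _ _ _).trans ?_
    calc ∑ j, (M (s j) j).degreeOf i ≤ ∑ j : Fin k, d := sum_le_sum fun j _ => h _ _
      _ = k * d := by simp
  rcases Int.units_eq_one_or (Equiv.Perm.sign s) with hs | hs <;> rw [hs]
  · simpa using h1
  · rw [Units.neg_smul, one_smul]
    have : (-∏ j, M (s j) j).degreeOf i = (∏ j, M (s j) j).degreeOf i := by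
      rw [MvPolynomial.degreeOf_eq_sup, MvPolynomial.degreeOf_eq_sup, MvPolynomial.support_neg]
    rw [this]; exact h1

end l1b

end

end Sub15


open Finset

namespace Sub15

set_option linter.unusedSimpArgs false
set_option linter.unusedVariables false
set_option linter.unusedSectionVars false

noncomputable section

/-- height-type lower bound for ξ -/
def RothH {K : Type*} [Field K] (ξ : K) (H : ℝ) : Prop :=
  ∀ (W : Polynomial ℤ) (l : ℕ), W ≠ 0 →
    (Polynomial.X - Polynomial.C ξ) ^ l ∣ W.map (Int.castRingHom K) →
    H ^ l ≤ ∑ i ∈ W.support, |((W.coeff i : ℤ) : ℝ)|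

lemma sum_max_bound (k d : ℕ) (hd : 1 ≤ d) (hk : k ≤ d + 1) (τ : ℝ) (h0 : 0 ≤ τ) (h1 : τ ≤ 1) :
    k * τ ^ 2 / 8 ≤ ∑ j : Fin k, max 0 (τ - (j : ℕ) / (d : ℝ)) := by
  have hd' : (1 : ℝ) ≤ d := by exact_mod_cast hd
  rw [Fin.sum_univ_eq_sum_range (fun j : ℕ => max 0 (τ - (j : ℝ) / (d : ℝ))) k]
  set t := ⌊τ * d / 2⌋₊ + 1
  have ht : τ * d / 2 ≤ t := by
    have := Nat.lt_floor_add_one (τ * d / 2)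
    simp only [t]; push_cast; linarith
  have hmin : k * τ / 4 ≤ ((min k t : ℕ) : ℝ) := by
    have hk' : (k : ℝ) ≤ d + 1 := by exact_mod_cast hk
    have hk0 : (0 : ℝ) ≤ k := Nat.cast_nonneg _
    rcases le_total k t with h | h
    · rw [min_eq_left h]; nlinarith
    · rw [min_eq_right h]; nlinarith
  calc k * τ ^ 2 / 8 ≤ ((min k t : ℕ) : ℝ) * (τ / 2) := by nlinarith
    _ = ∑ j ∈ range (min k t), τ / 2 := by simp
    _ ≤ ∑ j ∈ range (min k t), max 0 (τ - (j : ℝ) / (d : ℝ)) := by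
        refine sum_le_sum fun j hj => ?_
        refine le_trans ?_ (le_max_right _ _)
        have hj' : j < t := lt_of_lt_of_le (mem_range.1 hj) (min_le_right _ _)
        have hj2 : j ≤ ⌊τ * d / 2⌋₊ := by omega
        have hj3 : (j : ℝ) ≤ τ * d / 2 := (Nat.le_floor_iff (by positivity)).1 hj2
        have : (j : ℝ) / d ≤ τ / 2 := by
          rw [div_le_iff₀ (by linarith)]; linarith
        linarith
    _ ≤ ∑ j ∈ range k, max 0 (τ - (j : ℝ) / (d : ℝ)) := by
        apply sum_le_sum_of_subset_of_nonneg
        · exact range_subset_range.2 (min_le_left _ _)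
        · intros; exact le_max_left _ _

set_option maxHeartbeats 1600000 in
theorem roth_lemma (K : Type*) [Field K] [CharZero K] (n : ℕ) : ∀ ε : ℝ, 0 < ε → ∃ ω : ℝ, 0 < ω ∧
    ∀ (P : MvPolynomial (Fin n) ℤ) (d : Fin n → ℕ) (B : ℝ) (ξ : Fin n → K) (H : Fin n → ℝ),
      P ≠ 0 → (∀ h, P.degreeOf h ≤ d h) → (∀ h, 1 ≤ d h) → l1 P ≤ B →
      (∀ h h', h < h' → (d h : ℝ) ≤ ω * d h') →
      (∀ h, RothH (ξ h) (H h)) → (∀ h, 0 < H h) →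
      (∀ h, Real.log B + ∑ i, (d i : ℝ) ≤ ω * (d h * Real.log (H h))) →
      ∃ j ∈ (sh ξ (MvPolynomial.map (Int.castRingHom K) P)).support,
        wt (fun h => 1 / (d h : ℝ)) j ≤ ε := by
  induction n with
  | zero =>
    intro ε hε
    refine ⟨1, one_pos, ?_⟩
    intro P d B ξ H hP _ _ _ _ _ _ _
    have hinj : Function.Injective (sh ξ) := by
      intro a b hab
      rw [MvPolynomial.eq_C_of_isEmpty a, MvPolynomial.eq_C_of_isEmpty b] at hab ⊢
      simpa [sh] using hab
    have hne : sh ξ (MvPolynomial.map (Int.castRingHom K) P) ≠ 0 := by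
      rw [Ne, map_eq_zero_iff _ hinj,
        map_eq_zero_iff _ (MvPolynomial.map_injective _ (RingHom.injective_int _))]
      exact hP
    obtain ⟨j, hj⟩ := MvPolynomial.ne_zero_iff.1 hne
    exact ⟨j, MvPolynomial.mem_support_iff.2 hj, by simpa [wt] using hε.le⟩
  | succ n ih =>
    intro ε₀ hε₀
    set ε := min ε₀ 1 with hεdef
    have hε : 0 < ε := lt_min hε₀ one_pos
    have hε1 : ε ≤ 1 := min_le_right _ _
    obtain ⟨ω', hω', IH⟩ := ih (ε ^ 2 / 64) (by positivity)
    set ω := min (ω' / 3) (min (ε ^ 2 / 256) ω') with hωdef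
    have hω : 0 < ω := by positivity
    have hω1 : 3 * ω ≤ ω' := by
      have : ω ≤ ω' / 3 := min_le_left _ _
      linarith
    have hω2 : ω ≤ ε ^ 2 / 256 := (min_le_right _ _).trans (min_le_left _ _)
    refine ⟨ω, hω, ?_⟩
    intro P d B ξ H hP hdeg hd1 hB hdd hR hH hΛ
    by_contra hcon
    push Not at hcon
    set δ : Fin (n+1) → ℝ := fun h => 1 / (d h : ℝ) with hδ
    have hδ0 : ∀ h, 0 ≤ δ h := fun h => by simp only [hδ]; positivity
    set PK := MvPolynomial.map (Int.castRingHom K) P with hPK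
    have hPK0 : PK ≠ 0 := by
      rw [Ne, hPK, map_eq_zero_iff _ (MvPolynomial.map_injective _ (RingHom.injective_int _))]
      exact hP
    have hPKdeg : PK.degreeOf 0 ≤ d 0 := by
      rw [MvPolynomial.degreeOf_le_iff]
      intro m hm
      exact MvPolynomial.degreeOf_le_iff.1 (hdeg 0) m (MvPolynomial.support_map_subset _ _ hm)
    have hVan : Van δ ε (sh ξ PK) := fun a ha =>
      (min_le_left _ _).trans (hcon a ha).le
    set Λ := Real.log B + ∑ i, (d i : ℝ) with hΛdef
    have hB1 : 1 ≤ B := (one_le_l1 P hP).trans hB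
    have hlogB : 0 ≤ Real.log B := Real.log_nonneg hB1
    have hd0le : (d 0 : ℝ) ≤ ∑ i, (d i : ℝ) :=
      single_le_sum (f := fun i => (d i : ℝ)) (fun i _ => Nat.cast_nonneg _) (mem_univ 0)
    have hd01 : (1 : ℝ) ≤ d 0 := by exact_mod_cast hd1 0
    have hΛ1 : 1 ≤ Λ := by simp only [hΛdef]; linarith
    obtain ⟨k, φ, ψ, hk0, hk1, hφ, hψ, hdec⟩ := decomp (d 0) PK hPK0 hPKdeg
    obtain ⟨e, he, hG⟩ := wr_mv φ hφ
    obtain ⟨a, ha, hW⟩ := wr_poly ψ hψ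
    set G := (Matrix.of fun i j => hd (e i) (φ j)).det
    set W := (Matrix.of fun i j => Polynomial.hasseDeriv (a i) (ψ j)).det
    set MZ : Matrix (Fin k) (Fin k) (MvPolynomial (Fin (n+1)) ℤ) :=
      Matrix.of fun i j => hd ((e i).cons (a j)) P with hMZ
    set F := MZ.det with hF
    have hk0' : (1 : ℝ) ≤ k := by exact_mod_cast hk0
    have hFK : MvPolynomial.map (Int.castRingHom K) F = emb G W := by
      rw [← det_emb, ← hdec, hF, RingHom.map_det]
      congr 1
      refine Matrix.ext fun i j => ?_
      simp [hMZ, hd_map, hPK]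
    -- norm bound
    have hFn : Real.log (l1 F) ≤ 2 * k * Λ := by
      have h1 : l1 F ≤ k.factorial * (2 ^ (∑ i, d i) * B) ^ k := by
        refine l1_det _ _ fun i j => ?_
        refine (l1_hd _ P d hdeg).trans ?_
        gcongr
      have hF0 : F ≠ 0 := by
        intro h0
        rw [h0, map_zero] at hFK
        obtain ⟨g, hg⟩ := MvPolynomial.ne_zero_iff.1 hG
        obtain ⟨r, hr⟩ : ∃ r, W.coeff r ≠ 0 := by
          by_contra hh; push Not at hh; exact hW (Polynomial.ext (by simpa using hh))
        have := coeff_emb G W r g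
        rw [← hFK, MvPolynomial.coeff_zero] at this
        exact mul_ne_zero hg hr this.symm
      have hpos : 0 < l1 F := lt_of_lt_of_le one_pos (one_le_l1 F hF0)
      refine (Real.log_le_log hpos h1).trans ?_
      rw [Real.log_mul (by positivity) (by positivity), Real.log_pow,
        Real.log_mul (by positivity) (by positivity), Real.log_pow]
      have h2 : Real.log (k.factorial : ℝ) ≤ k * d 0 := by
        have h3 : (k.factorial : ℝ) ≤ (k : ℝ) ^ k := by exact_mod_cast Nat.factorial_le_pow k
        refine (Real.log_le_log (by positivity) h3).trans ?_
        rw [Real.log_pow]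
        have h4 : Real.log k ≤ d 0 := by
          have := Real.log_le_sub_one_of_pos (show (0:ℝ) < k by linarith)
          have hk1' : (k : ℝ) ≤ d 0 + 1 := by exact_mod_cast hk1
          linarith
        gcongr
      have h5 : Real.log 2 ≤ 1 := by linarith [Real.log_two_lt_d9]
      have h6 : (0:ℝ) ≤ ∑ i, (d i : ℝ) := sum_nonneg fun i _ => Nat.cast_nonneg _
      push_cast
      have h7 : (∑ i, (d i : ℝ)) * Real.log 2 ≤ ∑ i, (d i : ℝ) := by nlinarith
      have h8 : (d 0 : ℝ) + ((∑ i, (d i : ℝ)) * Real.log 2 + Real.log B) ≤ 2 * Λ := by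
        simp only [hΛdef]; linarith
      nlinarith
    -- G''
    obtain ⟨r, hr⟩ : ∃ r, W.coeff r ≠ 0 := by
      by_contra hh; push Not at hh; exact hW (Polynomial.ext (by simpa using hh))
    obtain ⟨g, hg⟩ := MvPolynomial.ne_zero_iff.1 hG
    set G2 : MvPolynomial (Fin n) ℤ := (MvPolynomial.finSuccEquiv ℤ n F).coeff r with hG2
    have hG2c : ∀ b, G2.coeff b = F.coeff (b.cons r) := fun b => by
      rw [hG2, MvPolynomial.finSuccEquiv_coeff_coeff]
    have hFc : ∀ b s, ((F.coeff (Finsupp.cons s b) : ℤ) : K) = G.coeff b * W.coeff s := by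
      intro b s
      rw [← coeff_emb, ← hFK, MvPolynomial.coeff_map]; rfl
    have hG2K : MvPolynomial.map (Int.castRingHom K) G2 = W.coeff r • G := by
      ext b
      rw [MvPolynomial.coeff_map, hG2c, MvPolynomial.coeff_smul, smul_eq_mul, mul_comm, ← hFc]
      rfl
    have hG20 : G2 ≠ 0 := by
      intro h0
      rw [h0, map_zero] at hG2K
      exact smul_ne_zero hr hG hG2K.symm
    have hG2n : l1 G2 ≤ l1 F := by
      rw [l1_eq, l1_eq]
      have hinj : Function.Injective (fun b : Fin n →₀ ℕ => b.cons r) :=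
        Finsupp.cons_right_injective r
      calc ∑ b ∈ G2.support, |((G2.coeff b : ℤ) : ℝ)|
          = ∑ b ∈ G2.support, |((F.coeff (b.cons r) : ℤ) : ℝ)| := by simp only [hG2c]
        _ = ∑ x ∈ G2.support.image (fun b : Fin n →₀ ℕ => b.cons r),
            |((F.coeff x : ℤ) : ℝ)| := by
              rw [sum_image (fun a _ b _ h => hinj h)]
        _ ≤ _ := by
          apply sum_le_sum_of_subset_of_nonneg
          · intro x hx
            obtain ⟨b, hb, rfl⟩ := mem_image.1 hx
            rw [MvPolynomial.mem_support_iff, hG2c] at hb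
            exact MvPolynomial.mem_support_iff.2 hb
          · intros; positivity
    have hl1F : 1 ≤ l1 F := (one_le_l1 G2 hG20).trans hG2n
    have hdegF : ∀ h, F.degreeOf h ≤ k * d h := fun h =>
      degreeOf_det _ _ _ fun i j => (degreeOf_hd _ _ _).trans (hdeg h)
    obtain ⟨j1, hj1, hj1w⟩ := IH G2 (fun h => k * d h.succ) (l1 F) (fun h => ξ h.succ)
      (fun h => H h.succ) hG20
      (by
        intro h
        refine (MvPolynomial.degreeOf_coeff_finSuccEquiv F h r).trans (hdegF _))
      (by intro h; exact Nat.mul_pos hk0 (hd1 _)) hG2n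
      (by
        intro h h' hh
        have := hdd h.succ h'.succ (Fin.succ_lt_succ_iff.2 hh)
        have hωω : ω ≤ ω' := (min_le_right _ _).trans (min_le_right _ _)
        have h2 : ω * (d h'.succ : ℝ) ≤ ω' * d h'.succ := by gcongr
        push_cast
        have : (k : ℝ) * d h.succ ≤ k * (ω' * d h'.succ) := by gcongr; linarith
        linarith)
      (fun h => hR h.succ) (fun h => hH h.succ)
      (by
        intro h
        have h1 := hΛ h.succ
        have h2 : ∑ i : Fin n, ((k * d i.succ : ℕ) : ℝ) ≤ k * Λ := by
          push_cast
          rw [← mul_sum]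
          gcongr
          simp only [hΛdef]
          rw [Fin.sum_univ_succ]
          linarith
        have h3 : 0 ≤ ω * (d h.succ * Real.log (H h.succ)) := by linarith
        have h3' : 0 ≤ (d h.succ * Real.log (H h.succ)) := by
          by_contra hc; push Not at hc; nlinarith
        calc Real.log (l1 F) + ∑ i : Fin n, ((k * d i.succ : ℕ) : ℝ) ≤ 3 * k * Λ := by linarith
          _ ≤ 3 * k * (ω * (d h.succ * Real.log (H h.succ))) := by gcongr
          _ = (3 * ω) * (k * (d h.succ * Real.log (H h.succ))) := by ring
          _ ≤ ω' * (k * (d h.succ * Real.log (H h.succ))) := by gcongr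
          _ = ω' * (((k * d h.succ : ℕ) : ℝ) * Real.log (H h.succ)) := by push_cast; ring)
    -- W''
    set W2 : Polynomial ℤ := ∑ s ∈ range (F.degreeOf 0 + 1),
      Polynomial.monomial s (F.coeff (Finsupp.cons s g)) with hW2
    have hW2c : ∀ s, W2.coeff s = F.coeff (Finsupp.cons s g) := by
      intro s
      simp only [hW2, Polynomial.finsetSum_coeff, Polynomial.coeff_monomial]
      rw [Finset.sum_ite_eq']
      split_ifs with hs
      · rfl
      · symm
        by_contra hne
        have := MvPolynomial.degreeOf_le_iff.1 (le_refl (F.degreeOf 0)) _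
          (MvPolynomial.mem_support_iff.2 hne)
        simp at this hs
        omega
    have hW2K : W2.map (Int.castRingHom K) = Polynomial.C (G.coeff g) * W := by
      ext s
      rw [Polynomial.coeff_map, hW2c, Polynomial.coeff_C_mul, ← hFc]
      rfl
    have hW20 : W2 ≠ 0 := by
      intro h0
      rw [h0, Polynomial.map_zero] at hW2K
      exact mul_ne_zero (Polynomial.C_ne_zero.2 hg) hW hW2K.symm
    have hW2n : ∑ i ∈ W2.support, |((W2.coeff i : ℤ) : ℝ)| ≤ l1 F := by
      rw [l1_eq]
      have hinj : Function.Injective (fun s : ℕ => Finsupp.cons s g) :=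
        fun a b h => by simpa using DFunLike.congr_fun h 0
      calc ∑ b ∈ W2.support, |((W2.coeff b : ℤ) : ℝ)|
          = ∑ b ∈ W2.support, |((F.coeff (Finsupp.cons b g) : ℤ) : ℝ)| := by simp only [hW2c]
        _ = ∑ x ∈ W2.support.image (fun s : ℕ => Finsupp.cons s g),
            |((F.coeff x : ℤ) : ℝ)| := by
              rw [sum_image (fun a _ b _ h => hinj h)]
        _ ≤ _ := by
          apply sum_le_sum_of_subset_of_nonneg
          · intro x hx
            obtain ⟨b, hb, rfl⟩ := mem_image.1 hx
            rw [Polynomial.mem_support_iff, hW2c] at hb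
            exact MvPolynomial.mem_support_iff.2 hb
          · intros; positivity
    set l := W.rootMultiplicity (ξ 0) with hl
    have hlb : (l : ℝ) / d 0 ≤ 2 * k * ω := by
      have h1 := hR 0 W2 l hW20 (by
        rw [hW2K]
        exact Dvd.dvd.mul_left (Polynomial.pow_rootMultiplicity_dvd W (ξ 0)) _)
      have h2 := h1.trans hW2n
      have h3 : l * Real.log (H 0) ≤ 2 * k * Λ := by
        rw [← Real.log_pow]
        exact (Real.log_le_log (pow_pos (hH 0) _) h2).trans hFn
      have h4 := hΛ 0
      have h5 : 0 < Real.log (H 0) := by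
        by_contra hc; push Not at hc
        have : ω * (d 0 * Real.log (H 0)) ≤ 0 := by
          apply mul_nonpos_of_nonneg_of_nonpos hω.le
          apply mul_nonpos_of_nonneg_of_nonpos (by linarith) hc
        linarith
      rw [div_le_iff₀ (by linarith)]
      have h6 : l * Real.log (H 0) ≤ (2 * k * ω * d 0) * Real.log (H 0) := by
        calc l * Real.log (H 0) ≤ 2 * k * Λ := h3
          _ ≤ 2 * k * (ω * (d 0 * Real.log (H 0))) := by gcongr
          _ = _ := by ring
      exact le_of_mul_le_mul_right h6 h5
    have hWl : (Polynomial.taylor (ξ 0) W).coeff l ≠ 0 := by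
      rw [hl, Polynomial.rootMultiplicity_eq_natTrailingDegree, Polynomial.taylor_apply]
      apply Polynomial.trailingCoeff_nonzero_iff_nonzero.2
      rw [← Polynomial.taylor_apply]
      exact (map_ne_zero_iff _ (Polynomial.taylor_injective (ξ 0))).2 hW
    -- exponent of sh F
    have hshF : sh ξ (MvPolynomial.map (Int.castRingHom K) F)
        = emb (sh (fun i => ξ i.succ) G) (Polynomial.taylor (ξ 0) W) := by
      rw [hFK, sh_emb]
    have hj1' : (sh (fun i => ξ i.succ) G).coeff j1 ≠ 0 := by
      rw [hG2K, map_smul, MvPolynomial.mem_support_iff, MvPolynomial.coeff_smul] at hj1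
      exact right_ne_zero_of_mul hj1
    have hmem : j1.cons l ∈ (sh ξ (MvPolynomial.map (Int.castRingHom K) F)).support := by
      rw [MvPolynomial.mem_support_iff, hshF, coeff_emb]
      exact mul_ne_zero hj1' hWl
    have hup : wt δ (j1.cons l) ≤ k * (ε ^ 2 / 64 + 2 * ω) := by
      rw [wt, Fin.sum_univ_succ]
      simp only [Finsupp.cons_zero, Finsupp.cons_succ]
      have h1 : (l : ℝ) * δ 0 ≤ 2 * k * ω := by
        simp only [hδ]; rw [mul_one_div]; exact hlb
      have h2 : ∑ i : Fin n, (j1 i : ℝ) * δ i.succ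
          = k * wt (fun h : Fin n => 1 / ((k * d h.succ : ℕ) : ℝ)) j1 := by
        rw [wt, mul_sum]
        refine sum_congr rfl fun i _ => ?_
        simp only [hδ]
        push_cast
        have : (k : ℝ) ≠ 0 := by positivity
        have : (d i.succ : ℝ) ≠ 0 := by have := hd1 i.succ; positivity
        field_simp
      rw [h2]
      have h3 : k * wt (fun h : Fin n => 1 / ((k * d h.succ : ℕ) : ℝ)) j1 ≤ k * (ε ^ 2 / 64) := by
        gcongr
      linarith
    have hlow : Van δ (∑ j : Fin k, max 0 ((ε - ω) - (j : ℕ) / (d 0 : ℝ)))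
        (sh ξ (MvPolynomial.map (Int.castRingHom K) F)) := by
      have h1 : sh ξ (MvPolynomial.map (Int.castRingHom K) F) =
          (Matrix.of fun i j => hd ((e i).cons (a j)) (sh ξ PK)).det := by
        rw [hF, RingHom.map_det]
        have : (sh ξ) (((MvPolynomial.map (Int.castRingHom K)).mapMatrix MZ).det)
          = (sh ξ).toRingHom (((MvPolynomial.map (Int.castRingHom K)).mapMatrix MZ).det) := rfl
        rw [this, RingHom.map_det]
        congr 1
        refine Matrix.ext fun i j => ?_
        simp only [hMZ, RingHom.mapMatrix_apply, Matrix.map_apply, Matrix.of_apply]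
        rw [hd_sh, ← hd_map]
        rfl
      rw [h1]
      refine Van.det (τ := fun j : Fin k => max 0 ((ε - ω) - (j : ℕ) / (d 0 : ℝ))) _
        fun i j => ?_
      intro b hb
      refine max_le (wt_nonneg δ hδ0 b) ?_
      refine le_trans ?_ (hVan.hd _ b hb)
      have h2 : wt δ ((e i).cons (a j)) ≤ (j : ℕ) / (d 0 : ℝ) + ω := by
        rw [wt, Fin.sum_univ_succ]
        simp only [Finsupp.cons_zero, Finsupp.cons_succ]
        have h3 : (a j : ℝ) * δ 0 ≤ (j : ℕ) / (d 0 : ℝ) := by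
          simp only [hδ]; rw [mul_one_div]
          gcongr
          exact_mod_cast ha j
        have h4 : ∑ x : Fin n, (e i x : ℝ) * δ x.succ ≤ ω := by
          calc ∑ x : Fin n, (e i x : ℝ) * δ x.succ ≤ ∑ x : Fin n, (e i x : ℝ) * (ω / d 0) := by
                refine sum_le_sum fun x _ => ?_
                gcongr
                simp only [hδ]
                have := hdd 0 x.succ (Fin.succ_pos x)
                have h5 : (1:ℝ) ≤ d x.succ := by exact_mod_cast hd1 x.succ
                rw [div_le_div_iff₀ (by linarith) (by linarith)]
                linarith
            _ = ((e i).degree : ℝ) * (ω / d 0) := by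
                rw [← sum_mul, Finsupp.degree_eq_sum]; push_cast; rfl
            _ ≤ d 0 * (ω / d 0) := by
                gcongr
                have h6 := he i
                have := i.2
                exact_mod_cast (by omega : (e i).degree ≤ d 0)
            _ = ω := by field_simp
        linarith
      linarith
    have h1 := hlow _ hmem
    have hε2 : ε ^ 2 ≤ ε := by nlinarith
    have hτ0 : 0 ≤ ε - ω := by linarith
    have h2 := sum_max_bound k (d 0) (hd1 0) hk1 (ε - ω) hτ0 (by linarith)
    have h3 : (k : ℝ) * ((ε - ω) ^ 2 / 8) ≤ k * (ε ^ 2 / 64 + 2 * ω) := by linarith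
    have h4 := le_of_mul_le_mul_left h3 (by linarith)
    have h5 : (3 / 4 * ε) ^ 2 ≤ (ε - ω) ^ 2 := by
      apply pow_le_pow_left₀ (by positivity)
      linarith
    nlinarith
end

end Sub15


open Finset

namespace Sub15

set_option linter.unusedSimpArgs false
set_option linter.unusedVariables false
set_option linter.unusedSectionVars false

noncomputable section

lemma not_rothH {K : Type*} [Field K] [CharZero K] (ξ : K) (H : ℝ) (h : ¬ RothH ξ H) (hH : 0 < H) :
    ∃ q : ℤ, q ≠ 0 ∧ IsIntegral ℤ ((q : K) * ξ) ∧ |(q : ℝ)| ≤ H ∧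
      ∀ σ : K →+* ℂ, ‖σ ((q : K) * ξ)‖ ≤ H := by
  classical
  unfold RothH at h
  push Not at h
  obtain ⟨W, l, hW, hdvd, hlt⟩ := h
  have hl : l ≠ 0 := by
    rintro rfl
    rw [pow_zero] at hlt
    obtain ⟨i, hi⟩ := Polynomial.support_nonempty.2 hW
    have h1 : (1:ℝ) ≤ |((W.coeff i : ℤ) : ℝ)| := by
      have := Int.one_le_abs (Polynomial.mem_support_iff.1 hi)
      exact_mod_cast this
    have h2 := single_le_sum (f := fun i => |((W.coeff i : ℤ) : ℝ)|)
      (fun i _ => abs_nonneg _) hi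
    exact absurd (h1.trans h2) (not_le.2 hlt)
  have hroot : Polynomial.aeval ξ W = 0 := by
    have h1 : (Polynomial.X - Polynomial.C ξ) ∣ W.map (Int.castRingHom K) :=
      (dvd_pow_self _ hl).trans hdvd
    rw [Polynomial.dvd_iff_isRoot, Polynomial.IsRoot, Polynomial.eval_map] at h1
    exact h1
  -- irreducible factor
  obtain ⟨f, hfirr, hf0, hfW⟩ : ∃ f : Polynomial ℤ, Irreducible f ∧ Polynomial.aeval ξ f = 0 ∧ f ∣ W := by
    obtain ⟨u, hu⟩ := UniqueFactorizationMonoid.factors_prod hW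
    have h1 : Polynomial.aeval ξ ((UniqueFactorizationMonoid.factors W).prod) = 0 := by
      rw [← hu, map_mul] at hroot
      rcases mul_eq_zero.1 hroot with h | h
      · exact h
      · exact absurd h ((u.isUnit.map (Polynomial.aeval ξ)).ne_zero)
    rw [map_multiset_prod, Multiset.prod_eq_zero_iff, Multiset.mem_map] at h1
    obtain ⟨f, hf, hf0⟩ := h1
    exact ⟨f, UniqueFactorizationMonoid.irreducible_of_factor f hf, hf0,
      UniqueFactorizationMonoid.dvd_of_mem_factors hf⟩
  have hfne : f ≠ 0 := hfirr.ne_zero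
  have hfdeg : f.natDegree ≠ 0 := by
    intro h0
    rw [Polynomial.eq_C_of_natDegree_eq_zero h0] at hf0
    simp at hf0
    apply hfne
    rw [Polynomial.eq_C_of_natDegree_eq_zero h0, hf0, Polynomial.C_0]
  have hprim : f.IsPrimitive := hfirr.isPrimitive hfdeg
  have hirrQ := (Polynomial.IsPrimitive.Int.irreducible_iff_irreducible_map_cast hprim).1 hfirr
  have hcomp : ∀ g : Polynomial ℤ, (g.map (Int.castRingHom ℚ)).map (algebraMap ℚ K) = g.map (Int.castRingHom K) := by
    intro g; rw [Polynomial.map_map]; congr 1; exact RingHom.ext_int _ _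
  have hmul1 : Polynomial.rootMultiplicity ξ (f.map (Int.castRingHom K)) ≤ 1 := by
    rw [← hcomp f]
    exact Polynomial.rootMultiplicity_le_one_of_separable (hirrQ.separable.map) ξ
  obtain ⟨e, g, hfg, hWe⟩ : ∃ e g, ¬ f ∣ g ∧ W = f ^ e * g := by
    have := FiniteMultiplicity.of_not_isUnit hfirr.not_isUnit hW
    obtain ⟨g, hg, hg2⟩ := this.exists_eq_pow_mul_and_not_dvd
    exact ⟨_, g, hg2, hg⟩
  have hgne : g ≠ 0 := by rintro rfl; exact hfg (dvd_zero _)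
  have hinjK : Function.Injective (Int.castRingHom K) := Int.cast_injective
  have hgroot : Polynomial.rootMultiplicity ξ (g.map (Int.castRingHom K)) = 0 := by
    rw [Polynomial.rootMultiplicity_eq_zero]
    intro hr
    apply hfg
    rw [Polynomial.IsPrimitive.Int.dvd_iff_map_cast_dvd_map_cast _ _ hprim]
    have hm : ∀ g : Polynomial ℤ, Polynomial.aeval ξ g = 0 → minpoly ℚ ξ ∣ g.map (Int.castRingHom ℚ) := by
      intro g hg
      apply minpoly.dvd
      rw [Polynomial.aeval_def, Polynomial.eval₂_eq_eval_map, hcomp, Polynomial.eval_map]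
      exact hg
    have h1 := hm f hf0
    have h2 := hm g (by rw [Polynomial.IsRoot, Polynomial.eval_map] at hr; exact hr)
    have h3 : Associated (minpoly ℚ ξ) (f.map (Int.castRingHom ℚ)) := by
      refine (minpoly.irreducible ?_).associated_of_dvd hirrQ h1
      refine IsAlgebraic.isIntegral ⟨f.map (Int.castRingHom ℚ), hirrQ.ne_zero, ?_⟩
      rw [Polynomial.aeval_def, Polynomial.eval₂_eq_eval_map, hcomp, Polynomial.eval_map]
      exact hf0
    exact h3.symm.dvd.trans h2
  have hle : l ≤ e := by
    have hWK : W.map (Int.castRingHom K) ≠ 0 := (Polynomial.map_ne_zero_iff hinjK).2 hW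
    have hfK : f.map (Int.castRingHom K) ≠ 0 := (Polynomial.map_ne_zero_iff hinjK).2 hfne
    have hgK : g.map (Int.castRingHom K) ≠ 0 := (Polynomial.map_ne_zero_iff hinjK).2 hgne
    have h1 : l ≤ Polynomial.rootMultiplicity ξ (W.map (Int.castRingHom K)) :=
      (Polynomial.le_rootMultiplicity_iff hWK).2 hdvd
    have hrp : Polynomial.rootMultiplicity ξ (f.map (Int.castRingHom K) ^ e)
        = e * Polynomial.rootMultiplicity ξ (f.map (Int.castRingHom K)) := by
      rw [← Polynomial.count_roots, Polynomial.roots_pow, Multiset.count_nsmul, Polynomial.count_roots]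
    rw [hWe, Polynomial.map_mul, Polynomial.map_pow,
      Polynomial.rootMultiplicity_mul (mul_ne_zero (pow_ne_zero _ hfK) hgK), hgroot,
      hrp] at h1
    nlinarith
  set ι := Int.castRingHom ℂ
  have hM : ∀ g : Polynomial ℤ, g ≠ 0 → 1 ≤ (g.map ι).mahlerMeasure :=
    fun g hg => Polynomial.one_le_mahlerMeasure_of_ne_zero hg
  have hMpow : ∀ n, ((f.map ι) ^ n).mahlerMeasure = (f.map ι).mahlerMeasure ^ n := by
    intro n
    induction n with
    | zero => simp
    | succ n ih => rw [pow_succ, Polynomial.mahlerMeasure_mul, ih, pow_succ]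
  have hMf : (f.map ι).mahlerMeasure < H := by
    have h1 : (f.map ι).mahlerMeasure ^ l ≤ (W.map ι).mahlerMeasure := by
      rw [hWe, Polynomial.map_mul, Polynomial.map_pow, Polynomial.mahlerMeasure_mul, hMpow]
      calc (f.map ι).mahlerMeasure ^ l ≤ (f.map ι).mahlerMeasure ^ e :=
            pow_le_pow_right₀ (hM f hfne) hle
        _ ≤ _ := le_mul_of_one_le_right (by have := hM f hfne; positivity) (hM g hgne)
    have h2 : (W.map ι).mahlerMeasure ≤ ∑ i ∈ W.support, |((W.coeff i : ℤ) : ℝ)| := by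
      refine (Polynomial.mahlerMeasure_le_sum_norm_coeff _).trans (le_of_eq ?_)
      rw [Polynomial.sum_def, Polynomial.support_map_of_injective _ Int.cast_injective]
      refine sum_congr rfl fun i _ => ?_
      rw [Polynomial.coeff_map]
      simp [ι]
    exact lt_of_pow_lt_pow_left₀ l hH.le (by linarith)
  have hlead : (f.map ι).leadingCoeff = (f.leadingCoeff : ℂ) := by
    rw [Polynomial.leadingCoeff_map_of_injective Int.cast_injective]; rfl
  refine ⟨f.leadingCoeff, Polynomial.leadingCoeff_ne_zero.2 hfne, ?_, ?_, ?_⟩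
  · have := isIntegral_leadingCoeff_smul f ξ hf0
    simpa using this
  · have := Polynomial.leadingCoeff_le_mahlerMeasure (f.map ι)
    rw [hlead] at this
    have h3 : ‖(f.leadingCoeff : ℂ)‖ = |(f.leadingCoeff : ℝ)| := by simp
    rw [← h3]; linarith
  · intro σ
    have hr : σ ξ ∈ (f.map ι).roots := by
      rw [Polynomial.mem_roots ((Polynomial.map_ne_zero_iff Int.cast_injective).2 hfne),
        Polynomial.IsRoot, Polynomial.eval_map]
      have := congrArg σ hf0
      rw [Polynomial.aeval_def, Polynomial.hom_eval₂, map_zero] at this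
      rw [RingHom.ext_int (σ.comp (algebraMap ℤ K)) ι] at this
      exact this
    have h1 : ‖σ ξ‖ ≤ ((f.map ι).roots.map (fun a => max 1 ‖a‖)).prod := by
      obtain ⟨s, hs⟩ := Multiset.exists_cons_of_mem hr
      rw [hs, Multiset.map_cons, Multiset.prod_cons]
      have h2 : 1 ≤ (s.map (fun a => max 1 ‖a‖)).prod := by
        apply Multiset.one_le_prod
        intro x hx
        obtain ⟨a, _, rfl⟩ := Multiset.mem_map.1 hx
        exact le_max_left _ _
      calc ‖σ ξ‖ ≤ max 1 ‖σ ξ‖ := le_max_right _ _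
        _ ≤ _ := le_mul_of_one_le_right (by positivity) h2
    rw [map_mul, norm_mul, map_intCast]
    have h2 := Polynomial.mahlerMeasure_eq_leadingCoeff_mul_prod_roots (f.map ι)
    rw [hlead] at h2
    calc _ ≤ _ := mul_le_mul_of_nonneg_left h1 (norm_nonneg _)
      _ = _ := h2.symm
      _ ≤ H := hMf.le

end

end Sub15


open Finset

namespace Sub15

set_option linter.unusedSimpArgs false
set_option linter.unusedVariables false
set_option linter.unusedSectionVars false

noncomputable section

lemma cheb {m : ℕ} {α : Type*} [DecidableEq α] (T : Fin m → Finset α) (f : Fin m → α → ℝ)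
    (h0 : ∀ h, ∑ x ∈ T h, f h x = 0) (h1 : ∀ h, ∀ x ∈ T h, |f h x| ≤ 1) :
    ∑ i ∈ Fintype.piFinset T, (∑ h, f h (i h)) ^ 2 ≤ m * (Fintype.piFinset T).card := by
  have hcross : ∀ h h', h ≠ h' → ∑ i ∈ Fintype.piFinset T, f h (i h) * f h' (i h') = 0 := by
    intro h h' hne
    set F : Fin m → α → ℝ := fun g x => if g = h then f h x else if g = h' then f h' x else 1 with hF
    have h2 : ∀ i : Fin m → α, f h (i h) * f h' (i h') = ∏ g, F g (i g) := by
      intro i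
      rw [← mul_prod_erase univ _ (mem_univ h), ← mul_prod_erase (univ.erase h) _
        (mem_erase.2 ⟨hne.symm, mem_univ h'⟩), prod_eq_one]
      · simp [hF, hne.symm]
      · intro g hg
        simp only [mem_erase, mem_univ, and_true] at hg
        simp [hF, hg.1, hg.2]
    simp_rw [h2]
    rw [← Finset.prod_univ_sum]
    apply prod_eq_zero (mem_univ h)
    simp [hF, h0]
  calc ∑ i ∈ Fintype.piFinset T, (∑ h, f h (i h)) ^ 2
      = ∑ h, ∑ h', ∑ i ∈ Fintype.piFinset T, f h (i h) * f h' (i h') := by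
        simp_rw [sq, sum_mul_sum]
        rw [sum_comm]
        refine sum_congr rfl fun h _ => ?_
        rw [sum_comm]
    _ = ∑ h, ∑ i ∈ Fintype.piFinset T, f h (i h) * f h (i h) := by
        refine sum_congr rfl fun h _ => ?_
        rw [sum_eq_single h]
        · intro h' _ hne; exact hcross _ _ hne.symm
        · simp
    _ ≤ ∑ h : Fin m, ∑ i ∈ Fintype.piFinset T, (1 : ℝ) := by
        refine sum_le_sum fun h _ => sum_le_sum fun i hi => ?_
        have := h1 h (i h) (Fintype.mem_piFinset.1 hi h)
        rw [← sq, ← sq_abs]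
        nlinarith [abs_nonneg (f h (i h))]
    _ = _ := by simp

variable {R : Type*} [CommRing R] {m N : ℕ}

/-- block substitution by a matrix -/
def subm (M : Matrix (Fin N) (Fin N) R) :
    MvPolynomial (Fin m × Fin N) R →ₐ[R] MvPolynomial (Fin m × Fin N) R :=
  MvPolynomial.aeval fun x => ∑ l, MvPolynomial.C (M x.2 l) * MvPolynomial.X (x.1, l)

/-- indicator weight of a block -/
def bw (h : Fin m) : Fin m × Fin N → ℝ := fun x => if x.1 = h then 1 else 0

lemma wt_bw (h : Fin m) (e : Fin m × Fin N →₀ ℕ) : wt (bw h) e = ∑ k, (e (h, k) : ℝ) := by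
  rw [wt, Fintype.sum_prod_type]
  simp only [bw]
  rw [sum_eq_single h]
  · simp
  · intro b _ hb; simp [hb]
  · simp

lemma wt_neg (δ : Fin m × Fin N → ℝ) (e : Fin m × Fin N →₀ ℕ) : wt (-δ) e = - wt δ e := by
  simp [wt]

/-- multihomogeneous -/
def MH (d : Fin m → ℕ) (P : MvPolynomial (Fin m × Fin N) R) : Prop :=
  ∀ e ∈ P.support, ∀ h, ∑ k, e (h, k) = d h

lemma MH_iff (d : Fin m → ℕ) (P : MvPolynomial (Fin m × Fin N) R) :
    MH d P ↔ ∀ h, Van (bw h) (d h) P ∧ Van (-bw h) (-(d h : ℝ)) P := by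
  constructor
  · intro H h
    refine ⟨fun e he => ?_, fun e he => ?_⟩
    · rw [wt_bw, ← H e he h]; push_cast; exact le_rfl
    · rw [wt_neg, wt_bw, ← H e he h]; push_cast; exact le_rfl
  · intro H e he h
    have h1 := (H h).1 e he
    have h2 := (H h).2 e he
    rw [wt_neg, wt_bw] at h2
    rw [wt_bw] at h1
    have : (∑ k, (e (h, k) : ℝ)) = d h := le_antisymm (by linarith) h1
    exact_mod_cast this

lemma Van.pow {σ : Type*} [Fintype σ] {δ : σ → ℝ} {τ : ℝ} {P : MvPolynomial σ R} (h : Van δ τ P) (n : ℕ) :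
    Van δ (n * τ) (P ^ n) := by
  have := Van.prod (τ := fun _ : ℕ => τ) (range n) (fun _ => P) (fun _ _ => h)
  simpa using this

lemma subm_monomial (M : Matrix (Fin N) (Fin N) R) (e : Fin m × Fin N →₀ ℕ) (a : R) :
    subm M (MvPolynomial.monomial e a) = MvPolynomial.C a *
      ∏ x, (∑ l, MvPolynomial.C (M x.2 l) * MvPolynomial.X (x.1, l)) ^ e x := by
  rw [subm, MvPolynomial.aeval_monomial, Finsupp.prod_fintype _ _ (by simp)]
  rfl

lemma Van.subm_monomial (M : Matrix (Fin N) (Fin N) R) (e : Fin m × Fin N →₀ ℕ) (a : R)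
    (δ : Fin m × Fin N → ℝ) (hδ : ∀ h k k', δ (h, k) = δ (h, k')) :
    Van δ (wt δ e) (subm M (MvPolynomial.monomial e a)) := by
  classical
  rw [Sub15.subm_monomial, wt]
  have h1 : Van δ 0 (MvPolynomial.C a : MvPolynomial (Fin m × Fin N) R) := by
    intro b hb
    rw [MvPolynomial.mem_support_iff, MvPolynomial.coeff_C] at hb
    have : b = 0 := by by_contra h; exact hb (if_neg (Ne.symm h))
    simp [this, wt]
  have h2 : Van δ (∑ x, (e x : ℝ) * δ x)
      (∏ x, (∑ l, MvPolynomial.C (M x.2 l) * MvPolynomial.X (x.1, l)) ^ e x) := by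
    refine Van.prod _ _ fun x _ => Van.pow (Van.sum _ _ fun l _ => ?_) _
    intro b hb
    rw [MvPolynomial.mem_support_iff, MvPolynomial.coeff_C_mul, MvPolynomial.coeff_X] at hb
    have : b = Finsupp.single (x.1, l) 1 := by
      by_contra h; apply hb; rw [if_neg (Ne.symm h), mul_zero]
    rw [this, wt, sum_eq_single (x.1, l)]
    · simp; exact le_of_eq (hδ x.1 x.2 l)
    · intro y _ hy; simp [Finsupp.single_apply, hy.symm]
    · simp
  simpa using h1.mul h2

lemma MH.subm {d : Fin m → ℕ} {P : MvPolynomial (Fin m × Fin N) R} (H : MH d P)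
    (M : Matrix (Fin N) (Fin N) R) : MH d (subm M P) := by
  rw [MH_iff] at H ⊢
  intro h
  have key : ∀ (δ : Fin m × Fin N → ℝ) (τ : ℝ), (∀ h k k', δ (h, k) = δ (h, k')) → Van δ τ P →
      Van δ τ (Sub15.subm M P) := by
    intro δ τ hδ hP
    rw [P.as_sum, map_sum]
    refine Van.sum _ _ fun e he a ha => ?_
    exact (hP e he).trans (Van.subm_monomial M e _ δ hδ a ha)
  exact ⟨key _ _ (fun _ _ _ => rfl) (H h).1, key _ _ (fun _ _ _ => rfl) (H h).2⟩

lemma l1_subm_monomial (M : Matrix (Fin N) (Fin N) ℤ) (A : ℝ) (hA : ∀ i, ∑ j, |(M i j : ℝ)| ≤ A)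
    (e : Fin m × Fin N →₀ ℕ) :
    l1 (subm M (MvPolynomial.monomial e 1)) ≤ A ^ (∑ x, e x) := by
  rw [subm_monomial, MvPolynomial.C_1, one_mul, ← prod_pow_eq_pow_sum]
  refine (l1_prod _ _).trans (prod_le_prod (fun _ _ => l1_nonneg _) fun x _ => ?_)
  refine (l1_pow _ _).trans (pow_le_pow_left₀ (l1_nonneg _) ?_ _)
  refine (l1_sum _ _).trans (le_trans (sum_le_sum fun l _ => ?_) (hA x.2))
  refine (l1_mul _ _).trans ?_
  rw [l1, l1, wnorm_C, wnorm_X]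
  simp [zav_apply]

/-- the index set -/
def idx (N : ℕ) {m : ℕ} (d : Fin m → ℕ) : Finset (Fin m → Fin N → ℕ) :=
  Fintype.piFinset fun h => piAntidiag univ (d h)

lemma mem_idx {d : Fin m → ℕ} {i : Fin m → Fin N → ℕ} :
    i ∈ idx N d ↔ ∀ h, ∑ k, i h k = d h := by
  simp [idx, Fintype.mem_piFinset]

lemma mean_zero (hN : 0 < N) (d : ℕ) (hd : 1 ≤ d) (k : Fin N) :
    ∑ x ∈ piAntidiag (univ : Finset (Fin N)) d, ((x k : ℝ) / d - 1 / N) = 0 := by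
  have hsym : ∀ k' : Fin N, ∑ x ∈ piAntidiag (univ : Finset (Fin N)) d, (x k : ℝ) =
      ∑ x ∈ piAntidiag (univ : Finset (Fin N)) d, (x k' : ℝ) := by
    intro k'
    refine sum_bij' (fun x _ => x ∘ Equiv.swap k k') (fun x _ => x ∘ Equiv.swap k k') ?_ ?_ ?_ ?_ ?_
    · intro x hx
      simp only [mem_piAntidiag, mem_univ, implies_true, and_true] at hx ⊢
      rw [← hx]; exact Equiv.sum_comp (Equiv.swap k k') x
    · intro x hx
      simp only [mem_piAntidiag, mem_univ, implies_true, and_true] at hx ⊢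
      rw [← hx]; exact Equiv.sum_comp (Equiv.swap k k') x
    · intro x _; ext l; simp
    · intro x _; ext l; simp
    · intro x _; simp
  have h2 : (N : ℝ) * ∑ x ∈ piAntidiag (univ : Finset (Fin N)) d, (x k : ℝ) =
      (piAntidiag (univ : Finset (Fin N)) d).card * d := by
    calc (N : ℝ) * ∑ x ∈ piAntidiag (univ : Finset (Fin N)) d, (x k : ℝ)
        = ∑ k' : Fin N, ∑ x ∈ piAntidiag (univ : Finset (Fin N)) d, (x k : ℝ) := by simp
      _ = ∑ k' : Fin N, ∑ x ∈ piAntidiag (univ : Finset (Fin N)) d, (x k' : ℝ) :=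
          sum_congr rfl fun k' _ => hsym k'
      _ = ∑ x ∈ piAntidiag (univ : Finset (Fin N)) d, (d : ℝ) := by
          rw [sum_comm]
          refine sum_congr rfl fun x hx => ?_
          simp only [mem_piAntidiag, mem_univ, implies_true, and_true] at hx
          rw [← hx]; push_cast; rfl
      _ = _ := by simp
  rw [sum_sub_distrib, ← sum_div]
  simp only [sum_const, nsmul_eq_mul]
  have hd' : (d : ℝ) ≠ 0 := by positivity
  have hN' : (N : ℝ) ≠ 0 := by positivity
  field_simp
  linarith

open Classical in
/-- number of unbalanced indices -/
lemma unbal_card (hN : 0 < N) (d : Fin m → ℕ) (hd : ∀ h, 1 ≤ d h) (ε : ℝ) (hε : 0 < ε) (hm : 0 < m) :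
    (((idx N d).filter fun i => ∃ k, ε * m < |∑ h, (i h k : ℝ) / d h - m / N|).card : ℝ) ≤
      N * (idx N d).card / (ε ^ 2 * m) := by
  have hm' : (0 : ℝ) < m := by exact_mod_cast hm
  have hone : ∀ k : Fin N,
      (((idx N d).filter fun i => ε * m < |∑ h, (i h k : ℝ) / d h - m / N|).card : ℝ) ≤
      (idx N d).card / (ε ^ 2 * m) := by
    intro k
    have hc := cheb (fun h => piAntidiag (univ : Finset (Fin N)) (d h))
      (fun h x => (x k : ℝ) / d h - 1 / N) (fun h => mean_zero hN (d h) (hd h) k) (by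
        intro h x hx
        simp only [mem_piAntidiag, mem_univ, implies_true, and_true] at hx
        have h1 : x k ≤ d h := by rw [← hx]; exact single_le_sum (fun _ _ => Nat.zero_le _) (mem_univ k)
        have h2 : (x k : ℝ) / d h ≤ 1 := by
          rw [div_le_one (by exact_mod_cast hd h)]; exact_mod_cast h1
        have h3 : (0:ℝ) ≤ (x k : ℝ) / d h := by positivity
        have h4 : (1 : ℝ) / N ≤ 1 := by
          rw [div_le_one (by positivity)]; exact_mod_cast hN
        have h5 : (0:ℝ) ≤ 1 / N := by positivity
        rw [abs_le]; constructor <;> linarith)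
    change ∑ i ∈ idx N d, _ ≤ m * ((idx N d).card : ℝ) at hc
    rw [le_div_iff₀ (by positivity)]
    set B := (idx N d).filter fun i => ε * m < |∑ h, (i h k : ℝ) / d h - m / N| with hB
    have h1 : (B.card : ℝ) * (ε * m) ^ 2 ≤ m * ((idx N d).card : ℝ) := by
      calc (B.card : ℝ) * (ε * m) ^ 2 = ∑ i ∈ B, (ε * m) ^ 2 := by simp
        _ ≤ ∑ i ∈ B, (∑ h, ((i h k : ℝ) / d h - 1 / N)) ^ 2 := by
            refine sum_le_sum fun i hi => ?_
            have := (mem_filter.1 hi).2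
            rw [sum_sub_distrib]
            simp only [sum_const, card_univ, Fintype.card_fin, nsmul_eq_mul, mul_one_div]
            rw [← sq_abs (∑ h, (i h k : ℝ) / d h - m / N)]
            exact pow_le_pow_left₀ (by positivity) this.le _
        _ ≤ ∑ i ∈ idx N d, (∑ h, ((i h k : ℝ) / d h - 1 / N)) ^ 2 :=
            sum_le_sum_of_subset_of_nonneg (filter_subset _ _) fun _ _ _ => sq_nonneg _
        _ ≤ _ := hc
    have h2 : (m : ℝ) * ((B.card : ℝ) * (ε ^ 2 * m)) ≤ m * (idx N d).card := by
      calc _ = (B.card : ℝ) * (ε * m) ^ 2 := by ring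
        _ ≤ _ := h1
    exact le_of_mul_le_mul_left h2 hm'
  calc _ ≤ (((univ : Finset (Fin N)).biUnion fun k =>
          (idx N d).filter fun i => ε * m < |∑ h, (i h k : ℝ) / d h - m / N|).card : ℝ) := by
        norm_cast
        apply card_le_card
        intro i hi
        rw [mem_filter] at hi
        obtain ⟨h1, k, hk⟩ := hi
        exact mem_biUnion.2 ⟨k, mem_univ k, mem_filter.2 ⟨h1, hk⟩⟩
    _ ≤ ∑ k : Fin N, (((idx N d).filter fun i => ε * m < |∑ h, (i h k : ℝ) / d h - m / N|).card : ℝ) := by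
        exact_mod_cast card_biUnion_le
    _ ≤ ∑ k : Fin N, ((idx N d).card / (ε ^ 2 * m) : ℝ) := sum_le_sum fun k _ => hone k
    _ = _ := by simp; ring

end

end Sub15


open Finset

namespace Sub15

set_option linter.unusedSimpArgs false
set_option linter.unusedVariables false
set_option linter.unusedSectionVars false

noncomputable section

section siegel
attribute [local instance] Matrix.seminormedAddCommGroup

lemma siegel_simple {α β : Type*} [Fintype α] [Fintype β] (A : Matrix α β ℤ)
    (hc : 2 * Fintype.card α ≤ Fintype.card β) (hβ : 0 < Fintype.card β) (B : ℝ) (hB : 1 ≤ B)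
    (hA : ∀ i j, |(A i j : ℝ)| ≤ B) :
    ∃ t : β → ℤ, t ≠ 0 ∧ A.mulVec t = 0 ∧ ∀ j, |(t j : ℝ)| ≤ Fintype.card β * B := by
  classical
  have hβ' : (1 : ℝ) ≤ Fintype.card β := by exact_mod_cast hβ
  rcases Nat.eq_zero_or_pos (Fintype.card α) with h0 | hpos
  · have : IsEmpty α := Fintype.card_eq_zero_iff.1 h0
    have : Nonempty β := Fintype.card_pos_iff.1 hβ
    refine ⟨fun _ => 1, ?_, Subsingleton.elim _ _, fun j => ?_⟩
    · intro h
      have := congrFun h (Classical.arbitrary β)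
      simp at this
    · simp; nlinarith
  · obtain ⟨t, h1, h2, h3⟩ := Int.Matrix.exists_ne_zero_int_vec_norm_le A (by omega) hpos
    refine ⟨t, h1, h2, fun j => ?_⟩
    have h4 : ‖A‖ ≤ B := by
      rw [Matrix.norm_le_iff (by linarith)]
      intro i j
      have := hA i j
      rwa [Int.norm_eq_abs]
    have h5 : |(t j : ℝ)| ≤ ‖t‖ := by
      have := norm_le_pi_norm t j
      rwa [Int.norm_eq_abs] at this
    refine h5.trans (h3.trans ?_)
    have h6 : (1 : ℝ) ≤ Fintype.card β * max 1 ‖A‖ := by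
      have := le_max_left 1 ‖A‖
      nlinarith
    have h7 : (Fintype.card α : ℝ) / (Fintype.card β - Fintype.card α) ≤ 1 := by
      have h8 : 2 * (Fintype.card α : ℝ) ≤ Fintype.card β := by exact_mod_cast hc
      have h9 : (0 : ℝ) < Fintype.card α := by exact_mod_cast hpos
      rw [div_le_one (by linarith)]; linarith
    calc _ ≤ ((Fintype.card β : ℝ) * max 1 ‖A‖) ^ (1 : ℝ) := Real.rpow_le_rpow_of_exponent_le h6 h7
      _ = (Fintype.card β : ℝ) * max 1 ‖A‖ := Real.rpow_one _
      _ ≤ _ := mul_le_mul_of_nonneg_left (max_le hB h4) (by positivity)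

end siegel

variable {m N : ℕ}

/-- exponent of an index -/
def ex (i : Fin m → Fin N → ℕ) : Fin m × Fin N →₀ ℕ :=
  Finsupp.equivFunOnFinite.symm fun x => i x.1 x.2

@[simp] lemma ex_apply (i : Fin m → Fin N → ℕ) (x : Fin m × Fin N) : ex i x = i x.1 x.2 := rfl

lemma ex_inj : Function.Injective (ex : (Fin m → Fin N → ℕ) → _) := by
  intro i j h
  ext a b
  exact DFunLike.congr_fun h (a, b)

lemma idx_card (d : Fin m → ℕ) (hd : ∀ h, 1 ≤ d h) : ((idx N d).card : ℝ) ≤ (2 ^ N) ^ (∑ h, d h) := by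
  classical
  have h1 : ∀ e : ℕ, (piAntidiag (univ : Finset (Fin N)) e).card ≤ (2 ^ N) ^ e := by
    intro e
    have hsub : piAntidiag (univ : Finset (Fin N)) e ⊆ Fintype.piFinset fun _ => range (e + 1) := by
      intro x hx
      simp only [mem_piAntidiag, mem_univ, implies_true, and_true] at hx
      rw [Fintype.mem_piFinset]
      intro k
      rw [mem_range, Nat.lt_succ_iff, ← hx]
      exact single_le_sum (f := x) (fun _ _ => Nat.zero_le _) (mem_univ k)
    refine (card_le_card hsub).trans ?_
    rw [Fintype.card_piFinset]
    simp only [card_range, prod_const, card_univ, Fintype.card_fin]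
    rw [← pow_mul, mul_comm, pow_mul]
    exact Nat.pow_le_pow_left (Nat.lt_two_pow_self) _
  rw [idx, Fintype.card_piFinset, ← prod_pow_eq_pow_sum]
  push_cast
  refine prod_le_prod (fun _ _ => by positivity) fun h _ => ?_
  exact_mod_cast h1 (d h)

theorem aux_poly {V : Type*} [Fintype V] (N : ℕ) (hN : 0 < N) (M : V → Matrix (Fin N) (Fin N) ℤ) :
    ∃ C : ℝ, 1 ≤ C ∧ ∀ ε : ℝ, 0 < ε → ∃ m₀ : ℕ, ∀ m : ℕ, m₀ ≤ m → ∀ d : Fin m → ℕ, (∀ h, 1 ≤ d h) →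
      ∃ P : MvPolynomial (Fin m × Fin N) ℤ, P ≠ 0 ∧ MH d P ∧ l1 P ≤ C ^ (∑ h, d h) ∧
        ∀ v, ∀ e ∈ (subm (M v) P).support, ∀ k, |∑ h, (e (h, k) : ℝ) / d h - m / N| ≤ ε * m := by
  classical
  set A : ℝ := 1 + ∑ v, ∑ i, ∑ j, |(M v i j : ℝ)| with hA
  have hA1 : 1 ≤ A := by
    have : 0 ≤ ∑ v, ∑ i, ∑ j, |(M v i j : ℝ)| := by positivity
    linarith
  have hAM : ∀ v i, ∑ j, |(M v i j : ℝ)| ≤ A := by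
    intro v i
    have h1 := single_le_sum (f := fun v => ∑ i, ∑ j, |(M v i j : ℝ)|)
      (fun _ _ => by positivity) (mem_univ v)
    have h2 := single_le_sum (f := fun i => ∑ j, |(M v i j : ℝ)|)
      (fun _ _ => by positivity) (mem_univ i)
    exact h2.trans (h1.trans (by linarith))
  refine ⟨(2 ^ N) * ((2 ^ N) * A), ?_, ?_⟩
  · have h2 : (1:ℝ) ≤ 2 ^ N := one_le_pow₀ (by norm_num)
    have : 1 ≤ 2 ^ N * A := one_le_mul_of_one_le_of_one_le h2 hA1
    exact one_le_mul_of_one_le_of_one_le h2 this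
  intro ε hε
  refine ⟨⌈2 * N * Fintype.card V / ε ^ 2⌉₊ + 1, fun m hm d hd => ?_⟩
  have hm1 : 0 < m := by omega
  have hmε : (2 : ℝ) * N * Fintype.card V ≤ ε ^ 2 * m := by
    have h1 : (2 : ℝ) * N * Fintype.card V / ε ^ 2 ≤ (m : ℝ) :=
      (Nat.le_ceil _).trans (Nat.cast_le.2 (by omega))
    rw [div_le_iff₀ (by positivity)] at h1
    linarith
  set U := (idx N d).filter fun i => ∃ k, ε * m < |∑ h, (i h k : ℝ) / d h - m / N| with hU
  have hUc := unbal_card hN d hd ε hε hm1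
  rw [← hU] at hUc
  have hidx : 0 < (idx N d).card := by
    rw [card_pos]
    refine ⟨fun h k => if k = ⟨0, hN⟩ then d h else 0, mem_idx.2 fun h => ?_⟩
    simp
  set S := ∑ h, d h with hS
  have hex : ∀ i ∈ idx N d, ∑ x, ex i x = S := by
    intro i hi
    rw [Fintype.sum_prod_type]
    exact sum_congr rfl fun h _ => mem_idx.1 hi h
  obtain ⟨t, ht0, htA, htB⟩ := siegel_simple
    (α := V × U) (β := idx N d)
    (Matrix.of fun (a : V × U) (i : idx N d) =>
      (subm (M a.1) (MvPolynomial.monomial (ex i.1) 1)).coeff (ex a.2.1)) (by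
      rw [Fintype.card_prod, Fintype.card_coe, Fintype.card_coe]
      have hm' : (0:ℝ) < m := by exact_mod_cast hm1
      rw [le_div_iff₀ (by positivity)] at hUc
      have : ((2 : ℝ) * ((Fintype.card V : ℝ) * (U.card : ℝ))) ≤ (idx N d).card := by
        have h1 : ((2 : ℝ) * ((Fintype.card V : ℝ) * (U.card : ℝ))) * (ε ^ 2 * m) ≤ (idx N d).card * (ε ^ 2 * m) := by
          calc ((2 : ℝ) * ((Fintype.card V : ℝ) * (U.card : ℝ))) * (ε ^ 2 * m)
              = (2:ℝ) * Fintype.card V * (U.card * (ε ^ 2 * m)) := by ring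
            _ ≤ (2:ℝ) * Fintype.card V * (N * (idx N d).card) := by gcongr
            _ = ((2:ℝ) * N * Fintype.card V) * (idx N d).card := by ring
            _ ≤ (ε ^ 2 * m) * (idx N d).card := by gcongr
            _ = _ := by ring
        exact le_of_mul_le_mul_right h1 (by positivity)
      exact_mod_cast this)
    (by rw [Fintype.card_coe]; exact hidx) (A ^ S) (one_le_pow₀ hA1) (by
      rintro ⟨v, j⟩ i
      simp only [Matrix.of_apply]
      refine (coeff_le_l1 _ _).trans ((l1_subm_monomial (M v) A (hAM v) _).trans (le_of_eq ?_))
      rw [hex _ i.2])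
  rw [Fintype.card_coe] at htB
  set P : MvPolynomial (Fin m × Fin N) ℤ := ∑ i : idx N d, MvPolynomial.monomial (ex i.1) (t i) with hP
  have hPc : ∀ i : idx N d, P.coeff (ex i.1) = t i := by
    intro i
    rw [hP, MvPolynomial.coeff_sum, sum_eq_single i]
    · simp
    · intro j _ hj
      rw [MvPolynomial.coeff_monomial, if_neg]
      intro h
      exact hj (Subtype.ext (ex_inj h))
    · simp
  have hMH : MH d P := by
    intro e he h
    rw [MvPolynomial.mem_support_iff, hP, MvPolynomial.coeff_sum] at he
    obtain ⟨i, _, hi⟩ := exists_ne_zero_of_sum_ne_zero he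
    rw [MvPolynomial.coeff_monomial] at hi
    have : ex i.1 = e := by by_contra h; exact hi (if_neg h)
    rw [← this]
    exact mem_idx.1 i.2 h
  refine ⟨P, ?_, hMH, ?_, ?_⟩
  · intro h0
    apply ht0
    ext i
    rw [← hPc i, h0]; simp
  · have hcard := idx_card (N := N) d hd
    calc l1 P ≤ ∑ i : idx N d, l1 (MvPolynomial.monomial (ex i.1) (t i)) := l1_sum _ _
      _ ≤ ∑ i : idx N d, ((idx N d).card * A ^ S : ℝ) := by
          refine sum_le_sum fun i _ => ?_
          rw [l1, wnorm_monomial]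
          simp only [one_pow, Finsupp.prod, prod_const_one, mul_one, zav_apply]
          exact htB i
      _ = (idx N d).card * ((idx N d).card * A ^ S) := by simp
      _ ≤ (2 ^ N) ^ S * ((2 ^ N) ^ S * A ^ S) := by gcongr
      _ = _ := by rw [mul_pow, mul_pow]
  · intro v e he
    have hH := (hMH.subm (M v)) e he
    set j : Fin m → Fin N → ℕ := fun h k => e (h, k) with hj
    have hej : ex j = e := by ext ⟨a, b⟩; rfl
    have hjm : j ∈ idx N d := mem_idx.2 hH
    by_contra hcon
    push Not at hcon
    have hjU : j ∈ U := mem_filter.2 ⟨hjm, hcon⟩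
    apply MvPolynomial.mem_support_iff.1 he
    have := congrFun htA (v, ⟨j, hjU⟩)
    simp only [Matrix.mulVec, dotProduct, Matrix.of_apply, Pi.zero_apply] at this
    rw [hej] at this
    rw [hP, map_sum, MvPolynomial.coeff_sum, ← this]
    refine sum_congr rfl fun i _ => ?_
    have h3 : (MvPolynomial.monomial (ex i.1) (t i) : MvPolynomial (Fin m × Fin N) ℤ)
        = MvPolynomial.C (t i) * MvPolynomial.monomial (ex i.1) 1 := by
      rw [MvPolynomial.C_mul_monomial, mul_one]
    rw [h3, map_mul, subm, MvPolynomial.algHom_C, MvPolynomial.algebraMap_eq, MvPolynomial.coeff_C_mul, mul_comm]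

end

end Sub15


open Finset

namespace Sub15

set_option linter.unusedSimpArgs false
set_option linter.unusedVariables false
set_option linter.unusedSectionVars false

noncomputable section

lemma av_int_le {K : Type*} [Field K] (v : AbsoluteValue K ℝ) (z : ℤ) : v (z : K) ≤ |(z : ℝ)| := by
  have hn : ∀ n : ℕ, v (n : K) ≤ n := by
    intro n
    induction n with
    | zero => simp
    | succ n ih =>
      push_cast
      refine (v.add_le _ _).trans ?_
      rw [v.map_one]; linarith
  obtain ⟨n, rfl | rfl⟩ := z.eq_nat_or_neg
  · simpa using hn n
  · simpa using hn n

lemma wnorm_aeval {K σ τ : Type*} [Field K] [Fintype σ] (v : AbsoluteValue K ℝ) (w : τ → ℝ)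
    (hw : ∀ i, 0 ≤ w i) (f : σ → MvPolynomial τ K) (P : MvPolynomial σ ℤ) (U : ℝ)
    (hU : ∀ e ∈ P.support, ∏ i, wnorm v w (f i) ^ e i ≤ U) :
    wnorm v w (MvPolynomial.aeval f P) ≤ l1 P * U := by
  conv_lhs => rw [P.as_sum, map_sum]
  refine (wnorm_sum v w hw _ _).trans ?_
  rw [l1_eq, sum_mul]
  refine sum_le_sum fun e he => ?_
  rw [MvPolynomial.aeval_monomial, Finsupp.prod_fintype _ _ (by simp)]
  refine (wnorm_mul v w hw _ _).trans ?_
  have h1 : wnorm v w ((algebraMap ℤ (MvPolynomial τ K)) (P.coeff e)) ≤ |((P.coeff e : ℤ) : ℝ)| := by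
    have : (algebraMap ℤ (MvPolynomial τ K)) (P.coeff e) = MvPolynomial.C ((P.coeff e : ℤ) : K) := by
      simp
    rw [this, wnorm_C]
    exact av_int_le v _
  refine mul_le_mul h1 ?_ (wnorm_nonneg v w hw _) (abs_nonneg _)
  refine (wnorm_prod v w hw _ _).trans (le_trans ?_ (hU e he))
  exact prod_le_prod (fun _ _ => wnorm_nonneg v w hw _) fun i _ => wnorm_pow v w hw _ _

lemma Van.C {R σ : Type*} [CommRing R] [Fintype σ] (δ : σ → ℝ) (a : R) :
    Van δ 0 (MvPolynomial.C a : MvPolynomial σ R) := by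
  classical
  intro b hb
  rw [MvPolynomial.mem_support_iff, MvPolynomial.coeff_C] at hb
  have : b = 0 := by by_contra h; exact hb (if_neg (Ne.symm h))
  simp [this, wt]

lemma Van.X {R σ : Type*} [CommRing R] [Fintype σ] (δ : σ → ℝ) (i : σ) :
    Van δ (δ i) (MvPolynomial.X i : MvPolynomial σ R) := by
  classical
  intro b hb
  rw [MvPolynomial.mem_support_iff, MvPolynomial.coeff_X] at hb
  have : b = Finsupp.single i 1 := by
    by_contra h; apply hb; rw [if_neg (Ne.symm h)]
  rw [this, wt, sum_eq_single i]
  · simp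
  · intro y _ hy; simp [Finsupp.single_apply, hy.symm]
  · simp

lemma Van.aeval {R σ τ : Type*} [CommRing R] [Fintype σ] [Fintype τ] (δ : σ → ℝ) (δ' : τ → ℝ)
    (f : σ → MvPolynomial τ R) (hf : ∀ i, Van δ' (δ i) (f i)) (P : MvPolynomial σ R) (t : ℝ)
    (hP : Van δ t P) : Van δ' t (MvPolynomial.aeval f P) := by
  rw [P.as_sum, map_sum]
  refine Van.sum _ _ fun e he => ?_
  rw [MvPolynomial.aeval_monomial, Finsupp.prod_fintype _ _ (by simp)]
  have h1 : Van δ' (wt δ e) (∏ i, f i ^ e i) := Van.prod _ _ fun i _ => Van.pow (hf i) _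
  have h2 := (Van.C δ' (P.coeff e)).mul h1
  rw [zero_add] at h2
  intro a ha
  exact (hP e he).trans (h2 a ha)

lemma l1_subm {m N : ℕ} (M : Matrix (Fin N) (Fin N) ℤ) (A : ℝ) (hA : ∀ i, ∑ j, |(M i j : ℝ)| ≤ A)
    (d : Fin m → ℕ) (P : MvPolynomial (Fin m × Fin N) ℤ) (hP : MH d P) :
    l1 (subm M P) ≤ A ^ (∑ h, d h) * l1 P := by
  conv_lhs => rw [P.as_sum, map_sum]
  refine (l1_sum _ _).trans ?_
  rw [l1_eq P, mul_sum]
  refine sum_le_sum fun e he => ?_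
  have h3 : (MvPolynomial.monomial e (P.coeff e) : MvPolynomial (Fin m × Fin N) ℤ)
        = MvPolynomial.C (P.coeff e) * MvPolynomial.monomial e 1 := by
      rw [MvPolynomial.C_mul_monomial, mul_one]
  rw [h3, map_mul, subm, MvPolynomial.algHom_C, MvPolynomial.algebraMap_eq, ← subm]
  refine (l1_mul _ _).trans ?_
  rw [l1, wnorm_C, zav_apply, mul_comm]
  have h4 : ∑ x, e x = ∑ h, d h := by
    rw [Fintype.sum_prod_type]
    exact sum_congr rfl fun h _ => hP e he h
  have := l1_subm_monomial M A hA e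
  rw [h4] at this
  exact mul_le_mul_of_nonneg_right this (abs_nonneg _)

lemma aeval_subm {m N : ℕ} {S : Type*} [CommRing S] (L : Matrix (Fin N) (Fin N) ℤ)
    (d : Fin m → ℕ) (P : MvPolynomial (Fin m × Fin N) ℤ) (hP : MH d P) (x : Fin m × Fin N → S) :
    MvPolynomial.aeval (fun z : Fin m × Fin N => ∑ j, (L z.2 j : S) * x (z.1, j))
      (subm L.adjugate P) = (L.det : S) ^ (∑ h, d h) * MvPolynomial.aeval x P := by
  have h1 : ∀ z : Fin m × Fin N, MvPolynomial.aeval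
      (fun z : Fin m × Fin N => ∑ j, (L z.2 j : S) * x (z.1, j))
      (∑ l, MvPolynomial.C (L.adjugate z.2 l) * MvPolynomial.X (z.1, l) :
        MvPolynomial (Fin m × Fin N) ℤ) = (L.det : S) * x z := by
    intro z
    rw [map_sum]
    simp only [map_mul, MvPolynomial.aeval_X, MvPolynomial.aeval_C, algebraMap_int_eq, eq_intCast]
    simp_rw [mul_sum]
    rw [sum_comm]
    have hadj : ∀ j, ∑ l, (L.adjugate z.2 l : S) * (L l j : S) = if z.2 = j then (L.det : S) else 0 := by
      intro j
      have := congrFun (congrFun (Matrix.adjugate_mul L) z.2) j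
      rw [Matrix.mul_apply] at this
      have h2 := congrArg (fun t : ℤ => (t : S)) this
      push_cast at h2
      rw [h2, Matrix.smul_apply, Matrix.one_apply]
      split_ifs <;> simp
    calc _ = ∑ j, (∑ l, (L.adjugate z.2 l : S) * (L l j : S)) * x (z.1, j) := by
          refine sum_congr rfl fun j _ => ?_
          rw [sum_mul]
          exact sum_congr rfl fun l _ => by rw [map_intCast]; ring
      _ = _ := by
          simp_rw [hadj]
          simp
  have h2 : MvPolynomial.aeval (fun z : Fin m × Fin N => ∑ j, (L z.2 j : S) * x (z.1, j))
      (subm L.adjugate P) = MvPolynomial.aeval (fun z => (L.det : S) * x z) P := by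
    rw [subm, ← AlgHom.comp_apply]
    congr 1
    apply MvPolynomial.algHom_ext
    intro z
    rw [AlgHom.comp_apply, MvPolynomial.aeval_X, MvPolynomial.aeval_X]
    exact h1 z
  rw [h2]
  conv_lhs => rw [P.as_sum, map_sum]
  conv_rhs => rw [P.as_sum, map_sum, mul_sum]
  refine sum_congr rfl fun e he => ?_
  rw [MvPolynomial.aeval_monomial, MvPolynomial.aeval_monomial, Finsupp.prod_fintype _ _ (by simp),
    Finsupp.prod_fintype _ _ (by simp)]
  simp_rw [mul_pow]
  rw [prod_mul_distrib, prod_pow_eq_pow_sum]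
  have h4 : ∑ x, e x = ∑ h, d h := by
    rw [Fintype.sum_prod_type]
    exact sum_congr rfl fun h _ => hP e he h
  rw [h4]; ring

/-- coefficient extraction at zero w-exponent -/
lemma coeff_inr {R α β : Type*} [CommRing R] (F : MvPolynomial (α ⊕ β) R) (j : β →₀ ℕ) :
    F.coeff (j.mapDomain Sum.inr) =
      (MvPolynomial.aeval (Sum.elim (fun _ => 0) MvPolynomial.X : α ⊕ β → MvPolynomial β R) F).coeff j := by
  classical
  induction F using MvPolynomial.induction_on' with
  | monomial u a =>
    rw [MvPolynomial.coeff_monomial, MvPolynomial.aeval_monomial, MvPolynomial.algebraMap_eq,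
      MvPolynomial.coeff_C_mul]
    by_cases h : ∃ x, u (Sum.inl x) ≠ 0
    · obtain ⟨x, hx⟩ := h
      rw [if_neg]
      · rw [Finsupp.prod, prod_eq_zero (i := Sum.inl x) (by simpa using hx)]
        · simp
        · simp [hx]
      · intro h0
        apply hx
        rw [h0]
        rw [Finsupp.mapDomain_of_notMem_range]
        simp
    · push Not at h
      obtain ⟨u', rfl⟩ : ∃ u' : β →₀ ℕ, u = u'.mapDomain Sum.inr := by
        refine ⟨u.comapDomain Sum.inr Sum.inr_injective.injOn, ?_⟩
        ext x
        rcases x with x | x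
        · rw [h x, Finsupp.mapDomain_of_notMem_range]; simp
        · rw [Finsupp.mapDomain_apply Sum.inr_injective]; rfl
      rw [Finsupp.prod_mapDomain_index_inj Sum.inr_injective]
      simp only [Sum.elim_inr]
      rw [Finsupp.prod, MvPolynomial.prod_X_pow_eq_monomial, MvPolynomial.coeff_monomial]
      by_cases hu : u' = j
      · simp [hu]
      · rw [if_neg, if_neg hu]
        · simp
        · intro h'
          exact hu (Finsupp.mapDomain_injective Sum.inr_injective h')
  | add p q hp hq => rw [MvPolynomial.coeff_add, map_add, MvPolynomial.coeff_add, hp, hq]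

end

end Sub15


open Finset

namespace Sub15

set_option linter.unusedSimpArgs false
set_option linter.unusedVariables false
set_option linter.unusedSectionVars false

noncomputable section

lemma exp_bound {m N : ℕ} (e : Fin m → Fin N → ℕ) (d : Fin m → ℕ) (hd : ∀ h, 1 ≤ d h)
    (he : ∀ h, ∑ k, e h k = d h) (c : Fin N → ℝ) (B : ℝ) (hc : ∀ k, |c k| ≤ B) (hB : 0 ≤ B)
    (q : Fin m → ℝ) (D η ε : ℝ) (hD : 0 < D) (hq : ∀ h, D ≤ d h * q h) (hq2 : ∀ h, d h * q h ≤ (1 + η) * D)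
    (hbal : ∀ k, |∑ h, (e h k : ℝ) / d h - m / N| ≤ ε * m) :
    ∑ h, ∑ k, (e h k : ℝ) * (c k * q h) ≤ D * m * ((∑ k, c k) / N + (N * B * ε + η * B)) := by
  have h1 : ∀ h k, (e h k : ℝ) * (c k * q h) ≤ D * (c k * ((e h k : ℝ) / d h)) + B * η * D * ((e h k : ℝ) / d h) := by
    intro h k
    have hdh : (0 : ℝ) < d h := by exact_mod_cast hd h
    have hf : 0 ≤ (e h k : ℝ) / d h := by positivity
    have h2 : (e h k : ℝ) * (c k * q h) = c k * ((e h k : ℝ) / d h) * (d h * q h) := by field_simp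
    have h3 : c k * (d h * q h - D) ≤ B * (η * D) := by
      have h4 : 0 ≤ d h * q h - D := by linarith [hq h]
      calc c k * (d h * q h - D) ≤ B * (d h * q h - D) :=
            mul_le_mul_of_nonneg_right ((le_abs_self _).trans (hc k)) h4
        _ ≤ _ := mul_le_mul_of_nonneg_left (by linarith [hq2 h]) hB
    rw [h2]
    nlinarith [mul_le_mul_of_nonneg_left h3 hf]
  have hone : ∀ h, ∑ k, (e h k : ℝ) / d h = 1 := by
    intro h
    have hdh : (0 : ℝ) < d h := by exact_mod_cast hd h
    rw [← sum_div, div_eq_one_iff_eq hdh.ne', ← he h]; push_cast; rfl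
  calc _ ≤ ∑ h, ∑ k, (D * (c k * ((e h k : ℝ) / d h)) + B * η * D * ((e h k : ℝ) / d h)) :=
        sum_le_sum fun h _ => sum_le_sum fun k _ => h1 h k
    _ = D * ∑ k, c k * (∑ h, (e h k : ℝ) / d h) + B * η * D * m := by
        simp_rw [sum_add_distrib, ← mul_sum, hone]
        congr 1
        · rw [sum_comm]; congr 1; exact sum_congr rfl fun k _ => by rw [mul_sum]
        · simp
    _ ≤ D * (∑ k, (c k * (m / N) + B * (ε * m))) + B * η * D * m := by
        gcongr with k
        have h5 : c k * (∑ h, (e h k : ℝ) / d h - m / N) ≤ B * (ε * m) := by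
          refine (le_abs_self _).trans ?_
          rw [abs_mul]
          exact mul_le_mul (hc k) (hbal k) (abs_nonneg _) hB
        linarith
    _ = _ := by
        rw [sum_add_distrib, ← sum_mul]
        simp only [sum_const, card_univ, Fintype.card_fin, nsmul_eq_mul]
        ring

section
variable {K : Type*} [Field K] [CharZero K] (O : Subring K) {V : Type*} [Fintype V]
  (av : V → AbsoluteValue K ℝ)

/-- the substituted vector -/
def xs {m n N : ℕ} (y : Fin m → Fin n → Fin N → K) (l : Fin N) (z : Fin m × Fin N) :
    MvPolynomial ((Fin m × Fin n) ⊕ Fin m) K :=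
  ∑ j, MvPolynomial.C (y z.1 j z.2) * MvPolynomial.X (Sum.inl (z.1, j)) +
    (if z.2 = l then MvPolynomial.X (Sum.inr z.1) else 0)

lemma coeff_mem {σ τ : Type*} (P : MvPolynomial σ ℤ) (f : σ → MvPolynomial τ K)
    (hf : ∀ i e, (f i).coeff e ∈ O) (e : τ →₀ ℕ) : (MvPolynomial.aeval f P).coeff e ∈ O := by
  have h1 : ∀ i, ∃ g : MvPolynomial τ O, MvPolynomial.map O.subtype g = f i := by
    intro i
    have : f i ∈ Set.range (MvPolynomial.map O.subtype) := by
      rw [MvPolynomial.mem_range_map_iff_coeffs_subset]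
      intro x hx
      rw [Finset.mem_coe, MvPolynomial.mem_coeffs_iff] at hx
      obtain ⟨n, _, rfl⟩ := hx
      exact ⟨⟨_, hf i n⟩, rfl⟩
    exact this
  choose g hg using h1
  have h2 : MvPolynomial.aeval f P = MvPolynomial.map O.subtype (MvPolynomial.aeval g P) := by
    induction P using MvPolynomial.induction_on with
    | C a => simp
    | add p q hp hq => rw [map_add, map_add, map_add, hp, hq]
    | mul_X p i hp => rw [map_mul, map_mul, map_mul, hp, MvPolynomial.aeval_X, MvPolynomial.aeval_X, hg]
  rw [h2, MvPolynomial.coeff_map]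
  exact ((MvPolynomial.aeval g P).coeff e).2

lemma xs_coeff {m n N : ℕ} (y : Fin m → Fin n → Fin N → K) (hy : ∀ h j k, y h j k ∈ O) (l : Fin N)
    (z : Fin m × Fin N) (e) : (xs y l z).coeff e ∈ O := by
  classical
  rw [xs, MvPolynomial.coeff_add, MvPolynomial.coeff_sum]
  refine O.add_mem (O.sum_mem fun j _ => ?_) ?_
  · rw [MvPolynomial.coeff_C_mul, MvPolynomial.coeff_X]
    split_ifs
    · simpa using hy _ _ _
    · simpa using O.zero_mem
  · split_ifs
    · rw [MvPolynomial.coeff_X]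
      split_ifs
      · exact O.one_mem
      · exact O.zero_mem
    · simpa using O.zero_mem

set_option maxHeartbeats 1000000 in
lemma low_vanish (PF : ∀ x ∈ O, x ≠ 0 → 1 ≤ ∏ v, av v x)
    {m n N : ℕ} (y : Fin m → Fin n → Fin N → K) (hy : ∀ h j k, y h j k ∈ O) (l : Fin N)
    (L : V → Matrix (Fin N) (Fin N) ℤ) (hL : ∀ v, (L v).det ≠ 0) (c : V → Fin N → ℝ)
    (B : ℝ) (hc : ∀ v k, |c v k| ≤ B) (hB : 0 ≤ B) (q : Fin m → ℝ) (hq0 : ∀ h, 0 < q h)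
    (hyL : ∀ v h j k, av v (∑ i, (L v k i : K) * y h j i) ≤ Real.exp (c v k * q h))
    (d : Fin m → ℕ) (hd : ∀ h, 1 ≤ d h) (P : MvPolynomial (Fin m × Fin N) ℤ) (hMH : MH d P)
    (C1 : ℝ) (hC1 : 1 ≤ C1) (hC2 : l1 P ≤ C1 ^ (∑ h, d h))
    (hC3 : ∀ v i, ∑ j, |((L v).adjugate i j : ℝ)| ≤ C1)
    (hC4 : ∀ v k, n + |(L v k l : ℝ)| ≤ C1) (hC5 : ∀ v, (av v ((L v).det : K))⁻¹ ≤ C1)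
    (D η ε₁ ε₂ : ℝ) (hD : 0 < D) (hη1 : η ≤ 1) (hq : ∀ h, D ≤ d h * q h) (hq2 : ∀ h, d h * q h ≤ (1 + η) * D)
    (hbal : ∀ v, ∀ e ∈ (subm (L v).adjugate P).support, ∀ k,
      |∑ h, (e (h, k) : ℝ) / d h - m / N| ≤ ε₁ * m)
    (hnum : ∑ v, ((∑ h, d h : ℕ) * (4 * Real.log C1) +
      D * m * ((∑ k, c v k) / N + (N * B * ε₁ + η * B)) + B * (2 * D * ε₂)) < 0) :
    Van (Sum.elim (fun _ => 0) (fun h => 1 / (d h : ℝ))) ε₂ (MvPolynomial.aeval (xs y l) P) := by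
  classical
  intro a ha
  by_contra hlt
  push Not at hlt
  set S := ∑ h, d h with hS
  set r := (MvPolynomial.aeval (xs y l) P).coeff a with hr
  have hr0 : r ≠ 0 := MvPolynomial.mem_support_iff.1 ha
  have hrO : r ∈ O := coeff_mem O P _ (xs_coeff O y hy l) a
  set w : (Fin m × Fin n) ⊕ Fin m → ℝ := Sum.elim (fun _ => 1) (fun h => Real.exp (-(B * q h))) with hw
  have hw0 : ∀ i, 0 ≤ w i := by
    intro i; rcases i with i | i
    · simp [hw]
    · simp [hw]; positivity
  have hlogC : 0 ≤ Real.log C1 := Real.log_nonneg hC1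
  have hC0 : 0 < C1 := by linarith
  have hCexp : ∀ k : ℕ, C1 ^ k = Real.exp (k * Real.log C1) := by
    intro k; rw [mul_comm, Real.exp_mul, Real.exp_log hC0, Real.rpow_natCast]
  have hmon : Real.exp (-(B * (2 * D * ε₂))) ≤ a.prod fun i k => w i ^ k := by
    rw [Finsupp.prod_fintype _ _ (by simp), Fintype.prod_sum_type]
    have h1 : ∏ x : Fin m × Fin n, w (Sum.inl x) ^ a (Sum.inl x) = 1 := by simp [hw]
    rw [h1, one_mul]
    simp only [hw, Sum.elim_inr]
    simp_rw [← Real.exp_nat_mul]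
    rw [← Real.exp_sum, Real.exp_le_exp]
    have h2 : wt (Sum.elim (fun _ => 0) (fun h => 1 / (d h : ℝ))) a = ∑ h, (a (Sum.inr h) : ℝ) * (1 / d h) := by
      rw [wt, Fintype.sum_sum_type]; simp
    rw [h2] at hlt
    have h3 : ∑ h, (a (Sum.inr h) : ℝ) * q h ≤ 2 * D * ε₂ := by
      calc _ ≤ ∑ h, 2 * D * ((a (Sum.inr h) : ℝ) * (1 / d h)) := by
            refine sum_le_sum fun h _ => ?_
            have hdh : (0 : ℝ) < d h := by exact_mod_cast hd h
            have h4 : q h ≤ 2 * D * (1 / d h) := by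
              rw [mul_one_div, le_div_iff₀ hdh]
              have := hq2 h
              nlinarith
            calc _ ≤ (a (Sum.inr h) : ℝ) * (2 * D * (1 / d h)) :=
                  mul_le_mul_of_nonneg_left h4 (Nat.cast_nonneg _)
              _ = _ := by ring
        _ = 2 * D * ∑ h, (a (Sum.inr h) : ℝ) * (1 / d h) := by rw [mul_sum]
        _ ≤ _ := by gcongr
    have h5 : ∑ h, (a (Sum.inr h) : ℝ) * (-(B * q h)) = -(B * ∑ h, (a (Sum.inr h) : ℝ) * q h) := by
      rw [mul_sum, ← sum_neg_distrib]
      exact sum_congr rfl fun h _ => by ring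
    rw [h5]
    have := mul_le_mul_of_nonneg_left h3 hB
    linarith
  have key : ∀ v, av v r ≤ Real.exp ((S : ℕ) * (4 * Real.log C1) +
      D * m * ((∑ k, c v k) / N + (N * B * ε₁ + η * B)) + B * (2 * D * ε₂)) := by
    intro v
    set E := D * m * ((∑ k, c v k) / N + (N * B * ε₁ + η * B)) with hE
    set f : Fin m × Fin N → MvPolynomial ((Fin m × Fin n) ⊕ Fin m) K :=
      fun z => ∑ j, ((L v z.2 j : ℤ) : MvPolynomial ((Fin m × Fin n) ⊕ Fin m) K) * xs y l (z.1, j) with hf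
    have hfn : ∀ z, wnorm (av v) w (f z) ≤ C1 * Real.exp (c v z.2 * q z.1) := by
      intro z
      have h1 : f z = ∑ j, MvPolynomial.C (∑ i, (L v z.2 i : K) * y z.1 j i) * MvPolynomial.X (Sum.inl (z.1, j))
          + MvPolynomial.C (L v z.2 l : K) * MvPolynomial.X (Sum.inr z.1) := by
        have hcast : ∀ t : ℤ, (t : MvPolynomial ((Fin m × Fin n) ⊕ Fin m) K) = MvPolynomial.C (t : K) := by
          intro t; simp
        simp only [hf, xs, mul_add, sum_add_distrib, hcast]
        congr 1
        · simp_rw [map_sum, sum_mul, mul_sum]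
          rw [sum_comm]
          refine sum_congr rfl fun j _ => sum_congr rfl fun i _ => ?_
          rw [MvPolynomial.C_mul]; ring
        · simp
      rw [h1]
      refine (wnorm_add _ _ hw0 _ _).trans ?_
      have h2 : wnorm (av v) w (∑ j, MvPolynomial.C (∑ i, (L v z.2 i : K) * y z.1 j i) *
          MvPolynomial.X (Sum.inl (z.1, j))) ≤ n * Real.exp (c v z.2 * q z.1) := by
        refine (wnorm_sum _ _ hw0 _ _).trans ?_
        calc _ ≤ ∑ j : Fin n, Real.exp (c v z.2 * q z.1) := by
              refine sum_le_sum fun j _ => (wnorm_mul _ _ hw0 _ _).trans ?_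
              rw [wnorm_C, wnorm_X]
              simp only [hw, Sum.elim_inl, mul_one]
              exact hyL v z.1 j z.2
          _ = _ := by simp
      have h3 : wnorm (av v) w (MvPolynomial.C (L v z.2 l : K) * MvPolynomial.X (Sum.inr z.1)) ≤
          |(L v z.2 l : ℝ)| * Real.exp (c v z.2 * q z.1) := by
        refine (wnorm_mul _ _ hw0 _ _).trans ?_
        rw [wnorm_C, wnorm_X]
        simp only [hw, Sum.elim_inr]
        refine mul_le_mul (av_int_le _ _) ?_ (Real.exp_nonneg _) (abs_nonneg _)
        rw [Real.exp_le_exp]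
        have := (abs_le.1 (hc v z.2)).1
        nlinarith [hq0 z.1]
      calc _ ≤ (n + |(L v z.2 l : ℝ)|) * Real.exp (c v z.2 * q z.1) := by linarith
        _ ≤ _ := mul_le_mul_of_nonneg_right (hC4 v z.2) (Real.exp_nonneg _)
    have hU : ∀ e ∈ (subm (L v).adjugate P).support, ∏ z, wnorm (av v) w (f z) ^ e z ≤ C1 ^ S * Real.exp E := by
      intro e he
      have hes := hMH.subm (L v).adjugate e he
      calc _ ≤ ∏ z, (C1 * Real.exp (c v z.2 * q z.1)) ^ e z :=
            prod_le_prod (fun z _ => pow_nonneg (wnorm_nonneg _ _ hw0 _) _) fun z _ =>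
              pow_le_pow_left₀ (wnorm_nonneg _ _ hw0 _) (hfn z) _
        _ = C1 ^ S * Real.exp (∑ h, ∑ k, (e (h, k) : ℝ) * (c v k * q h)) := by
            simp_rw [mul_pow]
            rw [prod_mul_distrib, prod_pow_eq_pow_sum]
            congr 1
            · congr 1
              rw [Fintype.sum_prod_type]
              exact sum_congr rfl fun h _ => hes h
            · simp_rw [← Real.exp_nat_mul]
              rw [← Real.exp_sum, Fintype.sum_prod_type]
        _ ≤ _ := by
            gcongr
            exact exp_bound (fun h k => e (h, k)) d hd hes (c v) B (hc v) hB q D η ε₁ hD hq hq2 (hbal v e he)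
    have h1 := wnorm_aeval (av v) w hw0 f (subm (L v).adjugate P) _ hU
    have h2 := aeval_subm (L v) d P hMH (xs y l)
    have h3 : av v ((L v).det : K) ^ S * av v r * (a.prod fun i k => w i ^ k) ≤
        wnorm (av v) w (MvPolynomial.aeval f (subm (L v).adjugate P)) := by
      have h4 := coeff_le_wnorm (av v) w hw0 (MvPolynomial.aeval f (subm (L v).adjugate P)) a
      have h5 : (MvPolynomial.aeval f (subm (L v).adjugate P)).coeff a = ((L v).det : K) ^ S * r := by
        rw [show MvPolynomial.aeval f (subm (L v).adjugate P) = _ from h2]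
        have : (((L v).det : ℤ) : MvPolynomial ((Fin m × Fin n) ⊕ Fin m) K) ^ (∑ h, d h) =
          MvPolynomial.C (((L v).det : K) ^ S) := by simp [hS]
        rw [this, MvPolynomial.coeff_C_mul]
        rfl
      rw [h5, map_mul, map_pow] at h4
      exact h4
    have h6 : l1 (subm (L v).adjugate P) ≤ C1 ^ S * C1 ^ S :=
      (l1_subm _ C1 (hC3 v) d P hMH).trans (mul_le_mul_of_nonneg_left hC2 (by positivity))
    have hdet : 0 < av v ((L v).det : K) := (av v).pos (by exact_mod_cast hL v)
    have h7 : av v ((L v).det : K) ^ S * av v r * Real.exp (-(B * (2 * D * ε₂))) ≤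
        C1 ^ S * C1 ^ S * (C1 ^ S * Real.exp E) := by
      calc _ ≤ av v ((L v).det : K) ^ S * av v r * (a.prod fun i k => w i ^ k) :=
            mul_le_mul_of_nonneg_left hmon (by positivity)
        _ ≤ _ := h3
        _ ≤ _ := h1
        _ ≤ _ := mul_le_mul_of_nonneg_right h6 (by positivity)
    have h8 : av v r ≤ C1 ^ S * (C1 ^ S * C1 ^ S * (C1 ^ S * Real.exp E)) * Real.exp (B * (2 * D * ε₂)) := by
      have h9 : 1 ≤ C1 ^ S * av v ((L v).det : K) ^ S := by
        rw [← mul_pow]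
        apply one_le_pow₀
        have := hC5 v
        rwa [inv_le_iff_one_le_mul₀ hdet] at this
      calc av v r ≤ (C1 ^ S * av v ((L v).det : K) ^ S) * av v r := le_mul_of_one_le_left (by positivity) h9
        _ = C1 ^ S * (av v ((L v).det : K) ^ S * av v r * Real.exp (-(B * (2 * D * ε₂)))) *
            Real.exp (B * (2 * D * ε₂)) := by
            have : Real.exp (-(B * (2 * D * ε₂))) * Real.exp (B * (2 * D * ε₂)) = 1 := by
              rw [← Real.exp_add]; simp
            linear_combination (-(C1 ^ S * av v ((L v).det : K) ^ S) * av v r) * this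
        _ ≤ _ := by gcongr
    refine h8.trans (le_of_eq ?_)
    rw [hCexp S]
    simp_rw [← Real.exp_add]
    congr 1
    ring
  have h10 := PF r hrO hr0
  have h11 : ∏ v, av v r ≤ ∏ v, Real.exp ((S : ℕ) * (4 * Real.log C1) +
      D * m * ((∑ k, c v k) / N + (N * B * ε₁ + η * B)) + B * (2 * D * ε₂)) :=
    prod_le_prod (fun v _ => by positivity) fun v _ => key v
  rw [← Real.exp_sum] at h11
  have := Real.exp_lt_exp.2 hnum
  rw [Real.exp_zero] at this
  linarith

end

end

end Sub15


open Finset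

namespace Sub15

set_option linter.unusedSimpArgs false
set_option linter.unusedVariables false
set_option linter.unusedSectionVars false

noncomputable section

lemma span_perp {K : Type*} [Field K] {n : ℕ} (y : Fin n → Fin (n+1) → K) (hy : LinearIndependent K y)
    (a : Fin (n+1) → K) (l : Fin (n+1)) (hal : a l = 1) (hay : ∀ j, ∑ k, a k * y j k = 0)
    (x : Fin (n+1) → K) (hx : ∑ k, a k * x k = 0) : ∃ σ : Fin n → K, ∀ i, ∑ j, σ j * y j i = x i := by
  classical
  let φ : (Fin (n+1) → K) →ₗ[K] K := ∑ k, a k • LinearMap.proj k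
  have hφ : ∀ z, φ z = ∑ k, a k * z k := by intro z; simp [φ]
  have hsurj : Function.Surjective φ := by
    intro t
    refine ⟨Pi.single l t, ?_⟩
    rw [hφ]; simp [Pi.single_apply, hal]
  have hle : Submodule.span K (Set.range y) ≤ LinearMap.ker φ := by
    rw [Submodule.span_le]
    rintro _ ⟨j, rfl⟩
    simp [hφ, hay]
  have hfr := LinearMap.finrank_range_add_finrank_ker φ
  rw [LinearMap.range_eq_top.2 hsurj] at hfr
  simp at hfr
  have heq : Submodule.span K (Set.range y) = LinearMap.ker φ := by
    apply Submodule.eq_of_le_of_finrank_eq hle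
    rw [finrank_span_eq_card hy]; simp; omega
  have hxm : x ∈ Submodule.span K (Set.range y) := by rw [heq]; simp [hφ, hx]
  rw [Submodule.mem_span_range_iff_exists_fun] at hxm
  obtain ⟨σ, hσ⟩ := hxm
  refine ⟨σ, fun i => ?_⟩
  rw [← hσ]; simp

section
variable {K : Type*} [Field K] {m N : ℕ}

/-- the specialised variables -/
def Wv (k l : Fin N) (z : Fin m × Fin N) : MvPolynomial ((Fin m × Fin N) ⊕ Fin m) K :=
  if z.2 = k then 1 else if z.2 = l then 0 else MvPolynomial.X (Sum.inl z)

/-- the specialised vector -/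
def Gv (a : Fin m → Fin N → K) (k l : Fin N) (z : Fin m × Fin N) :
    MvPolynomial ((Fin m × Fin N) ⊕ Fin m) K :=
  Wv k l z + if z.2 = l then MvPolynomial.X (Sum.inr z.1) - ∑ k', MvPolynomial.C (a z.1 k') * Wv k l (z.1, k') else 0

lemma Van_Wv (k l : Fin N) (δ : Fin m → ℝ) (z : Fin m × Fin N) :
    Van (Sum.elim (fun _ => 0) δ) 0 (Wv k l z : MvPolynomial _ K) := by
  classical
  unfold Wv
  split_ifs
  · simpa using Van.C (Sum.elim (fun _ => 0) δ : (Fin m × Fin N) ⊕ Fin m → ℝ) (1 : K)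
  · intro a ha; simp at ha
  · exact Van.X (Sum.elim (fun _ => 0) δ) (Sum.inl z)

lemma aeval_aeval' {σ τ ρ : Type*} (f : τ → MvPolynomial ρ K) (g : σ → MvPolynomial τ K)
    (P : MvPolynomial σ ℤ) : MvPolynomial.aeval f (MvPolynomial.aeval g P) =
      MvPolynomial.aeval (fun z => MvPolynomial.aeval f (g z)) P := by
  induction P using MvPolynomial.induction_on with
  | C c => simp
  | add p q hp hq => rw [map_add, map_add, map_add, hp, hq]
  | mul_X p i hp => rw [map_mul, map_mul, map_mul, hp, MvPolynomial.aeval_X, MvPolynomial.aeval_X]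

lemma van_spec {n : ℕ} (y : Fin m → Fin n → Fin (n+1) → K) (hy : ∀ h, LinearIndependent K (y h))
    (a : Fin m → Fin (n+1) → K) (k l : Fin (n+1)) (hkl : k ≠ l) (hal : ∀ h, a h l = 1)
    (hay : ∀ h j, ∑ k, a h k * y h j k = 0) (δ : Fin m → ℝ) (τ : ℝ) (P : MvPolynomial (Fin m × Fin (n+1)) ℤ)
    (hV : Van (Sum.elim (fun _ => 0) δ) τ (MvPolynomial.aeval (xs y l) P)) :
    Van (Sum.elim (fun _ => 0) δ) τ (MvPolynomial.aeval (Gv a k l) P) := by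
  classical
  have h1 : ∀ h k', ∃ σ : Fin n → K, ∀ i, ∑ j, σ j * y h j i = (if i = k' then 1 else 0) - (if i = l then a h k' else 0) := by
    intro h k'
    apply span_perp (y h) (hy h) (a h) l (hal h) (hay h)
    simp [mul_sub, sum_sub_distrib, hal h]
  choose σ hσ using h1
  let f : (Fin m × Fin n) ⊕ Fin m → MvPolynomial ((Fin m × Fin (n+1)) ⊕ Fin m) K :=
    Sum.elim (fun z => ∑ k', MvPolynomial.C (σ z.1 k' z.2) * Wv k l (z.1, k')) (fun h => MvPolynomial.X (Sum.inr h))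
  have h2 := Van.aeval (Sum.elim (fun _ => 0) δ) (Sum.elim (fun _ => 0) δ) f ?_ _ τ hV
  · have h3 : MvPolynomial.aeval f (MvPolynomial.aeval (xs y l) P) = MvPolynomial.aeval (Gv a k l) P := by
      have h4 : ∀ z, MvPolynomial.aeval f (xs y l z) = Gv a k l z := by
        intro z
        unfold xs Gv
        simp only [map_add, map_sum, map_mul, MvPolynomial.aeval_X, MvPolynomial.aeval_C, MvPolynomial.algebraMap_eq, apply_ite (MvPolynomial.aeval f), map_zero]
        have h5 : ∑ j, MvPolynomial.C (y z.1 j z.2) * f (Sum.inl (z.1, j)) =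
          ∑ k', MvPolynomial.C ((if z.2 = k' then (1:K) else 0) - (if z.2 = l then a z.1 k' else 0)) * Wv k l (z.1, k') := by
          simp only [f, Sum.elim_inl, mul_sum]
          rw [sum_comm]
          refine sum_congr rfl fun k' _ => ?_
          rw [← hσ, map_sum, sum_mul]
          refine sum_congr rfl fun j _ => ?_
          rw [MvPolynomial.C_mul]; ring
        rw [h5]
        simp only [MvPolynomial.C_sub, sub_mul, sum_sub_distrib]
        have h6 : ∑ k', MvPolynomial.C (if z.2 = k' then (1:K) else 0) * (Wv k l (z.1, k') : MvPolynomial ((Fin m × Fin (n+1)) ⊕ Fin m) K) = Wv k l z := by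
          rw [sum_eq_single z.2]
          · simp
          · intro b _ hb; simp [hb.symm]
          · simp
        rw [h6]
        by_cases hz : z.2 = l
        · simp [hz, f]; ring
        · simp [hz]
      rw [aeval_aeval']
      congr 2
      exact funext h4
    rwa [h3] at h2
  · intro i
    rcases i with z | h
    · simp only [f, Sum.elim_inl]
      refine Van.sum _ _ fun k' _ => ?_
      have := (Van.C (Sum.elim (fun _ => 0) δ : (Fin m × Fin (n+1)) ⊕ Fin m → ℝ) (σ z.1 k' z.2)).mul (Van_Wv (K := K) k l δ (z.1, k'))
      rwa [zero_add] at this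
    · simp only [f, Sum.elim_inr]
      exact Van.X (Sum.elim (fun _ => 0) δ) (Sum.inr h)


/-- exponents of the extra variables -/
def prx (k l : Fin N) (e : Fin m × Fin N →₀ ℕ) : (Fin m × Fin N) ⊕ Fin m →₀ ℕ :=
  Finsupp.equivFunOnFinite.symm (Sum.elim (fun z => if z.2 = k ∨ z.2 = l then 0 else e z) fun _ => 0)

/-- exponents at position l -/
def elx (l : Fin N) (e : Fin m × Fin N →₀ ℕ) : Fin m →₀ ℕ :=
  Finsupp.equivFunOnFinite.symm fun h => e (h, l)

lemma aeval_Gv_monomial (a : Fin m → Fin N → K) (k l : Fin N) (hkl : k ≠ l) (e : Fin m × Fin N →₀ ℕ) (p : ℤ) :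
    MvPolynomial.aeval (Gv a k l) (MvPolynomial.monomial e p) =
      MvPolynomial.monomial (prx k l e) (p : K) * ∏ h, Gv a k l (h, l) ^ e (h, l) := by
  classical
  rw [MvPolynomial.aeval_monomial, Finsupp.prod_fintype _ _ (by simp)]
  have h1 : ∀ z, Gv a k l z ^ e z = (if z.2 = l then Gv a k l z ^ e z else 1) *
      (if z.2 = k ∨ z.2 = l then 1 else MvPolynomial.X (Sum.inl z) ^ e z) := by
    intro z
    by_cases hz : z.2 = l
    · simp [hz]
    · by_cases hz' : z.2 = k
      · simp [hz, hz', Gv, Wv, hkl]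
      · simp [hz, hz', Gv, Wv]
  rw [prod_congr rfl fun z _ => h1 z, prod_mul_distrib]
  have h2 : ∏ z : Fin m × Fin N, (if z.2 = l then Gv a k l z ^ e z else 1) = ∏ h, Gv a k l (h, l) ^ e (h, l) := by
    rw [Fintype.prod_prod_type]
    refine prod_congr rfl fun h _ => ?_
    simp
  have h3 : (MvPolynomial.monomial (prx k l e) (p : K) : MvPolynomial ((Fin m × Fin N) ⊕ Fin m) K) =
      MvPolynomial.C (p : K) * ∏ z : Fin m × Fin N, (if z.2 = k ∨ z.2 = l then 1 else MvPolynomial.X (Sum.inl z) ^ e z) := by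
    rw [MvPolynomial.monomial_eq, Finsupp.prod_fintype _ _ (by simp), Fintype.prod_sum_type]
    congr 1
    simp only [prx, Finsupp.equivFunOnFinite_symm_apply_apply, Sum.elim_inr, pow_zero, prod_const_one, mul_one, Sum.elim_inl]
    refine prod_congr rfl fun z _ => ?_
    split_ifs <;> simp
  rw [h2, h3]
  simp
  ring

lemma pj_exists (k l : Fin N) (hkl : k ≠ l) (d : Fin m → ℕ) (P : MvPolynomial (Fin m × Fin N) ℤ) (hP : P ≠ 0)
    (hMH : MH d P) : ∃ PJ : MvPolynomial (Fin m) ℤ, PJ ≠ 0 ∧ l1 PJ ≤ l1 P ∧ (∀ h, PJ.degreeOf h ≤ d h) ∧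
      ∀ (a : Fin m → Fin N → K) (δ : Fin m → ℝ) (τ : ℝ),
        Van (Sum.elim (fun _ => 0) δ) τ (MvPolynomial.aeval (Gv a k l) P) →
        Van δ τ (sh (fun h => - a h k) (MvPolynomial.map (Int.castRingHom K) PJ)) := by
  classical
  obtain ⟨e0, he0, hmin⟩ := exists_min_image P.support (fun e => (prx k l e).degree)
    (MvPolynomial.support_nonempty.2 hP)
  set F := P.support.filter fun e => prx k l e = prx k l e0 with hF
  set PJ : MvPolynomial (Fin m) ℤ := ∑ e ∈ F, MvPolynomial.monomial (elx l e) (P.coeff e) with hPJ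
  have hinj : ∀ e ∈ F, elx l e = elx l e0 → e = e0 := by
    intro e he hel
    rw [hF, mem_filter] at he
    have h1 : ∀ h k', k' ≠ k → e (h, k') = e0 (h, k') := by
      intro h k' hk'
      by_cases hl : k' = l
      · subst hl; exact DFunLike.congr_fun hel h
      · have := DFunLike.congr_fun he.2 (Sum.inl (h, k'))
        simpa [prx, hk', hl] using this
    have h2 : ∀ h, e (h, k) = e0 (h, k) := by
      intro h
      have e1 := hMH e he.1 h
      have e2 := hMH e0 he0 h
      rw [← add_sum_erase _ _ (mem_univ k)] at e1 e2
      have e3 : ∑ x ∈ univ.erase k, e (h, x) = ∑ x ∈ univ.erase k, e0 (h, x) :=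
        sum_congr rfl fun x hx => h1 h x (ne_of_mem_erase hx)
      omega
    ext ⟨h, k'⟩
    by_cases hk' : k' = k
    · rw [hk']; exact h2 h
    · exact h1 h k' hk'
  refine ⟨PJ, ?_, ?_, ?_, ?_⟩
  · intro h0
    have h1 : PJ.coeff (elx l e0) = P.coeff e0 := by
      rw [hPJ, MvPolynomial.coeff_sum, sum_eq_single e0]
      · simp
      · intro b hb hne
        rw [MvPolynomial.coeff_monomial, if_neg]
        intro h; exact hne (hinj b hb h)
      · intro h; exact absurd (by rw [hF, mem_filter]; exact ⟨he0, rfl⟩) h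
    rw [h0] at h1
    exact MvPolynomial.mem_support_iff.1 he0 (by simpa using h1.symm)
  · refine (l1_sum _ _).trans ?_
    rw [l1_eq P]
    calc _ ≤ ∑ e ∈ F, |((P.coeff e : ℤ) : ℝ)| := by
          refine sum_le_sum fun e _ => ?_
          rw [l1_eq]
          by_cases h : P.coeff e = 0
          · simp [h]
          · rw [MvPolynomial.support_monomial, if_neg h]; simp
      _ ≤ _ := sum_le_sum_of_subset_of_nonneg (filter_subset _ _) fun _ _ _ => abs_nonneg _
  · intro h
    rw [MvPolynomial.degreeOf_le_iff]
    intro j hj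
    have h1 := MvPolynomial.support_sum hj
    rw [mem_biUnion] at h1
    obtain ⟨e, he, hje⟩ := h1
    have h2 := MvPolynomial.support_monomial_subset hje
    rw [mem_singleton] at h2
    rw [h2, ← hMH e (mem_filter.1 he).1 h]
    exact single_le_sum (f := fun k => e (h, k)) (fun _ _ => Nat.zero_le _) (mem_univ l)
  · intro a δ τ hV j hj
    have hcoef : (MvPolynomial.aeval (Gv a k l) P).coeff (prx k l e0 + j.mapDomain Sum.inr) =
        (sh (fun h => - a h k) (MvPolynomial.map (Int.castRingHom K) PJ)).coeff j := by
      have hinr : ∀ h : Fin m, (j.mapDomain Sum.inr : (Fin m × Fin N) ⊕ Fin m →₀ ℕ) (Sum.inr h) = j h :=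
        fun h => Finsupp.mapDomain_apply Sum.inr_injective _ _
      have hinl : ∀ z, (j.mapDomain Sum.inr : (Fin m × Fin N) ⊕ Fin m →₀ ℕ) (Sum.inl z) = 0 := by
        intro z; apply Finsupp.mapDomain_of_notMem_range; simp
      conv_lhs => rw [P.as_sum, map_sum, MvPolynomial.coeff_sum]
      rw [hPJ, map_sum, map_sum, MvPolynomial.coeff_sum, hF, sum_filter]
      refine sum_congr rfl fun e he => ?_
      rw [aeval_Gv_monomial a k l hkl, MvPolynomial.coeff_monomial_mul']
      have hiff : prx k l e ≤ prx k l e0 + j.mapDomain Sum.inr ↔ prx k l e = prx k l e0 := by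
        constructor
        · intro hle
          have h1 : prx k l e ≤ prx k l e0 := by
            intro z
            rcases z with z | z
            · have := hle (Sum.inl z)
              rw [Finsupp.add_apply, hinl, add_zero] at this
              exact this
            · simp [prx]
          have h2 := hmin e he
          obtain ⟨r, hr⟩ := le_iff_exists_add.1 h1
          rw [hr, map_add] at h2
          have h3 : r.degree = 0 := by omega
          rw [Finsupp.degree_eq_zero_iff] at h3
          rw [hr, h3, add_zero]
        · intro h; rw [h]; exact le_self_add
      by_cases hc : prx k l e = prx k l e0
      · rw [if_pos (hiff.2 hc), if_pos hc, hc, add_tsub_cancel_left, coeff_inr]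
        rw [MvPolynomial.map_monomial, sh, MvPolynomial.aeval_monomial, MvPolynomial.algebraMap_eq, MvPolynomial.coeff_C_mul,
          Finsupp.prod_fintype _ _ (by simp), map_prod]
        congr 2
        refine prod_congr rfl fun h _ => ?_
        rw [map_pow]
        simp only [elx, Finsupp.equivFunOnFinite_symm_apply_apply]
        congr 1
        simp only [Gv, Wv, if_true, hkl.symm, if_false, map_add, map_sub, map_sum, map_mul, map_zero, zero_add,
          MvPolynomial.aeval_X, Sum.elim_inr, MvPolynomial.aeval_C, MvPolynomial.algebraMap_eq]
        rw [sum_eq_single k]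
        · simp [sub_eq_add_neg]
        · intro b _ hb
          by_cases hbl : b = l
          · simp [hb, hbl, hkl.symm]
          · simp [hb, hbl]
        · simp
      · rw [if_neg (fun h => hc (hiff.1 h)), if_neg hc]
    have hmem : prx k l e0 + j.mapDomain Sum.inr ∈ (MvPolynomial.aeval (Gv a k l) P).support := by
      rw [MvPolynomial.mem_support_iff, hcoef]
      exact MvPolynomial.mem_support_iff.1 hj
    have := hV _ hmem
    rw [wt, Fintype.sum_sum_type] at this
    simp only [Sum.elim_inl, mul_zero, sum_const_zero, zero_add, Sum.elim_inr, Finsupp.add_apply] at this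
    rw [wt]
    convert this using 3 with h
    rw [Finsupp.mapDomain_apply Sum.inr_injective]
    simp [prx]

end

end

end Sub15


open Finset

namespace Sub15

set_option linter.unusedSimpArgs false
set_option linter.unusedVariables false
set_option linter.unusedSectionVars false

noncomputable section

lemma grow_seq (p : ℝ → Prop) (hp : ∀ x, ∃ y ≥ x, p y) (X r : ℝ) (hX : 0 < X) :
    ∃ g : ℕ → ℝ, (∀ i, p (g i)) ∧ (∀ i, X ≤ g i) ∧ ∀ i j, j < i → r * g j ≤ g i := by
  choose f hf1 hf2 using hp
  let s := max 1 r
  let g : ℕ → ℝ := fun i => Nat.rec (f X) (fun _ x => f (s * x)) i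
  have hg : ∀ i, g (i+1) = f (s * g i) := fun i => rfl
  have hs1 : 1 ≤ s := le_max_left _ _
  have h0 : ∀ i, X ≤ g i := by
    intro i
    induction i with
    | zero => exact hf1 X
    | succ i ih =>
      rw [hg]
      refine le_trans ?_ (hf1 _)
      nlinarith
  have h1 : ∀ i, s * g i ≤ g (i+1) := fun i => by rw [hg]; exact hf1 _
  have hmono : Monotone g := monotone_nat_of_le_succ fun i => by
    have := h1 i; have := h0 i; nlinarith
  refine ⟨g, ?_, h0, ?_⟩
  · intro i
    cases i with
    | zero => exact hf2 X
    | succ i => exact hf2 _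
  · intro i j hij
    have e1 := hmono (show j + 1 ≤ i from hij)
    have e2 := h1 j
    have e3 : r * g j ≤ s * g j := mul_le_mul_of_nonneg_right (le_max_right _ _) (by linarith [h0 j])
    linarith

section
variable {K : Type*} [Field K] [CharZero K] (O : Subring K) {V : Type*} [Fintype V]
  (av : V → AbsoluteValue K ℝ)

set_option maxHeartbeats 1000000 in
theorem thmA_b (PF : ∀ x ∈ O, x ≠ 0 → 1 ≤ ∏ v, av v x) {n : ℕ}
    (L : V → Matrix (Fin (n+1)) (Fin (n+1)) ℤ) (hL : ∀ v, (L v).det ≠ 0) (c : V → Fin (n+1) → ℝ)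
    (hc : ∑ v, ∑ i, c v i < 0) (k l : Fin (n+1)) (hkl : k ≠ l) (κ : ℝ) (hκ : 0 < κ)
    (hinf : ∀ q0 : ℝ, ∃ q ≥ q0, ∃ (y : Fin n → Fin (n+1) → K) (a : Fin (n+1) → K),
      LinearIndependent K y ∧ (∀ j i, y j i ∈ O) ∧ a l = 1 ∧ (∀ j, ∑ i, a i * y j i = 0) ∧
      (∀ v j i, av v (∑ i', (L v i i' : K) * y j i') ≤ Real.exp (c v i * q)) ∧
      RothH (- a k) (Real.exp (κ * q))) : False := by
  classical
  obtain ⟨C, hC1, hC⟩ := aux_poly (n+1) (Nat.succ_pos n) fun v => (L v).adjugate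
  set N : ℝ := ((n+1 : ℕ) : ℝ) with hN
  have hNpos : 0 < N := by rw [hN]; positivity
  have hN0 : N ≠ 0 := hNpos.ne'
  set c0 : ℝ := - ∑ v, ∑ i, c v i with hc0
  have hc0pos : 0 < c0 := by rw [hc0]; linarith
  have hVne : Nonempty V := by
    by_contra h
    rw [not_nonempty_iff] at h
    simp at hc
  set T : ℝ := (Fintype.card V : ℝ) with hT
  have hTpos : 0 < T := by rw [hT]; exact_mod_cast Fintype.card_pos
  set B : ℝ := 1 + ∑ v, ∑ i, |c v i| with hB
  have hBpos : 0 < B := by rw [hB]; positivity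
  have hcB : ∀ v i, |c v i| ≤ B := by
    intro v i
    have e1 : |c v i| ≤ ∑ i, |c v i| := single_le_sum (f := fun i => |c v i|) (fun _ _ => abs_nonneg _) (mem_univ i)
    have e2 : ∑ i, |c v i| ≤ ∑ v, ∑ i, |c v i| :=
      single_le_sum (f := fun v => ∑ i, |c v i|) (fun _ _ => by positivity) (mem_univ v)
    linarith
  set ε₁ := c0 / (8 * N * N * B * T) with hε₁
  have hε₁pos : 0 < ε₁ := by rw [hε₁]; positivity
  set η := min 1 (c0 / (8 * N * B * T)) with hη
  have hηpos : 0 < η := by rw [hη]; positivity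
  have hη1 : η ≤ 1 := min_le_left _ _
  have hη2 : T * (η * B) ≤ c0 / (8 * N) := by
    have : η ≤ c0 / (8 * N * B * T) := min_le_right _ _
    calc T * (η * B) ≤ T * (c0 / (8 * N * B * T) * B) := by gcongr
      _ = _ := by field_simp
  set ε₂ := c0 / (16 * N * B * T) with hε₂
  have hε₂pos : 0 < ε₂ := by rw [hε₂]; positivity
  obtain ⟨m0, hm0⟩ := hC ε₁ hε₁pos
  set m := m0 + 1 with hm
  obtain ⟨ω, hω, hroth⟩ := roth_lemma K m (ε₂ / 2) (by positivity)
  set C1 : ℝ := C + (∑ v, (∑ i, ∑ j, |((L v).adjugate i j : ℝ)| + ∑ i, |(L v i l : ℝ)| + (av v ((L v).det : K))⁻¹)) + n with hC1def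
  have hbig : ∀ v, ∑ i, ∑ j, |((L v).adjugate i j : ℝ)| + ∑ i, |(L v i l : ℝ)| + (av v ((L v).det : K))⁻¹ ≤ C1 - C - n := by
    intro v
    have := single_le_sum (f := fun v => ∑ i, ∑ j, |((L v).adjugate i j : ℝ)| + ∑ i, |(L v i l : ℝ)| + (av v ((L v).det : K))⁻¹)
      (fun v _ => by have := (av v).nonneg ((L v).det : K); positivity) (mem_univ v)
    rw [hC1def]
    linarith
  have hdetinv : ∀ v, 0 ≤ (av v ((L v).det : K))⁻¹ := fun v => inv_nonneg.2 ((av v).nonneg _)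
  have hnn : (0:ℝ) ≤ n := Nat.cast_nonneg _
  have s1 : ∀ v, 0 ≤ ∑ i, ∑ j, |((L v).adjugate i j : ℝ)| := fun v => by positivity
  have s2 : ∀ v, 0 ≤ ∑ i, |(L v i l : ℝ)| := fun v => by positivity
  have hCC1 : C ≤ C1 := by
    obtain ⟨v⟩ := hVne
    linarith [hbig v, s1 v, s2 v, hdetinv v]
  have hC3 : ∀ v i, ∑ j, |((L v).adjugate i j : ℝ)| ≤ C1 := by
    intro v i
    have := single_le_sum (f := fun i => ∑ j, |((L v).adjugate i j : ℝ)|) (fun _ _ => by positivity) (mem_univ i)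
    linarith [hbig v, s2 v, hdetinv v]
  have hC4 : ∀ v i, n + |(L v i l : ℝ)| ≤ C1 := by
    intro v i
    have := single_le_sum (f := fun i => |(L v i l : ℝ)|) (fun _ _ => abs_nonneg _) (mem_univ i)
    linarith [hbig v, s1 v, hdetinv v]
  have hC5 : ∀ v, (av v ((L v).det : K))⁻¹ ≤ C1 := by
    intro v
    linarith [hbig v, s1 v, s2 v]
  have hC11 : 1 ≤ C1 := hC1.trans hCC1
  have hlog : 0 ≤ Real.log C1 := Real.log_nonneg hC11
  have hmpos : (0:ℝ) < m := by rw [hm]; positivity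
  have hm1 : (1:ℝ) ≤ m := by rw [hm]; push_cast; linarith [(Nat.cast_nonneg m0 : (0:ℝ) ≤ m0)]
  set X : ℝ := 1 + 64 * N * T * Real.log C1 / c0 + 2 * m * (Real.log C1 + 1) / (ω * κ) with hX
  have hXa : 64 * N * T * Real.log C1 / c0 ≤ X := by
    have : 0 ≤ 2 * m * (Real.log C1 + 1) / (ω * κ) := by positivity
    linarith
  have hXb : 2 * m * (Real.log C1 + 1) / (ω * κ) ≤ X := by
    have : 0 ≤ 64 * N * T * Real.log C1 / c0 := by positivity
    linarith
  have hXpos : 0 < X := by rw [hX]; positivity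
  obtain ⟨g, hg1, hg2, hg3⟩ := grow_seq _ hinf X (2 / ω) hXpos
  set q : Fin m → ℝ := fun h => g (h.rev) with hq
  have hqX : ∀ h, X ≤ q h := fun h => hg2 _
  have hqpos : ∀ h, 0 < q h := fun h => hXpos.trans_le (hqX h)
  choose y a hyli hyO hal hay hyL hRo using fun h : Fin m => hg1 (h.rev)
  set D : ℝ := (1 + ∑ h, q h) / η with hD
  have hDpos : 0 < D := by
    have : 0 ≤ ∑ h, q h := sum_nonneg fun h _ => (hqpos h).le
    rw [hD]; positivity
  have hqD : ∀ h, q h ≤ η * D := by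
    intro h
    have e1 : q h ≤ ∑ h, q h := single_le_sum (f := q) (fun h _ => (hqpos h).le) (mem_univ h)
    have e2 : η * D = 1 + ∑ h, q h := by rw [hD]; field_simp
    linarith
  set d : Fin m → ℕ := fun h => ⌈D / q h⌉₊ with hd
  have hd1 : ∀ h, 1 ≤ d h := fun h => Nat.one_le_ceil_iff.2 (div_pos hDpos (hqpos h))
  have hdq1 : ∀ h, D ≤ d h * q h := fun h => by
    have := Nat.le_ceil (D / q h)
    rwa [div_le_iff₀ (hqpos h)] at this
  have hdq2 : ∀ h, d h * q h ≤ (1 + η) * D := fun h => by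
    have := Nat.ceil_lt_add_one (div_pos hDpos (hqpos h)).le
    have e2 : (d h : ℝ) * q h ≤ (D / q h + 1) * q h := mul_le_mul_of_nonneg_right this.le (hqpos h).le
    have e3 : (D / q h + 1) * q h = D + q h := by have := (hqpos h).ne'; field_simp
    linarith [hqD h]
  have hdq3 : ∀ h, (d h : ℝ) ≤ 2 * D / q h := fun h => by
    rw [le_div_iff₀ (hqpos h)]
    have := hdq2 h
    nlinarith
  have hS : ∑ h, (d h : ℝ) ≤ 2 * m * D / X := by
    calc _ ≤ ∑ h : Fin m, 2 * D / X := sum_le_sum fun h _ => (hdq3 h).trans (by gcongr; exact hqX h)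
      _ = _ := by simp; ring
  obtain ⟨P, hP0, hPMH, hPl1, hPbal⟩ := hm0 m (Nat.le_succ _) d hd1
  have hPl1' : l1 P ≤ C1 ^ (∑ h, d h) := hPl1.trans (pow_le_pow_left₀ (by linarith) hCC1 _)
  have hSn : ((∑ h, d h : ℕ) : ℝ) = ∑ h, (d h : ℝ) := by push_cast; rfl
  have hnum : ∑ v, (((∑ h, d h : ℕ) : ℝ) * (4 * Real.log C1) +
      D * m * ((∑ k, c v k) / ((n+1 : ℕ) : ℝ) + (((n+1 : ℕ) : ℝ) * B * ε₁ + η * B)) + B * (2 * D * ε₂)) < 0 := by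
    rw [← hN]
    simp only [sum_add_distrib, ← mul_sum, ← sum_div, sum_const, card_univ, nsmul_eq_mul, ← hT]
    have e0 : ∑ v, ∑ i, c v i = - c0 := by rw [hc0]; ring
    rw [e0, hSn]
    have e1 : T * ((∑ h, (d h : ℝ)) * (4 * Real.log C1)) ≤ D * m * (c0 / (8 * N)) := by
      calc _ ≤ T * ((2 * m * D / X) * (4 * Real.log C1)) := by gcongr
        _ = D * m * (8 * T * Real.log C1 / X) := by ring
        _ ≤ _ := by
          apply mul_le_mul_of_nonneg_left _ (by positivity)
          rw [div_le_div_iff₀ hXpos (by positivity)]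
          rw [div_le_iff₀ hc0pos] at hXa
          linarith
    have e2 : T * (N * B * ε₁) = c0 / (8 * N) := by rw [hε₁]; field_simp
    have e3 : T * (B * (2 * D * ε₂)) ≤ D * m * (c0 / (8 * N)) := by
      have : T * (B * (2 * D * ε₂)) = D * 1 * (c0 / (8 * N)) := by rw [hε₂]; field_simp; ring
      rw [this]; gcongr
    have e4 : D * m * (- c0 / N + (T * (N * B * ε₁) + T * (η * B))) ≤ D * m * (- (6 * (c0 / (8 * N)))) := by
      apply mul_le_mul_of_nonneg_left _ (by positivity)
      have : - c0 / N = - (8 * (c0 / (8 * N))) := by field_simp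
      rw [this, e2]; linarith
    have e5 : 0 < D * m * (c0 / (8 * N)) := by positivity
    linarith
  have hvan := low_vanish O av PF y hyO l L hL c B hcB hBpos.le q hqpos
    (fun v h j i => hyL h v j i) d hd1 P hPMH C1 hC11 hPl1' hC3 hC4 hC5 D η ε₁ ε₂ hDpos hη1 hdq1 hdq2 hPbal hnum
  have hvan2 := van_spec y hyli a k l hkl hal hay _ _ P hvan
  obtain ⟨PJ, hPJ0, hPJl, hPJd, hPJv⟩ := pj_exists (K := K) k l hkl d P hP0 hPMH
  have hvan3 := hPJv a _ _ hvan2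
  have hw1 : ∀ h h', h < h' → (d h : ℝ) ≤ ω * d h' := by
    intro h h' hh
    have e1 : 2 / ω * q h' ≤ q h := hg3 _ _ (by rw [← Fin.lt_def]; exact Fin.rev_lt_rev.2 hh)
    have e2 := hdq3 h
    have e3 := hdq1 h'
    rw [div_mul_eq_mul_div, div_le_iff₀ hω] at e1
    calc (d h : ℝ) ≤ 2 * D / q h := e2
      _ ≤ ω * (D / q h') := by
        rw [div_le_iff₀ (hqpos h)]
        have : ω * (D / q h') * q h = D / q h' * (q h * ω) := by ring
        rw [this]
        calc 2 * D = D / q h' * (2 * q h') := by have := (hqpos h').ne'; field_simp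
          _ ≤ _ := by have := (hqpos h'); gcongr
      _ ≤ _ := by
        gcongr
        rw [div_le_iff₀ (hqpos h')]; exact e3
  have hw2 : ∀ h, Real.log (C1 ^ (∑ h, d h)) + ∑ i, (d i : ℝ) ≤ ω * (d h * Real.log (Real.exp (κ * q h))) := by
    intro h
    rw [Real.log_exp, Real.log_pow, hSn]
    calc _ = (∑ h, (d h : ℝ)) * (Real.log C1 + 1) := by ring
      _ ≤ 2 * m * D / X * (Real.log C1 + 1) := by gcongr
      _ ≤ ω * κ * D := by
        rw [div_le_iff₀ (by positivity)] at hXb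
        rw [div_mul_eq_mul_div, div_le_iff₀ hXpos]
        nlinarith
      _ ≤ _ := by
        have := hdq1 h
        have e2 : ω * (d h * (κ * q h)) = ω * κ * (d h * q h) := by ring
        rw [e2]; gcongr
  obtain ⟨j, hj, hjw⟩ := hroth PJ d (C1 ^ (∑ h, d h)) (fun h => - a h k) (fun h => Real.exp (κ * q h)) hPJ0 hPJd hd1
    (hPJl.trans hPl1') hw1 hRo (fun h => Real.exp_pos _) hw2
  have := hvan3 j hj
  linarith

end

end

end Sub15


open Finset

namespace Sub15

set_option linter.unusedSimpArgs false
set_option linter.unusedVariables false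
set_option linter.unusedSectionVars false

noncomputable section

section
variable {K : Type*} [Field K]

/-- normal vector -/
def nv {n : ℕ} (y : Fin n → Fin (n+1) → K) (k : Fin (n+1)) : K :=
  (-1) ^ (k : ℕ) * (Matrix.of fun j i : Fin n => y j (k.succAbove i)).det

lemma det_cons {n : ℕ} (y : Fin n → Fin (n+1) → K) (x : Fin (n+1) → K) :
    (Matrix.of (Fin.cons x y : Fin (n+1) → Fin (n+1) → K)).det = ∑ k, nv y k * x k := by
  rw [Matrix.det_succ_row_zero]
  refine sum_congr rfl fun k _ => ?_
  rw [nv]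
  have : (Matrix.of (Fin.cons x y : Fin (n+1) → Fin (n+1) → K)).submatrix Fin.succ k.succAbove =
    Matrix.of fun j i : Fin n => y j (k.succAbove i) := by
    ext j i; simp
  rw [this]; simp; ring

lemma nv_perp {n : ℕ} (y : Fin n → Fin (n+1) → K) (j : Fin n) : ∑ k, nv y k * y j k = 0 := by
  rw [← det_cons]
  exact Matrix.det_zero_of_row_eq (i := 0) (j := j.succ) (Fin.succ_ne_zero j).symm (by ext; simp)

lemma nv_ne {n : ℕ} (y : Fin n → Fin (n+1) → K) (hy : LinearIndependent K y) : ∃ l, nv y l ≠ 0 := by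
  have h1 : Submodule.span K (Set.range y) ≠ ⊤ := by
    intro h
    have := finrank_span_eq_card hy
    rw [h] at this
    simp at this
  obtain ⟨x, hx⟩ : ∃ x, x ∉ Submodule.span K (Set.range y) := by
    by_contra h; push Not at h; exact h1 (eq_top_iff.2 fun x _ => h x)
  have h2 : LinearIndependent K (Fin.cons x y : Fin (n+1) → Fin (n+1) → K) := linearIndependent_finCons.2 ⟨hy, hx⟩
  have h3 : (Matrix.of (Fin.cons x y : Fin (n+1) → Fin (n+1) → K)).det ≠ 0 := by
    have := (Matrix.linearIndependent_rows_iff_isUnit (A := Matrix.of (Fin.cons x y : Fin (n+1) → Fin (n+1) → K))).1 h2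
    rw [Matrix.isUnit_iff_isUnit_det] at this
    exact this.ne_zero
  rw [det_cons] at h3
  by_contra h
  push Not at h
  exact h3 (by simp [h])

lemma det_mem (O : Subring K) {n : Type*} [Fintype n] [DecidableEq n] (M : Matrix n n K) (h : ∀ i j, M i j ∈ O) : M.det ∈ O := by
  rw [Matrix.det_apply]
  refine O.sum_mem fun σ _ => ?_
  rw [Units.smul_def]
  exact O.zsmul_mem (O.prod_mem fun i _ => h _ _) _

lemma nv_mem (O : Subring K) {n : ℕ} (y : Fin n → Fin (n+1) → K) (h : ∀ j i, y j i ∈ O) (k) : nv y k ∈ O :=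
  O.mul_mem (O.pow_mem (O.neg_mem O.one_mem) _) (det_mem O _ fun i j => h _ _)

lemma av_sum_le {ι : Type*} (v : AbsoluteValue K ℝ) (s : Finset ι) (f : ι → K) : v (∑ i ∈ s, f i) ≤ ∑ i ∈ s, v (f i) := by
  classical
  induction s using Finset.induction_on with
  | empty => simp
  | insert a s ha ih => rw [sum_insert ha, sum_insert ha]; exact (v.add_le _ _).trans (by linarith)

lemma av_det_le {n : Type*} [Fintype n] [DecidableEq n] (v : AbsoluteValue K ℝ) (M : Matrix n n K) (B : ℝ)
    (h : ∀ σ : Equiv.Perm n, ∏ i, v (M (σ i) i) ≤ B) : v M.det ≤ (Fintype.card n).factorial * B := by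
  rw [Matrix.det_apply]
  refine (av_sum_le v _ _).trans ?_
  calc _ ≤ ∑ σ : Equiv.Perm n, B := by
        refine sum_le_sum fun σ _ => ?_
        have : v (Equiv.Perm.sign σ • ∏ i, M (σ i) i) = ∏ i, v (M (σ i) i) := by
          rcases Int.units_eq_one_or (Equiv.Perm.sign σ) with h | h <;> simp [h, map_prod]
        rw [this]; exact h σ
    _ = _ := by simp [Fintype.card_perm]

lemma omega_bound {n : ℕ} (v : AbsoluteValue K ℝ) (L : Matrix (Fin (n+1)) (Fin (n+1)) ℤ) (hL : (L.det : K) ≠ 0)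
    (y : Fin n → Fin (n+1) → K) (b : Fin (n+1) → ℝ) (hb : ∀ i, 0 < b i)
    (hy : ∀ j i, v (∑ i', (L i i' : K) * y j i') ≤ b i) (i : Fin (n+1)) :
    v (∑ k, nv y k * (L.adjugate k i : K)) ≤ (n+1).factorial * ∏ i' ∈ univ.erase i, b i' := by
  classical
  set LK : Matrix (Fin (n+1)) (Fin (n+1)) K := L.map (fun z : ℤ => (z : K)) with hLK
  have hdet : LK.det = (L.det : K) := by
    rw [hLK]; exact (Int.cast_det L).symm
  have hadj : ∀ a b, ∑ k, (L a k : K) * (L.adjugate k b : K) = if a = b then (L.det : K) else 0 := by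
    intro a b
    have := congrFun (congrFun (Matrix.mul_adjugate L) a) b
    rw [Matrix.mul_apply, Matrix.smul_apply, Matrix.one_apply] at this
    have h2 := congrArg (fun z : ℤ => (z : K)) this
    push_cast at h2
    rw [h2]; split_ifs <;> simp
  set x : Fin (n+1) → K := fun k => (L.adjugate k i : K) with hx
  have h1 : ((Matrix.of (Fin.cons x y : Fin (n+1) → Fin (n+1) → K)) * LK.transpose).det =
      (L.det : K) * ∑ k, nv y k * (L.adjugate k i : K) := by
    rw [Matrix.det_mul, Matrix.det_transpose, hdet, det_cons, mul_comm]
  set M := ((Matrix.of (Fin.cons x y : Fin (n+1) → Fin (n+1) → K)) * LK.transpose) with hM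
  have hM0 : ∀ a, M 0 a = if a = i then (L.det : K) else 0 := by
    intro a
    rw [hM, Matrix.mul_apply, ← hadj a i]
    exact sum_congr rfl fun k _ => by simp [hLK, hx]; ring
  have hMs : ∀ j a, M (Fin.succ j) a = ∑ i', (L a i' : K) * y j i' := by
    intro j a
    rw [hM, Matrix.mul_apply]
    exact sum_congr rfl fun k _ => by simp [hLK]; ring
  have hvd : 0 < v (L.det : K) := v.pos hL
  have h2 : v M.transpose.det ≤ (Fintype.card (Fin (n+1))).factorial * (v (L.det : K) * ∏ i' ∈ univ.erase i, b i') := by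
    apply av_det_le
    intro σ
    simp only [Matrix.transpose_apply]
    rw [Fin.prod_univ_succ, hM0]
    by_cases hσ : σ 0 = i
    · rw [if_pos hσ]
      apply mul_le_mul_of_nonneg_left _ hvd.le
      calc _ ≤ ∏ j : Fin n, b (σ j.succ) := by
            refine prod_le_prod (fun _ _ => v.nonneg _) fun j _ => ?_
            rw [hMs]; exact hy j _
        _ = _ := by
            have e1 : ∏ a ∈ univ.erase i, b a = ∏ a ∈ univ.erase (0 : Fin (n+1)), b (σ a) := by
              symm
              apply prod_bij (fun a _ => σ a)
              · intro a ha; simp at ha ⊢; rw [← hσ]; simpa using ha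
              · intro a _ b _ h; exact σ.injective h
              · intro a ha
                refine ⟨σ.symm a, ?_, by simp⟩
                simp at ha ⊢
                intro h; apply ha; rw [← hσ, ← h]; simp
              · intro _ _; rfl
            have e2 : (univ.erase (0 : Fin (n+1))) = univ.image Fin.succ := by
              ext a
              simp only [mem_erase, mem_univ, and_true, mem_image, true_and]
              exact (Fin.exists_succ_eq (x := a)).symm
            rw [e1, e2, prod_image (fun a _ b _ h => Fin.succ_injective _ h)]
    · rw [if_neg hσ]
      simp
      exact mul_nonneg hvd.le (prod_nonneg fun a _ => (hb a).le)
  rw [Matrix.det_transpose, h1, map_mul, Fintype.card_fin] at h2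
  have : v (L.det : K) * v (∑ k, nv y k * (L.adjugate k i : K)) ≤ v (L.det : K) * ((n+1).factorial * ∏ i' ∈ univ.erase i, b i') := by
    linarith
  exact le_of_mul_le_mul_left this hvd

end

end

end Sub15


open Finset

namespace Sub15

set_option linter.unusedSimpArgs false
set_option linter.unusedVariables false
set_option linter.unusedSectionVars false

noncomputable section

section
variable {K : Type*} [Field K] [CharZero K] (O : Subring K) {V : Type*} [Fintype V]
  (av : V → AbsoluteValue K ℝ)

lemma hat_exists (HR : ∀ (ξ : K) (H : ℝ), 1 ≤ H → ¬ RothH ξ H → ∃ q : ℤ, q ≠ 0 ∧ (q : K) * ξ ∈ O ∧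
      ∀ v, av v (q : K) ≤ H ∧ av v ((q : K) * ξ) ≤ H) {n : ℕ} (w : Fin (n+1) → K) (l : Fin (n+1)) (hl : w l ≠ 0)
    (H : ℝ) (hH : 1 ≤ H) (hR : ∀ k, k ≠ l → ¬ RothH (- (w k / w l)) H) :
    ∃ b : Fin (n+1) → K, (∀ k, b k ∈ O) ∧ (∀ v k, av v (b k) ≤ H ^ (n+1)) ∧ b l ≠ 0 ∧ ∀ k, b k * w l = b l * w k := by
  classical
  have h1 : ∀ k, ∃ q : ℤ, q ≠ 0 ∧ (q : K) * (w k / w l) ∈ O ∧ ∀ v, av v (q : K) ≤ H ∧ av v ((q : K) * (w k / w l)) ≤ H := by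
    intro k
    by_cases hk : k = l
    · refine ⟨1, one_ne_zero, ?_, ?_⟩
      · rw [hk, div_self hl]; simpa using O.one_mem
      · intro v; rw [hk, div_self hl]; simpa using hH
    · obtain ⟨q, hq0, hq1, hq2⟩ := HR _ H hH (hR k hk)
      refine ⟨q, hq0, ?_, ?_⟩
      · have := O.neg_mem hq1
        simpa using this
      · intro v
        have := hq2 v
        simpa [mul_neg, AbsoluteValue.map_neg] using this
  choose q hq0 hqO hqv using h1
  have hsplit : ∀ k, ((∏ k', q k' : ℤ) : K) * (w k / w l) = (∏ k' ∈ univ.erase k, (q k' : K)) * ((q k : K) * (w k / w l)) := by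
    intro k
    push_cast
    rw [← mul_prod_erase univ (fun k => (q k : K)) (mem_univ k)]; ring
  refine ⟨fun k => ((∏ k', q k' : ℤ) : K) * (w k / w l), ?_, ?_, ?_, ?_⟩
  · intro k
    simp only
    rw [hsplit]
    exact O.mul_mem (O.prod_mem fun k' _ => intCast_mem O _) (hqO k)
  · intro v k
    simp only
    rw [hsplit, map_mul, map_prod]
    calc _ ≤ (∏ k' ∈ univ.erase k, H) * H := by
          apply mul_le_mul _ (hqv k v).2 ((av v).nonneg _) (prod_nonneg fun _ _ => by linarith)
          exact prod_le_prod (fun _ _ => (av v).nonneg _) fun k' _ => (hqv k' v).1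
      _ = _ := by
          rw [prod_const, card_erase_of_mem (mem_univ k), card_univ, Fintype.card_fin, Nat.add_sub_cancel, pow_succ]
  · simp only
    rw [div_self hl, mul_one]
    exact_mod_cast prod_ne_zero_iff.2 fun k _ => hq0 k
  · intro k
    field_simp

lemma av_lincomb_int {ι : Type*} [Fintype ι] (v : AbsoluteValue K ℝ) (b : ι → K) (z : ι → ℤ) (G A : ℝ) (hG : 0 ≤ G) (hb : ∀ k, v (b k) ≤ G)
    (hA : ∑ k, |(z k : ℝ)| ≤ A) : v (∑ k, b k * (z k : K)) ≤ A * G := by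
  refine (av_sum_le v _ _).trans ?_
  calc _ ≤ ∑ k, |(z k : ℝ)| * G := by
        refine sum_le_sum fun k _ => ?_
        rw [map_mul, mul_comm]
        exact mul_le_mul (av_int_le v _) (hb k) (v.nonneg _) (abs_nonneg _)
    _ = (∑ k, |(z k : ℝ)|) * G := by rw [sum_mul]
    _ ≤ _ := mul_le_mul_of_nonneg_right hA hG

lemma pf_lower (PF : ∀ x ∈ O, x ≠ 0 → 1 ≤ ∏ v, av v x) (x : K) (hx : x ∈ O) (h0 : x ≠ 0) (G : ℝ) (hG : 1 ≤ G)
    (hxG : ∀ v, av v x ≤ G) (v : V) : 1 ≤ av v x * G ^ Fintype.card V := by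
  classical
  have h1 := PF x hx h0
  rw [← mul_prod_erase univ _ (mem_univ v)] at h1
  refine h1.trans ?_
  apply mul_le_mul_of_nonneg_left _ ((av v).nonneg _)
  calc _ ≤ ∏ v' ∈ univ.erase v, G := prod_le_prod (fun _ _ => (av _).nonneg _) fun v' _ => hxG v'
    _ = G ^ (univ.erase v).card := by rw [prod_const]
    _ ≤ _ := pow_le_pow_right₀ hG (card_le_univ _)

lemma choice_ineq (PF : ∀ x ∈ O, x ≠ 0 → 1 ≤ ∏ v, av v x) {n : ℕ}
    (L : V → Matrix (Fin (n+1)) (Fin (n+1)) ℤ) (hL : ∀ v, (L v).det ≠ 0) (c : V → Fin (n+1) → ℝ)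
    (y : Fin n → Fin (n+1) → K) (hyO : ∀ j i, y j i ∈ O) (q : ℝ)
    (hyL : ∀ v j i, av v (∑ i', (L v i i' : K) * y j i') ≤ Real.exp (c v i * q))
    (l : Fin (n+1)) (hl : nv y l ≠ 0) (b : Fin (n+1) → K) (hbO : ∀ k, b k ∈ O) (H : ℝ) (hH : 1 ≤ H)
    (hbH : ∀ v k, av v (b k) ≤ H) (hbl : b l ≠ 0) (hbw : ∀ k, b k * nv y l = b l * nv y k)
    (A : ℝ) (hA1 : 1 ≤ A) (hA : ∀ v i, ∑ k, |((L v).adjugate k i : ℝ)| ≤ A)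
    (i : V → Fin (n+1)) (hi : ∀ v, ∑ k, b k * ((L v).adjugate k (i v) : K) ≠ 0) :
    1 ≤ ((A * H) ^ Fintype.card V) ^ Fintype.card V * H ^ Fintype.card V * (((n+1).factorial : ℝ) ^ Fintype.card V *
      Real.exp (((∑ v, ∑ i, c v i) - ∑ v, c v (i v)) * q)) := by
  classical
  have hAH : 1 ≤ A * H := by nlinarith
  set α : V → K := fun v => ∑ k, b k * ((L v).adjugate k (i v) : K) with hα
  have h1 : ∀ v, 1 ≤ av v (α v) * (A * H) ^ Fintype.card V := by
    intro v
    refine pf_lower O av PF _ (O.sum_mem fun k _ => O.mul_mem (hbO k) (intCast_mem O _)) (hi v) _ hAH ?_ v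
    intro v'
    exact av_lincomb_int (av v') b _ H A (by linarith) (hbH v') (hA v (i v))
  have h2 : ∀ v, α v * nv y l = b l * ∑ k, nv y k * ((L v).adjugate k (i v) : K) := by
    intro v
    rw [hα]; simp only
    rw [sum_mul, mul_sum]
    refine sum_congr rfl fun k _ => ?_
    linear_combination ((L v).adjugate k (i v) : K) * hbw k
  have h3 : ∀ v, av v (∑ k, nv y k * ((L v).adjugate k (i v) : K)) ≤ (n+1).factorial * Real.exp ((∑ i, c v i - c v (i v)) * q) := by
    intro v
    refine (omega_bound (av v) (L v) (by exact_mod_cast hL v) y (fun i => Real.exp (c v i * q)) (fun _ => Real.exp_pos _)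
      (hyL v) (i v)).trans (le_of_eq ?_)
    rw [← Real.exp_sum, ← sum_mul, ← add_sum_erase univ (c v) (mem_univ (i v))]
    congr 3; ring
  have h4 : 1 ≤ ∏ v, av v (nv y l) := PF _ (nv_mem O y hyO l) hl
  have h5 : ∀ v, av v (nv y l) ≤ (A * H) ^ Fintype.card V * (H * ((n+1).factorial * Real.exp ((∑ i, c v i - c v (i v)) * q))) := by
    intro v
    calc av v (nv y l) ≤ (av v (α v) * (A * H) ^ Fintype.card V) * av v (nv y l) :=
          le_mul_of_one_le_left ((av v).nonneg _) (h1 v)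
      _ = (A * H) ^ Fintype.card V * av v (α v * nv y l) := by rw [map_mul]; ring
      _ = (A * H) ^ Fintype.card V * (av v (b l) * av v (∑ k, nv y k * ((L v).adjugate k (i v) : K))) := by rw [h2, map_mul]
      _ ≤ _ := by
          have := hbH v l
          have := h3 v
          gcongr
  refine h4.trans ((prod_le_prod (fun v _ => (av v).nonneg _) fun v _ => h5 v).trans (le_of_eq ?_))
  simp only [prod_mul_distrib, prod_const, card_univ, ← Real.exp_sum, ← sum_mul, sum_sub_distrib]
  ring

lemma det_dot {N : ℕ} (L : Matrix (Fin N) (Fin N) ℤ) (b x : Fin N → K) :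
    (L.det : K) * ∑ k, b k * x k = ∑ i, (∑ k, b k * (L.adjugate k i : K)) * ∑ i', (L i i' : K) * x i' := by
  classical
  set A : Matrix (Fin N) (Fin N) K := L.adjugate.map (fun z : ℤ => (z : K)) with hA
  set M : Matrix (Fin N) (Fin N) K := L.map (fun z : ℤ => (z : K)) with hM
  have h1 : A * M = (L.det : K) • 1 := by
    ext a b
    have := congrFun (congrFun (Matrix.adjugate_mul L) a) b
    rw [Matrix.mul_apply, Matrix.smul_apply, Matrix.one_apply] at this
    have h2 := congrArg (fun z : ℤ => (z : K)) this
    push_cast at h2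
    rw [Matrix.mul_apply, Matrix.smul_apply, Matrix.one_apply]
    simp only [hA, hM, Matrix.map_apply]
    rw [h2]; split_ifs <;> simp
  have h2 : ∑ i, (∑ k, b k * (L.adjugate k i : K)) * ∑ i', (L i i' : K) * x i' =
    dotProduct (Matrix.vecMul b A) (Matrix.mulVec M x) := by
    simp [dotProduct, Matrix.vecMul, Matrix.mulVec, hA, hM]
  rw [h2, Matrix.dotProduct_mulVec, Matrix.vecMul_vecMul, h1]
  simp [dotProduct, Matrix.vecMul_smul, mul_sum]
  exact sum_congr rfl fun _ _ => by ring

open Filter in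
lemma ev_small {ι : Type*} (F : Ultrafilter ι) (q : ι → ℝ) (hq : Tendsto q F atTop) (δ : ℝ) (hδ : δ < 0) (C : ℝ) :
    ∀ᶠ t in (F : Filter ι), C * Real.exp (δ * q t) < 1 := by
  have h1 : Tendsto (fun t => C * Real.exp (δ * q t)) F (nhds (C * 0)) :=
    (Real.tendsto_exp_atBot.comp (hq.const_mul_atTop_of_neg hδ)).const_mul C
  rw [mul_zero] at h1
  exact h1.eventually_lt_const one_pos

open Filter in
set_option maxHeartbeats 1000000 in
theorem thmA (PF : ∀ x ∈ O, x ≠ 0 → 1 ≤ ∏ v, av v x)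
    (HR : ∀ (ξ : K) (H : ℝ), 1 ≤ H → ¬ RothH ξ H → ∃ q : ℤ, q ≠ 0 ∧ (q : K) * ξ ∈ O ∧
      ∀ v, av v (q : K) ≤ H ∧ av v ((q : K) * ξ) ≤ H) {n : ℕ}
    (L : V → Matrix (Fin (n+1)) (Fin (n+1)) ℤ) (hL : ∀ v, (L v).det ≠ 0) (c : V → Fin (n+1) → ℝ)
    (hc : ∑ v, ∑ i, c v i < 0) {ι : Type*} (F : Ultrafilter ι) (q : ι → ℝ) (hq : Tendsto q F atTop)
    (y : ι → Fin n → Fin (n+1) → K)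
    (hy : ∀ᶠ t in (F : Filter ι), LinearIndependent K (y t) ∧ (∀ j i, y t j i ∈ O) ∧
      (∀ v j i, av v (∑ i', (L v i i' : K) * y t j i') ≤ Real.exp (c v i * q t))) :
    ∃ a : Fin (n+1) → K, a ≠ 0 ∧ ∀ᶠ t in (F : Filter ι), ∀ j, ∑ i, a i * y t j i = 0 := by
  classical
  obtain ⟨l, hl⟩ : ∃ l, ∀ᶠ t in (F : Filter ι), nv (y t) l ≠ 0 := by
    by_contra h
    push Not at h
    have h2 : ∀ᶠ t in (F : Filter ι), ∀ l, nv (y t) l = 0 := by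
      rw [eventually_all]
      intro l
      exact h l
    obtain ⟨t, ht1, ht2⟩ := (hy.and h2).exists
    obtain ⟨l, hl⟩ := nv_ne (y t) ht1.1
    exact hl (ht2 l)
  set T := Fintype.card V with hT
  set c0 := - ∑ v, ∑ i, c v i with hc0
  have hc0pos : 0 < c0 := by rw [hc0]; linarith
  set R : ℝ := (n+1) * (T * T + T) + 1 with hR
  have hRpos : 0 < R := by rw [hR]; positivity
  set κ := c0 / (2 * R) with hκ
  have hκpos : 0 < κ := by rw [hκ]; positivity
  have hq0 : ∀ᶠ t in (F : Filter ι), 0 ≤ q t := hq.eventually_ge_atTop 0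
  by_cases hcase : ∃ k, k ≠ l ∧ ∀ᶠ t in (F : Filter ι), RothH (- (nv (y t) k / nv (y t) l)) (Real.exp (κ * q t))
  · exfalso
    obtain ⟨k, hkl, hk⟩ := hcase
    refine thmA_b O av PF L hL c hc k l hkl κ hκpos ?_
    intro q0
    obtain ⟨t, ⟨⟨ht1, ht2⟩, ht3⟩, ht4⟩ := (((hy.and hl).and hk).and (hq.eventually_ge_atTop q0)).exists
    refine ⟨q t, ht4, y t, fun i => nv (y t) i / nv (y t) l, ht1.1, ht1.2.1, div_self ht2, ?_, ht1.2.2, ht3⟩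
    intro j
    have := nv_perp (y t) j
    calc _ = (∑ k, nv (y t) k * y t j k) / nv (y t) l := by
          rw [sum_div]; exact sum_congr rfl fun i _ => by ring
      _ = 0 := by rw [this, zero_div]
  push Not at hcase
  have hnR : ∀ᶠ t in (F : Filter ι), ∀ k, k ≠ l → ¬ RothH (- (nv (y t) k / nv (y t) l)) (Real.exp (κ * q t)) := by
    rw [eventually_all]
    intro k
    by_cases hk : k = l
    · exact Eventually.of_forall fun t h => absurd hk h
    · exact (hcase k hk).mono fun t ht _ => ht
  have hhat : ∀ᶠ t in (F : Filter ι), ∃ b : Fin (n+1) → K, (∀ k, b k ∈ O) ∧ (∀ v k, av v (b k) ≤ Real.exp (κ * q t) ^ (n+1)) ∧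
      b l ≠ 0 ∧ ∀ k, b k * nv (y t) l = b l * nv (y t) k := by
    filter_upwards [hnR, hl, hq0] with t h1 h2 h3
    exact hat_exists O av HR _ l h2 _ (Real.one_le_exp (by positivity)) h1
  obtain ⟨b, hb⟩ : ∃ b : ι → Fin (n+1) → K, ∀ᶠ t in (F : Filter ι), (∀ k, b t k ∈ O) ∧
      (∀ v k, av v (b t k) ≤ Real.exp (κ * q t) ^ (n+1)) ∧ b t l ≠ 0 ∧ ∀ k, b t k * nv (y t) l = b t l * nv (y t) k := by
    refine ⟨fun t => if h : ∃ b : Fin (n+1) → K, (∀ k, b k ∈ O) ∧ (∀ v k, av v (b k) ≤ Real.exp (κ * q t) ^ (n+1)) ∧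
      b l ≠ 0 ∧ ∀ k, b k * nv (y t) l = b l * nv (y t) k then h.choose else 0, ?_⟩
    filter_upwards [hhat] with t ht
    rw [dif_pos ht]
    exact ht.choose_spec
  set A : ℝ := 1 + ∑ v, ∑ i, ∑ k, |((L v).adjugate k i : ℝ)| with hAdef
  have hA1 : 1 ≤ A := by
    have : 0 ≤ ∑ v, ∑ i, ∑ k, |((L v).adjugate k i : ℝ)| := by positivity
    linarith
  have hA : ∀ v i, ∑ k, |((L v).adjugate k i : ℝ)| ≤ A := by
    intro v i
    have e1 := single_le_sum (f := fun i => ∑ k, |((L v).adjugate k i : ℝ)|) (fun _ _ => by positivity) (mem_univ i)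
    have e2 := single_le_sum (f := fun v => ∑ i, ∑ k, |((L v).adjugate k i : ℝ)|) (fun _ _ => by positivity) (mem_univ v)
    have e3 : ∑ k, |((L v).adjugate k i : ℝ)| ≤ ∑ v, ∑ i, ∑ k, |((L v).adjugate k i : ℝ)| := e1.trans e2
    linarith
  -- support pattern
  set α : ι → V → Fin (n+1) → K := fun t v i => ∑ k, b t k * ((L v).adjugate k i : K) with hα
  set s : V → Finset (Fin (n+1)) := fun v => univ.filter fun i => ∀ᶠ t in (F : Filter ι), α t v i ≠ 0 with hs
  have hpat : ∀ᶠ t in (F : Filter ι), ∀ v i, (α t v i ≠ 0 ↔ i ∈ s v) := by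
    rw [eventually_all]; intro v
    rw [eventually_all]; intro i
    by_cases h : ∀ᶠ t in (F : Filter ι), α t v i ≠ 0
    · filter_upwards [h] with t ht
      simp only [ht, hs, mem_filter, mem_univ, true_and, ne_eq, not_false_eq_true, true_iff]
      exact h
    · have h2 := Ultrafilter.frequently_iff_eventually.1 (not_eventually.1 h)
      filter_upwards [h2] with t ht
      simp only [ht, hs, mem_filter, mem_univ, true_and, false_iff]
      exact h
  have hdetsum : ∀ v t (x : Fin (n+1) → K), ((L v).det : K) * ∑ k, b t k * x k = ∑ i, α t v i * ∑ i', (L v i i' : K) * x i' := by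
    intro v t x
    exact det_dot (L v) (b t) x
  have hchoice : ∀ i : V → Fin (n+1), (∀ v, i v ∈ s v) → ∑ v, c v (i v) < 0 := by
    intro i hi
    by_contra hneg
    push Not at hneg
    have e1 := ev_small F q hq (-(c0/2)) (by linarith) (A ^ (T * T) * ((n+1).factorial : ℝ) ^ T)
    obtain ⟨t, ⟨⟨⟨⟨h1, h2⟩, h3⟩, h4⟩, h5⟩, h6⟩ := (((((hy.and hl).and hb).and hpat).and hq0).and e1).exists
    have hHexp : Real.exp (κ * q t) ^ (n+1) = Real.exp ((n+1) * κ * q t) := by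
      rw [← Real.exp_nat_mul]; push_cast; ring_nf
    have e2 := choice_ineq O av PF L hL c (y t) h1.2.1 (q t) h1.2.2 l h2 (b t) h3.1 _
      (one_le_pow₀ (Real.one_le_exp (by positivity))) h3.2.1 h3.2.2.1 h3.2.2.2 A hA1 hA i (fun v => (h4 v (i v)).2 (hi v))
    rw [← hT, hHexp] at e2
    have e3 : ((A * Real.exp ((n+1) * κ * q t)) ^ T) ^ T * Real.exp ((n+1) * κ * q t) ^ T *
        (((n+1).factorial : ℝ) ^ T * Real.exp (((∑ v, ∑ i, c v i) - ∑ v, c v (i v)) * q t)) =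
        A ^ (T * T) * ((n+1).factorial : ℝ) ^ T * Real.exp (q t * (((n+1) * (T * T + T) * κ) - c0 - ∑ v, c v (i v))) := by
      have : Real.exp (q t * (((n+1) * (T * T + T) * κ) - c0 - ∑ v, c v (i v))) =
        (Real.exp ((n+1) * κ * q t) ^ T) ^ T * Real.exp ((n+1) * κ * q t) ^ T * Real.exp (((∑ v, ∑ i, c v i) - ∑ v, c v (i v)) * q t) := by
        simp only [← Real.exp_nat_mul, ← Real.exp_add]
        congr 1
        rw [hc0]; ring
      rw [this, mul_pow, mul_pow, pow_mul]; ring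
    rw [e3] at e2
    have e4 : Real.exp (q t * (((n+1) * (T * T + T) * κ) - c0 - ∑ v, c v (i v))) ≤ Real.exp (-(c0/2) * q t) := by
      rw [Real.exp_le_exp, mul_comm]
      apply mul_le_mul_of_nonneg_right _ h5
      have e5 : R * κ = c0 / 2 := by rw [hκ]; field_simp
      have e6 : (n+1) * (T * T + T) * κ ≤ R * κ := by
        apply mul_le_mul_of_nonneg_right _ hκpos.le
        rw [hR]; linarith
      linarith
    have e5 : A ^ (T * T) * ((n+1).factorial : ℝ) ^ T * Real.exp (q t * (((n+1) * (T * T + T) * κ) - c0 - ∑ v, c v (i v))) ≤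
       A ^ (T * T) * ((n+1).factorial : ℝ) ^ T * Real.exp (-(c0/2) * q t) := by
      gcongr
    linarith
  obtain ⟨t0, hb0, hpat0⟩ := (hb.and hpat).exists
  have hdetK : ∀ v, ((L v).det : K) ≠ 0 := fun v => by exact_mod_cast hL v
  have hsne : ∀ v, (s v).Nonempty := by
    intro v
    by_contra h
    rw [not_nonempty_iff_eq_empty] at h
    have e1 : ∀ i, α t0 v i = 0 := by
      intro i
      by_contra h2
      have := (hpat0 v i).1 h2
      rw [h] at this
      simp at this
    have e2 := hdetsum v t0 (Pi.single l 1)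
    simp only [e1, zero_mul, sum_const_zero, mul_eq_zero] at e2
    rcases e2 with e2 | e2
    · exact hdetK v e2
    · simp [Pi.single_apply] at e2
      exact hb0.2.2.1 e2
  choose im him hmax using fun v => exists_max_image (s v) (c v) (hsne v)
  have hneg := hchoice im him
  refine ⟨b t0, fun h => hb0.2.2.1 (by rw [h]; rfl), ?_⟩
  set E : V → ℝ := fun v => (∑ i, av v (α t0 v i)) / av v ((L v).det : K) with hE
  filter_upwards [hy, ev_small F q hq _ hneg (∏ v, E v), hq0] with t h1 h2 h3
  intro j
  by_contra hne
  have hrO : ∑ i, b t0 i * y t j i ∈ O := O.sum_mem fun k _ => O.mul_mem (hb0.1 k) (h1.2.1 j k)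
  have hPF := PF _ hrO hne
  have hbd : ∀ v, av v (∑ i, b t0 i * y t j i) ≤ E v * Real.exp (c v (im v) * q t) := by
    intro v
    have hd : 0 < av v ((L v).det : K) := (av v).pos (hdetK v)
    rw [hE]; simp only
    rw [div_mul_eq_mul_div, le_div_iff₀ hd, mul_comm, ← map_mul, hdetsum, sum_mul]
    refine (av_sum_le _ _ _).trans (sum_le_sum fun i _ => ?_)
    rw [map_mul]
    by_cases hi : α t0 v i = 0
    · simp [hi]
    · apply mul_le_mul_of_nonneg_left _ ((av v).nonneg _)
      refine (h1.2.2 v j i).trans ?_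
      rw [Real.exp_le_exp]
      exact mul_le_mul_of_nonneg_right (hmax v i ((hpat0 v i).1 hi)) h3
  have := prod_le_prod (s := univ) (fun v _ => (av v).nonneg _) fun v _ => hbd v
  rw [prod_mul_distrib, ← Real.exp_sum, ← sum_mul] at this
  linarith

end

end

end Sub15

set_option linter.unusedVariables false
set_option linter.unusedSectionVars false
set_option linter.style.longLine false
namespace Sub15
noncomputable section
open Finset

variable {K : Type*} [Field K]

lemma chain_aux (v : AbsoluteValue K ℝ) {E : Type*} [AddCommGroup E] [Module K E] [FiniteDimensional K E]
    (V : ℕ → Submodule K E) (m : ℕ) (hfr : ∀ j ≤ m, Module.finrank K (V j) = j) :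
    ∀ (l : Fin m → (E →ₗ[K] K)) (A : Fin m → ℝ) (hA : ∀ i, 0 < A i),
    ∃ π : Fin m → Fin m, Function.Injective π ∧ ∀ k : Fin m, ∃ γ : Fin m → K,
      (∀ i', v (γ i') * A (π i') ≤ A (π k)) ∧ (∀ i', k ≤ i' → γ i' = 0) ∧
      ∀ z ∈ V k, l (π k) z = ∑ i', γ i' * l (π i') z := by
  induction m with
  | zero => intro l A hA; exact ⟨id, fun _ _ h => h, fun k => k.elim0⟩
  | succ m ih =>
    intro l A hA
    -- dependence
    have hdep : ∃ α : Fin (m+1) → K, α ≠ 0 ∧ ∀ z ∈ V m, ∑ i, α i * l i z = 0 := by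
      have h1 : ¬ LinearIndependent K (fun i : Fin (m+1) => (l i).comp (V m).subtype) := by
        intro h
        have := h.fintype_card_le_finrank
        have h2 : Module.finrank K (V m →ₗ[K] K) = m := by
          have h3 := Subspace.dual_finrank_eq (K := K) (V := V m)
          rw [hfr m (by omega)] at h3
          exact h3
        rw [h2, Fintype.card_fin] at this
        omega
      rw [Fintype.not_linearIndependent_iff] at h1
      obtain ⟨g, hg, i, hi⟩ := h1
      refine ⟨g, fun h => hi (by rw [h]; rfl), fun z hz => ?_⟩
      have := congrArg (fun f => f ⟨z, hz⟩) hg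
      simpa using this
    obtain ⟨α, hα, hz⟩ := hdep
    obtain ⟨i0, -, hi0⟩ := Finset.exists_max_image (Finset.univ : Finset (Fin (m+1)))
      (fun i => v (α i) * A i) ⟨0, Finset.mem_univ _⟩
    have hα0 : α i0 ≠ 0 := by
      intro h
      apply hα
      funext i
      have := hi0 i (Finset.mem_univ _)
      rw [h, map_zero, zero_mul] at this
      have h2 : v (α i) ≤ 0 := by
        by_contra h3
        push Not at h3
        have := mul_pos h3 (hA i)
        linarith
      have := le_antisymm h2 (v.nonneg _)
      simpa using this
    obtain ⟨π, hπ, hk⟩ := ih (fun j hj => hfr j (by omega)) (fun i => l (i0.succAbove i))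
      (fun i => A (i0.succAbove i)) (fun i => hA _)
    refine ⟨Fin.snoc (α := fun _ => Fin (m+1)) (fun k => i0.succAbove (π k)) i0, ?_, ?_⟩
    · intro a b
      induction a using Fin.lastCases with
      | last =>
        induction b using Fin.lastCases with
        | last => simp
        | cast b => simp [(Fin.succAbove_ne i0 _).symm]
      | cast a =>
        induction b using Fin.lastCases with
        | last => simp [(Fin.succAbove_ne i0 _)]
        | cast b =>
          simp only [Fin.snoc_castSucc, Fin.succAbove_right_inj]
          intro h; rw [hπ h]
    · intro k
      induction k using Fin.lastCases with
      | last =>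
        refine ⟨Fin.snoc (α := fun _ => K) (fun k => - α (i0.succAbove (π k)) / α i0) 0, ?_, ?_, ?_⟩
        · intro i'
          induction i' using Fin.lastCases with
          | last => simp [(hA i0).le]
          | cast i' =>
            simp only [Fin.snoc_castSucc, Fin.snoc_last, map_div₀, v.map_neg]
            have := hi0 (i0.succAbove (π i')) (Finset.mem_univ _)
            rw [div_mul_eq_mul_div, div_le_iff₀ (v.pos hα0)]
            linarith
        · intro i' hi'
          have : i' = Fin.last m := le_antisymm (Fin.le_last _) hi'
          rw [this]; simp
        · intro z hz'
          have h := hz z (by simpa using hz')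
          rw [Fin.sum_univ_castSucc]
          simp only [Fin.snoc_castSucc, Fin.snoc_last, zero_mul, add_zero]
          rw [Fin.sum_univ_succAbove _ i0] at h
          have hb : Function.Bijective π := Finite.injective_iff_bijective.1 hπ
          have h3 : ∑ k, -α (i0.succAbove (π k)) / α i0 * l (i0.succAbove (π k)) z
            = ∑ k, -α (i0.succAbove k) / α i0 * l (i0.succAbove k) z :=
            hb.sum_comp (fun k => -α (i0.succAbove k) / α i0 * l (i0.succAbove k) z)
          rw [h3]
          have h4 : ∑ k, -α (i0.succAbove k) / α i0 * l (i0.succAbove k) z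
            = -(∑ k, α (i0.succAbove k) * l (i0.succAbove k) z) / α i0 := by
            rw [← Finset.sum_neg_distrib, Finset.sum_div]
            exact Finset.sum_congr rfl fun k _ => by ring
          rw [h4, eq_div_iff hα0]
          linear_combination h
      | cast k =>
        obtain ⟨γ, h1, h2, h3⟩ := hk k
        refine ⟨Fin.snoc (α := fun _ => K) γ 0, ?_, ?_, ?_⟩
        · intro i'
          induction i' using Fin.lastCases with
          | last => simp [(hA _).le]
          | cast i' => simpa using h1 i'
        · intro i' hi'
          induction i' using Fin.lastCases with
          | last => simp
          | cast i' => simpa using h2 i' (by simpa using hi')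
        · intro z hz'
          rw [Fin.sum_univ_castSucc]
          simpa using h3 z (by simpa using hz')

lemma chain' (v : AbsoluteValue K ℝ) {E : Type*} [AddCommGroup E] [Module K E] [FiniteDimensional K E]
    (V : ℕ → Submodule K E) (hV : Monotone V) (m : ℕ) (hfr : ∀ j ≤ m, Module.finrank K (V j) = j)
    (l : Fin m → (E →ₗ[K] K)) (A : Fin m → ℝ) (hA : ∀ i, 0 < A i) :
    ∃ π : Equiv.Perm (Fin m), ∀ j : ℕ, ∀ z ∈ V j, ∀ μ : ℝ, 0 ≤ μ →
      (∀ i' : Fin m, (i' : ℕ) < j → v (l (π i') z) ≤ A (π i') * μ) →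
      ∀ i : Fin m, v (l (π i) z) ≤ 2 ^ m * (A (π i) * μ) := by
  obtain ⟨π, hπ, hk⟩ := chain_aux v V m hfr l A hA
  refine ⟨Equiv.ofBijective π (Finite.injective_iff_bijective.1 hπ), ?_⟩
  intro j z hz μ hμ h
  simp only [Equiv.ofBijective_apply] at h ⊢
  have key : ∀ n : ℕ, ∀ i : Fin m, (i : ℕ) = n → v (l (π i) z) ≤ 2 ^ n * (A (π i) * μ) := by
    intro n
    induction n using Nat.strong_induction_on with
    | _ n ih =>
      intro i hi
      by_cases hij : (i : ℕ) < j
      · refine (h i hij).trans ?_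
        have : (1:ℝ) ≤ 2 ^ n := one_le_pow₀ (by norm_num)
        nlinarith [mul_nonneg (hA (π i)).le hμ]
      · obtain ⟨γ, h1, h2, h3⟩ := hk i
        rw [h3 z (hV (by omega) hz)]
        refine (av_sum_le v _ _).trans ?_
        have hb : ∀ i' : Fin m, v (γ i' * l (π i') z) ≤
            if (i' : ℕ) < n then 2 ^ (i' : ℕ) * (A (π i) * μ) else 0 := by
          intro i'
          split_ifs with hlt
          · rw [map_mul]
            have e1 := ih i' hlt i' rfl
            calc v (γ i') * v (l (π i') z) ≤ v (γ i') * (2 ^ (i' : ℕ) * (A (π i') * μ)) := by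
                  gcongr
              _ = 2 ^ (i' : ℕ) * ((v (γ i') * A (π i')) * μ) := by ring
              _ ≤ _ := by gcongr; exact h1 i'
          · rw [h2 i' (by rw [Fin.le_def]; omega)]; simp
        refine (Finset.sum_le_sum fun i' _ => hb i').trans ?_
        have hle : ∑ i' : Fin m, (if (i' : ℕ) < n then 2 ^ (i' : ℕ) * (A (π i) * μ) else 0)
            = ∑ i' ∈ Finset.range n, 2 ^ i' * (A (π i) * μ) := by
          rw [Fin.sum_univ_eq_sum_range (fun i' : ℕ => if i' < n then (2:ℝ) ^ i' * (A (π i) * μ) else 0) m]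
          rw [← Finset.sum_filter]
          congr 1
          ext a; simp; omega
        rw [hle, ← Finset.sum_mul]
        gcongr
        · exact mul_nonneg (hA _).le hμ
        · have := geom_sum_eq (x := (2:ℝ)) (by norm_num) n
          rw [this]; norm_num
  intro i
  refine (key i i rfl).trans ?_
  gcongr
  · exact mul_nonneg (hA _).le hμ
  · norm_num
  · exact i.2.le

end
end Sub15

set_option linter.unusedVariables false
set_option linter.unusedSectionVars false
set_option linter.style.longLine false
namespace Sub15
noncomputable section
open Finset

variable {K : Type*} [Field K]

lemma minima {E : Type*} [AddCommGroup E] [Module K E] [FiniteDimensional K E]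
    (Λ : Set E) (hs : Submodule.span K Λ = ⊤) (nrm : E → ℝ) (ε : ℝ) (hε : 0 < ε)
    (h0 : ∀ x ∈ Λ, x ≠ 0 → ε ≤ nrm x) (N : ℕ) (hN : Module.finrank K E = N) :
    ∃ (b : ℕ → E) (lam : ℕ → ℝ) (V : ℕ → Submodule K E), Monotone V ∧
      (∀ j, V j = Submodule.span K (b '' Set.Iio j)) ∧
      (∀ j ≤ N, Module.finrank K (V j) = j) ∧
      (∀ j < N, b j ∈ Λ ∧ nrm (b j) ≤ 2 * lam j ∧ ε ≤ lam j ∧ ∀ x ∈ Λ, x ∉ V j → lam j ≤ nrm x) ∧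
      ∀ i j, i ≤ j → j < N → lam i ≤ lam j := by
  classical
  set m : Submodule K E → ℝ := fun U => sInf (nrm '' (Λ \ U)) with hm
  have hne : ∀ U : Submodule K E, U ≠ ⊤ → (Λ \ U).Nonempty := by
    intro U hU
    by_contra h
    rw [Set.not_nonempty_iff_eq_empty, Set.sdiff_eq_empty] at h
    apply hU
    rw [eq_top_iff, ← hs]
    exact Submodule.span_le.2 h
  have hlow : ∀ U : Submodule K E, ∀ y ∈ nrm '' (Λ \ U), ε ≤ y := by
    rintro U _ ⟨x, ⟨hx, hxU⟩, rfl⟩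
    exact h0 x hx (fun h => hxU (by rw [h]; exact U.zero_mem))
  have hmε : ∀ U, U ≠ ⊤ → ε ≤ m U := fun U hU => le_csInf ((hne U hU).image _) (hlow U)
  have hex : ∀ U : Submodule K E, ∃ x : E, U ≠ ⊤ → x ∈ Λ ∧ x ∉ U ∧ nrm x ≤ 2 * m U := by
    intro U
    by_cases hU : U = ⊤
    · exact ⟨0, fun h => absurd hU h⟩
    · have h1 := hmε U hU
      obtain ⟨_, ⟨x, hx, rfl⟩, hlt⟩ := exists_lt_of_csInf_lt ((hne U hU).image nrm)
        (show sInf (nrm '' (Λ \ U)) < 2 * m U by change m U < _; linarith)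
      exact ⟨x, fun _ => ⟨hx.1, hx.2, hlt.le⟩⟩
  choose f hf using hex
  obtain ⟨V, hV0, hVs⟩ : ∃ V : ℕ → Submodule K E, V 0 = ⊥ ∧
      ∀ n, V (n+1) = V n ⊔ Submodule.span K {f (V n)} :=
    ⟨fun n => Nat.rec ⊥ (fun _ U => U ⊔ Submodule.span K {f U}) n, rfl, fun n => rfl⟩
  have hmono : Monotone V := monotone_nat_of_le_succ fun n => by rw [hVs]; exact le_sup_left
  have hspan : ∀ j, V j = Submodule.span K ((fun n => f (V n)) '' Set.Iio j) := by
    intro j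
    induction j with
    | zero => rw [hV0]; simp
    | succ j ih =>
      rw [hVs]
      have : Set.Iio (j+1) = insert j (Set.Iio j) := by ext a; simp only [Set.mem_Iio, Set.mem_insert_iff]; omega
      rw [this, Set.image_insert_eq, Submodule.span_insert, ← ih, sup_comm]
  have hfr : ∀ j ≤ N, Module.finrank K (V j) = j := by
    intro j
    induction j with
    | zero => intro _; rw [hV0]; simp
    | succ j ih =>
      intro hj
      have ih := ih (by omega)
      have hjt : V j ≠ ⊤ := by
        intro h; rw [h, finrank_top, hN] at ih; omega
      have hfj := (hf (V j) hjt).2.1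
      apply le_antisymm
      · rw [hVs]
        refine (Submodule.finrank_add_le_finrank_add_finrank _ _).trans ?_
        rw [ih]
        have := finrank_span_le_card (R := K) ({f (V j)} : Set E)
        simp only [Set.toFinset_singleton, Finset.card_singleton] at this
        omega
      · have : V j < V (j+1) := by
          refine lt_of_le_of_ne (hmono (by omega)) fun h => hfj ?_
          have h' : f (V j) ∈ V (j+1) := by
            rw [hVs]
            exact Submodule.mem_sup_right (Submodule.mem_span_singleton_self _)
          rwa [← h] at h'
        have := Submodule.finrank_lt_finrank_of_lt this
        omega
  have hnt : ∀ j < N, V j ≠ ⊤ := by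
    intro j hj h
    have := hfr j hj.le
    rw [h, finrank_top, hN] at this; omega
  refine ⟨fun n => f (V n), fun n => m (V n), V, hmono, hspan, hfr, ?_, ?_⟩
  · intro j hj
    obtain ⟨h1, h2, h3⟩ := hf (V j) (hnt j hj)
    exact ⟨h1, h3, hmε _ (hnt j hj), fun x hx hxV => csInf_le ⟨ε, hlow _⟩ ⟨x, ⟨hx, hxV⟩, rfl⟩⟩
  · intro i j hij hj
    apply csInf_le_csInf ⟨ε, hlow _⟩ ((hne _ (hnt j hj)).image _)
    exact Set.image_mono (Set.sdiff_subset_sdiff_right (hmono hij))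

end
end Sub15

set_option linter.unusedVariables false
set_option linter.unusedSectionVars false
set_option linter.style.longLine false
namespace Sub15
noncomputable section
open Finset

variable {K : Type*} [Field K]

/-- integer linear form as a K-linear functional -/
def lf {N : ℕ} (L : Matrix (Fin N) (Fin N) ℤ) (i : Fin N) : (Fin N → K) →ₗ[K] K :=
  ∑ i', (L i i' : K) • LinearMap.proj i'

lemma lf_apply {N : ℕ} (L : Matrix (Fin N) (Fin N) ℤ) (i : Fin N) (x : Fin N → K) :
    lf L i x = ∑ i', (L i i' : K) * x i' := by
  simp [lf]

lemma lf_adj {N : ℕ} (L : Matrix (Fin N) (Fin N) ℤ) (x : Fin N → K) (k : Fin N) :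
    (L.det : K) * x k = ∑ i, (L.adjugate k i : K) * lf L i x := by
  have h : (L.adjugate * L) = L.det • (1 : Matrix (Fin N) (Fin N) ℤ) := Matrix.adjugate_mul L
  have h2 : ∀ l, ∑ i, (L.adjugate k i : K) * (L i l : K) = if k = l then (L.det : K) else 0 := by
    intro l
    have := congrFun (congrFun h k) l
    rw [Matrix.mul_apply, Matrix.smul_apply, Matrix.one_apply] at this
    have h3 := congrArg (fun z : ℤ => (z : K)) this
    push_cast at h3
    rw [h3]; split_ifs <;> simp
  simp only [lf_apply, Finset.mul_sum]
  rw [Finset.sum_comm]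
  have : ∀ l, ∑ i, (L.adjugate k i : K) * ((L i l : K) * x l) = if k = l then (L.det : K) * x l else 0 := by
    intro l
    simp only [← mul_assoc, ← Finset.sum_mul, h2]
    split_ifs <;> simp
  simp [this]

lemma lf_mem {N : ℕ} (O : Subring K) (L : Matrix (Fin N) (Fin N) ℤ) (i : Fin N) (x : Fin N → K)
    (hx : ∀ i, x i ∈ O) : lf L i x ∈ O := by
  rw [lf_apply]
  exact Subring.sum_mem _ fun k _ => O.mul_mem (intCast_mem O _) (hx k)

/-- Properties of a (totally complex) number field used in the geometry of numbers -/
structure Geo {W S : Type*} [Fintype W] [Fintype S] (O : Subring K)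
    (av : W ⊕ S → AbsoluteValue K ℝ) : Prop where
  pf : ∀ x ∈ O, x ≠ 0 → 1 ≤ ∏ v, av v x
  hr : ∀ (ξ : K) (H : ℝ), 1 ≤ H → ¬ RothH ξ H → ∃ q : ℤ, q ≠ 0 ∧ (q : K) * ξ ∈ O ∧
    ∀ v, av v (q : K) ≤ H ∧ av v ((q : K) * ξ) ≤ H
  fin_le : ∀ s, ∀ x ∈ O, av (Sum.inr s) x ≤ 1
  ultra : ∀ s x y, av (Sum.inr s) (x + y) ≤ max (av (Sum.inr s) x) (av (Sum.inr s) y)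
  round : ∃ C : ℝ, ∀ α : W → K, ∃ a ∈ O, ∀ w, av (Sum.inl w) (a - α w) ≤ C
  mink : ∀ (N : ℕ), 0 < N → ∀ (L : W ⊕ S → Matrix (Fin N) (Fin N) ℤ), (∀ v, (L v).det ≠ 0) →
    ∃ C : ℝ, ∀ A : W ⊕ S → Fin N → ℝ, (∀ v i, 0 < A v i) → (∀ s i, A (Sum.inr s) i ≤ 1) →
      C < ∏ v, ∏ i, A v i → ∃ x : Fin N → K, x ≠ 0 ∧ (∀ i, x i ∈ O) ∧
        ∀ v i, av v (lf (L v) i x) ≤ A v i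

variable {W S : Type*} [Fintype W] [Fintype S] [CharZero K] {O : Subring K}
  {av : W ⊕ S → AbsoluteValue K ℝ}

lemma low_nrm [Nonempty W] (hG : Geo O av) {N : ℕ} (L : W ⊕ S → Matrix (Fin N) (Fin N) ℤ)
    (hL : ∀ v, (L v).det ≠ 0) :
    ∃ C : ℝ, 1 ≤ C ∧ ∀ (A : W → Fin N → ℝ) (M μ : ℝ), 0 ≤ μ → (∀ w i, A w i ≤ M) → (∀ w i, 0 < A w i) →
      ∀ x : Fin N → K, x ≠ 0 → (∀ i, x i ∈ O) →
      (∀ w i, av (Sum.inl w) (lf (L (Sum.inl w)) i x) ≤ A w i * μ) → 1 ≤ C * M * μ := by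
  classical
  set D : ℤ := ∏ w : W, (L (Sum.inl w)).det with hD
  set C : ℝ := 1 + ∑ w : W, ∑ k, ∑ i, |((∏ w' ∈ univ.erase w, (L (Sum.inl w')).det : ℤ) : ℝ)| *
    |((L (Sum.inl w)).adjugate k i : ℝ)| with hC
  have hC1 : 1 ≤ C := by
    rw [hC]
    have : 0 ≤ ∑ w : W, ∑ k, ∑ i, |((∏ w' ∈ univ.erase w, (L (Sum.inl w')).det : ℤ) : ℝ)| *
      |((L (Sum.inl w)).adjugate k i : ℝ)| := by positivity
    linarith
  refine ⟨C, hC1, ?_⟩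
  intro A M μ hμ hAM hA x hx hxO hb
  obtain ⟨k, hk⟩ := Function.ne_iff.1 hx
  obtain ⟨w0⟩ := ‹Nonempty W›
  have hM : 0 < M := (hA w0 k).trans_le (hAM w0 k)
  have hDK : (D : K) ≠ 0 := by
    rw [Int.cast_ne_zero, hD]
    exact Finset.prod_ne_zero_iff.2 fun w _ => hL _
  have h1 := hG.pf ((D : K) * x k) (O.mul_mem (intCast_mem O _) (hxO k)) (mul_ne_zero hDK hk)
  rw [Fintype.prod_sum_type] at h1
  have hS : ∏ s : S, av (Sum.inr s) ((D : K) * x k) ≤ 1 :=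
    Finset.prod_le_one (fun _ _ => (av _).nonneg _)
      fun s _ => hG.fin_le s _ (O.mul_mem (intCast_mem O _) (hxO k))
  have hw : ∀ w, av (Sum.inl w) ((D : K) * x k) ≤ C * M * μ := by
    intro w
    have e : (D : K) * x k = ((∏ w' ∈ univ.erase w, (L (Sum.inl w')).det : ℤ) : K) *
        (((L (Sum.inl w)).det : K) * x k) := by
      rw [hD, ← Finset.mul_prod_erase univ _ (Finset.mem_univ w)]
      push_cast; ring
    rw [e, lf_adj, map_mul]
    calc _ ≤ |((∏ w' ∈ univ.erase w, (L (Sum.inl w')).det : ℤ) : ℝ)| *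
          ∑ i, |((L (Sum.inl w)).adjugate k i : ℝ)| * (M * μ) := by
            gcongr
            · exact av_int_le _ _
            · refine (av_sum_le _ _ _).trans (Finset.sum_le_sum fun i _ => ?_)
              rw [map_mul]
              gcongr
              · exact av_int_le _ _
              · refine (hb w i).trans ?_
                gcongr
                exact hAM w i
      _ = (∑ i, |((∏ w' ∈ univ.erase w, (L (Sum.inl w')).det : ℤ) : ℝ)| *
          |((L (Sum.inl w)).adjugate k i : ℝ)|) * (M * μ) := by
            rw [Finset.sum_mul, Finset.mul_sum]
            exact Finset.sum_congr rfl fun i _ => by ring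
      _ ≤ C * (M * μ) := by
            gcongr
            rw [hC]
            have h1 := Finset.single_le_sum (f := fun w : W => ∑ k, ∑ i, |((∏ w' ∈ univ.erase w, (L (Sum.inl w')).det : ℤ) : ℝ)| *
              |((L (Sum.inl w)).adjugate k i : ℝ)|) (fun _ _ => by positivity) (Finset.mem_univ w)
            have h2 := Finset.single_le_sum (f := fun k => ∑ i, |((∏ w' ∈ univ.erase w, (L (Sum.inl w')).det : ℤ) : ℝ)| *
              |((L (Sum.inl w)).adjugate k i : ℝ)|) (fun _ _ => by positivity) (Finset.mem_univ k)
            linarith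
      _ = _ := by ring
  by_contra hlt
  push Not at hlt
  have h2 : ∏ w : W, av (Sum.inl w) ((D : K) * x k) ≤ (C * M * μ) ^ Fintype.card W := by
    refine (Finset.prod_le_prod (fun _ _ => (av _).nonneg _) fun w _ => hw w).trans ?_
    simp
  have h3 : (C * M * μ) ^ Fintype.card W < 1 :=
    pow_lt_one₀ (by positivity) hlt Fintype.card_ne_zero
  have h4 := mul_le_mul_of_nonneg_left hS
    (Finset.prod_nonneg (s := (univ : Finset W)) fun w _ => (av (Sum.inl w)).nonneg ((D : K) * x k))
  linarith

/-- successive minima together with the upper bound of the second theorem of Minkowski -/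
lemma base [Nonempty W] (hG : Geo O av) {N : ℕ} (hN : 0 < N) (L : W ⊕ S → Matrix (Fin N) (Fin N) ℤ)
    (hL : ∀ v, (L v).det ≠ 0) :
    ∃ C : ℝ, 1 ≤ C ∧ ∀ A : W ⊕ S → Fin N → ℝ, (∀ v i, 0 < A v i) → (∀ s i, A (Sum.inr s) i ≤ 1) →
      ∃ (b : ℕ → Fin N → K) (lam : ℕ → ℝ) (V : ℕ → Submodule K (Fin N → K)),
      (∀ j, V j = Submodule.span K (b '' Set.Iio j)) ∧
      (∀ j ≤ N, Module.finrank K (V j) = j) ∧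
      (∀ j < N, (∀ i, b j i ∈ O) ∧ (∀ s i, av (Sum.inr s) (lf (L (Sum.inr s)) i (b j)) ≤ A (Sum.inr s) i) ∧
        (∀ w i, av (Sum.inl w) (lf (L (Sum.inl w)) i (b j)) ≤ A (Sum.inl w) i * (2 * lam j)) ∧ 0 < lam j ∧
        ∀ x : Fin N → K, (∀ i, x i ∈ O) → (∀ s i, av (Sum.inr s) (lf (L (Sum.inr s)) i x) ≤ A (Sum.inr s) i) →
          x ∉ V j → ∀ μ : ℝ, (∀ w i, av (Sum.inl w) (lf (L (Sum.inl w)) i x) ≤ A (Sum.inl w) i * μ) →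
            lam j ≤ C * μ) ∧
      (∀ i j, i ≤ j → j < N → lam i ≤ lam j) ∧
      (∏ j ∈ range N, lam j) ^ Fintype.card W * ∏ v, ∏ i, A v i ≤ C := by
  classical
  obtain ⟨C1, hC1, hlow⟩ := low_nrm hG L hL
  obtain ⟨C2, hmink⟩ := hG.mink N hN L hL
  obtain ⟨C3, hmink1⟩ := hG.mink 1 one_pos (fun _ => 1) (by simp)
  set T : ℝ := Fintype.card W * N * 2 ^ N with hT
  have hW : (1:ℝ) ≤ Fintype.card W := by exact_mod_cast Fintype.card_pos
  have hNr : (1:ℝ) ≤ N := by exact_mod_cast hN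
  have hT1 : 1 ≤ T := by
    have : (1:ℝ) ≤ 2 ^ N := one_le_pow₀ (by norm_num)
    rw [hT]
    calc (1:ℝ) = 1 * 1 * 1 := by norm_num
      _ ≤ _ := by gcongr
  set η : ℝ := (2 * T)⁻¹ with hη
  have hη0 : 0 < η := by positivity
  set C : ℝ := T + |C2| * (η ^ (N * Fintype.card W))⁻¹ with hC
  have hC0 : T ≤ C := by
    have : 0 ≤ |C2| * (η ^ (N * Fintype.card W))⁻¹ := by positivity
    linarith
  refine ⟨C, hT1.trans hC0, ?_⟩
  intro A hA hAs
  set Λ : Set (Fin N → K) := {x | (∀ i, x i ∈ O) ∧ ∀ s i, av (Sum.inr s) (lf (L (Sum.inr s)) i x) ≤ A (Sum.inr s) i} with hΛ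
  set nrm : (Fin N → K) → ℝ := fun x => ∑ w, ∑ i, av (Sum.inl w) (lf (L (Sum.inl w)) i x) / A (Sum.inl w) i with hnrm
  have hnrm0 : ∀ x, 0 ≤ nrm x := fun x => Finset.sum_nonneg fun w _ => Finset.sum_nonneg fun i _ =>
    div_nonneg ((av _).nonneg _) (hA _ _).le
  have hnrm1 : ∀ x w i, av (Sum.inl w) (lf (L (Sum.inl w)) i x) ≤ A (Sum.inl w) i * nrm x := by
    intro x w i
    rw [mul_comm, ← div_le_iff₀ (hA _ _)]
    have h0 : ∀ w i, 0 ≤ av (Sum.inl w) (lf (L (Sum.inl w)) i x) / A (Sum.inl w) i :=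
      fun w i => div_nonneg ((av _).nonneg _) (hA _ _).le
    exact (Finset.single_le_sum (f := fun i => av (Sum.inl w) (lf (L (Sum.inl w)) i x) / A (Sum.inl w) i)
      (fun i _ => h0 w i) (Finset.mem_univ i)).trans
      (Finset.single_le_sum (f := fun w => ∑ i, av (Sum.inl w) (lf (L (Sum.inl w)) i x) / A (Sum.inl w) i)
      (fun w _ => Finset.sum_nonneg fun i _ => h0 w i) (Finset.mem_univ w))
  have hnrm2 : ∀ x μ, (∀ w i, av (Sum.inl w) (lf (L (Sum.inl w)) i x) ≤ A (Sum.inl w) i * μ) →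
      nrm x ≤ Fintype.card W * N * μ := by
    intro x μ h
    calc nrm x ≤ ∑ w : W, ∑ i : Fin N, μ := Finset.sum_le_sum fun w _ => Finset.sum_le_sum fun i _ => by
          rw [div_le_iff₀ (hA _ _), mul_comm]; exact h w i
      _ = _ := by simp; ring
  set M : ℝ := ∑ w : W, ∑ i, A (Sum.inl w) i with hM
  have hMle : ∀ w i, A (Sum.inl w) i ≤ M := by
    intro w i
    exact (Finset.single_le_sum (f := fun i => A (Sum.inl w) i)
      (fun i _ => (hA _ _).le) (Finset.mem_univ i)).trans
      (Finset.single_le_sum (f := fun w : W => ∑ i, A (Sum.inl w) i)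
      (fun w _ => Finset.sum_nonneg fun i _ => (hA _ _).le) (Finset.mem_univ w))
  have hM0 : 0 < M := by
    obtain ⟨w0⟩ := ‹Nonempty W›
    exact (hA (Sum.inl w0) ⟨0, hN⟩).trans_le (hMle _ _)
  have hε : 0 < (C1 * M)⁻¹ := by positivity
  have hspan : Submodule.span K Λ = ⊤ := by
    -- a multiplier
    obtain ⟨B, hB0, hB⟩ : ∃ B : ℝ, 0 < B ∧ C3 < B := ⟨|C3| + 1, by positivity, by
      have := le_abs_self C3; linarith⟩
    set a : S → ℝ := fun s => ∏ i, A (Sum.inr s) i with ha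
    have ha0 : ∀ s, 0 < a s := fun s => Finset.prod_pos fun i _ => hA _ _
    have ha1 : ∀ s, a s ≤ 1 := fun s => Finset.prod_le_one (fun i _ => (hA _ _).le) fun i _ => hAs _ _
    have haA : ∀ s i, a s ≤ A (Sum.inr s) i := by
      intro s i
      rw [ha]
      simp only
      rw [← Finset.mul_prod_erase univ _ (Finset.mem_univ i)]
      exact mul_le_of_le_one_right (hA _ _).le (Finset.prod_le_one (fun i _ => (hA _ _).le) fun i _ => hAs _ _)
    have hpa : 0 < ∏ s, a s := Finset.prod_pos fun s _ => ha0 s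
    obtain ⟨R, hR1, hR⟩ : ∃ R : ℝ, 1 ≤ R ∧ C3 < R * ∏ s, a s := by
      refine ⟨max 1 (B / ∏ s, a s), le_max_left _ _, hB.trans_le ?_⟩
      rw [← div_le_iff₀ hpa]; exact le_max_right _ _
    obtain ⟨x, hx0, hxO, hx⟩ := hmink1 (fun v _ => Sum.elim (fun _ : W => R) a v)
      (by rintro (w | s) i; · simp; linarith
          · exact ha0 s) (by intro s i; exact ha1 s) (by
        simp only [Finset.univ_unique, Finset.prod_singleton, Fintype.prod_sum_type, Sum.elim_inl, Sum.elim_inr]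
        refine hR.trans_le ?_
        gcongr
        rw [Finset.prod_const, Finset.card_univ]
        exact le_self_pow₀ hR1 Fintype.card_ne_zero)
    set D := x 0 with hD
    have hD0 : D ≠ 0 := by
      intro h; apply hx0; funext i; rw [Subsingleton.elim i 0]; exact h
    have hDs : ∀ s, av (Sum.inr s) D ≤ a s := by
      intro s
      have := hx (Sum.inr s) 0
      rw [lf_apply] at this
      simpa using this
    rw [eq_top_iff]
    intro y _
    have hy : y = ∑ k, (y k / D) • (Pi.single k D : Fin N → K) := by
      funext i
      rw [Finset.sum_apply, Finset.sum_eq_single i]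
      · simp [hD0]
      · intro k _ hk; simp [hk.symm]
      · simp
    rw [hy]
    refine Submodule.sum_mem _ fun k _ => Submodule.smul_mem _ _ (Submodule.subset_span ?_)
    refine ⟨fun i => ?_, fun s i => ?_⟩
    · by_cases h : i = k
      · rw [h]; simpa using hxO 0
      · simp [h, O.zero_mem]
    · rw [lf_apply, Finset.sum_eq_single k (by intro j _ hj; simp [hj]) (by simp)]
      rw [Pi.single_eq_same, map_mul]
      calc _ ≤ 1 * a s := by
            gcongr
            · exact hG.fin_le s _ (intCast_mem O _)
            · exact hDs s
        _ ≤ _ := by rw [one_mul]; exact haA s i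
  obtain ⟨b, lam, V, hVm, hVs, hfr, hb, hlm⟩ := minima Λ hspan nrm _ hε (by
    intro x hx hx0
    have := hlow (fun w i => A (Sum.inl w) i) M (nrm x) (hnrm0 x) hMle (fun _ _ => hA _ _) x hx0 hx.1
      (hnrm1 x)
    rw [inv_le_iff_one_le_mul₀ (by positivity)]
    linarith) N (by simp)
  have hlam0 : ∀ j < N, 0 < lam j := fun j hj => hε.trans_le (hb j hj).2.2.1
  refine ⟨b, lam, V, hVs, hfr, ?_, hlm, ?_⟩
  · intro j hj
    obtain ⟨h1, h2, h3, h4⟩ := hb j hj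
    refine ⟨h1.1, h1.2, fun w i => (hnrm1 _ w i).trans ?_, hlam0 j hj, ?_⟩
    · exact mul_le_mul_of_nonneg_left h2 (hA _ _).le
    · intro x hxO hxs hxV μ hμ
      have hle := (h4 x ⟨hxO, hxs⟩ hxV).trans (hnrm2 x μ hμ)
      have hpos : 0 < Fintype.card W * N * μ := (hlam0 j hj).trans_le hle
      have hμ0 : 0 < μ := by
        by_contra h
        push Not at h
        have : Fintype.card W * N * μ ≤ 0 := mul_nonpos_of_nonneg_of_nonpos (by positivity) h
        linarith
      refine hle.trans ?_
      gcongr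
      refine le_trans ?_ hC0
      rw [hT]
      exact le_mul_of_one_le_right (by positivity) (one_le_pow₀ (by norm_num))
  · have hch : ∀ w : W, _ := fun w => chain' (av (Sum.inl w)) V hVm N hfr (fun i => lf (L (Sum.inl w)) i)
      (fun i => A (Sum.inl w) i) (fun i => hA _ _)
    choose π hπ using hch
    set A' : W ⊕ S → Fin N → ℝ := fun v => Sum.elim (fun w => fun i => A (Sum.inl w) i * (η * lam ((π w).symm i)))
      (fun s => A (Sum.inr s)) v with hA'
    have hno : ¬ (C2 < ∏ v, ∏ i, A' v i) := by
      intro hlt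
      obtain ⟨x, hx0, hxO, hx⟩ := hmink A' (by
        rintro (w | s) i
        · exact mul_pos (hA _ _) (mul_pos hη0 (hlam0 _ (Fin.is_lt _)))
        · exact hA _ _) (fun s i => hAs s i) hlt
      have hxN : x ∈ V N := by
        have : V N = ⊤ := Submodule.eq_top_of_finrank_eq (by rw [hfr N le_rfl]; simp)
        rw [this]; trivial
      have hx00 : x ∉ V 0 := by
        rw [hVs]; simpa using hx0
      obtain ⟨j, hj, hj1, hj2⟩ : ∃ j < N, x ∉ V j ∧ x ∈ V (j+1) := by
        have hex : ∃ j, x ∈ V j := ⟨N, hxN⟩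
        have h1 := Nat.find_spec hex
        have h2 : Nat.find hex ≤ N := Nat.find_min' hex hxN
        have h3 : Nat.find hex ≠ 0 := fun h => hx00 (h ▸ h1)
        obtain ⟨j, hj⟩ := Nat.exists_eq_succ_of_ne_zero h3
        refine ⟨j, by omega, Nat.find_min hex (by omega), ?_⟩
        rw [hj] at h1; exact h1
      have hle := (hb j hj).2.2.2 x ⟨hxO, fun s i => hx (Sum.inr s) i⟩ hj1
      have hl0 := hlam0 j hj
      have h2 : nrm x ≤ Fintype.card W * N * (2 ^ N * (η * lam j)) := by
        apply hnrm2
        intro w i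
        have := hπ w (j+1) x hj2 (η * lam j) (by positivity) (by
          intro i' hi'
          have h3 := hx (Sum.inl w) (π w i')
          simp only [hA', Sum.elim_inl, Equiv.symm_apply_apply] at h3
          refine h3.trans ?_
          refine mul_le_mul_of_nonneg_left (mul_le_mul_of_nonneg_left (hlm _ _ (by omega) hj) hη0.le) (hA _ _).le) ((π w).symm i)
        rw [Equiv.apply_symm_apply] at this
        linarith
      have h3 : Fintype.card W * N * (2 ^ N * (η * lam j)) = lam j / 2 := by
        have : Fintype.card W * N * (2 ^ N * (η * lam j)) = T * η * lam j := by rw [hT]; ring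
        rw [this, hη]
        field_simp
      linarith
    push Not at hno
    have hprod : ∏ v, ∏ i, A' v i = η ^ (N * Fintype.card W) *
        ((∏ j ∈ range N, lam j) ^ Fintype.card W * ∏ v, ∏ i, A v i) := by
      rw [Fintype.prod_sum_type, Fintype.prod_sum_type]
      have : ∀ w : W, ∏ i, A' (Sum.inl w) i = η ^ N * (∏ j ∈ range N, lam j) * ∏ i, A (Sum.inl w) i := by
        intro w
        simp only [hA', Sum.elim_inl]
        rw [Finset.prod_mul_distrib, Finset.prod_mul_distrib]
        rw [Equiv.prod_comp (π w).symm (fun i : Fin N => lam i), Fin.prod_univ_eq_prod_range]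
        simp; ring
      rw [Finset.prod_congr rfl fun w _ => this w]
      rw [Finset.prod_mul_distrib, Finset.prod_const, mul_pow, Finset.card_univ, ← pow_mul]
      simp only [hA', Sum.elim_inr]; ring
    rw [hprod] at hno
    have hp : 0 < η ^ (N * Fintype.card W) := by positivity
    have h5 : (∏ j ∈ range N, lam j) ^ Fintype.card W * ∏ v, ∏ i, A v i ≤ |C2| * (η ^ (N * Fintype.card W))⁻¹ := by
      rw [← div_eq_mul_inv, le_div_iff₀ hp]
      have := le_abs_self C2
      linarith
    linarith

end
end Sub15

set_option linter.unusedVariables false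
set_option linter.unusedSectionVars false
set_option linter.style.longLine false
namespace Sub15
noncomputable section
open Finset

variable {K : Type*} [Field K]
variable {W S : Type*} [Fintype W] [Fintype S] [CharZero K] {O : Subring K}
  {av : W ⊕ S → AbsoluteValue K ℝ}

lemma span_O_le {E : Type*} [AddCommGroup E] [Module K E] (O : Subring K) (s : Set E) (x : E)
    (hx : x ∈ Submodule.span O s) : x ∈ Submodule.span K s := by
  induction hx using Submodule.span_induction with
  | mem x h => exact Submodule.subset_span h
  | zero => exact Submodule.zero_mem _
  | add x y _ _ hx hy => exact Submodule.add_mem _ hx hy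
  | smul a x _ hx => exact Submodule.smul_mem _ (a : K) hx

lemma tri_span {E : Type*} [AddCommGroup E] [Module K E] (O : Subring K) (b y : ℕ → E) (j : ℕ)
    (h : ∀ k < j, y k - b k ∈ Submodule.span O (b '' Set.Iio k)) :
    Submodule.span K (b '' Set.Iio j) ≤ Submodule.span K (y '' Set.Iio j) := by
  induction j with
  | zero => simp
  | succ j ih =>
    have ih := ih (fun k hk => h k (by omega))
    have hm : Submodule.span K (y '' Set.Iio j) ≤ Submodule.span K (y '' Set.Iio (j+1)) :=
      Submodule.span_mono (Set.image_mono (Set.Iio_subset_Iio (by omega)))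
    rw [Submodule.span_le]
    rintro _ ⟨k, hk, rfl⟩
    rcases Nat.lt_succ_iff_lt_or_eq.1 hk with hk | rfl
    · exact hm (ih (Submodule.subset_span ⟨k, hk, rfl⟩))
    · have h1 := hm (ih (span_O_le O _ _ (h k (by omega))))
      have h2 : y k ∈ Submodule.span K (y '' Set.Iio (k+1)) := Submodule.subset_span ⟨k, by simp, rfl⟩
      have := Submodule.sub_mem _ h2 h1
      simpa using this

lemma reduce (hG : Geo O av) (N : ℕ) :
    ∃ C : ℝ, 1 ≤ C ∧ ∀ (L : W ⊕ S → Matrix (Fin N) (Fin N) ℤ) (hL : ∀ v, (L v).det ≠ 0)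
      (A : W → Fin N → ℝ) (hA : ∀ w i, 0 < A w i) (b : ℕ → Fin N → K) (lam : ℕ → ℝ)
      (hlam : ∀ j < N, 0 < lam j) (hlm : ∀ i j, i ≤ j → j < N → lam i ≤ lam j)
      (hfr : ∀ j ≤ N, Module.finrank K (Submodule.span K (b '' Set.Iio j)) = j)
      (hb : ∀ j < N, ∀ w i, av (Sum.inl w) (lf (L (Sum.inl w)) i (b j)) ≤ A w i * lam j),
      ∃ (π : W → Equiv.Perm (Fin N)) (y : ℕ → Fin N → K), ∀ j < N,
        y j - b j ∈ Submodule.span O (b '' Set.Iio j) ∧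
        ∀ w, ∀ i : Fin N, av (Sum.inl w) (lf (L (Sum.inl w)) (π w i) (y j)) ≤
          C * (A w (π w i) * lam (min i j)) := by
  classical
  obtain ⟨R0, hR0⟩ := hG.round
  obtain ⟨R, hR1, hR⟩ : ∃ R : ℝ, 0 ≤ R ∧ ∀ α : W → K, ∃ a ∈ O, ∀ w, av (Sum.inl w) (a - α w) ≤ R :=
    ⟨|R0|, abs_nonneg _, fun α => (hR0 α).imp fun a h => ⟨h.1, fun w => (h.2 w).trans (le_abs_self _)⟩⟩
  set B : ℝ := 1 + 2 ^ N + N * R with hB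
  have hB1 : 1 ≤ B := by
    have : (0:ℝ) ≤ 2 ^ N + N * R := by positivity
    linarith
  refine ⟨B ^ N, one_le_pow₀ hB1, ?_⟩
  intro L hL A hA b lam hlam hlm hfr hb
  set V : ℕ → Submodule K (Fin N → K) := fun j => Submodule.span K (b '' Set.Iio j) with hV
  have hVm : Monotone V := fun i j hij => Submodule.span_mono (Set.image_mono (Set.Iio_subset_Iio hij))
  have hch : ∀ w : W, _ := fun w => chain' (av (Sum.inl w)) V hVm N hfr (fun i => lf (L (Sum.inl w)) i)
      (fun i => A w i) (fun i => hA _ _)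
  choose π hπ using hch
  have key : ∀ j, j < N → ∃ y : Fin N → K, y - b j ∈ Submodule.span O (b '' Set.Iio j) ∧
        ∀ w, ∀ i : Fin N, av (Sum.inl w) (lf (L (Sum.inl w)) (π w i) y) ≤
          B ^ (j+1) * (A w (π w i) * lam (min i j)) := by
    intro j
    induction j using Nat.strong_induction_on with
    | _ j ih =>
      intro hj
      have ih' : ∀ k, ∃ y : Fin N → K, k < j → y - b k ∈ Submodule.span O (b '' Set.Iio k) ∧
        ∀ w, ∀ i : Fin N, av (Sum.inl w) (lf (L (Sum.inl w)) (π w i) y) ≤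
          B ^ (k+1) * (A w (π w i) * lam (min i k)) := by
        intro k
        by_cases hk : k < j
        · obtain ⟨y, hy⟩ := ih k hk (by omega)
          exact ⟨y, fun _ => hy⟩
        · exact ⟨0, fun h => absurd h hk⟩
      choose y hy using ih'
      have hVy : V j ≤ Submodule.span K (y '' Set.Iio j) := tri_span O b y j fun k hk => (hy k hk).1
      -- exact solution
      have hsol : ∀ w, ∃ α : ℕ → K, (∑ k ∈ range j, α k • y k) ∈ V j ∧
          ∀ i : Fin N, (i : ℕ) < j →
          lf (L (Sum.inl w)) (π w i) (b j + ∑ k ∈ range j, α k • y k) = 0 := by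
        intro w
        let T : V j →ₗ[K] (Fin j → K) :=
          LinearMap.pi fun i : Fin j => (lf (L (Sum.inl w)) (π w ⟨i, by omega⟩)).comp (V j).subtype
        have hinj : Function.Injective T := by
          rw [← LinearMap.ker_eq_bot, LinearMap.ker_eq_bot']
          rintro ⟨z, hz⟩ hTz
          have h0 : ∀ i : Fin N, lf (L (Sum.inl w)) (π w i) z = 0 := by
            intro i
            have := hπ w j z hz 0 le_rfl (by
              intro i' hi'
              have h1 := congrFun hTz ⟨i', hi'⟩
              have h2 : lf (L (Sum.inl w)) (π w i') z = 0 := h1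
              rw [h2]; simp) i
            have h3 : av (Sum.inl w) (lf (L (Sum.inl w)) (π w i) z) = 0 :=
              le_antisymm (by simpa using this) ((av _).nonneg _)
            simpa using h3
          have h1 : z = 0 := by
            funext k
            have h2 := lf_adj (L (Sum.inl w)) z k
            rw [Finset.sum_eq_zero] at h2
            · have h3 : ((L (Sum.inl w)).det : K) ≠ 0 := by exact_mod_cast hL _
              simpa [h3] using h2
            · intro i _
              have := h0 ((π w).symm i)
              rw [Equiv.apply_symm_apply] at this
              rw [this, mul_zero]
          simp [h1]
        have hsurj : Function.Surjective T :=
          (LinearMap.injective_iff_surjective_of_finrank_eq_finrank (by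
            rw [Module.finrank_fin_fun]; exact hfr j hj.le)).1 hinj
        obtain ⟨⟨z, hz⟩, hTz⟩ := hsurj (fun i => - lf (L (Sum.inl w)) (π w ⟨i, by omega⟩) (b j))
        have hz2 := hVy hz
        have hrange : y '' Set.Iio j = Set.range (fun i : Fin j => y i) := by
          ext a; constructor
          · rintro ⟨k, hk, rfl⟩; exact ⟨⟨k, hk⟩, rfl⟩
          · rintro ⟨k, rfl⟩; exact ⟨k, k.2, rfl⟩
        rw [hrange, Submodule.mem_span_range_iff_exists_fun] at hz2
        obtain ⟨α, hα⟩ := hz2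
        refine ⟨fun k => if h : k < j then α ⟨k, h⟩ else 0, ?_⟩
        have e : ∑ k ∈ range j, (if h : k < j then α ⟨k, h⟩ else 0) • y k = z := by
          rw [← hα, ← Fin.sum_univ_eq_sum_range (fun k => (if h : k < j then α ⟨k, h⟩ else 0) • y k)]
          exact Finset.sum_congr rfl fun k _ => by simp
        simp only [e]
        refine ⟨hz, fun i hi => ?_⟩
        rw [map_add]
        have h1 : lf (L (Sum.inl w)) (π w i) z = - lf (L (Sum.inl w)) (π w i) (b j) := congrFun hTz ⟨i, hi⟩
        rw [h1]; ring
      choose α hαV hα using hsol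
      have hround := fun k : ℕ => hR (fun w => α w k)
      choose a haO ha using hround
      refine ⟨b j + ∑ k ∈ range j, a k • y k, ?_, ?_⟩
      · rw [add_sub_cancel_left]
        refine Submodule.sum_mem _ fun k hk => ?_
        have hk := Finset.mem_range.1 hk
        refine Submodule.smul_mem _ (⟨a k, haO k⟩ : O) ?_
        have h1 : y k - b k ∈ Submodule.span O (b '' Set.Iio j) :=
          Submodule.span_mono (Set.image_mono (Set.Iio_subset_Iio (by omega))) (hy k hk).1
        have h2 : b k ∈ Submodule.span O (b '' Set.Iio j) := Submodule.subset_span ⟨k, hk, rfl⟩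
        have := Submodule.add_mem _ h1 h2
        simpa using this
      · intro w i
        set D := A w (π w i) * lam (min i j) with hD
        have hD0 : 0 ≤ D := by
          have := hlam (min i j) (by omega)
          have := hA w (π w i)
          positivity
        have e : b j + ∑ k ∈ range j, a k • y k = (b j + ∑ k ∈ range j, α w k • y k) +
            ∑ k ∈ range j, (a k - α w k) • y k := by
          simp only [sub_smul, Finset.sum_sub_distrib]; abel
        have hfirst : av (Sum.inl w) (lf (L (Sum.inl w)) (π w i) (b j + ∑ k ∈ range j, α w k • y k)) ≤
            (1 + 2 ^ N) * D := by
          by_cases hij : (i : ℕ) < j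
          · rw [hα w i hij, map_zero]; positivity
          · have hmin : min (i : ℕ) j = j := by omega
            rw [map_add]
            refine ((av _).add_le _ _).trans ?_
            have h1 := hb j hj w (π w i)
            have h2 := hπ w j _ (hαV w) (lam j) (hlam j hj).le (by
              intro i' hi'
              have h3 := hα w i' hi'
              rw [map_add] at h3
              rw [eq_neg_of_add_eq_zero_right h3, (av _).map_neg]
              exact hb j hj w _) i
            rw [hD, hmin]
            linarith
        have hsecond : av (Sum.inl w) (lf (L (Sum.inl w)) (π w i) (∑ k ∈ range j, (a k - α w k) • y k)) ≤
            N * R * (B ^ j * D) := by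
          rw [map_sum]
          refine (av_sum_le _ _ _).trans ?_
          have : ∀ k ∈ range j, av (Sum.inl w) (lf (L (Sum.inl w)) (π w i) ((a k - α w k) • y k)) ≤ R * (B ^ j * D) := by
            intro k hk
            have hk := Finset.mem_range.1 hk
            rw [map_smul, smul_eq_mul, map_mul]
            have h1 := (hy k hk).2 w i
            have h2 : lam (min i k) ≤ lam (min i j) := hlm _ _ (by omega) (by omega)
            have h3 : B ^ (k+1) ≤ B ^ j := pow_le_pow_right₀ hB1 (by omega)
            have h5 := hA w (π w i)
            have h6 := hlam (min i k) (by omega)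
            gcongr
            · exact ha k w
            · refine h1.trans ?_
              rw [hD]
              gcongr
          refine (Finset.sum_le_sum this).trans ?_
          rw [Finset.sum_const, Finset.card_range, nsmul_eq_mul]
          have : (j:ℝ) ≤ N := by exact_mod_cast hj.le
          have h4 : 0 ≤ R * (B ^ j * D) := by positivity
          nlinarith
        rw [e, map_add]
        refine ((av _).add_le _ _).trans ?_
        have h7 : (1:ℝ) ≤ B ^ j := one_le_pow₀ hB1
        have h8 : (1 + 2 ^ N) * D ≤ (1 + 2 ^ N) * (B ^ j * D) := by
          have : D ≤ B ^ j * D := by nlinarith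
          gcongr
        have h9 : B ^ (j+1) * D = (1 + 2 ^ N) * (B ^ j * D) + N * R * (B ^ j * D) := by
          rw [pow_succ, hB]; ring
        linarith
  have key' : ∀ j, ∃ y : Fin N → K, j < N → y - b j ∈ Submodule.span O (b '' Set.Iio j) ∧
        ∀ w, ∀ i : Fin N, av (Sum.inl w) (lf (L (Sum.inl w)) (π w i) y) ≤
          B ^ (j+1) * (A w (π w i) * lam (min i j)) := by
    intro j
    by_cases hj : j < N
    · obtain ⟨y, hy⟩ := key j hj; exact ⟨y, fun _ => hy⟩
    · exact ⟨0, fun h => absurd h hj⟩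
  choose y hy using key'
  refine ⟨π, y, fun j hj => ⟨(hy j hj).1, fun w i => ((hy j hj).2 w i).trans ?_⟩⟩
  have h5 := hA w (π w i)
  have h6 := hlam (min i j) (by omega)
  gcongr
  omega

lemma ultra_const {ι κ : Type*} [Finite κ] (F : Ultrafilter ι) (f : ι → κ) :
    ∃ k, ∀ᶠ t in (F : Filter ι), f t = k := by
  have h : (⋃ k ∈ (Set.univ : Set κ), {t | f t = k}) ∈ F := by
    have : (⋃ k ∈ (Set.univ : Set κ), {t | f t = k}) = Set.univ := by ext; simp
    rw [this]; exact Filter.univ_mem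
  obtain ⟨k, -, hk⟩ := (Ultrafilter.finite_biUnion_mem_iff Set.finite_univ).1 h
  exact ⟨k, hk⟩

lemma ultra_span (hG : Geo O av) (s : S) {N : ℕ} (f : (Fin N → K) →ₗ[K] K) (T : Set (Fin N → K)) (B : ℝ)
    (hB : 0 ≤ B) (h : ∀ x ∈ T, av (Sum.inr s) (f x) ≤ B) (x : Fin N → K) (hx : x ∈ Submodule.span O T) :
    av (Sum.inr s) (f x) ≤ B := by
  induction hx using Submodule.span_induction with
  | mem x hx => exact h x hx
  | zero => simpa using hB
  | add x y _ _ hx hy => rw [map_add]; exact (hG.ultra s _ _).trans (max_le hx hy)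
  | smul a x _ hx =>
    have : f (a • x) = (a : K) * f x := by
      change f ((a : K) • x) = _
      rw [map_smul, smul_eq_mul]
    rw [this, map_mul]
    calc _ ≤ 1 * B := by
          gcongr
          exact hG.fin_le s _ a.2
      _ = B := one_mul B

lemma O_span {N : ℕ} (T : Set (Fin N → K)) (h : ∀ x ∈ T, ∀ i, x i ∈ O) (x : Fin N → K)
    (hx : x ∈ Submodule.span O T) : ∀ i, x i ∈ O := by
  induction hx using Submodule.span_induction with
  | mem x hx => exact h x hx
  | zero => intro i; exact O.zero_mem
  | add x y _ _ hx hy => intro i; exact O.add_mem (hx i) (hy i)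
  | smul a x _ hx => intro i; exact O.mul_mem a.2 (hx i)

open Filter in
/-- The gap theorem: a gap between the last two (limit) minima forces the hyperplane to be fixed. -/
lemma gap [Nonempty W] (hG : Geo O av) (n : ℕ) (L : W ⊕ S → Matrix (Fin (n+2)) (Fin (n+2)) ℤ)
    (hL : ∀ v, (L v).det ≠ 0) {ι : Type*} (F : Ultrafilter ι) (q : ι → ℝ) (hq : Tendsto q F atTop)
    (c : W ⊕ S → Fin (n+2) → ℝ) (l : ℕ → ℝ) (hl : ∀ i j, i ≤ j → j < n+2 → l i ≤ l j)
    (hgap : l n < l (n+1)) (hsum : ∑ v, ∑ i, c v i + Fintype.card W * ∑ j ∈ range (n+2), l j ≤ 0)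
    (b : ι → ℕ → Fin (n+2) → K)
    (hfr : ∀ᶠ t in (F : Filter ι), ∀ j ≤ n+2, Module.finrank K (Submodule.span K (b t '' Set.Iio j)) = j)
    (hb : ∀ ε : ℝ, 0 < ε → ∀ᶠ t in (F : Filter ι), ∀ j < n+2, (∀ i, b t j i ∈ O) ∧
      (∀ s i, av (Sum.inr s) (lf (L (Sum.inr s)) i (b t j)) ≤ Real.exp ((c (Sum.inr s) i + ε) * q t)) ∧
      ∀ w i, av (Sum.inl w) (lf (L (Sum.inl w)) i (b t j)) ≤ Real.exp ((c (Sum.inl w) i + l j + ε) * q t)) :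
    ∃ a : Fin (n+2) → K, a ≠ 0 ∧ ∀ᶠ t in (F : Filter ι), ∀ j < n+1, ∑ i, a i * b t j i = 0 := by
  classical
  obtain ⟨C, hC1, hred⟩ := reduce hG (n+2)
  set D : ℝ := Fintype.card (W ⊕ S) * (n+2) with hD
  have hD1 : 0 ≤ D := by positivity
  set ε : ℝ := (l (n+1) - l n) / (4 * (D + 1)) with hε
  have hε0 : 0 < ε := div_pos (by linarith) (by positivity)
  have hεD : 2 * ε * D < l (n+1) - l n := by
    have h1 : ε * (4 * (D + 1)) = l (n+1) - l n := by rw [hε]; field_simp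
    nlinarith
  have hCε := ev_small F q hq (-ε) (by linarith) C
  have hq0 : ∀ᶠ t in (F : Filter ι), 0 < q t := hq.eventually_gt_atTop 0
  -- reduced bases
  have hex : ∀ t, ∃ (π : W → Equiv.Perm (Fin (n+2))) (y : ℕ → Fin (n+2) → K), 0 < q t →
      (∀ j ≤ n+2, Module.finrank K (Submodule.span K (b t '' Set.Iio j)) = j) →
      (∀ j < n+2, (∀ i, b t j i ∈ O) ∧
      (∀ s i, av (Sum.inr s) (lf (L (Sum.inr s)) i (b t j)) ≤ Real.exp ((c (Sum.inr s) i + ε) * q t)) ∧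
      ∀ w i, av (Sum.inl w) (lf (L (Sum.inl w)) i (b t j)) ≤ Real.exp ((c (Sum.inl w) i + l j + ε) * q t)) →
      ∀ j < n+2, y j - b t j ∈ Submodule.span O (b t '' Set.Iio j) ∧
        ∀ w, ∀ i : Fin (n+2), av (Sum.inl w) (lf (L (Sum.inl w)) (π w i) (y j)) ≤
          C * Real.exp ((c (Sum.inl w) (π w i) + l (min i j) + ε) * q t) := by
    intro t
    by_cases h : 0 < q t ∧ (∀ j ≤ n+2, Module.finrank K (Submodule.span K (b t '' Set.Iio j)) = j) ∧
      (∀ j < n+2, (∀ i, b t j i ∈ O) ∧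
      (∀ s i, av (Sum.inr s) (lf (L (Sum.inr s)) i (b t j)) ≤ Real.exp ((c (Sum.inr s) i + ε) * q t)) ∧
      ∀ w i, av (Sum.inl w) (lf (L (Sum.inl w)) i (b t j)) ≤ Real.exp ((c (Sum.inl w) i + l j + ε) * q t))
    · obtain ⟨h0, h1, h2⟩ := h
      obtain ⟨π, y, hy⟩ := hred L hL (fun w i => Real.exp (c (Sum.inl w) i * q t)) (fun _ _ => Real.exp_pos _)
        (b t) (fun j => Real.exp ((l j + ε) * q t)) (fun _ _ => Real.exp_pos _)
        (fun i j hij hj => Real.exp_le_exp.2 (mul_le_mul_of_nonneg_right (by linarith [hl i j hij hj]) h0.le)) h1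
        (fun j hj w i => by
          refine ((h2 j hj).2.2 w i).trans (le_of_eq ?_)
          rw [← Real.exp_add]; ring_nf)
      refine ⟨π, y, fun _ _ _ j hj => ⟨(hy j hj).1, fun w i => ((hy j hj).2 w i).trans (le_of_eq ?_)⟩⟩
      rw [← Real.exp_add]; ring_nf
    · refine ⟨fun _ => 1, 0, fun h0 h1 h2 => absurd ⟨h0, h1, h2⟩ h⟩
  choose π y hy using hex
  obtain ⟨π0, hπ0⟩ := ultra_const F π
  set c' : W ⊕ S → Fin (n+2) → ℝ := fun v => Sum.elim
    (fun w i => c (Sum.inl w) i + l (min ((π0 w).symm i) n) + 2 * ε) (fun s i => c (Sum.inr s) i + 2 * ε) v with hc'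
  have hc'sum : ∑ v, ∑ i, c' v i < 0 := by
    have h1 : ∀ w, ∑ i, c' (Sum.inl w) i = ∑ i, c (Sum.inl w) i + (∑ j ∈ range (n+2), l j - (l (n+1) - l n)) + (n+2) * (2*ε) := by
      intro w
      simp only [hc', Sum.elim_inl]
      rw [Finset.sum_add_distrib, Finset.sum_add_distrib,
        Equiv.sum_comp (π0 w).symm (fun i : Fin (n+2) => l (min (i:ℕ) n)),
        Fin.sum_univ_eq_sum_range (fun i => l (min i n)), Finset.sum_range_succ, Finset.sum_range_succ _ (n+1),
        Finset.sum_congr rfl (fun i hi => by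
          rw [min_eq_left (by have := Finset.mem_range.1 hi; omega)] : ∀ i ∈ range (n+1), l (min i n) = l i)]
      simp
      ring
    have h2 : ∀ s, ∑ i, c' (Sum.inr s) i = ∑ i, c (Sum.inr s) i + (n+2) * (2*ε) := by
      intro s
      simp only [hc', Sum.elim_inr]
      rw [Finset.sum_add_distrib]; simp
    rw [Fintype.sum_sum_type, Finset.sum_congr rfl fun w _ => h1 w, Finset.sum_congr rfl fun s _ => h2 s]
    rw [Fintype.sum_sum_type] at hsum
    simp only [Finset.sum_add_distrib, Finset.sum_const, Finset.card_univ, nsmul_eq_mul]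
    have hDD : D = (Fintype.card W + Fintype.card S) * (n+2) := by rw [hD, Fintype.card_sum]; push_cast; ring
    have hW : (1:ℝ) ≤ Fintype.card W := by exact_mod_cast Fintype.card_pos
    have h3 : 0 ≤ (Fintype.card W - 1) * (l (n+1) - l n) := mul_nonneg (by linarith) (by linarith)
    rw [hDD] at hεD
    nlinarith
  have hCe : ∀ t, C * Real.exp (-ε * q t) < 1 → ∀ x : ℝ, C * Real.exp ((x + ε) * q t) ≤ Real.exp ((x + 2 * ε) * q t) := by
    intro t ht x
    have : (x + ε) * q t = -ε * q t + (x + 2 * ε) * q t := by ring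
    rw [this, Real.exp_add, ← mul_assoc]
    exact mul_le_of_le_one_left (Real.exp_pos _).le ht.le
  have hmain : ∀ᶠ t in (F : Filter ι), (∀ j < n+1, y t j - b t j ∈ Submodule.span O (b t '' Set.Iio j)) ∧
      LinearIndependent K (fun j : Fin (n+1) => y t j) ∧
      (∀ (j : Fin (n+1)) (i : Fin (n+2)), y t j i ∈ O) ∧ ∀ v (j : Fin (n+1)) (i : Fin (n+2)),
        av v (∑ i', (L v i i' : K) * y t j i') ≤ Real.exp (c' v i * q t) := by
    filter_upwards [hCε, hq0, hfr, hb ε hε0, hπ0] with t h1 h2 h3 h4 h5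
    have h6 := hy t h2 h3 h4
    have hmem : ∀ j < n+2, y t j ∈ Submodule.span O (b t '' Set.Iio (n+2)) := by
      intro j hj
      have e1 : y t j - b t j ∈ Submodule.span O (b t '' Set.Iio (n+2)) :=
          Submodule.span_mono (Set.image_mono (Set.Iio_subset_Iio (by omega))) (h6 j hj).1
      have e2 : b t j ∈ Submodule.span O (b t '' Set.Iio (n+2)) := Submodule.subset_span ⟨j, hj, rfl⟩
      have := Submodule.add_mem _ e1 e2
      simpa using this
    refine ⟨fun j hj => (h6 j (by omega)).1, ?_, ?_, ?_⟩
    · have e1 := tri_span O (b t) (y t) (n+1) (fun k hk => (h6 k (by omega)).1)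
      rw [linearIndependent_iff_card_le_finrank_span, Fintype.card_fin]
      have hrange : y t '' Set.Iio (n+1) = Set.range (fun i : Fin (n+1) => y t i) := by
        ext a; constructor
        · rintro ⟨k, hk, rfl⟩; exact ⟨⟨k, hk⟩, rfl⟩
        · rintro ⟨k, rfl⟩; exact ⟨k, k.2, rfl⟩
      rw [hrange] at e1
      have e2 := Submodule.finrank_mono e1
      rw [h3 (n+1) (by omega)] at e2
      exact e2
    · intro j
      exact O_span _ (by rintro _ ⟨k, hk, rfl⟩; exact (h4 k hk).1) _ (hmem j (by omega))
    · rintro (w | s) j i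
      · have e1 := (h6 j (by omega)).2 w ((π t w).symm i)
        rw [Equiv.apply_symm_apply, lf_apply] at e1
        refine e1.trans ((hCe t h1 _).trans ?_)
        rw [Real.exp_le_exp]
        apply mul_le_mul_of_nonneg_right _ h2.le
        simp only [hc', Sum.elim_inl]
        rw [h5]
        have := hl (min ((π0 w).symm i) j) (min ((π0 w).symm i) n) (by omega) (by omega)
        linarith
      · rw [← lf_apply]
        refine (ultra_span hG s (lf (L (Sum.inr s)) i) _ (Real.exp ((c (Sum.inr s) i + ε) * q t))
          (Real.exp_pos _).le ?_ _ (hmem j (by omega))).trans ?_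
        · rintro _ ⟨k, hk, rfl⟩; exact (h4 k hk).2.1 s i
        · rw [Real.exp_le_exp]
          apply mul_le_mul_of_nonneg_right _ h2.le
          simp only [hc', Sum.elim_inr]
          linarith
  obtain ⟨a, ha0, ha⟩ := thmA O av hG.pf hG.hr L hL c' hc'sum F q hq (fun t (j : Fin (n+1)) => y t j)
    (hmain.mono fun t h => h.2)
  refine ⟨a, ha0, ?_⟩
  filter_upwards [ha, hmain] with t h1 h2 j hj
  have e1 := tri_span O (b t) (y t) (n+1) (fun k hk => h2.1 k (by omega))
  have e2 : b t j ∈ Submodule.span K (y t '' Set.Iio (n+1)) := e1 (Submodule.subset_span ⟨j, hj, rfl⟩)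
  have : ∀ x ∈ Submodule.span K (y t '' Set.Iio (n+1)), ∑ i, a i * x i = 0 := by
    intro x hx
    induction hx using Submodule.span_induction with
    | mem x hx => obtain ⟨k, hk, rfl⟩ := hx; exact h1 ⟨k, hk⟩
    | zero => simp
    | add x y _ _ hx hy => simp only [Pi.add_apply, mul_add, Finset.sum_add_distrib, hx, hy, add_zero]
    | smul r x _ hx =>
      have : ∑ i, a i * (r • x) i = r * ∑ i, a i * x i := by
        rw [Finset.mul_sum]; exact Finset.sum_congr rfl fun i _ => by simp; ring
      rw [this, hx, mul_zero]
  exact this _ e2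

end
end Sub15

set_option linter.unusedVariables false
set_option linter.unusedSectionVars false
set_option linter.style.longLine false
namespace Sub15
noncomputable section
open Finset

/-- index set of the exterior power -/
abbrev PI (N p : ℕ) := Set.powersetCard (Fin N) p

/-- increasing enumeration -/
abbrev en {N p : ℕ} (s : PI N p) : Fin p ↪o Fin N := Set.powersetCard.ofFinEmbEquiv.symm s

section ring
variable {R : Type*} [CommRing R] {N p : ℕ}

/-- compound matrix -/
def cpd (p : ℕ) (M : Matrix (Fin N) (Fin N) R) : Matrix (PI N p) (PI N p) R :=
  fun s t => (Matrix.of fun i j => M (en s i) (en t j)).det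

/-- Plücker coordinates -/
def plk (v : Fin p → Fin N → R) (s : PI N p) : R := (Matrix.of fun i j => v i (en s j)).det

lemma plk_repr (v : Fin p → Fin N → R) (s : PI N p) :
    plk v s = ((Pi.basisFun R (Fin N)).exteriorPower p).repr (exteriorPower.ιMulti R p v) s := by
  rw [exteriorPower.basis_repr_apply, exteriorPower.ιMultiDual_apply_ιMulti]
  simp [plk]

lemma cauchy_binet (M : Matrix (Fin N) (Fin N) R) (v : Fin p → Fin N → R) (s : PI N p) :
    plk (fun i => M.mulVec (v i)) s = ∑ t, cpd p M s t * plk v t := by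
  have h1 : exteriorPower.ιMulti R p (fun i => M.mulVec (v i)) =
      exteriorPower.map p M.mulVecLin (exteriorPower.ιMulti R p v) := by
    rw [exteriorPower.map_apply_ιMulti]; rfl
  rw [plk_repr, h1]
  have h2 := ((Pi.basisFun R (Fin N)).exteriorPower p).sum_repr (exteriorPower.ιMulti R p v)
  conv_lhs => rw [← h2]
  rw [map_sum, map_sum, Finsupp.finsetSum_apply]
  refine Finset.sum_congr rfl fun t _ => ?_
  rw [map_smul, map_smul, Finsupp.smul_apply, ← plk_repr, smul_eq_mul, mul_comm]
  congr 1
  rw [exteriorPower.basis_apply, exteriorPower.ιMulti_family, exteriorPower.map_apply_ιMulti, ← plk_repr]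
  rw [plk, cpd, ← Matrix.det_transpose]
  congr 1
  ext i j
  simp

lemma cpd_mul (A B : Matrix (Fin N) (Fin N) R) : cpd p (A * B) = cpd p A * cpd p B := by
  ext s t
  rw [Matrix.mul_apply]
  have h := cauchy_binet A (fun i : Fin p => fun k => B k (en t i)) s
  have e1 : ∀ C : Matrix (Fin N) (Fin N) R, ∀ u, plk (fun i : Fin p => fun k => C k (en t i)) u = cpd p C u t := by
    intro C u
    rw [plk, cpd, ← Matrix.det_transpose]; rfl
  simp only [e1] at h
  rw [← h, ← e1]
  rfl

lemma cpd_one : cpd p (1 : Matrix (Fin N) (Fin N) R) = 1 := by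
  ext s t
  have h : cpd p (1 : Matrix (Fin N) (Fin N) R) s t = plk (fun i : Fin p => Pi.single (en t i) (1:R)) s := by
    rw [plk, cpd, ← Matrix.det_transpose]
    congr 1
    ext i j
    simp [Matrix.one_apply, Pi.single_apply]
  rw [h, plk_repr]
  have : exteriorPower.ιMulti R p (fun i : Fin p => Pi.single (en t i) (1:R)) =
      exteriorPower.ιMulti_family R p (Pi.basisFun R (Fin N)) t := by
    rw [exteriorPower.ιMulti_family]
    congr 1
    ext i; simp
  rw [this, exteriorPower.basis_repr, Matrix.one_apply, Finsupp.single_apply]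
  congr 1
  exact propext eq_comm

lemma cpd_det_ne {L : Matrix (Fin N) (Fin N) ℤ} (h : L.det ≠ 0) : (cpd p L).det ≠ 0 := by
  have h1 : cpd p L * cpd p L.adjugate = L.det ^ p • 1 := by
    rw [← cpd_mul, Matrix.mul_adjugate, ← cpd_one]
    ext s t
    rw [Matrix.smul_apply, cpd, cpd]
    have : (Matrix.of fun i j => (L.det • (1 : Matrix (Fin N) (Fin N) ℤ)) (en s i) (en t j)) =
      L.det • (Matrix.of fun i j => (1 : Matrix (Fin N) (Fin N) ℤ) (en s i) (en t j)) := by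
      ext i j; simp
    rw [this, Matrix.det_smul]; simp
  intro h0
  have h2 := congrArg Matrix.det h1
  rw [Matrix.det_mul, h0, zero_mul, Matrix.det_smul, Matrix.det_one, mul_one] at h2
  exact pow_ne_zero _ (pow_ne_zero _ h) h2.symm

lemma cpd_map {R' : Type*} [CommRing R'] (f : R →+* R') (M : Matrix (Fin N) (Fin N) R) (s t : PI N p) :
    cpd p (M.map f) s t = f (cpd p M s t) := by
  rw [cpd, cpd, RingHom.map_det]; rfl

end ring

section field
variable {K : Type*} [Field K] {N p : ℕ}

lemma plk_indep (b : Fin N → Fin N → K) (h : LinearIndependent K b) :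
    LinearIndependent K (fun s : PI N p => plk (fun i => b (en s i))) := by
  have h1 := exteriorPower.ιMulti_family_linearIndependent_field (n := p) h
  have h2 := h1.map' ((Pi.basisFun K (Fin N)).exteriorPower p).equivFun.toLinearMap (LinearEquiv.ker _)
  have e : (fun s : PI N p => plk (fun i => b (en s i))) =
      (((Pi.basisFun K (Fin N)).exteriorPower p).equivFun.toLinearMap ∘ exteriorPower.ιMulti_family K p b) := by
    funext s t
    rw [plk_repr]; rfl
  rw [e]
  exact h2

lemma sum_en (κ : ℕ) (hκ : κ = (N-1).choose (p-1)) (hp : 0 < p) (f : Fin N → ℝ) :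
    ∑ s : PI N p, ∑ k, f (en s k) = κ * ∑ i, f i := by
  classical
  have h1 : ∀ s : PI N p, ∑ k, f (en s k) = ∑ i, if i ∈ (s : Finset (Fin N)) then f i else 0 := by
    intro s
    rw [← Finset.sum_filter]
    have : (univ.filter fun i => i ∈ (s : Finset (Fin N))) = univ.map (en s).toEmbedding := by
      ext i
      have := Set.powersetCard.mem_range_ofFinEmbEquiv_symm_iff_mem s i
      simp only [Finset.mem_filter, Finset.mem_univ, true_and, Finset.mem_map]
      rw [← Set.powersetCard.mem_coe_iff] at *
      rw [← this]; rfl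
    rw [this, Finset.sum_map]; rfl
  rw [Finset.sum_congr rfl fun s _ => h1 s, Finset.sum_comm, Finset.mul_sum]
  refine Finset.sum_congr rfl fun i _ => ?_
  rw [← Finset.sum_filter, Finset.sum_const, nsmul_eq_mul]
  congr 2
  rw [hκ]
  have h2 : ((Finset.powersetCard (p-1) (univ.erase i)).card) = (N-1).choose (p-1) := by
    rw [Finset.card_powersetCard, Finset.card_erase_of_mem (Finset.mem_univ i)]; simp
  rw [← h2]
  refine Finset.card_bij (fun s _ => (s : Finset (Fin N)).erase i) ?_ ?_ ?_
  · intro s hs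
    have hs := (Finset.mem_filter.1 hs).2
    rw [Finset.mem_powersetCard]
    refine ⟨Finset.erase_subset_erase _ (Finset.subset_univ _), ?_⟩
    rw [Finset.card_erase_of_mem hs]
    have : (s : Finset (Fin N)).card = p := s.2
    omega
  · intro s hs t ht h
    have hs := (Finset.mem_filter.1 hs).2
    have ht := (Finset.mem_filter.1 ht).2
    apply Subtype.ext
    rw [← Finset.insert_erase hs, ← Finset.insert_erase ht, h]
  · intro u hu
    rw [Finset.mem_powersetCard] at hu
    have hi : i ∉ u := fun h => by simpa using hu.1 h
    refine ⟨⟨insert i u, ?_⟩, ?_, ?_⟩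
    · change (insert i u).card = p
      rw [Finset.card_insert_of_notMem hi]; omega
    · simp
    · simp [hi]

end field
end
end Sub15

set_option linter.unusedVariables false
set_option linter.unusedSectionVars false
set_option linter.style.longLine false
namespace Sub15
noncomputable section
open Finset Filter

variable {K : Type*} [Field K]
variable {W S : Type*} [Fintype W] [Fintype S] [CharZero K] {O : Subring K}
  {av : W ⊕ S → AbsoluteValue K ℝ}

lemma ultra_lim {ι : Type*} (F : Ultrafilter ι) (f : ι → ℝ) (a b : ℝ)
    (h : ∀ᶠ t in (F : Filter ι), f t ∈ Set.Icc a b) : ∃ x, Tendsto f F (nhds x) := by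
  obtain ⟨x, _, hx⟩ := (isCompact_Icc (a := a) (b := b)).ultrafilter_le_nhds (F.map f)
    (by rw [Filter.le_principal_iff]; exact h)
  exact ⟨x, hx⟩

/-- lower bound for the sum of the limit minima -/
lemma lim_lower (hG : Geo O av) {N : ℕ} (L : W ⊕ S → Matrix (Fin N) (Fin N) ℤ)
    (hL : ∀ v, (L v).det ≠ 0) {ι : Type*} (F : Ultrafilter ι) (q : ι → ℝ) (hq : Tendsto q F atTop)
    (c : W ⊕ S → Fin N → ℝ) (l : ℕ → ℝ) (b : ι → ℕ → Fin N → K)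
    (hfr : ∀ᶠ t in (F : Filter ι), LinearIndependent K (fun j : Fin N => b t j))
    (hb : ∀ ε : ℝ, 0 < ε → ∀ᶠ t in (F : Filter ι), ∀ j < N, (∀ i, b t j i ∈ O) ∧
      (∀ s i, av (Sum.inr s) (lf (L (Sum.inr s)) i (b t j)) ≤ Real.exp ((c (Sum.inr s) i + ε) * q t)) ∧
      ∀ w i, av (Sum.inl w) (lf (L (Sum.inl w)) i (b t j)) ≤ Real.exp ((c (Sum.inl w) i + l j + ε) * q t)) :
    0 ≤ ∑ v, ∑ i, c v i + Fintype.card W * ∑ j ∈ range N, l j := by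
  classical
  by_contra hneg
  push Not at hneg
  set σ := ∑ v, ∑ i, c v i + Fintype.card W * ∑ j ∈ range N, l j with hσ
  set D : ℝ := Fintype.card (W ⊕ S) * N with hD
  have hD0 : 0 ≤ D := by positivity
  set ε : ℝ := -σ / (2 * (D + 1)) with hε
  have hε0 : 0 < ε := div_pos (by linarith) (by positivity)
  have hεD : σ + D * ε < 0 := by
    have h1 : ε * (2 * (D + 1)) = -σ := by rw [hε]; field_simp
    nlinarith
  set C : ℝ := ∏ v, ((N.factorial : ℝ) / av v ((L v).det : K)) with hC
  have hLK : ∀ v, 0 < av v ((L v).det : K) := fun v => (av v).pos (by exact_mod_cast hL v)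
  obtain ⟨t, h1, h2, h3⟩ := (hfr.and ((hb ε hε0).and (ev_small F q hq _ hεD C))).exists
  set lv : W ⊕ S → ℝ := Sum.elim (fun _ => ∑ j ∈ range N, l j) (fun _ => 0) with hlv
  have hdet : (Matrix.of fun j : Fin N => b t j).det ≠ 0 := by
    have := (Matrix.linearIndependent_rows_iff_isUnit (A := Matrix.of fun j : Fin N => b t j)).1 h1
    exact ((Matrix.isUnit_iff_isUnit_det _).1 this).ne_zero
  have hO : (Matrix.of fun j : Fin N => b t j).det ∈ O := det_mem O _ fun i j => (h2 i i.2).1 j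
  have hpf := hG.pf _ hO hdet
  have hv : ∀ v, av v (Matrix.of fun j : Fin N => b t j).det ≤
      ((N.factorial : ℝ) / av v ((L v).det : K)) * Real.exp ((∑ i, c v i + lv v + N * ε) * q t) := by
    intro v
    rw [div_mul_eq_mul_div, le_div_iff₀ (hLK v), mul_comm, ← map_mul]
    have e1 : ((L v).det : K) * (Matrix.of fun j : Fin N => b t j).det =
        (Matrix.of fun i j : Fin N => lf (L v) i (b t j)).det := by
      rw [← Matrix.det_transpose (Matrix.of fun j : Fin N => b t j)]
      have : ((L v).det : K) = ((L v).map (Int.castRingHom K)).det := by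
        rw [← RingHom.mapMatrix_apply, ← RingHom.map_det]; rfl
      rw [this, ← Matrix.det_mul]
      congr 1
      ext i j
      simp [Matrix.mul_apply, lf_apply]
    rw [e1]
    have := av_det_le (av v) (Matrix.of fun i j : Fin N => lf (L v) i (b t j))
      (Real.exp ((∑ i, c v i + lv v + N * ε) * q t)) ?_
    · simpa using this
    intro τ
    have hle : ∀ j : Fin N, av v (lf (L v) (τ j) (b t j)) ≤
        Real.exp ((c v (τ j) + (Sum.elim (fun _ => l j) (fun _ => 0) v : ℝ) + ε) * q t) := by
      intro j
      rcases v with w | s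
      · exact (h2 j j.2).2.2 w _
      · simpa using (h2 j j.2).2.1 s _
    refine (Finset.prod_le_prod (fun _ _ => (av v).nonneg _) fun j _ => hle j).trans ?_
    rw [← Real.exp_sum, ← Finset.sum_mul, Finset.sum_add_distrib, Finset.sum_add_distrib,
      Equiv.sum_comp τ (fun i => c v i)]
    apply le_of_eq
    congr 2
    simp only [Finset.sum_const, Finset.card_univ, Fintype.card_fin, nsmul_eq_mul]
    congr 2
    rcases v with w | s
    · simp [hlv, Finset.sum_range]
    · simp [hlv]
  have := hpf.trans (Finset.prod_le_prod (fun _ _ => (av _).nonneg _) fun v _ => hv v)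
  rw [Finset.prod_mul_distrib, ← Real.exp_sum, ← Finset.sum_mul] at this
  have e : ∑ v, (∑ i, c v i + lv v + N * ε) = σ + D * ε := by
    rw [Finset.sum_add_distrib, Finset.sum_add_distrib, hσ, hD]
    have : ∑ v, lv v = Fintype.card W * ∑ j ∈ range N, l j := by
      simp [hlv, Fintype.sum_sum_type]
    rw [this]
    simp only [Finset.sum_const, Finset.card_univ, nsmul_eq_mul]; ring
  rw [e] at this
  linarith

lemma indep_of_finrank {N : ℕ} (b : ℕ → Fin N → K)
    (h : Module.finrank K (Submodule.span K (b '' Set.Iio N)) = N) :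
    LinearIndependent K (fun j : Fin N => b j) := by
  rw [linearIndependent_iff_card_eq_finrank_span, Fintype.card_fin]
  have : Set.range (fun j : Fin N => b j) = b '' Set.Iio N := by
    ext x; constructor
    · rintro ⟨j, rfl⟩; exact ⟨j, j.2, rfl⟩
    · rintro ⟨j, hj, rfl⟩; exact ⟨⟨j, hj⟩, rfl⟩
  rw [Set.finrank, this, h]

lemma base_lim [Nonempty W] (hG : Geo O av) {N : ℕ} (hN : 0 < N) (L : W ⊕ S → Matrix (Fin N) (Fin N) ℤ)
    (hL : ∀ v, (L v).det ≠ 0) {ι : Type*} (F : Ultrafilter ι) (q : ι → ℝ) (hq : Tendsto q F atTop)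
    (c : W ⊕ S → Fin N → ℝ) (hc : ∀ s i, c (Sum.inr s) i ≤ 0) :
    ∃ (l : ℕ → ℝ) (b : ι → ℕ → Fin N → K), (∀ i j, i ≤ j → j < N → l i ≤ l j) ∧
    (∀ᶠ t in (F : Filter ι), ∀ j ≤ N, Module.finrank K (Submodule.span K (b t '' Set.Iio j)) = j) ∧
    (∀ ε : ℝ, 0 < ε → ∀ᶠ t in (F : Filter ι), ∀ j < N, (∀ i, b t j i ∈ O) ∧
      (∀ s i, av (Sum.inr s) (lf (L (Sum.inr s)) i (b t j)) ≤ Real.exp ((c (Sum.inr s) i + ε) * q t)) ∧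
      ∀ w i, av (Sum.inl w) (lf (L (Sum.inl w)) i (b t j)) ≤ Real.exp ((c (Sum.inl w) i + l j + ε) * q t)) ∧
    (∑ v, ∑ i, c v i + Fintype.card W * ∑ j ∈ range N, l j ≤ 0) ∧
    (0 ≤ ∑ v, ∑ i, c v i + Fintype.card W * ∑ j ∈ range N, l j) ∧
    ∀ x : ι → Fin N → K, (∀ᶠ t in (F : Filter ι), (∀ i, x t i ∈ O) ∧ ∀ v i, av v (lf (L v) i (x t)) ≤ Real.exp (c v i * q t)) →
      ∀ j < N, 0 < l j → ∀ᶠ t in (F : Filter ι), x t ∈ Submodule.span K (b t '' Set.Iio j) := by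
  classical
  obtain ⟨C1, hC1, hlow⟩ := low_nrm hG L hL
  obtain ⟨C, hC, hbase⟩ := base hG hN L hL
  have hex : ∀ t, ∃ (b : ℕ → Fin N → K) (lam : ℕ → ℝ), 0 < q t → 
      (∀ j ≤ N, Module.finrank K (Submodule.span K (b '' Set.Iio j)) = j) ∧
      (∀ j < N, (∀ i, b j i ∈ O) ∧ (∀ s i, av (Sum.inr s) (lf (L (Sum.inr s)) i (b j)) ≤ Real.exp (c (Sum.inr s) i * q t)) ∧
        (∀ w i, av (Sum.inl w) (lf (L (Sum.inl w)) i (b j)) ≤ Real.exp (c (Sum.inl w) i * q t) * (2 * lam j)) ∧ 0 < lam j ∧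
        ∀ x : Fin N → K, (∀ i, x i ∈ O) → (∀ s i, av (Sum.inr s) (lf (L (Sum.inr s)) i x) ≤ Real.exp (c (Sum.inr s) i * q t)) →
          x ∉ Submodule.span K (b '' Set.Iio j) → ∀ μ : ℝ, (∀ w i, av (Sum.inl w) (lf (L (Sum.inl w)) i x) ≤ Real.exp (c (Sum.inl w) i * q t) * μ) →
            lam j ≤ C * μ) ∧
      (∀ i j, i ≤ j → j < N → lam i ≤ lam j) ∧
      (∏ j ∈ range N, lam j) ^ Fintype.card W * ∏ v, ∏ i, Real.exp (c v i * q t) ≤ C := by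
    intro t
    by_cases ht : 0 < q t
    · obtain ⟨b, lam, V, hV, h1, h2, h3, h4⟩ := hbase (fun v i => Real.exp (c v i * q t))
        (fun _ _ => Real.exp_pos _) (fun s i => by
          rw [Real.exp_le_one_iff]; exact mul_nonpos_of_nonpos_of_nonneg (hc s i) ht.le)
      obtain rfl : V = fun j => Submodule.span K (b '' Set.Iio j) := funext hV
      exact ⟨b, lam, fun _ => ⟨h1, h2, h3, h4⟩⟩
    · exact ⟨0, 0, fun h => absurd h ht⟩
  choose b lam hbl using hex
  have hq0 : ∀ᶠ t in (F : Filter ι), 0 < q t := hq.eventually_gt_atTop 0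
  set cm : ℝ := ∑ v, ∑ i, |c v i| with hcm
  have hcle : ∀ v i, c v i ≤ cm := by
    intro v i
    refine (le_abs_self _).trans ?_
    refine (Finset.single_le_sum (f := fun i => |c v i|) (fun _ _ => abs_nonneg _) (Finset.mem_univ i)).trans ?_
    exact Finset.single_le_sum (f := fun v => ∑ i, |c v i|) (fun _ _ => Finset.sum_nonneg fun _ _ => abs_nonneg _) (Finset.mem_univ v)
  set σ := ∑ v, ∑ i, c v i with hσ
  have hlogsum : ∀ t, 0 < q t → Fintype.card W * ∑ j ∈ range N, Real.log (lam t j) + σ * q t ≤ Real.log C := by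
    intro t ht
    obtain ⟨-, h2, -, h4⟩ := hbl t ht
    have hpos : ∀ j ∈ range N, lam t j ≠ 0 := fun j hj => (h2 j (Finset.mem_range.1 hj)).2.2.2.1.ne'
    have hprod : ∏ j ∈ range N, lam t j ≠ 0 := Finset.prod_ne_zero_iff.2 hpos
    have e1 : ∏ v, ∏ i, Real.exp (c v i * q t) = Real.exp (σ * q t) := by
      simp_rw [← Real.exp_sum, ← Finset.sum_mul]; rfl
    rw [e1] at h4
    have hpp : 0 < ∏ j ∈ range N, lam t j := Finset.prod_pos fun j hj => (h2 j (Finset.mem_range.1 hj)).2.2.2.1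
    have := Real.log_le_log (by positivity) h4
    rw [Real.log_mul (by positivity) (Real.exp_pos _).ne', Real.log_exp, Real.log_pow, Real.log_prod hpos] at this
    exact this
  have hlo : ∀ᶠ t in (F : Filter ι), ∀ j < N, -(cm + 1) * q t ≤ Real.log (lam t j) := by
    filter_upwards [hq0, hq.eventually_ge_atTop (Real.log (C1 * 2))] with t ht ht2 j hj
    obtain ⟨h1, h2, -, -⟩ := hbl t ht
    obtain ⟨hO, -, hw, hl0, -⟩ := h2 j hj
    have hne : b t j ≠ 0 := (indep_of_finrank _ (h1 N le_rfl)).ne_zero ⟨j, hj⟩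
    have := hlow (fun w i => Real.exp (c (Sum.inl w) i * q t)) (Real.exp (cm * q t)) (2 * lam t j) (by positivity)
      (fun w i => by rw [Real.exp_le_exp]; exact mul_le_mul_of_nonneg_right (hcle _ _) ht.le)
      (fun _ _ => Real.exp_pos _) (b t j) hne hO hw
    have h5 := Real.log_le_log one_pos this
    have e : C1 * Real.exp (cm * q t) * (2 * lam t j) = (C1 * 2) * Real.exp (cm * q t) * lam t j := by ring
    rw [e, Real.log_mul (by positivity) hl0.ne', Real.log_mul (by positivity) (by positivity), Real.log_exp, Real.log_one] at h5
    linarith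
  have hW : (1:ℝ) ≤ Fintype.card W := by exact_mod_cast Fintype.card_pos
  have hcm0 : 0 ≤ cm := Finset.sum_nonneg fun _ _ => Finset.sum_nonneg fun _ _ => abs_nonneg _
  set B : ℝ := 1 + |σ| + N * (cm + 1) with hB
  have hup : ∀ᶠ t in (F : Filter ι), ∀ j < N, Real.log (lam t j) ≤ B * q t := by
    filter_upwards [hq0, hlo, hq.eventually_ge_atTop (Real.log C)] with t ht hlo ht2 j hj
    have h1 := hlogsum t ht
    have h2 : ∑ i ∈ range N, Real.log (lam t i) ≤ (1 + |σ|) * q t := by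
      by_cases h0 : 0 ≤ ∑ i ∈ range N, Real.log (lam t i)
      · have := le_mul_of_one_le_left h0 hW
        nlinarith [neg_abs_le σ]
      · push Not at h0
        have : 0 ≤ (1 + |σ|) * q t := by positivity
        linarith
    have h3 : ∑ i ∈ (range N).erase j, Real.log (lam t i) ≥ ∑ i ∈ (range N).erase j, (-(cm + 1) * q t) :=
      Finset.sum_le_sum fun i hi => hlo i (Finset.mem_range.1 (Finset.mem_of_mem_erase hi))
    rw [Finset.sum_const, nsmul_eq_mul] at h3
    have h4 : (((range N).erase j).card : ℝ) ≤ N := by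
      exact_mod_cast (Finset.card_le_card (Finset.erase_subset _ _)).trans (by simp)
    have h5 := Finset.add_sum_erase (range N) (fun i => Real.log (lam t i)) (Finset.mem_range.2 hj)
    have h6 : (((range N).erase j).card : ℝ) * ((cm + 1) * q t) ≤ N * ((cm + 1) * q t) := by gcongr
    rw [hB]
    nlinarith
  have hlim : ∀ j, ∃ x, j < N → Tendsto (fun t => Real.log (lam t j) / q t) F (nhds x) := by
    intro j
    by_cases hj : j < N
    · obtain ⟨x, hx⟩ := ultra_lim F (fun t => Real.log (lam t j) / q t) (-(cm+1)) B (by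
        filter_upwards [hq0, hlo, hup] with t ht h1 h2
        exact ⟨(le_div_iff₀ ht).2 (h1 j hj), (div_le_iff₀ ht).2 (h2 j hj)⟩)
      exact ⟨x, fun _ => hx⟩
    · exact ⟨0, fun h => absurd h hj⟩
  choose l hl using hlim
  have hb : ∀ ε : ℝ, 0 < ε → ∀ᶠ t in (F : Filter ι), ∀ j < N, (∀ i, b t j i ∈ O) ∧
      (∀ s i, av (Sum.inr s) (lf (L (Sum.inr s)) i (b t j)) ≤ Real.exp ((c (Sum.inr s) i + ε) * q t)) ∧
      ∀ w i, av (Sum.inl w) (lf (L (Sum.inl w)) i (b t j)) ≤ Real.exp ((c (Sum.inl w) i + l j + ε) * q t) := by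
    intro ε hε
    have hl2 : ∀ᶠ t in (F : Filter ι), ∀ j ∈ range N, Real.log (lam t j) / q t < l j + ε / 2 := by
      rw [Filter.eventually_all_finset]
      intro j hj
      exact (hl j (Finset.mem_range.1 hj)).eventually_lt_const (by linarith)
    filter_upwards [hq0, hl2, ev_small F q hq (-(ε/2)) (by linarith) 2] with t ht h1 h2 j hj
    obtain ⟨-, h3, -, -⟩ := hbl t ht
    obtain ⟨hO, hs, hw, hl0, -⟩ := h3 j hj
    refine ⟨hO, fun s i => (hs s i).trans ?_, fun w i => (hw w i).trans ?_⟩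
    · rw [Real.exp_le_exp]; nlinarith
    · have h4 := h1 j (Finset.mem_range.2 hj)
      rw [div_lt_iff₀ ht] at h4
      have h5 : lam t j ≤ Real.exp ((l j + ε / 2) * q t) := by
        rw [← Real.log_le_iff_le_exp hl0]; exact h4.le
      have h6 : 2 ≤ Real.exp (ε / 2 * q t) := by
        have e : Real.exp (-(ε/2) * q t) = (Real.exp (ε / 2 * q t))⁻¹ := by rw [← Real.exp_neg]; ring_nf
        rw [e, ← div_eq_mul_inv, div_lt_one (Real.exp_pos _)] at h2
        exact h2.le
      calc _ ≤ Real.exp (c (Sum.inl w) i * q t) * (Real.exp (ε / 2 * q t) * Real.exp ((l j + ε / 2) * q t)) := by gcongr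
        _ = _ := by rw [← Real.exp_add, ← Real.exp_add]; congr 1; ring
  have hfr : ∀ᶠ t in (F : Filter ι), ∀ j ≤ N, Module.finrank K (Submodule.span K (b t '' Set.Iio j)) = j := by
    filter_upwards [hq0] with t ht
    exact (hbl t ht).1
  have hlogC : Tendsto (fun t => Real.log C / q t) F (nhds 0) := hq.const_div_atTop _
  refine ⟨l, b, ?_, hfr, hb, ?_, ?_, ?_⟩
  · intro i j hij hj
    refine le_of_tendsto_of_tendsto (hl i (by omega)) (hl j hj) ?_
    filter_upwards [hq0] with t ht
    obtain ⟨-, h3, h4, -⟩ := hbl t ht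
    exact div_le_div_of_nonneg_right (Real.log_le_log (h3 i (by omega)).2.2.2.1 (h4 i j hij hj)) ht.le
  · have h1 : Tendsto (fun t => σ + Fintype.card W * ∑ j ∈ range N, Real.log (lam t j) / q t) F
        (nhds (σ + Fintype.card W * ∑ j ∈ range N, l j)) :=
      tendsto_const_nhds.add (tendsto_const_nhds.mul (tendsto_finsetSum _ fun j hj => hl j (Finset.mem_range.1 hj)))
    refine le_of_tendsto_of_tendsto h1 hlogC ?_
    filter_upwards [hq0] with t ht
    rw [le_div_iff₀ ht, ← Finset.sum_div, add_mul, mul_assoc, div_mul_cancel₀ _ ht.ne']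
    linarith [hlogsum t ht]
  · exact lim_lower hG L hL F q hq c l b (by filter_upwards [hfr] with t ht using indep_of_finrank _ (ht N le_rfl)) hb
  · intro x hx j hj hlj
    have h1 := (hl j hj).eventually_const_lt (show l j / 2 < l j by linarith)
    have h2 := hlogC.eventually_lt_const (show 0 < l j / 2 by linarith)
    filter_upwards [hq0, hx, h1, h2] with t ht hx h1 h2
    by_contra hn
    obtain ⟨-, h3, -, -⟩ := hbl t ht
    obtain ⟨-, -, -, hl0, h4⟩ := h3 j hj
    have := h4 (x t) hx.1 (fun s i => hx.2 _ i) hn 1 (fun w i => by rw [mul_one]; exact hx.2 _ i)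
    rw [mul_one] at this
    have h5 := div_le_div_of_nonneg_right (Real.log_le_log hl0 this) ht.le
    linarith

end
end Sub15

set_option linter.unusedVariables false
set_option linter.unusedSectionVars false
set_option linter.style.longLine false
namespace Sub15
noncomputable section
open Finset Filter

variable {K : Type*} [Field K]

lemma en_mem {N p : ℕ} (s : PI N p) (i : Fin N) : i ∈ (s : Finset (Fin N)) ↔ ∃ k, en s k = i := by
  have := Set.powersetCard.mem_range_ofFinEmbEquiv_symm_iff_mem s i
  rw [← Set.powersetCard.mem_coe_iff] at this
  rw [← this]; rfl

lemma en_sum {N p : ℕ} (s : PI N p) (f : Fin N → ℝ) : ∑ k, f (en s k) = ∑ i ∈ (s : Finset (Fin N)), f i := by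
  have : (s : Finset (Fin N)) = univ.map (en s).toEmbedding := by
    ext i
    rw [en_mem]; simp
  rw [this, Finset.sum_map]; rfl

lemma en_of_strictMono {N p : ℕ} (g : Fin p → Fin N) (hg : StrictMono g) : ∃ s : PI N p, ∀ k, en s k = g k := by
  refine ⟨Set.powersetCard.ofFinEmbEquiv (OrderEmbedding.ofStrictMono g hg), fun k => ?_⟩
  simp [en]

lemma finrank_of_indep {M N : ℕ} (b : ℕ → Fin N → K) (h : LinearIndependent K (fun j : Fin M => b j)) :
    ∀ j ≤ M, Module.finrank K (Submodule.span K (b '' Set.Iio j)) = j := by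
  intro j hj
  have h1 : LinearIndependent K (fun i : Fin j => b i) := by
    have := h.comp (Fin.castLE hj) (Fin.castLE_injective hj)
    exact this
  have h2 := finrank_span_eq_card h1
  have : Set.range (fun i : Fin j => b i) = b '' Set.Iio j := by
    ext x; constructor
    · rintro ⟨j, rfl⟩; exact ⟨j, j.2, rfl⟩
    · rintro ⟨j, hj, rfl⟩; exact ⟨⟨j, hj⟩, rfl⟩
  rw [this] at h2
  simpa using h2

lemma wedge_kill {N p' : ℕ} (φ : (Fin N → K) [⋀^Fin (p'+1)]→ₗ[K] K) (b : Fin N → Fin N → K)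
    (hb : LinearIndependent K b) (d : ℕ)
    (h : ∀ s : PI N (p'+1), (∃ k, (en s k : ℕ) < d) → φ (fun k => b (en s k)) = 0)
    (x : Fin N → K) (hx : x ∈ Submodule.span K (b '' {j | (j : ℕ) < d})) : φ.curryLeft x = 0 := by
  classical
  rcases Nat.eq_zero_or_pos N with rfl | hN
  · have : x = 0 := Subsingleton.elim _ _
    rw [this, map_zero]
  have : Nonempty (Fin N) := ⟨⟨0, hN⟩⟩
  induction hx using Submodule.span_induction with
  | zero => exact map_zero _
  | add x y _ _ hx hy => rw [map_add, hx, hy, add_zero]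
  | smul a x _ hx => rw [map_smul, hx, smul_zero]
  | mem x hx =>
    obtain ⟨j, hj, rfl⟩ := hx
    set B := basisOfLinearIndependentOfCardEqFinrank hb (by simp) with hB
    refine Module.Basis.ext_alternating B fun f hf => ?_
    have hBb : ∀ i, B i = b i := fun i => by rw [hB]; simp
    simp only [hBb]
    rw [AlternatingMap.curryLeft_apply_apply, AlternatingMap.zero_apply]
    set g : Fin (p'+1) → Fin N := Fin.cons j f with hg
    have e : (Matrix.vecCons (b j) fun i => b (f i)) = b ∘ g := by
      funext k
      refine Fin.cases ?_ (fun k => ?_) k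
      · simp [hg]
      · simp [hg]
    rw [e]
    by_cases hgi : Function.Injective g
    · set σ := Tuple.sort g with hσ
      have hm : StrictMono (g ∘ σ) := (Tuple.monotone_sort g).strictMono_of_injective (hgi.comp σ.injective)
      obtain ⟨s, hs⟩ := en_of_strictMono _ hm
      have h1 := h s ⟨σ.symm 0, by rw [hs]; simpa [hg] using hj⟩
      have e2 : (fun k => b (en s k)) = (b ∘ g) ∘ σ := by
        funext k; rw [hs]; rfl
      rw [e2, AlternatingMap.map_perm] at h1
      rcases Int.units_eq_one_or (Equiv.Perm.sign σ) with h2 | h2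
      · rwa [h2, one_smul] at h1
      · rw [h2] at h1
        simpa using h1
    · exact AlternatingMap.map_eq_zero_of_not_injective _ _ (fun hh => hgi (Function.Injective.of_comp hh))

lemma alt_sum_apply {N p : ℕ} {κ : Type*} (s : Finset κ) (f : κ → (Fin N → K) [⋀^Fin p]→ₗ[K] K) (v) :
    (∑ i ∈ s, f i) v = ∑ i ∈ s, f i v := by
  classical
  induction s using Finset.induction_on with
  | empty => simp
  | insert a s ha ih => rw [Finset.sum_insert ha, Finset.sum_insert ha, AlternatingMap.add_apply, ih]

/-- the alternating form with given coefficients -/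
def altf {N p : ℕ} (a : PI N p → K) : (Fin N → K) [⋀^Fin p]→ₗ[K] K :=
  (∑ s, a s • ((Pi.basisFun K (Fin N)).exteriorPower p).coord s).compAlternatingMap (exteriorPower.ιMulti K p)

lemma altf_apply {N p : ℕ} (a : PI N p → K) (v : Fin p → Fin N → K) : altf a v = ∑ s, a s * plk v s := by
  rw [altf, LinearMap.compAlternatingMap_apply, LinearMap.sum_apply]
  refine Finset.sum_congr rfl fun s _ => ?_
  rw [plk_repr]; rfl

lemma altf_ne {N p : ℕ} (a : PI N p → K) (ha : a ≠ 0) : ∃ v, altf a v ≠ 0 := by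
  classical
  obtain ⟨s, hs⟩ := Function.ne_iff.1 ha
  refine ⟨fun i => Pi.single (en s i) 1, ?_⟩
  rw [altf_apply]
  have h : ∀ t : PI N p, plk (fun i : Fin p => Pi.single (en s i) (1:K)) t = cpd p (1 : Matrix (Fin N) (Fin N) K) t s := by
    intro t
    rw [plk, cpd, ← Matrix.det_transpose]
    congr 1
    ext i j
    simp [Matrix.one_apply, Pi.single_apply]
  simp only [h, cpd_one, Matrix.one_apply]
  simpa using hs

variable {W S : Type*} [Fintype W] [Fintype S] [CharZero K] {O : Subring K}
  {av : W ⊕ S → AbsoluteValue K ℝ}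

/-- bounds for the minors -/
lemma plk_bound (v : AbsoluteValue K ℝ) {N p : ℕ} (L : Matrix (Fin N) (Fin N) ℤ) (y : Fin p → Fin N → K)
    (I : PI N p) (g : Fin N → ℝ) (l : Fin p → ℝ) (ε q : ℝ)
    (h : ∀ i k, v (lf L i (y k)) ≤ Real.exp ((g i + l k + ε) * q)) :
    v (∑ s, ((cpd p L I s : ℤ) : K) * plk y s) ≤ p.factorial * Real.exp ((∑ k, g (en I k) + ∑ k, l k + p * ε) * q) := by
  have e1 : ∑ s, ((cpd p L I s : ℤ) : K) * plk y s = plk (fun k => (L.map (Int.castRingHom K)).mulVec (y k)) I := by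
    rw [cauchy_binet]
    refine Finset.sum_congr rfl fun s _ => ?_
    rw [cpd_map]; rfl
  rw [e1, plk]
  have := av_det_le v (Matrix.of fun i j => (L.map (Int.castRingHom K)).mulVec (y i) (en I j))
    (Real.exp ((∑ k, g (en I k) + ∑ k, l k + p * ε) * q)) ?_
  · simpa using this
  intro τ
  have hle : ∀ j, v ((L.map (Int.castRingHom K)).mulVec (y (τ j)) (en I j)) ≤
      Real.exp ((g (en I j) + l (τ j) + ε) * q) := by
    intro j
    have := h (en I j) (τ j)
    rw [lf_apply] at this
    exact this
  refine (Finset.prod_le_prod (fun _ _ => v.nonneg _) fun j _ => hle j).trans ?_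
  rw [← Real.exp_sum, ← Finset.sum_mul, Finset.sum_add_distrib, Finset.sum_add_distrib, Equiv.sum_comp τ l]
  simp

theorem thmS [Nonempty W] (hG : Geo O av) {N : ℕ} (L : W ⊕ S → Matrix (Fin N) (Fin N) ℤ)
    (hL : ∀ v, (L v).det ≠ 0) {ι : Type*} (F : Ultrafilter ι) (q : ι → ℝ) (hq : Tendsto q F atTop)
    (c : W ⊕ S → Fin N → ℝ) (hc : ∀ s i, c (Sum.inr s) i ≤ 0) (hsum : ∑ v, ∑ i, c v i < 0)
    (x : ι → Fin N → K) (hx0 : ∀ᶠ t in (F : Filter ι), x t ≠ 0)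
    (hx : ∀ᶠ t in (F : Filter ι), (∀ i, x t i ∈ O) ∧ ∀ v i, av v (lf (L v) i (x t)) ≤ Real.exp (c v i * q t)) :
    ∃ a : Fin N → K, a ≠ 0 ∧ ∀ᶠ t in (F : Filter ι), ∑ i, a i * x t i = 0 := by
  classical
  have hN : 0 < N := by
    rcases Nat.eq_zero_or_pos N with rfl | h
    · obtain ⟨t, ht⟩ := hx0.exists
      exact absurd (Subsingleton.elim _ _) ht
    · exact h
  obtain ⟨l, b, hl, hfr, hb, hs1, hs2, hspan⟩ := base_lim hG hN L hL F q hq c hc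
  have hspan := hspan x hx
  have hl0 : l 0 ≤ 0 := by
    by_contra hcon
    push Not at hcon
    obtain ⟨t, h1, h2⟩ := (hx0.and (hspan 0 hN hcon)).exists
    apply h1
    simpa using h2
  have hex : ∃ d, d < N ∧ 0 < l d := by
    by_contra hcon
    push Not at hcon
    have : ∑ j ∈ range N, l j ≤ 0 := Finset.sum_nonpos fun j hj => hcon j (Finset.mem_range.1 hj)
    have h2 : (Fintype.card W : ℝ) * ∑ j ∈ range N, l j ≤ 0 := mul_nonpos_of_nonneg_of_nonpos (by positivity) this
    linarith
  set d := Nat.find hex with hd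
  obtain ⟨hdN, hld⟩ := Nat.find_spec hex
  rw [← hd] at hdN hld
  have hlt : ∀ j < d, l j ≤ 0 := by
    intro j hj
    have := Nat.find_min hex hj
    push Not at this
    exact this (by omega)
  have hd0 : 0 < d := by
    rcases Nat.eq_zero_or_pos d with h | h
    · rw [h] at hld; linarith
    · exact h
  obtain ⟨p', hp'⟩ : ∃ p', N - d = p' + 1 := ⟨N - d - 1, by omega⟩
  set p := p' + 1 with hp
  obtain ⟨n, hn⟩ : ∃ n, N.choose p = n + 2 := by
    have h1 : 2 ≤ N.choose p := by
      obtain ⟨M, hM⟩ : ∃ M, N = M + 1 := ⟨N - 1, by omega⟩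
      rw [hM, hp, Nat.choose_succ_succ]
      have h2 : 0 < M.choose p' := Nat.choose_pos (by omega)
      have h3 : 0 < M.choose (p'+1) := Nat.choose_pos (by omega)
      simp only [Nat.succ_eq_add_one]
      omega
    exact ⟨N.choose p - 2, by omega⟩
  have hcard : Fintype.card (PI N p) = n + 2 := by
    rw [← hn, ← Nat.card_eq_fintype_card, Set.powersetCard.card, Nat.card_eq_fintype_card, Fintype.card_fin]
  set lJ : PI N p → ℝ := fun s => ∑ k, l (en s k) with hlJ
  obtain ⟨e, he⟩ : ∃ e : Fin (n+2) ≃ PI N p, Monotone (lJ ∘ e) := by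
    set e0 := (Fintype.equivFinOfCardEq hcard).symm
    exact ⟨(Tuple.sort (lJ ∘ e0)).trans e0, Tuple.monotone_sort (lJ ∘ e0)⟩
  set J0f : Finset (Fin N) := univ.filter fun i => d ≤ (i : ℕ) with hJ0f
  have hJ0c : J0f.card = p := by
    have : J0f = Finset.Ici (⟨d, hdN⟩ : Fin N) := by
      ext i; simp [hJ0f, Fin.le_def]
    rw [this, Fin.card_Ici]
    exact hp'
  set J0 : PI N p := ⟨J0f, hJ0c⟩ with hJ0
  have hmax : ∀ s : PI N p, s ≠ J0 → lJ s < lJ J0 := by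
    intro s hs
    rw [hlJ]
    simp only
    rw [en_sum s (fun i => l i), en_sum J0 (fun i => l i)]
    change ∑ i ∈ (s : Finset (Fin N)), l i < ∑ i ∈ J0f, l i
    rw [← Finset.sum_inter_add_sum_sdiff (s : Finset (Fin N)) J0f, ← Finset.sum_inter_add_sum_sdiff J0f (s : Finset (Fin N)), Finset.inter_comm J0f]
    have h1 : ∑ i ∈ (s : Finset (Fin N)) \ J0f, l i ≤ 0 := Finset.sum_nonpos fun i hi => by
      rw [Finset.mem_sdiff] at hi
      apply hlt
      by_contra hh
      exact hi.2 (by simp [hJ0f]; omega)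
    have h2 : 0 < ∑ i ∈ J0f \ (s : Finset (Fin N)), l i := by
      refine Finset.sum_pos (fun i hi => ?_) ?_
      · rw [Finset.mem_sdiff] at hi
        have : d ≤ (i : ℕ) := by simpa [hJ0f] using hi.1
        exact hld.trans_le (hl d i this i.2)
      · rw [Finset.sdiff_nonempty]
        intro hsub
        apply hs
        apply Subtype.ext
        have hsc : (s : Finset (Fin N)).card = p := s.2
        exact (Finset.eq_of_subset_of_card_le hsub (by rw [hsc, hJ0c])).symm
    linarith
  have hlast : e (Fin.last (n+1)) = J0 := by
    by_contra hcon
    have h1 := hmax _ hcon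
    have h2 := he (Fin.le_last (e.symm J0))
    simp only [Function.comp, Equiv.apply_symm_apply] at h2
    linarith
  set l' : ℕ → ℝ := fun j => if h : j < n + 2 then lJ (e ⟨j, h⟩) else 0 with hl'
  set b' : ι → ℕ → Fin (n+2) → K := fun t j i => if h : j < n + 2 then
    plk (fun k => b t (en (e ⟨j, h⟩) k)) (e i) else 0 with hb'
  set L' : W ⊕ S → Matrix (Fin (n+2)) (Fin (n+2)) ℤ := fun v => (cpd p (L v)).submatrix e e with hL'
  set c' : W ⊕ S → Fin (n+2) → ℝ := fun v i => ∑ k, c v (en (e i) k) with hc'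
  set κ := (N-1).choose (p-1) with hκ
  have hlf : ∀ v i t j (hj : j < n + 2), lf (L' v) i (b' t j) =
      ∑ s, ((cpd p (L v) (e i) s : ℤ) : K) * plk (fun k => b t (en (e ⟨j, hj⟩) k)) s := by
    intro v i t j hj
    rw [lf_apply, ← Equiv.sum_comp e]
    refine Finset.sum_congr rfl fun i' _ => ?_
    simp [hL', hb', hj]
  have key : ∃ a : Fin (n+2) → K, a ≠ 0 ∧ ∀ᶠ t in (F : Filter ι), ∀ j < n+1, ∑ i, a i * b' t j i = 0 := by
    refine gap hG n L' (fun v => ?_) F q hq c' l' ?_ ?_ ?_ b' ?_ ?_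
    · rw [hL']; simp only; rw [Matrix.det_submatrix_equiv_self]; exact cpd_det_ne (hL v)
    · intro i j hij hj
      simp only [hl', hj, lt_of_le_of_lt hij hj, dif_pos]
      exact he (by simpa using hij)
    · simp only [hl']
      rw [dif_pos (by omega), dif_pos (by omega)]
      have h1 : e ⟨n+1, by omega⟩ = J0 := hlast
      rw [h1]
      apply hmax
      intro h2
      rw [← hlast] at h2
      have := e.injective h2
      simp [Fin.ext_iff] at this
    · have h1 : ∀ v, ∑ i, c' v i = κ * ∑ i, c v i := by
        intro v
        rw [hc', Equiv.sum_comp e (fun s => ∑ k, c v (en s k)), sum_en κ hκ (by omega)]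
      have h2 : ∑ j ∈ range (n+2), l' j = κ * ∑ j ∈ range N, l j := by
        rw [Finset.sum_range, Finset.sum_range, ← sum_en κ hκ (by omega), ← Equiv.sum_comp e]
        refine Finset.sum_congr rfl fun j _ => ?_
        simp [hl', hlJ]
      simp only [h1, h2]
      rw [← Finset.mul_sum, mul_left_comm, ← mul_add]
      exact mul_nonpos_of_nonneg_of_nonpos (by positivity) hs1
    · filter_upwards [hfr] with t ht
      apply finrank_of_indep
      have h1 := plk_indep (p := p) _ (indep_of_finrank _ (ht N le_rfl))
      have h2 := h1.comp e e.injective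
      have h3 := h2.map' (LinearEquiv.funCongrLeft K K e).toLinearMap (LinearEquiv.ker _)
      have e1 : (fun j : Fin (n+2) => b' t j) = ((LinearEquiv.funCongrLeft K K e).toLinearMap ∘
          (fun s : PI N p => plk (fun i => b t (en s i))) ∘ e) := by
        funext j i
        simp [hb', LinearEquiv.funCongrLeft]
      rw [e1]; exact h3
    · intro ε hε
      have hp0 : (0:ℝ) < p := by positivity
      have hε' : 0 < ε / (2 * p) := by positivity
      have heε : (p:ℝ) * (ε / (2 * p)) = ε / 2 := by field_simp
      filter_upwards [hb _ hε', hq.eventually_gt_atTop 0, ev_small F q hq (-(ε/2)) (by linarith) p.factorial] with t h1 hqt h2 j hj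
      have hfac : (p.factorial : ℝ) ≤ Real.exp (ε / 2 * q t) := by
        have e : Real.exp (-(ε/2) * q t) = (Real.exp (ε / 2 * q t))⁻¹ := by rw [← Real.exp_neg]; ring_nf
        rw [e, ← div_eq_mul_inv, div_lt_one (Real.exp_pos _)] at h2
        exact h2.le
      refine ⟨fun i => ?_, fun s i => ?_, fun w i => ?_⟩
      · simp only [hb', hj, dif_pos]
        exact det_mem O _ fun i' j' => (h1 _ (Fin.is_lt _)).1 _
      · rw [hlf _ _ _ _ hj]
        refine (plk_bound (av (Sum.inr s)) (L (Sum.inr s)) _ (e i) (c (Sum.inr s)) (fun _ => 0) (ε / (2*p)) (q t) ?_).trans ?_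
        · intro i' k
          simpa using (h1 _ (Fin.is_lt _)).2.1 s i'
        · rw [heε]
          refine (mul_le_mul_of_nonneg_right hfac (Real.exp_pos _).le).trans ?_
          rw [← Real.exp_add, Real.exp_le_exp]
          simp only [Finset.sum_const_zero, hc']
          linarith
      · rw [hlf _ _ _ _ hj]
        refine (plk_bound (av (Sum.inl w)) (L (Sum.inl w)) _ (e i) (c (Sum.inl w)) (fun k => l (en (e ⟨j, hj⟩) k)) (ε / (2*p)) (q t) ?_).trans ?_
        · intro i' k
          exact (h1 _ (Fin.is_lt _)).2.2 w i'
        · rw [heε]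
          refine (mul_le_mul_of_nonneg_right hfac (Real.exp_pos _).le).trans ?_
          rw [← Real.exp_add, Real.exp_le_exp]
          simp only [hl', hj, dif_pos, hlJ, hc']
          linarith
  obtain ⟨a, ha, hker⟩ := key
  set φ := altf (fun s => a (e.symm s)) with hφ
  have hφ0 : ∃ v, φ v ≠ 0 := altf_ne _ (by
    intro h
    apply ha
    funext i
    simpa using congrFun h (e i))
  obtain ⟨v, hv⟩ := hφ0
  refine ⟨fun i => φ.curryLeft (Pi.single i 1) (Matrix.vecTail v), ?_, ?_⟩
  all_goals
    have hlin : ∀ y : Fin N → K, ∑ i, φ.curryLeft (Pi.single i 1) (Matrix.vecTail v) * y i =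
        φ.curryLeft y (Matrix.vecTail v) := by
      intro y
      conv_rhs => rw [← Finset.univ_sum_single y]
      rw [map_sum, alt_sum_apply]
      refine Finset.sum_congr rfl fun i _ => ?_
      have : (Pi.single i (y i) : Fin N → K) = y i • Pi.single i 1 := by
        rw [← Pi.single_smul]; simp
      rw [this, map_smul, AlternatingMap.smul_apply, smul_eq_mul, mul_comm]
  · intro h0
    have h1 := hlin (Matrix.vecHead v)
    rw [AlternatingMap.curryLeft_apply_apply] at h1
    rw [show Matrix.vecCons (Matrix.vecHead v) (Matrix.vecTail v) = v from Matrix.cons_head_tail v] at h1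
    apply hv
    rw [← h1]
    refine Finset.sum_eq_zero fun i _ => ?_
    rw [show φ.curryLeft (Pi.single i 1) (Matrix.vecTail v) = 0 from congrFun h0 i, zero_mul]
  · filter_upwards [hker, hfr, hspan d hdN hld] with t h1 h2 h3
    rw [hlin]
    have := wedge_kill φ (fun j : Fin N => b t j) (indep_of_finrank _ (h2 N le_rfl)) d ?_ (x t) ?_
    · rw [this]; rfl
    · rintro s ⟨k, hk⟩
      have hs : s ≠ J0 := by
        rintro rfl
        have := (en_mem J0 _).2 ⟨k, rfl⟩
        have h4 : en J0 k ∈ J0f := this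
        simp [hJ0f] at h4
        omega
      have hj : ((e.symm s : Fin (n+2)) : ℕ) < n + 1 := by
        have h5 : e.symm s ≠ Fin.last (n+1) := by
          intro h; apply hs; rw [← hlast, ← h]; simp
        have := (e.symm s).2
        have h6 : ((e.symm s : Fin (n+2)) : ℕ) ≠ n + 1 := fun h => h5 (Fin.ext h)
        omega
      have h4 := h1 _ hj
      rw [hφ, altf_apply, ← Equiv.sum_comp e]
      rw [← h4]
      refine Finset.sum_congr rfl fun i _ => ?_
      simp [hb']
      left; rfl
    · convert h3 using 2
      ext y; constructor
      · rintro ⟨j, hj, rfl⟩; exact ⟨j, hj, rfl⟩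
      · rintro ⟨j, hj, rfl⟩; exact ⟨⟨j, lt_trans hj hdN⟩, hj, rfl⟩

end
end Sub15

set_option linter.unusedVariables false
set_option linter.unusedSectionVars false
set_option linter.style.longLine false
namespace Sub15
noncomputable section
open Finset Filter NumberField IsDedekindDomain

variable (K : Type*) [Field K] [NumberField K]

/-- ring of integers as a subring of the field -/
def oK : Subring K := (algebraMap (𝓞 K) K).range

variable {K}

lemma mem_oK {x : K} : x ∈ oK K ↔ IsIntegral ℤ x := by
  constructor
  · rintro ⟨y, rfl⟩; exact y.2
  · intro h; exact ⟨⟨x, h⟩, rfl⟩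

lemma sqrt_base (v : HeightOneSpectrum (𝓞 K)) : 1 < NNReal.sqrt (Ideal.absNorm v.asIdeal : NNReal) := by
  rw [← NNReal.sqrt_one, NNReal.sqrt_lt_sqrt]
  exact HeightOneSpectrum.one_lt_absNorm_nnreal v

/-- square root of the normalised finite absolute value -/
def fa (v : HeightOneSpectrum (𝓞 K)) : AbsoluteValue K ℝ := v.adicAbv (sqrt_base v)

lemma fa_sq (v : HeightOneSpectrum (𝓞 K)) (x : K) : fa v x ^ 2 = HeightOneSpectrum.adicAbv K v x := by
  have h1 : fa v x = WithZeroMulInt.toNNReal (ne_zero_of_lt (sqrt_base v)) (v.valuation K x) := rfl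
  have h2 : HeightOneSpectrum.adicAbv K v x = WithZeroMulInt.toNNReal (ne_zero_of_lt (HeightOneSpectrum.one_lt_absNorm_nnreal v)) (v.valuation K x) := rfl
  rw [h1, h2]
  by_cases h : v.valuation K x = 0
  · rw [h]; simp
  · rw [WithZeroMulInt.toNNReal_neg_apply _ h, WithZeroMulInt.toNNReal_neg_apply _ h, ← NNReal.coe_pow]
    congr 1
    rw [← zpow_natCast, ← zpow_mul, mul_comm, zpow_mul, zpow_natCast, NNReal.sq_sqrt]

lemma fa_ultra (v : HeightOneSpectrum (𝓞 K)) (x y : K) : fa v (x + y) ≤ max (fa v x) (fa v y) :=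
  v.isNonarchimedean_adicAbv (sqrt_base v) x y

lemma fa_le_one (v : HeightOneSpectrum (𝓞 K)) (x : K) (hx : x ∈ oK K) : fa v x ≤ 1 := by
  obtain ⟨y, rfl⟩ := hx
  exact v.adicAbv_coe_le_one (sqrt_base v) y

lemma fa_pow_mem (v : HeightOneSpectrum (𝓞 K)) (e : ℕ) (x : 𝓞 K) (hx : x ∈ v.asIdeal ^ e) :
    fa v (algebraMap (𝓞 K) K x) ^ 2 ≤ ((Ideal.absNorm v.asIdeal : ℝ) ^ e)⁻¹ := by
  rw [fa_sq]
  have h2 : HeightOneSpectrum.adicAbv K v (algebraMap (𝓞 K) K x) = WithZeroMulInt.toNNReal (ne_zero_of_lt (HeightOneSpectrum.one_lt_absNorm_nnreal v)) (v.valuation K (algebraMap (𝓞 K) K x)) := rfl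
  rw [h2, v.valuation_of_algebraMap]
  have h3 := (v.intValuation_le_pow_iff_mem x e).2 hx
  have h4 := (WithZeroMulInt.toNNReal_strictMono (HeightOneSpectrum.one_lt_absNorm_nnreal v)).monotone h3
  refine (NNReal.coe_le_coe.2 h4).trans (le_of_eq ?_)
  have h5 : WithZero.exp (-(e:ℤ)) ≠ 0 := WithZero.exp_ne_zero
  rw [WithZeroMulInt.toNNReal_neg_apply _ h5]
  have : (WithZero.unzero h5).toAdd = -(e:ℤ) := rfl
  rw [this]
  simp

lemma fp_prod (x : K) (hx : x ≠ 0) (S : Finset (HeightOneSpectrum (𝓞 K)))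
    (h : ∀ v ∉ S, fa v x = 1) : ∏ᶠ w : FinitePlace K, w x = ∏ v ∈ S, fa v x ^ 2 := by
  rw [← finprod_comp_equiv FinitePlace.equivHeightOneSpectrum.symm]
  have h1 : ∀ v, (FinitePlace.equivHeightOneSpectrum.symm v) x = fa v x ^ 2 := by
    intro v
    rw [FinitePlace.equivHeightOneSpectrum_symm_apply, FinitePlace.norm_embedding, fa_sq]
  simp only [h1]
  apply finprod_eq_prod_of_mulSupport_subset
  intro v hv
  by_contra hh
  exact hv (by simp [h v (by simpa using hh)])

lemma fa_fin (x : K) (hx : x ≠ 0) : {v : HeightOneSpectrum (𝓞 K) | fa v x ≠ 1}.Finite := by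
  have h := FinitePlace.hasFiniteMulSupport hx
  refine (Set.Finite.image FinitePlace.equivHeightOneSpectrum h).subset ?_
  intro v hv
  refine ⟨FinitePlace.equivHeightOneSpectrum.symm v, ?_, by simp⟩
  intro h2
  apply hv
  have h2 : (FinitePlace.equivHeightOneSpectrum.symm v) x = 1 := h2
  rw [FinitePlace.equivHeightOneSpectrum_symm_apply, FinitePlace.norm_embedding, ← fa_sq] at h2
  exact (pow_eq_one_iff_of_nonneg ((fa v).nonneg _) two_ne_zero).1 h2

variable (S : Finset (HeightOneSpectrum (𝓞 K)))

/-- the absolute values used -/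
def pav : InfinitePlace K ⊕ S → AbsoluteValue K ℝ := Sum.elim (fun w => w.1) (fun s => fa s.1)

lemma pav_inl (w : InfinitePlace K) (x : K) : pav S (Sum.inl w) x = w x := rfl
lemma pav_inr (s : S) (x : K) : pav S (Sum.inr s) x = fa s.1 x := rfl

lemma pav_prod_one [IsTotallyComplex K] (x : K) (hx : x ≠ 0) (h : ∀ v ∉ S, fa v x = 1) : ∏ v, pav S v x = 1 := by
  have h1 := prod_abs_eq_one hx
  rw [fp_prod x hx S h] at h1
  simp only [fun w : InfinitePlace K => (IsTotallyComplex.isComplex w).mult_eq_two] at h1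
  rw [Finset.prod_pow, Finset.prod_pow, ← mul_pow] at h1
  rw [Fintype.prod_sum_type]
  simp only [pav_inl, pav_inr]
  rw [Finset.prod_coe_sort S (fun v => fa v x)]
  have h0 : 0 ≤ (∏ w : InfinitePlace K, w x) * ∏ v ∈ S, fa v x :=
    mul_nonneg (Finset.prod_nonneg fun w _ => apply_nonneg _ _) (Finset.prod_nonneg fun w _ => (fa _).nonneg _)
  exact (pow_eq_one_iff_of_nonneg h0 two_ne_zero).1 h1

lemma pav_pf [IsTotallyComplex K] (x : K) (hxO : x ∈ oK K) (hx : x ≠ 0) : 1 ≤ ∏ v, pav S v x := by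
  classical
  have hfin : {v : HeightOneSpectrum (𝓞 K) | fa v x ≠ 1}.Finite := fa_fin x hx
  set T := S ∪ hfin.toFinset with hT
  have h1 := pav_prod_one T x hx (fun v hv => by
    by_contra hh
    exact hv (by rw [hT]; simp [hh]))
  rw [Fintype.prod_sum_type] at h1 ⊢
  simp only [pav_inl, pav_inr] at h1 ⊢
  rw [Finset.prod_coe_sort T (fun v => fa v x)] at h1
  rw [Finset.prod_coe_sort S (fun v => fa v x)]
  rw [← h1]
  refine mul_le_mul_of_nonneg_left ?_ (Finset.prod_nonneg fun w _ => apply_nonneg _ _)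
  exact Finset.prod_le_prod_of_subset_of_le_one (by rw [hT]; exact Finset.subset_union_left) (fun v _ => (fa v).nonneg _) (fun v _ _ => fa_le_one v x hxO)

end
end Sub15

set_option linter.unusedVariables false
set_option linter.unusedSectionVars false
set_option linter.style.longLine false
namespace Sub15
noncomputable section
open Finset Filter NumberField IsDedekindDomain

variable {K : Type*} [Field K] [NumberField K]

lemma cell1 (R δ : ℝ) (hR : 0 ≤ R) (hδ : 0 < δ) :
    ∃ n : ℕ, (n : ℝ) ≤ 2 * R / δ + 1 ∧ ∃ f : ℝ → Fin n, ∀ x y, |x| ≤ R → |y| ≤ R → f x = f y → |x - y| ≤ δ := by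
  refine ⟨⌊2 * R / δ⌋₊ + 1, ?_, fun x => ⟨⌊(x + R) / δ⌋₊ % (⌊2 * R / δ⌋₊ + 1), Nat.mod_lt _ (Nat.succ_pos _)⟩, ?_⟩
  · push_cast
    have := Nat.floor_le (show 0 ≤ 2 * R / δ by positivity)
    linarith
  · intro x y hx hy h
    have key : ∀ x, |x| ≤ R → 0 ≤ (x + R) / δ ∧ ⌊(x + R) / δ⌋₊ % (⌊2 * R / δ⌋₊ + 1) = ⌊(x + R) / δ⌋₊ := by
      intro x hx
      have h1 := abs_le.1 hx
      refine ⟨div_nonneg (by linarith) hδ.le, Nat.mod_eq_of_lt (Nat.lt_succ_of_le ?_)⟩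
      apply Nat.floor_le_floor
      apply div_le_div_of_nonneg_right _ hδ.le
      linarith
    have h2 := congrArg Fin.val h
    simp only at h2
    rw [(key x hx).2, (key y hy).2] at h2
    have a1 := Nat.floor_le (key x hx).1
    have a2 := Nat.lt_floor_add_one ((x + R) / δ)
    have a3 := Nat.floor_le (key y hy).1
    have a4 := Nat.lt_floor_add_one ((y + R) / δ)
    rw [h2] at a1 a2
    have b : |(x + R) / δ - (y + R) / δ| ≤ 1 := by rw [abs_le]; constructor <;> linarith
    rw [← sub_div, abs_div, abs_of_pos hδ, div_le_one hδ] at b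
    rwa [show x + R - (y + R) = x - y by ring] at b

lemma cell2 (R A : ℝ) (hA : 0 < A) (hAR : A ≤ R) :
    ∃ n : ℕ, (n : ℝ) ≤ (8 * R / A) ^ 2 ∧ ∃ f : ℂ → Fin n, ∀ x y, ‖x‖ ≤ R → ‖y‖ ≤ R → f x = f y → ‖x - y‖ ≤ A := by
  obtain ⟨n, hn, f, hf⟩ := cell1 R (A / 2) (by linarith) (by linarith)
  refine ⟨n * n, ?_, fun z => finProdFinEquiv (f z.re, f z.im), ?_⟩
  · have h1 : (n : ℝ) ≤ 8 * R / A := by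
      refine hn.trans ?_
      have : 1 ≤ R / A := by rwa [one_le_div hA]
      have e1 : 2 * R / (A / 2) = 4 * (R / A) := by field_simp; ring
      have e2 : 8 * R / A = 8 * (R / A) := by ring
      rw [e1, e2]; linarith
    push_cast
    rw [sq]
    exact mul_le_mul h1 h1 (Nat.cast_nonneg _) (by have : 0 < R := by linarith
                                                   positivity)
  · intro x y hx hy h
    have h2 := finProdFinEquiv.injective h
    simp only [Prod.mk.injEq] at h2
    have a1 := hf _ _ ((Complex.abs_re_le_norm x).trans hx) ((Complex.abs_re_le_norm y).trans hy) h2.1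
    have a2 := hf _ _ ((Complex.abs_im_le_norm x).trans hx) ((Complex.abs_im_le_norm y).trans hy) h2.2
    refine (Complex.norm_le_abs_re_add_abs_im _).trans ?_
    rw [Complex.sub_re, Complex.sub_im]
    linarith

lemma pcell (v : HeightOneSpectrum (𝓞 K)) (A : ℝ) (hA : 0 < A) (hA1 : A ≤ 1) :
    ∃ n : ℕ, (n : ℝ) ≤ (Ideal.absNorm v.asIdeal : ℝ) / A ^ 2 ∧ ∃ f : K → Fin n, ∀ x ∈ oK K, ∀ y ∈ oK K,
      f x = f y → fa v (x - y) ≤ A := by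
  classical
  have hb : (1 : ℝ) < Ideal.absNorm v.asIdeal := by
    exact_mod_cast HeightOneSpectrum.one_lt_absNorm v
  obtain ⟨e, he1, he2⟩ := exists_nat_pow_near (x := (A ^ 2)⁻¹) (y := (Ideal.absNorm v.asIdeal : ℝ))
    (by rw [one_le_inv₀ (by positivity)]; exact pow_le_one₀ hA.le hA1) hb
  set I := v.asIdeal ^ (e + 1) with hI
  have hI0 : I ≠ ⊥ := pow_ne_zero _ v.ne_bot
  have : Finite (𝓞 K ⧸ I) := Ideal.finiteQuotientOfFreeOfNeBot I hI0
  have hcard : Nat.card (𝓞 K ⧸ I) = Ideal.absNorm v.asIdeal ^ (e + 1) := by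
    rw [← map_pow, ← hI, Ideal.absNorm_apply, Submodule.cardQuot_apply]
  have hg : ∀ x : K, ∃ g : 𝓞 K, x ∈ oK K → algebraMap (𝓞 K) K g = x := by
    intro x
    by_cases hx : x ∈ oK K
    · obtain ⟨g, hg⟩ := hx
      exact ⟨g, fun _ => hg⟩
    · exact ⟨0, fun h => absurd h hx⟩
  choose g hg using hg
  refine ⟨Nat.card (𝓞 K ⧸ I), ?_, fun x => Finite.equivFin _ (Ideal.Quotient.mk I (g x)), ?_⟩
  · rw [hcard, Nat.cast_pow, pow_succ, div_eq_inv_mul]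
    exact mul_le_mul_of_nonneg_right he1 (by linarith)
  · intro x hx y hy h
    have h2 := (Finite.equivFin _).injective h
    rw [Ideal.Quotient.eq] at h2
    have h3 := fa_pow_mem v (e + 1) _ h2
    rw [map_sub, hg x hx, hg y hy] at h3
    have h4 : fa v (x - y) ^ 2 ≤ ((Ideal.absNorm v.asIdeal : ℝ) ^ (e + 1))⁻¹ := h3
    have h5 : ((Ideal.absNorm v.asIdeal : ℝ) ^ (e + 1))⁻¹ ≤ A ^ 2 := inv_le_of_inv_le₀ (by positivity) he2.le
    exact le_of_sq_le_sq (h4.trans h5) hA.le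

lemma round_inst [IsTotallyComplex K] : ∃ C : ℝ, ∀ α : InfinitePlace K → K, ∃ a ∈ oK K, ∀ w : InfinitePlace K, w (a - α w) ≤ C := by
  classical
  set b := mixedEmbedding.latticeBasis K with hb
  have hbi : ∀ j, b j = mixedEmbedding K (integralBasis K j) := fun j => mixedEmbedding.latticeBasis_apply K j
  have hw2 : ∀ (x : K) (w : InfinitePlace K), (mixedEmbedding K x).2 ⟨w, IsTotallyComplex.isComplex w⟩ = w.embedding x := fun x w => rfl
  have hn : ∀ (w : InfinitePlace K) (x : K), ‖w.embedding x‖ = w x := fun w x => InfinitePlace.norm_embedding_eq w x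
  refine ⟨∑ w : InfinitePlace K, ∑ j, w (integralBasis K j), fun α => ?_⟩
  set z : mixedEmbedding.mixedSpace K := (0, fun w => w.1.embedding (α w.1)) with hz
  refine ⟨∑ j, (⌊b.repr z j⌋ : K) * integralBasis K j, ?_, ?_⟩
  · refine Subring.sum_mem _ fun j _ => Subring.mul_mem _ (intCast_mem _ _) ?_
    rw [integralBasis_apply]
    exact ⟨_, rfl⟩
  · intro w
    have h1 : z.2 ⟨w, IsTotallyComplex.isComplex w⟩ = ∑ j, (b.repr z j : ℂ) * w.embedding (integralBasis K j) := by
      conv_lhs => rw [← b.sum_repr z]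
      rw [Prod.snd_sum, Finset.sum_apply]
      refine Finset.sum_congr rfl fun j _ => ?_
      rw [Prod.smul_snd, Pi.smul_apply, hbi, hw2, Complex.real_smul]
    have h2 : z.2 ⟨w, IsTotallyComplex.isComplex w⟩ = w.embedding (α w) := rfl
    rw [← hn, map_sub, ← h2, h1, map_sum, ← Finset.sum_sub_distrib]
    refine (norm_sum_le _ _).trans ?_
    refine le_trans ?_ (Finset.single_le_sum (f := fun w : InfinitePlace K => ∑ j, w (integralBasis K j))
      (fun w _ => Finset.sum_nonneg fun j _ => apply_nonneg _ _) (Finset.mem_univ w))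
    refine Finset.sum_le_sum fun j _ => ?_
    rw [map_mul, map_intCast, ← sub_mul, norm_mul, hn]
    refine mul_le_of_le_one_left (apply_nonneg _ _) ?_
    have : ((⌊b.repr z j⌋ : ℂ) - (b.repr z j : ℂ)) = ((⌊b.repr z j⌋ - b.repr z j : ℝ) : ℂ) := by push_cast; rfl
    rw [this, Complex.norm_real, Real.norm_eq_abs, abs_le]
    constructor
    · have := Int.lt_floor_add_one (b.repr z j); linarith
    · have := Int.floor_le (b.repr z j); linarith

end
end Sub15

set_option linter.unusedVariables false
set_option linter.unusedSectionVars false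
set_option linter.style.longLine false
namespace Sub15
noncomputable section
open Finset Filter NumberField IsDedekindDomain

variable {K : Type*} [Field K] [NumberField K] (S : Finset (HeightOneSpectrum (𝓞 K)))

lemma vcell (R : ℝ) (v : InfinitePlace K ⊕ S) (A : ℝ) (hA : 0 < A) (hAR : A ≤ R) (hA1 : ∀ s, v = Sum.inr s → A ≤ 1) :
    ∃ n : ℕ, (n : ℝ) ≤ (Sum.elim (fun _ => (8 * R) ^ 2) (fun s => (Ideal.absNorm s.1.asIdeal : ℝ)) v) / A ^ 2 ∧ ∃ f : K → Fin n, ∀ x ∈ oK K, ∀ y ∈ oK K,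
      pav S v x ≤ R → pav S v y ≤ R → f x = f y → pav S v (x - y) ≤ A := by
  rcases v with w | s
  · obtain ⟨n, hn, f, hf⟩ := cell2 R A hA hAR
    refine ⟨n, by simpa [div_pow] using hn, fun x => f (w.embedding x), ?_⟩
    intro x _ y _ hx hy h
    rw [pav_inl, ← InfinitePlace.norm_embedding_eq] at hx hy ⊢
    rw [map_sub]
    exact hf _ _ hx hy h
  · obtain ⟨n, hn, f, hf⟩ := pcell s.1 A hA (hA1 s rfl)
    exact ⟨n, hn, f, fun x hx y hy _ _ h => hf x hx y hy h⟩

lemma lf_mem_oK {N : ℕ} (L : Matrix (Fin N) (Fin N) ℤ) (i : Fin N) (x : Fin N → K) (hx : ∀ i, x i ∈ oK K) : lf L i x ∈ oK K := by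
  rw [lf_apply]
  exact Subring.sum_mem _ fun j _ => Subring.mul_mem _ (intCast_mem _ _) (hx j)

lemma mink_inst [IsTotallyComplex K] (N : ℕ) (hN : 0 < N) (L : InfinitePlace K ⊕ S → Matrix (Fin N) (Fin N) ℤ) :
    ∃ C : ℝ, ∀ A : InfinitePlace K ⊕ S → Fin N → ℝ, (∀ v i, 0 < A v i) → (∀ s i, A (Sum.inr s) i ≤ 1) →
      C < ∏ v, ∏ i, A v i → ∃ x : Fin N → K, x ≠ 0 ∧ (∀ i, x i ∈ oK K) ∧
        ∀ v i, pav S v (lf (L v) i x) ≤ A v i := by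
  classical
  set J := Module.Free.ChooseBasisIndex ℤ (𝓞 K) with hJ
  set ω : J → K := fun j => integralBasis K j with hω
  have hωO : ∀ j, ω j ∈ oK K := by
    intro j
    simp only [hω, integralBasis_apply]
    exact ⟨_, rfl⟩
  have hcJ : Fintype.card J = 2 * Fintype.card (InfinitePlace K) := by
    have h1 : Module.finrank ℚ K = Fintype.card J := Module.finrank_eq_card_basis (integralBasis K)
    rw [← h1, ← InfinitePlace.sum_mult_eq]
    simp only [fun w : InfinitePlace K => (IsTotallyComplex.isComplex w).mult_eq_two]
    simp [mul_comm]
  set C0 : ℝ := 1 + ∑ v, ∑ i, ∑ k, ∑ j, |(L v i k : ℝ)| * pav S v (ω j) with hC0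
  have hnn : ∀ v i k j, 0 ≤ |(L v i k : ℝ)| * pav S v (ω j) := fun v i k j => mul_nonneg (abs_nonneg _) ((pav S v).nonneg _)
  have hC1 : 1 ≤ C0 := by
    have : 0 ≤ ∑ v, ∑ i, ∑ k, ∑ j, |(L v i k : ℝ)| * pav S v (ω j) :=
      Finset.sum_nonneg fun v _ => Finset.sum_nonneg fun i _ => Finset.sum_nonneg fun k _ => Finset.sum_nonneg fun j _ => hnn v i k j
    linarith
  have hCv : ∀ v i, ∑ k, ∑ j, |(L v i k : ℝ)| * pav S v (ω j) ≤ C0 := by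
    intro v i
    have h1 := Finset.single_le_sum (f := fun i => ∑ k, ∑ j, |(L v i k : ℝ)| * pav S v (ω j))
      (fun i _ => Finset.sum_nonneg fun k _ => Finset.sum_nonneg fun j _ => hnn v i k j) (Finset.mem_univ i)
    have h2 := Finset.single_le_sum (f := fun v => ∑ i, ∑ k, ∑ j, |(L v i k : ℝ)| * pav S v (ω j))
      (fun v _ => Finset.sum_nonneg fun i _ => Finset.sum_nonneg fun k _ => Finset.sum_nonneg fun j _ => hnn v i k j) (Finset.mem_univ v)
    linarith
  set D : ℝ := (8 * C0) ^ (2 * Fintype.card (InfinitePlace K) * N) * ∏ s : S, (Ideal.absNorm s.1.asIdeal : ℝ) ^ N with hD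
  have hD0 : 0 ≤ D := mul_nonneg (by positivity) (Finset.prod_nonneg fun s _ => by positivity)
  refine ⟨1 + D, fun A hA hA1 hprod => ?_⟩
  set T := ∏ v, ∏ i, A v i with hT
  have hT2 : D < T ^ 2 := by nlinarith
  obtain ⟨Y, hY⟩ := exists_nat_ge (1 + ∑ v, ∑ i, A v i)
  have hAY : ∀ v i, A v i ≤ Y := by
    intro v i
    have h1 := Finset.single_le_sum (f := fun i => A v i) (fun i _ => (hA v i).le) (Finset.mem_univ i)
    have h2 := Finset.single_le_sum (f := fun v => ∑ i, A v i)
      (fun v _ => Finset.sum_nonneg fun i _ => (hA v i).le) (Finset.mem_univ v)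
    linarith
  have hY1 : (1 : ℝ) ≤ Y := by
    have : 0 ≤ ∑ v, ∑ i, A v i := Finset.sum_nonneg fun v _ => Finset.sum_nonneg fun i _ => (hA v i).le
    linarith
  set R : ℝ := C0 * Y with hR
  have hAR : ∀ v i, A v i ≤ R := fun v i => (hAY v i).trans (le_mul_of_one_le_left (by linarith) hC1)
  have hcell := fun v i => vcell S R v (A v i) (hA v i) (hAR v i) (fun s hs => by rw [hs]; exact hA1 s i)
  choose n hn f hf using hcell
  set X : (Fin N → J → Fin (Y + 1)) → Fin N → K := fun y k => ∑ j, ((y k j : ℕ) : K) * ω j with hX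
  have hXO : ∀ y k, X y k ∈ oK K := fun y k => Subring.sum_mem _ fun j _ => Subring.mul_mem _ (natCast_mem _ _) (hωO j)
  have hXR : ∀ y v i, pav S v (lf (L v) i (X y)) ≤ R := by
    intro y v i
    rw [lf_apply]
    refine (av_sum_le _ _ _).trans ?_
    refine le_trans ?_ (mul_le_mul_of_nonneg_right (hCv v i) (by linarith : (0:ℝ) ≤ Y))
    rw [Finset.sum_mul]
    refine Finset.sum_le_sum fun k _ => ?_
    rw [map_mul]
    have h1 : pav S v (X y k) ≤ ∑ j, Y * pav S v (ω j) := by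
      refine (av_sum_le _ _ _).trans (Finset.sum_le_sum fun j _ => ?_)
      rw [map_mul]
      refine mul_le_mul_of_nonneg_right ?_ ((pav S v).nonneg _)
      have h2 := av_int_le (pav S v) ((y k j : ℕ) : ℤ)
      rw [Int.cast_natCast] at h2
      refine h2.trans ?_
      rw [Int.cast_natCast, Nat.abs_cast]
      exact_mod_cast Nat.lt_succ_iff.1 (y k j).2
    refine (mul_le_mul (av_int_le _ _) h1 ((pav S v).nonneg _) (abs_nonneg _)).trans (le_of_eq ?_)
    rw [Finset.mul_sum, Finset.sum_mul]
    exact Finset.sum_congr rfl fun j _ => by ring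
  set Φ : (Fin N → J → Fin (Y + 1)) → (∀ v i, Fin (n v i)) := fun y v i => f v i (lf (L v) i (X y)) with hΦ
  have hcard : Fintype.card (∀ v i, Fin (n v i)) < Fintype.card (Fin N → J → Fin (Y + 1)) := by
    simp only [Fintype.card_pi, Fintype.card_fin, Finset.prod_const, Finset.card_univ]
    rw [← pow_mul, hcJ]
    have h1 : ((∏ v, ∏ i, n v i : ℕ) : ℝ) ≤ ∏ v, ∏ i, (Sum.elim (fun _ => (8 * R) ^ 2) (fun s : S => (Ideal.absNorm s.1.asIdeal : ℝ)) v) / A v i ^ 2 := by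
      push_cast
      refine Finset.prod_le_prod (fun v _ => Finset.prod_nonneg fun i _ => Nat.cast_nonneg _) fun v _ => ?_
      exact Finset.prod_le_prod (fun i _ => Nat.cast_nonneg _) fun i _ => hn v i
    have h2 : (∏ v, ∏ i, (Sum.elim (fun _ => (8 * R) ^ 2) (fun s : S => (Ideal.absNorm s.1.asIdeal : ℝ)) v) / A v i ^ 2)
        = D * Y ^ (2 * Fintype.card (InfinitePlace K) * N) / T ^ 2 := by
      simp only [Finset.prod_div_distrib, Finset.prod_const, Finset.card_univ, Fintype.card_fin, Finset.prod_pow]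
      rw [← hT]
      congr 1
      rw [Fintype.prod_sum_type]
      simp only [Sum.elim_inl, Sum.elim_inr, Finset.prod_const, Finset.card_univ, Finset.prod_pow]
      rw [hD, hR, Finset.prod_pow, mul_pow _ _ N]
      have : (8 * (C0 * (Y:ℝ))) = (8 * C0) * Y := by ring
      rw [this, ← pow_mul, ← pow_mul, mul_pow]
      ring
    have hTpos : 0 < T ^ 2 := lt_of_le_of_lt hD0 hT2
    have h3 : D * Y ^ (2 * Fintype.card (InfinitePlace K) * N) / T ^ 2 < (Y : ℝ) ^ (2 * Fintype.card (InfinitePlace K) * N) := by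
      rw [div_lt_iff₀ hTpos, mul_comm]
      exact mul_lt_mul_of_pos_left hT2 (by positivity)
    have h4 : ((∏ v, ∏ i, n v i : ℕ) : ℝ) < ((Y + 1 : ℕ) : ℝ) ^ (2 * Fintype.card (InfinitePlace K) * N) := by
      refine lt_of_lt_of_le (lt_of_le_of_lt (h1.trans h2.le) h3) ?_
      exact pow_le_pow_left₀ (by linarith) (by push_cast; linarith) _
    exact_mod_cast h4
  obtain ⟨y, y', hne, heq⟩ := Fintype.exists_ne_map_eq_of_card_lt Φ hcard
  refine ⟨X y - X y', ?_, fun i => Subring.sub_mem _ (hXO _ _) (hXO _ _), ?_⟩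
  · intro h0
    apply hne
    funext k
    have h1 := congrFun h0 k
    simp only [hX, Pi.sub_apply, Pi.zero_apply] at h1
    rw [← Finset.sum_sub_distrib] at h1
    have hli := (integralBasis K).linearIndependent
    rw [Fintype.linearIndependent_iff] at hli
    have h2 := hli (fun j => ((y k j : ℕ) : ℚ) - ((y' k j : ℕ) : ℚ)) (by
      rw [← h1]
      refine Finset.sum_congr rfl fun j _ => ?_
      rw [Algebra.smul_def, map_sub, map_natCast, map_natCast]
      ring)
    funext j
    have h3 := h2 j
    rw [sub_eq_zero] at h3
    exact Fin.ext (by exact_mod_cast h3)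
  · intro v i
    rw [map_sub]
    exact hf v i _ (lf_mem_oK _ _ _ (hXO y)) _ (lf_mem_oK _ _ _ (hXO y')) (hXR y v i) (hXR y' v i)
      (congrFun (congrFun heq v) i)

theorem geo_inst [IsTotallyComplex K] : Geo (oK K) (pav S) where
  pf := fun x hx h0 => pav_pf S x hx h0
  hr := by
    intro ξ H hH h
    obtain ⟨q, hq, hintg, hqH, hσ⟩ := not_rothH ξ H h (by linarith)
    refine ⟨q, hq, mem_oK.2 hintg, ?_⟩
    rintro (w | s)
    · refine ⟨(av_int_le _ _).trans hqH, ?_⟩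
      rw [pav_inl, ← InfinitePlace.norm_embedding_eq]
      exact hσ _
    · exact ⟨(fa_le_one _ _ (intCast_mem _ _)).trans hH, (fa_le_one _ _ (mem_oK.2 hintg)).trans hH⟩
  fin_le := fun s x hx => fa_le_one _ _ hx
  ultra := fun s x y => fa_ultra _ _ _
  round := round_inst
  mink := fun N hN L _ => mink_inst S N hN L

end
end Sub15

set_option linter.unusedVariables false
set_option linter.unusedSectionVars false
set_option linter.style.longLine false
namespace Sub15
noncomputable section
open Finset Filter

variable {K : Type*} [Field K] [CharZero K] {W S : Type*} [Fintype W] [Fintype S] {O : Subring K}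
  {av : W ⊕ S → AbsoluteValue K ℝ}

/-- for each omitted index there is an integral unimodular system of forms -/
lemma omit_forms (N : ℕ) (k : Fin (N + 1)) : ∃ (L : Matrix (Fin N) (Fin N) ℤ) (h : Fin N → Fin (N + 1)), L.det ≠ 0 ∧
    (∀ f : Fin (N + 1) → ℝ, ∑ i, f (h i) = ∑ j, f j - f k) ∧
    ∀ X : Fin (N + 1) → K, ∑ j, X j = 0 → ∀ i, lf L i (fun i => X i.castSucc) = X (h i) := by
  classical
  rcases Fin.eq_castSucc_or_eq_last k with ⟨k0, rfl⟩ | rfl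
  · refine ⟨(1 : Matrix (Fin N) (Fin N) ℤ).updateRow k0 (fun _ => -1),
      fun i => if i = k0 then Fin.last N else i.castSucc, ?_, ?_, ?_⟩
    · rw [← Matrix.cramer_transpose_apply, Matrix.transpose_one, Matrix.cramer_one]
      simp
    · intro f
      rw [Fin.sum_univ_castSucc]
      have h1 : ∀ i : Fin N, f (if i = k0 then Fin.last N else i.castSucc) =
          f i.castSucc + (if i = k0 then f (Fin.last N) - f k0.castSucc else 0) := by
        intro i; split_ifs with h
        · rw [h]; ring
        · ring
      simp only [h1, Finset.sum_add_distrib, Finset.sum_ite_eq', Finset.mem_univ, if_true]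
      ring
    · intro X hX i
      rw [lf_apply]
      by_cases h : i = k0
      · subst h
        rw [Fin.sum_univ_castSucc] at hX
        simp only [Matrix.updateRow_self, if_true]
        rw [eq_neg_of_add_eq_zero_right hX]
        simp
      · simp only [Matrix.updateRow_ne h, if_neg h, Matrix.one_apply]
        simp
  · refine ⟨1, Fin.castSucc, by simp, ?_, ?_⟩
    · intro f
      rw [Fin.sum_univ_castSucc]; ring
    · intro X hX i
      rw [lf_apply]
      simp [Matrix.one_apply]

lemma vec_step [Nonempty W] (hG : Geo O av) {ι : Type*} (F : Ultrafilter ι) (q : ι → ℝ) (hq : Tendsto q F atTop)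
    {N : ℕ} (X : Fin (N + 1) → ι → K) (hXO : ∀ j t, X j t ∈ O) (hX0 : ∀ᶠ t in (F : Filter ι), ∀ j, X j t ≠ 0)
    (E : Fin (N + 1) → W ⊕ S → ℝ) (hE : ∀ j v, ∀ ε > 0, ∀ᶠ t in (F : Filter ι), av v (X j t) ≤ Real.exp ((E j v + ε) * q t))
    (hs : ∀ j, ∑ v, E j v = 0) (hne : ∃ j1 j2, E j1 ≠ E j2)
    (hrel : ∀ᶠ t in (F : Filter ι), ∑ j, X j t = 0) :
    ∃ a : Fin N → K, a ≠ 0 ∧ ∀ᶠ t in (F : Filter ι), ∑ i, a i * X i.castSucc t = 0 := by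
  classical
  have hmax : ∀ v, ∃ k, ∀ j, E j v ≤ E k v := by
    intro v
    obtain ⟨k, _, hk⟩ := Finset.exists_max_image (univ : Finset (Fin (N + 1))) (fun j => E j v) ⟨0, mem_univ _⟩
    exact ⟨k, fun j => hk j (mem_univ j)⟩
  choose k hk using hmax
  have hΔ : 0 < ∑ v, E (k v) v := by
    obtain ⟨j1, j2, h12⟩ := hne
    have : ∃ v, E j1 v ≠ E j2 v := by
      by_contra hh
      push Not at hh
      exact h12 (funext hh)
    obtain ⟨v, hv⟩ := this
    have key : ∀ j, E j v < E (k v) v → 0 < ∑ v, E (k v) v := by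
      intro j hj
      rw [← hs j]
      exact Finset.sum_lt_sum (fun v _ => hk v j) ⟨v, mem_univ _, hj⟩
    rcases lt_or_gt_of_ne hv with h | h
    · exact key j1 (lt_of_lt_of_le h (hk v j2))
    · exact key j2 (lt_of_lt_of_le h (hk v j1))
  set Δ := ∑ v, E (k v) v with hΔd
  choose L h hdet hsum hform using fun v => omit_forms (K := K) N (k v)
  set ε : ℝ := Δ / (Fintype.card (W ⊕ S) * N + 1) with hε
  have hden : (0:ℝ) < Fintype.card (W ⊕ S) * N + 1 := by positivity
  have hε0 : 0 < ε := div_pos hΔ hden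
  set c : W ⊕ S → Fin N → ℝ := fun v i => Sum.elim (fun w : W => E (h v i) v + ε) (fun s : S => min 0 (E (h v i) v + ε)) v with hc
  have hcle : ∀ v i, c v i ≤ E (h v i) v + ε := by
    rintro (w | s) i
    · exact le_refl _
    · exact min_le_right _ _
  refine thmS hG L hdet F q hq c (fun s i => min_le_left _ _) ?_ (fun t i => X i.castSucc t) ?_ ?_
  · have h1 : ∑ v, ∑ i, c v i ≤ ∑ v, ∑ i, (E (h v i) v + ε) :=
      Finset.sum_le_sum fun v _ => Finset.sum_le_sum fun i _ => hcle v i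
    have h2 : ∑ v, ∑ i, (E (h v i) v + ε) = -Δ + Fintype.card (W ⊕ S) * N * ε := by
      simp only [Finset.sum_add_distrib, Finset.sum_const, Finset.card_univ, Fintype.card_fin, nsmul_eq_mul]
      rw [Finset.sum_congr rfl fun v _ => hsum v (fun j => E j v), Finset.sum_sub_distrib, Finset.sum_comm]
      simp only [hs]
      rw [← hΔd, Finset.sum_const_zero]
      ring
    have h3 : (Fintype.card (W ⊕ S) * N + 1) * ε = Δ := by rw [hε]; field_simp
    linarith
  · have hN : 0 < N := by
      rcases Nat.eq_zero_or_pos N with rfl | h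
      · obtain ⟨j1, j2, h12⟩ := hne
        exact absurd (by rw [Fin.fin_one_eq_zero j1, Fin.fin_one_eq_zero j2]) h12
      · exact h
    filter_upwards [hX0] with t ht h0
    exact ht _ (congrFun h0 ⟨0, hN⟩)
  · have hall : ∀ᶠ t in (F : Filter ι), ∀ v, ∀ j, av v (X j t) ≤ Real.exp ((E j v + ε) * q t) := by
      rw [eventually_all]; intro v
      rw [eventually_all]; intro j
      exact hE j v ε hε0
    filter_upwards [hrel, hall] with t ht hb
    refine ⟨fun i => hXO _ _, fun v i => ?_⟩
    rw [hform v (fun j => X j t) ht i]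
    rcases v with w | s
    · exact hb _ _
    · have e1 := hb (Sum.inr s) (h (Sum.inr s) i)
      have e2 : av (Sum.inr s) (X (h (Sum.inr s) i) t) ≤ 1 := hG.fin_le s _ (hXO _ _)
      show _ ≤ Real.exp (min 0 (E (h (Sum.inr s) i) (Sum.inr s) + ε) * q t)
      rcases min_choice 0 (E (h (Sum.inr s) i) (Sum.inr s) + ε) with h | h <;> rw [h]
      · simpa using e2
      · exact e1

lemma class_step [Nonempty W] (hG : Geo O av) (hden : ∀ c : K, ∃ D : ℤ, D ≠ 0 ∧ (D : K) * c ∈ O)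
    {ι : Type*} (F : Ultrafilter ι) (q : ι → ℝ) (hq : Tendsto q F atTop)
    {T : Type*} [Fintype T] (g : T → ι → K) (hgO : ∀ j t, g j t ∈ O) (hg0 : ∀ᶠ t in (F : Filter ι), ∀ j, g j t ≠ 0)
    (e : T → W ⊕ S → ℝ) (he : ∀ j v, ∀ ε > 0, ∀ᶠ t in (F : Filter ι), av v (g j t) ≤ Real.exp ((e j v + ε) * q t))
    (hs : ∀ j, ∑ v, e j v = 0) (c : T → K) (hne : ∃ j1 j2, c j1 ≠ 0 ∧ c j2 ≠ 0 ∧ e j1 ≠ e j2)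
    (hrel : ∀ᶠ t in (F : Filter ι), ∑ j, c j * g j t = 0) :
    ∃ b : T → K, (∀ j, c j = 0 → b j = 0) ∧ (∃ j, b j ≠ 0) ∧ (∃ j, c j ≠ 0 ∧ b j = 0) ∧
      ∀ᶠ t in (F : Filter ι), ∑ j, b j * g j t = 0 := by
  classical
  choose D hD0 hDO using hden
  set Dt : ℤ := ∏ j, D (c j) with hDt
  have hDt0 : (Dt : K) ≠ 0 := by
    rw [Int.cast_ne_zero, hDt]
    exact Finset.prod_ne_zero_iff.2 fun j _ => hD0 _
  have hDtO : ∀ j, (Dt : K) * c j ∈ O := by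
    intro j
    rw [hDt, ← Finset.mul_prod_erase _ _ (mem_univ j), Int.cast_mul, mul_right_comm]
    exact O.mul_mem (hDO _) (intCast_mem _ _)
  obtain ⟨j1, j2, hj1, hj2, h12⟩ := hne
  set T' := {j : T // c j ≠ 0} with hT'
  have hcardpos : 0 < Fintype.card T' := Fintype.card_pos_iff.2 ⟨⟨j1, hj1⟩⟩
  obtain ⟨N, hN⟩ : ∃ N, Fintype.card T' = N + 1 := ⟨_, (Nat.succ_pred_eq_of_pos hcardpos).symm⟩
  let σ : T' ≃ Fin (N + 1) := Fintype.equivFinOfCardEq hN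
  have hsumT : ∀ f : T → K, (∀ j, c j = 0 → f j = 0) → ∑ j, f j = ∑ i, f (σ.symm i).1 := by
    intro f hf
    rw [Equiv.sum_comp σ.symm (fun j : T' => f j.1)]
    rw [← Finset.sum_filter_of_ne (p := fun j => c j ≠ 0) (fun j _ hj h0 => hj (hf j h0))]
    exact Finset.sum_subtype _ (by simp) _
  obtain ⟨a, ha0, ha⟩ := vec_step hG F q hq (fun i t => (Dt : K) * c (σ.symm i).1 * g (σ.symm i).1 t)
    (fun i t => O.mul_mem (hDtO _) (hgO _ _))
    (by filter_upwards [hg0] with t ht i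
        exact mul_ne_zero (mul_ne_zero hDt0 (σ.symm i).2) (ht _))
    (fun i => e (σ.symm i).1) (by
      intro i v ε hε
      filter_upwards [he (σ.symm i).1 v (ε / 2) (by linarith), ev_small F q hq (-(ε / 2)) (by linarith)
        (av v ((Dt : K) * c (σ.symm i).1))] with t h1 h2
      rw [map_mul]
      calc _ ≤ av v ((Dt : K) * c (σ.symm i).1) * Real.exp ((e (σ.symm i).1 v + ε / 2) * q t) :=
            mul_le_mul_of_nonneg_left h1 ((av v).nonneg _)
        _ = (av v ((Dt : K) * c (σ.symm i).1) * Real.exp (-(ε / 2) * q t)) * Real.exp ((e (σ.symm i).1 v + ε) * q t) := by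
            rw [mul_assoc, ← Real.exp_add]; congr 2; ring
        _ ≤ _ := mul_le_of_le_one_left (Real.exp_nonneg _) h2.le)
    (fun i => hs _) ⟨σ ⟨j1, hj1⟩, σ ⟨j2, hj2⟩, by simpa using h12⟩
    (by filter_upwards [hrel] with t ht
        rw [hsumT (fun j => c j * g j t) (fun j hj => by rw [hj, zero_mul])] at ht
        simp only [mul_assoc]
        rw [← Finset.mul_sum, ht, mul_zero])
  set a' : Fin (N + 1) → K := Fin.snoc (α := fun _ => K) a 0 with ha'
  set b : T → K := fun j => if h : c j ≠ 0 then a' (σ ⟨j, h⟩) * ((Dt : K) * c j) else 0 with hb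
  have hbσ : ∀ i, b (σ.symm i).1 = a' i * ((Dt : K) * c (σ.symm i).1) := by
    intro i
    have := (σ.symm i).2
    simp only [hb]
    rw [dif_pos this]
    simp
  refine ⟨b, ?_, ?_, ?_, ?_⟩
  · intro j hj
    simp [hb, hj]
  · obtain ⟨i, hi⟩ := Function.ne_iff.1 ha0
    refine ⟨(σ.symm i.castSucc).1, ?_⟩
    rw [hbσ]
    refine mul_ne_zero ?_ (mul_ne_zero hDt0 (σ.symm _).2)
    rw [ha', Fin.snoc_castSucc]; exact hi
  · refine ⟨(σ.symm (Fin.last N)).1, (σ.symm _).2, ?_⟩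
    rw [hbσ, ha', Fin.snoc_last, zero_mul]
  · filter_upwards [ha] with t ht
    rw [hsumT (fun j => b j * g j t) (fun j hj => by simp [hb, hj]), Fin.sum_univ_castSucc]
    simp only [hbσ]
    rw [ha', Fin.snoc_last, zero_mul, zero_mul, add_zero]
    refine Eq.trans ?_ ht
    refine Finset.sum_congr rfl fun i _ => ?_
    rw [Fin.snoc_castSucc]; ring

open Classical in
lemma class_lem [Nonempty W] (hG : Geo O av) (hden : ∀ c : K, ∃ D : ℤ, D ≠ 0 ∧ (D : K) * c ∈ O)
    {ι : Type*} (F : Ultrafilter ι) (q : ι → ℝ) (hq : Tendsto q F atTop)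
    {T : Type*} [Fintype T] (g : T → ι → K) (hgO : ∀ j t, g j t ∈ O) (hg0 : ∀ᶠ t in (F : Filter ι), ∀ j, g j t ≠ 0)
    (e : T → W ⊕ S → ℝ) (he : ∀ j v, ∀ ε > 0, ∀ᶠ t in (F : Filter ι), av v (g j t) ≤ Real.exp ((e j v + ε) * q t))
    (hs : ∀ j, ∑ v, e j v = 0) (n : ℕ) : ∀ (c : T → K), #{j | c j ≠ 0} = n →
    (∀ᶠ t in (F : Filter ι), ∑ j, c j * g j t = 0) → ∀ E : W ⊕ S → ℝ,
      ∀ᶠ t in (F : Filter ι), ∑ j, (if e j = E then c j * g j t else 0) = 0 := by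
  induction n using Nat.strong_induction_on with
  | _ n ih =>
    intro c hcn hrel E
    by_cases hne : ∃ j1 j2, c j1 ≠ 0 ∧ c j2 ≠ 0 ∧ e j1 ≠ e j2
    · obtain ⟨b, hb1, ⟨j1, hj1⟩, ⟨j0, hj0, hbj0⟩, hbrel⟩ := class_step hG hden F q hq g hgO hg0 e he hs c hne hrel
      have hlt : #{j | b j ≠ 0} < n := by
        rw [← hcn]
        apply Finset.card_lt_card
        refine ⟨fun j hj => ?_, fun hh => ?_⟩
        · simp only [mem_filter, mem_univ, true_and] at hj ⊢
          exact fun h => hj (hb1 j h)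
        · have := hh (show j0 ∈ ({j | c j ≠ 0} : Finset T) by simp [hj0])
          simp [hbj0] at this
      have hbc := ih _ hlt b rfl hbrel
      have hb1rel := hbc (e j1)
      set c' : T → K := fun j => c j - (c j1 / b j1) * (if e j = e j1 then b j else 0) with hc'
      have hc'1 : c' j1 = 0 := by simp [hc', hj1]
      have hcj1 : c j1 ≠ 0 := fun h => hj1 (hb1 _ h)
      have hlt' : #{j | c' j ≠ 0} < n := by
        rw [← hcn]
        apply Finset.card_lt_card
        refine ⟨fun j hj => ?_, fun hh => ?_⟩
        · simp only [mem_filter, mem_univ, true_and] at hj ⊢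
          exact fun h => hj (by simp [hc', h, hb1 j h])
        · have := hh (show j1 ∈ ({j | c j ≠ 0} : Finset T) by simp [hcj1])
          simp [hc'1] at this
      have hc'rel : ∀ᶠ t in (F : Filter ι), ∑ j, c' j * g j t = 0 := by
        filter_upwards [hrel, hb1rel] with t h1 h2
        have : ∑ j, c' j * g j t = ∑ j, c j * g j t - (c j1 / b j1) * ∑ j, (if e j = e j1 then b j * g j t else 0) := by
          rw [Finset.mul_sum, ← Finset.sum_sub_distrib]
          refine Finset.sum_congr rfl fun j _ => ?_
          simp only [hc']; split_ifs <;> ring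
        rw [this, h1, h2]; simp
      have hfin := ih _ hlt' c' rfl hc'rel E
      filter_upwards [hfin, hb1rel] with t h1 h2
      have : ∑ j, (if e j = E then c j * g j t else 0) = ∑ j, (if e j = E then c' j * g j t else 0) +
          (c j1 / b j1) * (if e j1 = E then ∑ j, (if e j = e j1 then b j * g j t else 0) else 0) := by
        by_cases hE : e j1 = E
        · rw [if_pos hE, Finset.mul_sum, ← Finset.sum_add_distrib]
          refine Finset.sum_congr rfl fun j _ => ?_
          rw [hE]
          simp only [hc', hE]; split_ifs <;> ring
        · rw [if_neg hE, mul_zero, add_zero]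
          refine Finset.sum_congr rfl fun j _ => ?_
          by_cases h : e j = E
          · have h3 : e j ≠ e j1 := fun h4 => hE (h4 ▸ h)
            simp [hc', h3]
          · simp [h]
      rw [this, h1, h2]; simp
    · push Not at hne
      by_cases hE : ∃ j, c j ≠ 0 ∧ e j = E
      · obtain ⟨j1, hj1, hj1E⟩ := hE
        filter_upwards [hrel] with t ht
        refine Eq.trans ?_ ht
        refine Finset.sum_congr rfl fun j _ => ?_
        by_cases hj : c j = 0
        · simp [hj]
        · rw [if_pos]
          rw [← hj1E]; exact hne j j1 hj hj1
      · push Not at hE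
        refine Eventually.of_forall fun t => Finset.sum_eq_zero fun j _ => ?_
        by_cases hj : c j = 0
        · simp [hj]
        · rw [if_neg (hE j hj)]

end
end Sub15

set_option linter.unusedVariables false
set_option linter.unusedSectionVars false
set_option linter.style.longLine false
namespace Sub15
noncomputable section
open Finset Filter NumberField IsDedekindDomain

variable {K : Type*} [Field K] [NumberField K]

lemma fa_zpow (v : HeightOneSpectrum (𝓞 K)) : ∃ b : ℝ, 1 < b ∧ ∀ x : K, x ≠ 0 → ∃ k : ℤ, fa v x = b ^ k := by
  refine ⟨NNReal.sqrt (Ideal.absNorm v.asIdeal : NNReal), by exact_mod_cast sqrt_base v, fun x hx => ?_⟩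
  have h1 : fa v x = WithZeroMulInt.toNNReal (ne_zero_of_lt (sqrt_base v)) (v.valuation K x) := rfl
  have h : v.valuation K x ≠ 0 := by simpa using hx
  rw [h1, WithZeroMulInt.toNNReal_neg_apply _ h]
  exact ⟨_, NNReal.coe_zpow _ _⟩

lemma kron (x : K) (hw : ∀ w : InfinitePlace K, w x = 1) (hv : ∀ v, fa v x = 1) : ∃ n : ℕ, 0 < n ∧ x ^ n = 1 := by
  have hintg : x ∈ oK K := by
    refine HeightOneSpectrum.mem_integers_of_valuation_le_one K x fun v => ?_
    have h1 : fa v x = WithZeroMulInt.toNNReal (ne_zero_of_lt (sqrt_base v)) (v.valuation K x) := rfl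
    have h2 := hv v
    rw [h1] at h2
    rw [← WithZeroMulInt.toNNReal_le_one_iff (sqrt_base v)]
    exact_mod_cast h2.le
  obtain ⟨n, hn, h⟩ := Embeddings.pow_eq_one_of_norm_eq_one K ℂ (mem_oK.1 hintg) (fun φ => by
    rw [← InfinitePlace.apply]; exact hw _)
  exact ⟨n, hn, h⟩

lemma hden_inst (c : K) : ∃ D : ℤ, D ≠ 0 ∧ (D : K) * c ∈ oK K := by
  have h : IsAlgebraic ℤ c := (IsFractionRing.isAlgebraic_iff ℤ ℚ K).2 (Algebra.IsAlgebraic.isAlgebraic c)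
  obtain ⟨y, hy, h⟩ := IsAlgebraic.exists_integral_multiple h
  refine ⟨y, hy, mem_oK.2 ?_⟩
  simpa using h

lemma exists_fa_p [IsTotallyComplex K] (p : ℕ) (hp : 1 < p) : ∃ v : HeightOneSpectrum (𝓞 K), fa v (p : K) ≠ 1 := by
  by_contra hh
  push Not at hh
  have hp0 : (p : K) ≠ 0 := by exact_mod_cast (by omega : p ≠ 0)
  have h := pav_prod_one (∅ : Finset (HeightOneSpectrum (𝓞 K))) (p : K) hp0 (fun v _ => hh v)
  rw [Fintype.prod_sum_type] at h
  simp only [pav_inl] at h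
  have h1 : ∀ w : InfinitePlace K, w (p : K) = p := by
    intro w
    rw [← InfinitePlace.norm_embedding_eq, map_natCast, Complex.norm_natCast]
  simp only [h1, Finset.prod_const] at h
  rw [Finset.univ_eq_empty (α := ↥(∅ : Finset (HeightOneSpectrum (𝓞 K)))), Finset.prod_empty, mul_one] at h
  have h2 : (1 : ℝ) < (p : ℝ) ^ #(univ : Finset (InfinitePlace K)) :=
    one_lt_pow₀ (by exact_mod_cast hp) (by simp)
  linarith

lemma pos_of_ne {v : AbsoluteValue K ℝ} {x : K} (hx : x ≠ 0) : 0 < v x := v.pos hx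

/-- same logarithmic absolute values implies quotient a root of unity -/
lemma classA (S : Finset (HeightOneSpectrum (𝓞 K))) (x y : K) (hx : x ≠ 0) (hy : y ≠ 0)
    (hxS : ∀ v ∉ S, fa v x = 1) (hyS : ∀ v ∉ S, fa v y = 1)
    (h : ∀ v, Real.log (pav S v x) = Real.log (pav S v y)) : ∃ n : ℕ, 0 < n ∧ (x / y) ^ n = 1 := by
  have h1 : ∀ v, pav S v x = pav S v y := fun v =>
    Real.log_injOn_pos ((pav S v).pos hx) ((pav S v).pos hy) (h v)
  apply kron
  · intro w
    rw [map_div₀]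
    have := h1 (Sum.inl w)
    rw [pav_inl, pav_inl] at this
    rw [this]
    exact div_self (by simpa using hy)
  · intro v
    rw [map_div₀]
    by_cases hv : v ∈ S
    · have := h1 (Sum.inr ⟨v, hv⟩)
      rw [pav_inr, pav_inr] at this
      simp only at this
      rw [this]
      exact div_self ((fa v).pos hy).ne'
    · rw [hxS v hv, hyS v hv, div_one]

lemma classB [IsTotallyComplex K] (S : Finset (HeightOneSpectrum (𝓞 K))) (x : K) (p : ℕ) (hp : 1 < p) (hx : x ≠ 0)
    (hxS : ∀ v ∉ S, fa v x = 1) (hpS : ∀ v ∉ S, fa v (p : K) = 1) (θ : ℝ)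
    (h : ∀ v, Real.log (pav S v x) = θ * Real.log (pav S v (p : K)))
    (hind : ∀ a b : ℤ, x ^ a = (p : K) ^ b → a = 0 ∧ b = 0) : False := by
  have hp0 : (p : K) ≠ 0 := by exact_mod_cast (by omega : p ≠ 0)
  obtain ⟨v, hv⟩ := exists_fa_p (K := K) p hp
  have hvS : v ∈ S := by
    by_contra hh; exact hv (hpS v hh)
  obtain ⟨b, hb, hbz⟩ := fa_zpow v
  obtain ⟨f, hf⟩ := hbz x hx
  obtain ⟨e, he⟩ := hbz p hp0
  have h1 := h (Sum.inr ⟨v, hvS⟩)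
  rw [pav_inr, pav_inr] at h1
  simp only at h1
  rw [hf, he, Real.log_zpow, Real.log_zpow] at h1
  have hlb : 0 < Real.log b := Real.log_pos hb
  have h2 : (f : ℝ) = θ * e := by
    have : (f - θ * e) * Real.log b = 0 := by linarith
    rcases mul_eq_zero.1 this with h | h <;> linarith
  have he0 : e ≠ 0 := by
    rintro rfl
    exact hv (by rw [he, zpow_zero])
  obtain ⟨n, hn, hn1⟩ := classA S (x ^ e) ((p : K) ^ f) (zpow_ne_zero _ hx) (zpow_ne_zero _ hp0)
    (fun v hv => by rw [map_zpow₀, hxS v hv, one_zpow]) (fun v hv => by rw [map_zpow₀, hpS v hv, one_zpow])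
    (fun v => by
      rw [map_zpow₀, map_zpow₀, Real.log_zpow, Real.log_zpow, h, h2]; ring)
  rw [div_pow, div_eq_one_iff_eq (pow_ne_zero _ (zpow_ne_zero _ hp0)), ← zpow_natCast, ← zpow_natCast, ← zpow_mul, ← zpow_mul] at hn1
  have := (hind _ _ hn1).1
  rcases mul_eq_zero.1 this with h | h
  · exact he0 h
  · omega

lemma ev_pow_exp (a : ℕ) (ε : ℝ) (hε : 0 < ε) : ∀ᶠ n : ℕ in atTop, (n : ℝ) ^ a ≤ Real.exp (ε * n) := by
  have h := (isLittleO_pow_exp_pos_mul_atTop a hε).bound (c := 1) one_pos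
  have h2 := tendsto_natCast_atTop_atTop (R := ℝ) |>.eventually h
  filter_upwards [h2] with n hn
  rw [one_mul, Real.norm_eq_abs, Real.norm_eq_abs, abs_of_nonneg (by positivity), abs_of_pos (Real.exp_pos _)] at hn
  exact hn

theorem main_K [IsTotallyComplex K] (p : ℕ) (hp : 1 < p) {s : ℕ} (r : Fin s → K) (hr0 : ∀ i, r i ≠ 0)
    (hrint : ∀ i, IsIntegral ℤ (r i)) (hnd : ∀ i j, i ≠ j → ∀ k : ℕ, 0 < k → (r i / r j) ^ k ≠ 1)
    (i0 : Fin s) (hind : ∀ a b : ℤ, r i0 ^ a = (p : K) ^ b → a = 0 ∧ b = 0)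
    {D k : ℕ} (C : Fin s → Fin D → K) (d : Fin k → K) (m : Fin k → ℕ → ℕ) (B : ℝ)
    (F : Ultrafilter ℕ) (hF : (F : Filter ℕ) ≤ atTop)
    (hm : ∀ᶠ n : ℕ in (F : Filter ℕ), ∀ j, (m j n : ℝ) ≤ B * n)
    (hrel : ∀ᶠ n : ℕ in (F : Filter ℕ), ∑ i, (∑ a, C i a * (n : K) ^ (a : ℕ)) * r i ^ n + ∑ j, d j * (p : K) ^ m j n = 0) :
    ∀ᶠ n : ℕ in (F : Filter ℕ), ∑ a, C i0 a * (n : K) ^ (a : ℕ) = 0 := by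
  classical
  have hp0 : (p : K) ≠ 0 := by exact_mod_cast (by omega : p ≠ 0)
  set S : Finset (HeightOneSpectrum (𝓞 K)) := (fa_fin (p : K) hp0).toFinset ∪ univ.biUnion fun i => (fa_fin (r i) (hr0 i)).toFinset with hS
  have hpS : ∀ v ∉ S, fa v (p : K) = 1 := by
    intro v hv
    by_contra hh
    exact hv (by rw [hS]; simp [hh])
  have hrS : ∀ i, ∀ v ∉ S, fa v (r i) = 1 := by
    intro i v hv
    by_contra hh
    refine hv ?_
    rw [hS, mem_union, mem_biUnion]
    right
    exact ⟨i, mem_univ _, by simpa using hh⟩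
  have hpos : ∀ᶠ n : ℕ in (F : Filter ℕ), 0 < n := hF (eventually_gt_atTop 0)
  have hθ : ∀ j, ∃ θ, Tendsto (fun n : ℕ => (m j n : ℝ) / n) F (nhds θ) := by
    intro j
    refine ultra_lim F _ 0 B ?_
    filter_upwards [hm, hpos] with n h1 h2
    have : (0 : ℝ) < n := by exact_mod_cast h2
    exact ⟨by positivity, by rw [div_le_iff₀ this]; exact h1 j⟩
  choose θ hθ using hθ
  let T := (Fin s × Fin D) ⊕ Fin k
  let g : T → ℕ → K := Sum.elim (fun ia n => (n : K) ^ (ia.2 : ℕ) * r ia.1 ^ n) (fun j n => (p : K) ^ m j n)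
  let e : T → InfinitePlace K ⊕ S → ℝ := Sum.elim (fun ia v => Real.log (pav S v (r ia.1))) (fun j v => θ j * Real.log (pav S v (p : K)))
  let c : T → K := Sum.elim (fun ia => C ia.1 ia.2) d
  have hq : Tendsto (fun n : ℕ => (n : ℝ)) F atTop := tendsto_natCast_atTop_atTop.mono_left hF
  have key := class_lem (geo_inst S) hden_inst F (fun n : ℕ => (n : ℝ)) hq g ?_ ?_ e ?_ ?_ _ c rfl ?_
    (fun v => Real.log (pav S v (r i0)))
  · filter_upwards [key] with n hn
    rw [Fintype.sum_sum_type] at hn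
    have h1 : ∀ j, e (Sum.inr j) ≠ fun v => Real.log (pav S v (r i0)) := by
      intro j hj
      exact classB S (r i0) p hp (hr0 i0) (hrS i0) hpS (θ j) (fun v => (congrFun hj v).symm) hind
    have h2 : ∀ ia : Fin s × Fin D, (e (Sum.inl ia) = fun v => Real.log (pav S v (r i0))) ↔ ia.1 = i0 := by
      intro ia
      constructor
      · intro h
        by_contra hne
        obtain ⟨k, hk, hk1⟩ := classA S (r ia.1) (r i0) (hr0 _) (hr0 _) (hrS _) (hrS _) (fun v => congrFun h v)
        exact hnd _ _ hne k hk hk1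
      · intro h
        rw [← h]; rfl
    simp only [h1, h2, if_false, Finset.sum_const_zero, add_zero] at hn
    rw [Fintype.sum_prod_type] at hn
    simp only at hn
    rw [Finset.sum_eq_single i0 (fun i _ hi => by simp [hi]) (by simp)] at hn
    simp only [if_true] at hn
    have h3 : (∑ a, C i0 a * (n : K) ^ (a : ℕ)) * r i0 ^ n = 0 := by
      rw [← hn, Finset.sum_mul]
      exact Finset.sum_congr rfl fun a _ => mul_assoc _ _ _
    exact (mul_eq_zero.1 h3).resolve_right (pow_ne_zero _ (hr0 _))
  · rintro (ia | j) n
    · exact (oK K).mul_mem ((oK K).pow_mem (natCast_mem _ _) _) ((oK K).pow_mem (mem_oK.2 (hrint _)) _)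
    · exact (oK K).pow_mem (natCast_mem _ _) _
  · filter_upwards [hpos] with n hn
    rintro (ia | j)
    · exact mul_ne_zero (pow_ne_zero _ (by exact_mod_cast hn.ne')) (pow_ne_zero _ (hr0 _))
    · exact pow_ne_zero _ hp0
  · rintro (ia | j) v ε hε
    · filter_upwards [hF (ev_pow_exp ia.2 ε hε)] with n hn
      show pav S v ((n : K) ^ (ia.2 : ℕ) * r ia.1 ^ n) ≤ Real.exp ((Real.log (pav S v (r ia.1)) + ε) * n)
      rw [map_mul, map_pow, map_pow, add_mul, Real.exp_add, mul_comm]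
      have e1 : pav S v (r ia.1) ^ n = Real.exp (Real.log (pav S v (r ia.1)) * n) := by
        rw [mul_comm, Real.exp_nat_mul, Real.exp_log ((pav S v).pos (hr0 _))]
      rw [e1]
      refine mul_le_mul_of_nonneg_left ?_ (Real.exp_nonneg _)
      refine le_trans (pow_le_pow_left₀ ((pav S v).nonneg _) ?_ _) hn
      have := av_int_le (pav S v) (n : ℤ)
      simpa using this
    · have h1 := (hθ j).mul_const (Real.log (pav S v (p : K)))
      have h2 := h1.eventually_lt_const (show θ j * Real.log (pav S v (p : K)) < θ j * Real.log (pav S v (p : K)) + ε by linarith)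
      filter_upwards [h2, hpos] with n h3 h4
      show pav S v ((p : K) ^ m j n) ≤ Real.exp ((θ j * Real.log (pav S v (p : K)) + ε) * n)
      have h4' : (0 : ℝ) < n := by exact_mod_cast h4
      rw [map_pow, ← Real.exp_log ((pav S v).pos hp0), ← Real.exp_nat_mul, Real.exp_le_exp, Real.log_exp]
      have h5 := mul_le_mul_of_nonneg_right h3.le h4'.le
      refine le_trans (le_of_eq ?_) h5
      field_simp
  · have hlog : ∀ x : K, x ≠ 0 → (∀ v ∉ S, fa v x = 1) → ∑ v, Real.log (pav S v x) = 0 := by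
      intro x hx h
      rw [← Real.log_prod (fun v _ => ((pav S v).pos hx).ne'), pav_prod_one S x hx h, Real.log_one]
    rintro (ia | j)
    · exact hlog _ (hr0 _) (hrS _)
    · show ∑ v, θ j * Real.log (pav S v (p : K)) = 0
      rw [← Finset.mul_sum, hlog _ hp0 hpS, mul_zero]
  · filter_upwards [hrel] with n hn
    rw [Fintype.sum_sum_type, Fintype.sum_prod_type]
    refine Eq.trans ?_ hn
    congr 1
    refine Finset.sum_congr rfl fun i _ => ?_
    rw [Finset.sum_mul]
    exact Finset.sum_congr rfl fun a _ => (mul_assoc _ _ _).symm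

end
end Sub15

set_option linter.unusedVariables false
set_option linter.unusedSectionVars false
set_option linter.style.longLine false
namespace Sub15
noncomputable section
open Finset Filter Polynomial

/-- the shift operator -/
def shiftE : Module.End ℂ (ℕ → ℂ) := LinearMap.funLeft ℂ ℂ (fun n => n + 1)

lemma shiftE_apply (f : ℕ → ℂ) (n : ℕ) : shiftE f n = f (n + 1) := rfl

lemma shiftE_pow (k : ℕ) (f : ℕ → ℂ) (n : ℕ) : (shiftE ^ k) f n = f (n + k) := by
  induction k generalizing f n with
  | zero => simp
  | succ k ih =>
    rw [pow_succ, Module.End.mul_apply, ih, shiftE_apply]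
    congr 1

lemma polyexp_gen (r : ℂ) (N : ℕ) : ∀ P : ℂ[X], P.degree < N → ((shiftE - r • 1) ^ N) (fun n => P.eval (n : ℂ) * r ^ n) = 0 := by
  induction N with
  | zero =>
    intro P hP
    have : P = 0 := by
      rw [← degree_eq_bot]
      simpa [Nat.WithBot.lt_zero_iff] using hP
    subst this
    funext n; simp
  | succ N ih =>
    intro P hP
    rw [pow_succ, Module.End.mul_apply]
    have h1 : (shiftE - r • 1 : Module.End ℂ (ℕ → ℂ)) (fun n => P.eval (n : ℂ) * r ^ n) =
        fun n : ℕ => (C r * (taylor 1 P - P)).eval (n : ℂ) * r ^ n := by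
      funext n
      simp only [LinearMap.sub_apply, LinearMap.smul_apply, Module.End.one_apply, Pi.sub_apply, Pi.smul_apply, shiftE_apply, smul_eq_mul]
      rw [eval_mul, eval_C, eval_sub, taylor_eval]
      push_cast
      ring
    rw [h1]
    apply ih
    by_cases hP0 : P = 0
    · subst hP0
      simp
    have h2 : (taylor 1 P - P).degree < P.degree := by
      have := degree_sub_lt_left (p := taylor 1 P) (q := P) (by simp) (by simpa using hP0) (by simp)
      simpa using this
    rw [← smul_eq_C_mul]
    refine lt_of_le_of_lt (degree_smul_le _ _) ?_
    have h3 : P.degree ≤ N := degree_le_of_natDegree_le (Nat.lt_succ_iff.1 ((natDegree_lt_iff_degree_lt hP0).2 hP))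
    exact lt_of_lt_of_le h2 h3

theorem integral_roots (u : ℕ → ℤ) (m : ℕ) (c : Fin m → ℤ)
    (hrec : ∀ n : ℕ, u (n + m) + ∑ i : Fin m, c i * u (n + i) = 0)
    (s : ℕ) (P : Fin s → ℂ[X]) (r : Fin s → ℂ)
    (hPne : ∀ i, P i ≠ 0) (hrne : ∀ i, r i ≠ 0) (hrinj : Function.Injective r)
    (hu : ∀ n : ℕ, (u n : ℂ) = ∑ i, (P i).eval (n : ℂ) * r i ^ n) (i : Fin s) : IsIntegral ℤ (r i) := by
  let χ : ℤ[X] := X ^ m + ∑ j : Fin m, C (c j) * X ^ (j : ℕ)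
  have hmon : χ.Monic := by
    apply monic_X_pow_add
    refine lt_of_le_of_lt (degree_sum_le _ _) ?_
    rw [Finset.sup_lt_iff (by exact WithBot.bot_lt_coe m)]
    intro j _
    exact lt_of_le_of_lt (degree_C_mul_X_pow_le _ _) (by exact_mod_cast j.2)
  refine ⟨χ, hmon, ?_⟩
  by_contra hne
  let χ' : ℂ[X] := χ.map (algebraMap ℤ ℂ)
  have hχr : χ'.eval (r i) ≠ 0 := by rwa [eval_map]
  let U : Fin s → ℕ → ℂ := fun i n => (P i).eval (n : ℂ) * r i ^ n
  have hU : ∀ i, ∃ k : ℕ, ((shiftE - r i • 1 : Module.End ℂ (ℕ → ℂ)) ^ k) (U i) = 0 := fun i =>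
    ⟨(P i).natDegree + 1, polyexp_gen (r i) _ _ (lt_of_le_of_lt degree_le_natDegree (by exact_mod_cast Nat.lt_succ_self _))⟩
  have hχE : ∀ f n, (aeval shiftE χ') f n = f (n + m) + ∑ j : Fin m, (c j : ℂ) * f (n + j) := by
    intro f n
    have : aeval shiftE χ' = shiftE ^ m + ∑ j : Fin m, (c j : ℂ) • shiftE ^ (j : ℕ) := by
      simp only [χ', χ, Polynomial.map_add, Polynomial.map_pow, Polynomial.map_X, Polynomial.map_sum, Polynomial.map_mul, Polynomial.map_C, map_add, map_pow, aeval_X, map_sum, map_mul, aeval_C]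
      congr 1
    rw [this, LinearMap.add_apply, Pi.add_apply, shiftE_pow, LinearMap.sum_apply, Finset.sum_apply]
    simp only [LinearMap.smul_apply, Pi.smul_apply, shiftE_pow, smul_eq_mul]
  have hsum : ∑ j, (aeval shiftE χ') (U j) = 0 := by
    rw [← map_sum]
    funext n
    have hUu : ∀ n, (∑ j, U j) n = (u n : ℂ) := fun n => by rw [hu, Finset.sum_apply]
    rw [hχE]
    simp only [hUu]
    show _ = (0 : ℂ)
    exact_mod_cast hrec n
  have hind := (iSupIndep_iff_finsetSum_eq_zero_imp_eq_zero _).1 ((Module.End.independent_maxGenEigenspace shiftE).comp hrinj)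
    univ (fun j => (aeval shiftE χ') (U j)) (fun j _ => by
      rw [Function.comp_apply, Module.End.mem_maxGenEigenspace]
      obtain ⟨k, hk⟩ := hU j
      refine ⟨k, ?_⟩
      have e1 : (shiftE - r j • 1 : Module.End ℂ (ℕ → ℂ)) ^ k = aeval shiftE ((X - C (r j)) ^ k) := by
        simp [Algebra.smul_def]
      rw [e1] at hk ⊢
      rw [← Module.End.mul_apply, ← map_mul, mul_comm, map_mul, Module.End.mul_apply, hk, map_zero]) hsum i (mem_univ _)
  obtain ⟨k, hk⟩ := hU i
  have e1 : (shiftE - r i • 1 : Module.End ℂ (ℕ → ℂ)) ^ k = aeval shiftE ((X - C (r i)) ^ k) := by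
    simp [Algebra.smul_def]
  rw [e1] at hk
  have hcop : IsCoprime ((X - C (r i)) ^ k) χ' := by
    apply IsCoprime.pow_left
    rw [(irreducible_X_sub_C (r i)).coprime_iff_not_dvd, dvd_iff_isRoot]
    exact hχr
  obtain ⟨a, b, hab⟩ := hcop
  have hzero : U i = 0 := by
    have : U i = aeval shiftE (1 : ℂ[X]) (U i) := by simp
    rw [this, ← hab, map_add, map_mul, map_mul, LinearMap.add_apply, Module.End.mul_apply, Module.End.mul_apply, hk]
    rw [hind, map_zero, map_zero, add_zero]
  apply hPne i
  apply Polynomial.eq_zero_of_infinite_isRoot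
  refine Set.Infinite.mono ?_ (Set.infinite_range_of_injective (Nat.cast_injective (R := ℂ)))
  rintro _ ⟨n, rfl⟩
  have := congrFun hzero n
  exact (mul_eq_zero.1 this).resolve_right (pow_ne_zero _ (hrne i))

end
end Sub15

set_option linter.unusedVariables false
set_option linter.unusedSectionVars false
set_option linter.style.longLine false
namespace Sub15
noncomputable section
open Finset Filter

lemma pexp_bound (p : ℕ) (hp : 2 ≤ p) {k : ℕ} (cc : Fin k → ℤ) (m : Fin k → ℕ) (U : ℤ) (W : ℕ) (hW : 0 < W)
    (hUW : |U| + ∑ j, |cc j| < (p : ℤ) ^ W) (hU : U = ∑ j, cc j * (p : ℤ) ^ m j)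
    (hsub : ∀ J : Finset (Fin k), J.Nonempty → ∑ j ∈ J, cc j * (p : ℤ) ^ m j ≠ 0) (j : Fin k) : m j ≤ W * k := by
  classical
  have hp1 : (1 : ℤ) ≤ p := by exact_mod_cast (by omega : 1 ≤ p)
  obtain ⟨l, hl, hlf⟩ : ∃ l ∈ range (k + 1), l ∉ univ.image fun j => m j / W := by
    apply Finset.exists_mem_notMem_of_card_lt_card
    refine lt_of_le_of_lt card_image_le ?_
    simp
  have hlf' : ∀ j, m j / W ≠ l := fun j h => hlf (mem_image.2 ⟨j, mem_univ _, h⟩)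
  set J := univ.filter fun j => l < m j / W with hJ
  have hsplit := Finset.sum_filter_add_sum_filter_not univ (fun j => l < m j / W) (fun j => cc j * (p : ℤ) ^ m j)
  rw [← hU] at hsplit
  have hdvd : (p : ℤ) ^ (W * (l + 1)) ∣ ∑ j ∈ J, cc j * (p : ℤ) ^ m j := by
    apply Finset.dvd_sum
    intro j hj
    rw [hJ, mem_filter] at hj
    refine Dvd.dvd.mul_left (pow_dvd_pow _ ?_) _
    have : l + 1 ≤ m j / W := hj.2
    rw [Nat.le_div_iff_mul_le hW] at this
    rwa [mul_comm]
  have hsm : |∑ j ∈ univ.filter (fun j => ¬ l < m j / W), cc j * (p : ℤ) ^ m j| ≤ (∑ j, |cc j|) * (p : ℤ) ^ (W * l) := by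
    refine (Finset.abs_sum_le_sum_abs _ _).trans ?_
    rw [Finset.sum_mul]
    refine le_trans (Finset.sum_le_sum (g := fun j => |cc j| * (p : ℤ) ^ (W * l)) fun j hj => ?_)
      (Finset.sum_le_sum_of_subset_of_nonneg (subset_univ _) fun j _ _ => by positivity)
    rw [mem_filter] at hj
    rw [abs_mul, abs_of_nonneg (by positivity : (0 : ℤ) ≤ (p : ℤ) ^ m j)]
    refine mul_le_mul_of_nonneg_left (pow_le_pow_right₀ hp1 ?_) (abs_nonneg _)
    have h1 : m j / W < l := lt_of_le_of_ne (not_lt.1 hj.2) (hlf' j)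
    rw [Nat.div_lt_iff_lt_mul hW] at h1
    rw [mul_comm]; exact h1.le
  have hpl : (1 : ℤ) ≤ (p : ℤ) ^ (W * l) := one_le_pow₀ hp1
  have hlt : |∑ j ∈ J, cc j * (p : ℤ) ^ m j| < (p : ℤ) ^ (W * (l + 1)) := by
    have e : ∑ j ∈ J, cc j * (p : ℤ) ^ m j = U - ∑ j ∈ univ.filter (fun j => ¬ l < m j / W), cc j * (p : ℤ) ^ m j := by
      rw [← hsplit]; ring
    rw [e]
    refine lt_of_le_of_lt (abs_sub _ _) ?_
    rw [mul_add, mul_one, pow_add]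
    nlinarith [abs_nonneg U]
  have hz := Int.eq_zero_of_abs_lt_dvd hdvd hlt
  have hJe : ¬ J.Nonempty := fun h => hsub J h hz
  have hjJ : j ∉ J := fun h => hJe ⟨j, h⟩
  rw [hJ, mem_filter] at hjJ
  have h1 : m j / W < l := lt_of_le_of_ne (not_lt.1 fun h => hjJ ⟨mem_univ _, h⟩) (hlf' j)
  rw [Nat.div_lt_iff_lt_mul hW, mul_comm] at h1
  have : l ≤ k := by rw [mem_range] at hl; omega
  exact h1.le.trans (Nat.mul_le_mul_left _ this)

lemma rec_growth (u : ℕ → ℤ) (m : ℕ) (c : Fin m → ℤ)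
    (hrec : ∀ n : ℕ, u (n + m) + ∑ i : Fin m, c i * u (n + i) = 0) :
    ∃ H : ℕ, 0 < H ∧ ∀ n, |u n| ≤ (H : ℤ) ^ (n + 1) := by
  set G : ℤ := 1 + ∑ i, |c i| + ∑ i ∈ range m, |u i| with hG
  have hc0 : 0 ≤ ∑ i, |c i| := Finset.sum_nonneg fun _ _ => abs_nonneg _
  have hu0 : 0 ≤ ∑ i ∈ range m, |u i| := Finset.sum_nonneg fun _ _ => abs_nonneg _
  have hG1 : 1 ≤ G := by omega
  refine ⟨G.toNat, by omega, ?_⟩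
  rw [Int.toNat_of_nonneg (by omega)]
  intro n
  induction n using Nat.strong_induction_on with
  | _ n ih =>
    rcases lt_or_ge n m with h | h
    · have h1 : |u n| ≤ ∑ i ∈ range m, |u i| :=
        Finset.single_le_sum (f := fun i => |u i|) (fun _ _ => abs_nonneg _) (mem_range.2 h)
      have h2 : G ≤ G ^ (n + 1) := le_self_pow₀ hG1 (by omega)
      omega
    · obtain ⟨n', rfl⟩ := Nat.exists_eq_add_of_le' h
      have e : u (n' + m) = - ∑ i : Fin m, c i * u (n' + i) := by linarith [hrec n']
      rw [e, abs_neg]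
      refine (Finset.abs_sum_le_sum_abs _ _).trans ?_
      refine le_trans (Finset.sum_le_sum (g := fun i => |c i| * G ^ (n' + m)) fun i _ => ?_) ?_
      · rw [abs_mul]
        refine mul_le_mul_of_nonneg_left ((ih (n' + i) (by omega)).trans (pow_le_pow_right₀ hG1 (by omega))) (abs_nonneg _)
      · rw [← Finset.sum_mul, pow_succ, mul_comm]
        exact mul_le_mul_of_nonneg_left (by omega) (by positivity)

lemma sol_bound (p : ℕ) (hp : 2 ≤ p) (u : ℕ → ℤ) (m : ℕ) (c : Fin m → ℤ)
    (hrec : ∀ n : ℕ, u (n + m) + ∑ i : Fin m, c i * u (n + i) = 0) {k : ℕ} (cc : Fin k → ℤ) :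
    ∃ B : ℕ, ∀ n : ℕ, 0 < n → ∀ e : Fin k → ℕ, u n = ∑ j, cc j * (p : ℤ) ^ e j →
      (∀ J : Finset (Fin k), J.Nonempty → ∑ j ∈ J, cc j * (p : ℤ) ^ e j ≠ 0) → ∀ j, e j ≤ B * n := by
  obtain ⟨H, hH, hb⟩ := rec_growth u m c hrec
  set A : ℤ := ∑ j, |cc j| with hA
  have hA0 : 0 ≤ A := Finset.sum_nonneg fun _ _ => abs_nonneg _
  set C1 : ℕ := H + A.toNat + 1 with hC1
  refine ⟨C1 * 2 * k, fun n hn e he hs j => ?_⟩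
  have h := pexp_bound p hp cc e (u n) (C1 * (n + 1)) (by positivity) ?_ he hs j
  · refine h.trans ?_
    have : C1 * (n + 1) * k ≤ C1 * (2 * n) * k := by gcongr; omega
    refine this.trans (le_of_eq (by ring))
  · have hpc : (C1 : ℤ) ≤ (p : ℤ) ^ C1 := by
      exact_mod_cast (Nat.lt_pow_self (by omega : 1 < p)).le
    have h1 : (C1 : ℤ) ^ (n + 1) ≤ (p : ℤ) ^ (C1 * (n + 1)) := by
      rw [pow_mul]; exact pow_le_pow_left₀ (by positivity) hpc _
    have h2 : (C1 : ℤ) = H + (A + 1) := by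
      rw [hC1]; push_cast; rw [Int.toNat_of_nonneg hA0]; ring
    have h3 : (H : ℤ) ^ (n + 1) + (A + 1) ^ (n + 1) ≤ (C1 : ℤ) ^ (n + 1) := by
      rw [h2]
      exact pow_add_pow_le (by positivity) (by positivity) (by omega)
    have h4 : A + 1 ≤ (A + 1) ^ (n + 1) := le_self_pow₀ (by omega) (by omega)
    have := hb n
    linarith

end
end Sub15

set_option linter.unusedVariables false
set_option linter.unusedSectionVars false
set_option linter.style.longLine false
namespace Sub15
noncomputable section
open Finset Filter NumberField

lemma totComplex {K : Type*} [Field K] [NumberField K] (J : K) (hJ : J ^ 2 = -1) : IsTotallyComplex K := by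
  refine ⟨fun w => ?_⟩
  rw [← InfinitePlace.not_isReal_iff_isComplex, InfinitePlace.isReal_iff]
  intro h
  have h1 := RingHom.congr_fun (ComplexEmbedding.isReal_iff.1 h) J
  rw [ComplexEmbedding.conjugate_coe_eq, Complex.conj_eq_iff_im] at h1
  have h2 : w.embedding J ^ 2 = -1 := by rw [← map_pow, hJ, map_neg, map_one]
  have h3 := congrArg Complex.re h2
  rw [pow_two, Complex.mul_re, h1] at h3
  simp at h3
  nlinarith [mul_self_nonneg (w.embedding J).re]

lemma final_K (p : ℕ) (hp : 1 < p) (K : IntermediateField ℚ ℂ) [NumberField K] [IsTotallyComplex K]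
    {s : ℕ} (P : Fin s → Polynomial ℂ) (r : Fin s → K) (hPne : ∀ i, P i ≠ 0) (hr0 : ∀ i, r i ≠ 0)
    (hrint : ∀ i, IsIntegral ℤ (r i)) (hnd : ∀ i j, i ≠ j → ∀ k : ℕ, 0 < k → (r i / r j) ^ k ≠ 1)
    (i0 : Fin s) (hind : ∀ a b : ℤ, r i0 ^ a = (p : K) ^ b → a = 0 ∧ b = 0)
    {k : ℕ} (cc : Fin k → ℤ) (B : ℕ) (A : Set ℕ) (hA : A.Infinite) (e : Fin k → ℕ → ℕ)
    (he : ∀ n ∈ A, 0 < n → ∀ j, e j n ≤ B * n)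
    (hrel : ∀ n ∈ A, ∑ i, (P i).eval (n : ℂ) * (r i : ℂ) ^ n = ∑ j, (cc j : ℂ) * (p : ℂ) ^ e j n) : False := by
  have hne : (atTop ⊓ 𝓟 A : Filter ℕ).NeBot := by
    rw [← Filter.frequently_mem_iff_neBot]
    exact Nat.frequently_atTop_iff_infinite.2 hA
  let F : Ultrafilter ℕ := Ultrafilter.of (atTop ⊓ 𝓟 A)
  have hFle : (F : Filter ℕ) ≤ atTop ⊓ 𝓟 A := Ultrafilter.of_le _
  have hF : (F : Filter ℕ) ≤ atTop := hFle.trans inf_le_left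
  have hFA : ∀ᶠ n : ℕ in (F : Filter ℕ), n ∈ A := hFle.trans inf_le_right (mem_principal_self A)
  obtain ⟨ψ, hψ⟩ : ∃ ψ : Module.Dual K ℂ, ψ (P i0).leadingCoeff ≠ 0 := by
    by_contra hh
    push Not at hh
    exact hPne i0 (Polynomial.leadingCoeff_eq_zero.1 ((Module.forall_dual_apply_eq_zero_iff K _).1 hh))
  let D : ℕ := univ.sup (fun i => (P i).natDegree) + 1
  have hD : ∀ i, (P i).natDegree < D := fun i => Nat.lt_succ_of_le (Finset.le_sup (f := fun i => (P i).natDegree) (mem_univ i))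
  have hev : ∀ i (n : ℕ), (P i).eval (n : ℂ) = ∑ a : Fin D, (P i).coeff a * (n : ℂ) ^ (a : ℕ) := by
    intro i n
    rw [Polynomial.eval_eq_sum_range' (hD i), Finset.sum_range]
  have hsm : ∀ (x : K) (z : ℂ), ψ ((x : ℂ) * z) = x * ψ z := by
    intro x z
    have := ψ.map_smul x z
    rwa [IntermediateField.smul_def, smul_eq_mul, smul_eq_mul] at this
  have key := main_K p hp r hr0 hrint hnd i0 hind (D := D) (fun i a => ψ ((P i).coeff a)) (fun j => -((cc j : K) * ψ 1)) e B F hF ?_ ?_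
  · let Q : Polynomial K := ∑ a : Fin D, Polynomial.C (ψ ((P i0).coeff a)) * Polynomial.X ^ (a : ℕ)
    have hQ0 : Q = 0 := by
      apply Polynomial.eq_zero_of_infinite_isRoot
      have hinf : {n : ℕ | ∑ a : Fin D, ψ ((P i0).coeff a) * (n : K) ^ (a : ℕ) = 0}.Infinite := by
        rw [← Nat.frequently_atTop_iff_infinite]
        exact key.frequently.filter_mono hF
      refine (hinf.image (Nat.cast_injective (R := K)).injOn).mono ?_
      rintro _ ⟨n, hn, rfl⟩
      show Q.eval (n : K) = 0
      simp only [Q, Polynomial.eval_finsetSum, Polynomial.eval_mul, Polynomial.eval_C, Polynomial.eval_pow, Polynomial.eval_X]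
      exact hn
    apply hψ
    have h1 : Q.coeff (P i0).natDegree = ψ (P i0).leadingCoeff := by
      simp only [Q, Polynomial.finsetSum_coeff, Polynomial.coeff_C_mul, Polynomial.coeff_X_pow]
      rw [Finset.sum_eq_single (⟨(P i0).natDegree, hD i0⟩ : Fin D)]
      · simp
      · intro b _ hb
        rw [if_neg, mul_zero]
        intro h
        exact hb (Fin.ext h.symm)
      · simp
    rw [← h1, hQ0, Polynomial.coeff_zero]
  · filter_upwards [hFA, hF (eventually_gt_atTop 0)] with n h1 h2 j
    exact_mod_cast he n h1 h2 j
  · filter_upwards [hFA] with n hn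
    have h := congrArg ψ (hrel n hn)
    rw [map_sum, map_sum] at h
    have e1 : ∀ i, ψ ((P i).eval (n : ℂ) * (r i : ℂ) ^ n) = (∑ a : Fin D, ψ ((P i).coeff a) * (n : K) ^ (a : ℕ)) * r i ^ n := by
      intro i
      have : (P i).eval (n : ℂ) * (r i : ℂ) ^ n = ((r i ^ n : K) : ℂ) * (P i).eval (n : ℂ) := by push_cast; ring
      rw [this, hsm, hev, map_sum, mul_comm]
      congr 1
      refine Finset.sum_congr rfl fun a _ => ?_
      have : (P i).coeff a * (n : ℂ) ^ (a : ℕ) = (((n : K) ^ (a : ℕ) : K) : ℂ) * (P i).coeff a := by push_cast; ring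
      rw [this, hsm, mul_comm]
    have e2 : ∀ j, ψ ((cc j : ℂ) * (p : ℂ) ^ e j n) = (cc j : K) * ψ 1 * (p : K) ^ e j n := by
      intro j
      have : (cc j : ℂ) * (p : ℂ) ^ e j n = (((cc j : K) * (p : K) ^ e j n : K) : ℂ) * 1 := by push_cast; ring
      rw [this, hsm]; ring
    simp only [e1, e2] at h
    rw [h, ← Finset.sum_add_distrib]
    exact Finset.sum_eq_zero fun j _ => by ring

end
end Sub15

theorem stmt15 (p : ℕ) (hp : p.Prime)
    (u : ℕ → ℤ) (m : ℕ) (hm : 0 < m) (c : Fin m → ℤ) (hc0 : c ⟨0, hm⟩ ≠ 0)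
    (hrec : ∀ n : ℕ, u (n + m) + ∑ i : Fin m, c i * u (n + i) = 0)
    (s : ℕ) (P : Fin s → Polynomial ℂ) (r : Fin s → ℂ)
    (hPne : ∀ i, P i ≠ 0) (hrne : ∀ i, r i ≠ 0) (hrinj : Function.Injective r)
    (hu : ∀ n : ℕ, (u n : ℂ) = ∑ i, (P i).eval (n : ℂ) * r i ^ n)
    -- non-degeneracy: characteristic roots and their ratios that are roots of
    -- unity are equal to 1
    (hnd1 : ∀ i, (∃ k : ℕ, 0 < k ∧ r i ^ k = 1) → r i = 1)
    (hnd2 : ∀ i j, (∃ k : ℕ, 0 < k ∧ (r i / r j) ^ k = 1) → r i / r j = 1)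
    -- some characteristic root is multiplicatively independent from p
    (hlam : ∃ i, ∀ r' s' : ℤ, r i ^ r' = (p : ℂ) ^ s' → r' = 0 ∧ s' = 0)
    (k : ℕ) (cc : Fin k → ℤ) (kk : Fin k → ℕ)
    -- no proper subsum vanishes at a solution
    (hsubsum : ∀ (n : ℕ) (f : Fin k → ℕ),
      u n = ∑ j, cc j * (p : ℤ) ^ (kk j * f j) →
      ∀ (I : Finset (Fin s)) (J : Finset (Fin k)),
        (I.Nonempty ∨ J.Nonempty) → (I ≠ Finset.univ ∨ J ≠ Finset.univ) →
        ∑ i ∈ I, (P i).eval (n : ℂ) * r i ^ n ≠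
          ∑ j ∈ J, (cc j : ℂ) * (p : ℂ) ^ (kk j * f j)) :
    {n : ℕ | ∃ f : Fin k → ℕ,
      u n = ∑ j, cc j * (p : ℤ) ^ (kk j * f j)}.Finite := by
  classical
  by_contra hA
  have hA : {n : ℕ | ∃ f : Fin k → ℕ, u n = ∑ j, cc j * (p : ℤ) ^ (kk j * f j)}.Infinite := hA
  set A := {n : ℕ | ∃ f : Fin k → ℕ, u n = ∑ j, cc j * (p : ℤ) ^ (kk j * f j)} with hAdef
  obtain ⟨i0, hi0⟩ := hlam
  have hintg := Sub15.integral_roots u m c hrec s P r hPne hrne hrinj hu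
  obtain ⟨B, hB⟩ := Sub15.sol_bound p hp.two_le u m c hrec cc
  have hch : ∀ n : ℕ, ∃ f : Fin k → ℕ, n ∈ A → u n = ∑ j, cc j * (p : ℤ) ^ (kk j * f j) := by
    intro n
    by_cases h : n ∈ A
    · obtain ⟨f, hf⟩ := h
      exact ⟨f, fun _ => hf⟩
    · exact ⟨0, fun h' => absurd h' h⟩
  choose f hf using hch
  let S : Set ℂ := Set.range r ∪ {Complex.I}
  let K : IntermediateField ℚ ℂ := IntermediateField.adjoin ℚ S
  have hfd : FiniteDimensional ℚ K := by
    have : Finite S := by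
      have : S.Finite := (Set.finite_range r).union (Set.finite_singleton _)
      exact this
    apply IntermediateField.finiteDimensional_adjoin
    rintro x (⟨i, rfl⟩ | hx)
    · exact (hintg i).tower_top
    · rw [Set.mem_singleton_iff] at hx
      subst hx
      exact Complex.isIntegral_rat_I
  haveI : NumberField K := { to_charZero := inferInstance, to_finiteDimensional := hfd }
  have hS : S ⊆ K := IntermediateField.subset_adjoin ℚ S
  haveI : NumberField.IsTotallyComplex K := Sub15.totComplex (⟨Complex.I, hS (Or.inr rfl)⟩ : K) (by
    apply Subtype.ext
    push_cast
    exact Complex.I_sq)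
  refine Sub15.final_K p hp.one_lt K P (fun i => ⟨r i, hS (Or.inl ⟨i, rfl⟩)⟩) hPne ?_ ?_ ?_ i0 ?_ cc B A hA
    (fun j n => kk j * f n j) ?_ ?_
  · intro i h
    exact hrne i (congrArg Subtype.val h)
  · intro i
    rw [← isIntegral_algebraMap_iff (A := K) (B := ℂ) (FaithfulSMul.algebraMap_injective K ℂ)]
    exact hintg i
  · intro i j hij k hk h
    have h1 := congrArg (Subtype.val : K → ℂ) h
    push_cast at h1
    have h2 := hnd2 i j ⟨k, hk, h1⟩
    rw [div_eq_one_iff_eq (hrne j)] at h2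
    exact hij (hrinj h2)
  · intro a b h
    have h1 := congrArg (Subtype.val : K → ℂ) h
    push_cast at h1
    exact hi0 a b h1
  · intro n hn hn0
    refine hB n hn0 _ (hf n hn) fun J hJ h => ?_
    refine hsubsum n (f n) (hf n hn) ∅ J (Or.inr hJ) (Or.inl ?_) ?_
    · intro h
      exact Finset.notMem_empty i0 (h ▸ Finset.mem_univ i0)
    · rw [Finset.sum_empty]
      exact_mod_cast h.symm
  · intro n hn
    rw [← hu n]
    exact_mod_cast hf n hn
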